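/- Let Γ be a finitely generated group such that for some finite symmetric generating set S, the metric space (Γ, d_S) is quasi-isometric to (Sol, d_Sol). Then Γ is virtually a lattice in Sol: there exist a finite-index subgroup Γ′ ≤ Γ and a finite normal subgroup N ⊴ Γ′ such that Γ′/N is isomorphic to a subgroup Λ of the Lie group Sol which is discrete as a subset of ℝ³ and cocompact. -/

import Mathlib

open Set

noncomputable section

/-- A path `γ : ℝ → E` is piecewise `C¹` on `[0,1]`. -/
def PiecewiseC1 {E : Type*} [NormedAddCommGroup E] [NormedSpace ℝ E] (γ : ℝ → E) : Prop :=
  ∃ (n : ℕ) (τ : ℕ → ℝ), τ 0 = 0 ∧ τ n = 1 ∧ (∀ i < n, τ i ≤ τ (i + 1)) ∧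
    ∀ i < n, ContDiffOn ℝ 1 γ (Set.Icc (τ i) (τ (i + 1)))

/-- The `Sol` length of a path `γ(t) = (x(t), y(t), z(t))`, for the metric
`ds² = e^{-z} dx² + e^{z} dy² + dz²`. -/
def solLength (γ : ℝ → ℝ × ℝ × ℝ) : ℝ :=
  ∫ t in (0:ℝ)..1,
    Real.sqrt (Real.exp (-(γ t).2.2) * (deriv (fun s => (γ s).1) t) ^ 2 +
      Real.exp ((γ t).2.2) * (deriv (fun s => (γ s).2.1) t) ^ 2 +
      (deriv (fun s => (γ s).2.2) t) ^ 2)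

/-- The left-invariant distance on `Sol = ℝ³`. -/
def dSol (p q : ℝ × ℝ × ℝ) : ℝ :=
  sInf {ℓ : ℝ | ∃ γ : ℝ → ℝ × ℝ × ℝ,
    γ 0 = p ∧ γ 1 = q ∧ PiecewiseC1 γ ∧ solLength γ = ℓ}

/-- Height function on `Sol`. -/
def solHeight (p : ℝ × ℝ × ℝ) : ℝ := p.2.2

/-- `f` is a `(K, C)`-quasi-isometric embedding with respect to the given distances. -/
def IsQIE {X Y : Type*} (dX : X → X → ℝ) (dY : Y → Y → ℝ) (K C : ℝ) (f : X → Y) : Prop :=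
  ∀ a b : X, (1 / K) * dX a b - C ≤ dY (f a) (f b) ∧ dY (f a) (f b) ≤ K * dX a b + C

/-- `f` is a `(K, C)`-quasi-isometry with respect to the given distances. -/
def IsQI {X Y : Type*} (dX : X → X → ℝ) (dY : Y → Y → ℝ) (K C : ℝ) (f : X → Y) : Prop :=
  IsQIE dX dY K C f ∧ ∀ y : Y, ∃ x : X, dY (f x) y ≤ C

/-- Two "metric spaces", given by distance functions, are quasi-isometric. -/
def QuasiIsometric {X Y : Type*} (dX : X → X → ℝ) (dY : Y → Y → ℝ) : Prop :=
  ∃ (K C : ℝ) (f : X → Y), 1 ≤ K ∧ 0 ≤ C ∧ IsQI dX dY K C f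

/-- The word norm of `g` with respect to a generating set `S`: the least `m` such that `g` is a
product of `m` elements of `S`. -/
def wordNorm {Γ : Type*} [Group Γ] (S : Set Γ) (g : Γ) : ℕ :=
  sInf {m : ℕ | ∃ l : List Γ, (∀ x ∈ l, x ∈ S) ∧ l.prod = g ∧ l.length = m}

/-- The word metric on a group `Γ` with respect to a generating set `S`. -/
def wordDist {Γ : Type*} [Group Γ] (S : Set Γ) (a b : Γ) : ℝ :=
  (wordNorm S (a⁻¹ * b) : ℝ)

/-- `S` is a finite symmetric generating set of `Γ`. -/
def IsFinSymmGen {Γ : Type*} [Group Γ] (S : Set Γ) : Prop :=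
  S.Finite ∧ (∀ s ∈ S, s⁻¹ ∈ S) ∧ Subgroup.closure S = ⊤

/-- The group multiplication of `Sol`:
`(x,y,z)·(x',y',z') = (x + e^{z/2} x', y + e^{-z/2} y', z + z')`. -/
def solMul (p q : ℝ × ℝ × ℝ) : ℝ × ℝ × ℝ :=
  (p.1 + Real.exp (p.2.2 / 2) * q.1,
   p.2.1 + Real.exp (-p.2.2 / 2) * q.2.1,
   p.2.2 + q.2.2)

namespace SolQI

/-- Points of the model of `Sol`: real horizontal coordinates and an integer level. -/
@[ext] structure Pt where
  x : ℝ
  y : ℝ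
  k : ℤ

/-- Coarse neighbourhood relation at scale `n`. -/
def Near (n : ℕ) (p q : Pt) : Prop :=
  |q.k - p.k| ≤ n ∧ |q.x - p.x| ≤ ((2:ℝ)^n - 1) * (2:ℝ)^p.k ∧
    |q.y - p.y| ≤ ((2:ℝ)^n - 1) * (2:ℝ)^(-p.k)

/-- The flip of the model exchanging the two horizontal directions. -/
def sw (p : Pt) : Pt := ⟨p.y, p.x, -p.k⟩

/-- Left translation by `p`. -/
def tr (p q : Pt) : Pt := ⟨p.x + (2:ℝ)^p.k * q.x, p.y + (2:ℝ)^(-p.k) * q.y, p.k + q.k⟩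

/-- The inverse of `p` for the multiplication `tr`. -/
def pinv (p : Pt) : Pt := ⟨-((2:ℝ)^(-p.k) * p.x), -((2:ℝ)^p.k * p.y), -p.k⟩

lemma zpow_two_pos (k : ℤ) : (0:ℝ) < (2:ℝ)^k := by positivity

lemma zpow_two_add (a b : ℤ) : (2:ℝ)^(a+b) = (2:ℝ)^a * (2:ℝ)^b := zpow_add₀ (by norm_num) a b

lemma zpow_two_mono {a b : ℤ} (h : a ≤ b) : (2:ℝ)^a ≤ (2:ℝ)^b :=
  zpow_le_zpow_right₀ (by norm_num) h

lemma zpow_two_neg_mul (k : ℤ) : (2:ℝ)^(-k) * (2:ℝ)^k = 1 := by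
  rw [← zpow_two_add]; simp

lemma zpow_two_mul_neg (k : ℤ) : (2:ℝ)^k * (2:ℝ)^(-k) = 1 := by
  rw [← zpow_two_add]; simp

lemma one_le_two_pow_real (n : ℕ) : (1:ℝ) ≤ (2:ℝ)^n := one_le_pow₀ (by norm_num)

@[simp] lemma sw_sw (p : Pt) : sw (sw p) = p := by simp [sw]
@[simp] lemma sw_k (p : Pt) : (sw p).k = -p.k := rfl

@[simp] lemma tr_pinv (p q : Pt) : tr p (tr (pinv p) q) = q := by
  have h1 := zpow_two_mul_neg p.k
  have h2 := zpow_two_neg_mul p.k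
  ext
  · simp only [tr, pinv]; linear_combination (q.x - p.x) * h1
  · simp only [tr, pinv, neg_neg]; linear_combination (q.y - p.y) * h2
  · simp [tr, pinv]

@[simp] lemma pinv_tr (p q : Pt) : tr (pinv p) (tr p q) = q := by
  have h1 := zpow_two_mul_neg p.k
  have h2 := zpow_two_neg_mul p.k
  ext
  · simp only [tr, pinv]; linear_combination q.x * h2
  · simp only [tr, pinv, neg_neg]; linear_combination q.y * h1
  · simp [tr, pinv]

lemma near_refl (n : ℕ) (p : Pt) : Near n p p := by
  have := one_le_two_pow_real n
  have h : (0:ℝ) ≤ (2:ℝ)^n - 1 := by linarith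
  refine ⟨by simp, ?_, ?_⟩ <;> simp only [sub_self, abs_zero] <;> positivity

lemma near_mono {n m : ℕ} (h : n ≤ m) {p q : Pt} (hn : Near n p q) : Near m p q := by
  obtain ⟨h1, h2, h3⟩ := hn
  have h0 : (2:ℝ)^n ≤ (2:ℝ)^m := pow_le_pow_right₀ (by norm_num) h
  refine ⟨h1.trans (by exact_mod_cast h), h2.trans ?_, h3.trans ?_⟩ <;>
    (gcongr)

lemma near_trans {n m : ℕ} {p q r : Pt} (h1 : Near n p q) (h2 : Near m q r) :
    Near (n + m) p r := by
  obtain ⟨a1, a2, a3⟩ := h1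
  obtain ⟨b1, b2, b3⟩ := h2
  have hm := one_le_two_pow_real m
  have hq : (2:ℝ)^q.k ≤ (2:ℝ)^n * (2:ℝ)^p.k := by
    rw [← zpow_natCast, ← zpow_two_add]; apply zpow_two_mono
    have := (abs_le.mp a1).2; linarith
  have hq' : (2:ℝ)^(-q.k) ≤ (2:ℝ)^n * (2:ℝ)^(-p.k) := by
    rw [← zpow_natCast, ← zpow_two_add]; apply zpow_two_mono
    have := (abs_le.mp a1).1; linarith
  refine ⟨?_, ?_, ?_⟩
  · have := abs_add_le (q.k - p.k) (r.k - q.k)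
    rw [show q.k - p.k + (r.k - q.k) = r.k - p.k by ring] at this
    push_cast; linarith
  · have := abs_add_le (q.x - p.x) (r.x - q.x)
    rw [show q.x - p.x + (r.x - q.x) = r.x - p.x by ring] at this
    have h4 := mul_le_mul_of_nonneg_left hq (by linarith : (0:ℝ) ≤ (2:ℝ)^m - 1)
    rw [pow_add]; linarith
  · have := abs_add_le (q.y - p.y) (r.y - q.y)
    rw [show q.y - p.y + (r.y - q.y) = r.y - p.y by ring] at this
    have h4 := mul_le_mul_of_nonneg_left hq' (by linarith : (0:ℝ) ≤ (2:ℝ)^m - 1)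
    rw [pow_add]; linarith

lemma near_symm {n : ℕ} {p q : Pt} (h : Near n p q) : Near (2 * n) q p := by
  obtain ⟨a1, a2, a3⟩ := h
  have hn := one_le_two_pow_real n
  have hq : (2:ℝ)^p.k ≤ (2:ℝ)^n * (2:ℝ)^q.k := by
    rw [← zpow_natCast, ← zpow_two_add]; apply zpow_two_mono
    have := (abs_le.mp a1).1; linarith
  have hq' : (2:ℝ)^(-p.k) ≤ (2:ℝ)^n * (2:ℝ)^(-q.k) := by
    rw [← zpow_natCast, ← zpow_two_add]; apply zpow_two_mono
    have := (abs_le.mp a1).2; linarith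
  refine ⟨?_, ?_, ?_⟩
  · rw [abs_sub_comm]; push_cast; have := abs_nonneg (q.k - p.k); linarith
  · rw [abs_sub_comm]
    have h4 := mul_le_mul_of_nonneg_left hq (by linarith : (0:ℝ) ≤ (2:ℝ)^n - 1)
    have h5 : 0 ≤ ((2:ℝ)^n - 1) * (2:ℝ)^q.k :=
      mul_nonneg (by linarith) (zpow_two_pos _).le
    rw [two_mul, pow_add]; nlinarith
  · rw [abs_sub_comm]
    have h4 := mul_le_mul_of_nonneg_left hq' (by linarith : (0:ℝ) ≤ (2:ℝ)^n - 1)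
    have h5 : 0 ≤ ((2:ℝ)^n - 1) * (2:ℝ)^(-q.k) :=
      mul_nonneg (by linarith) (zpow_two_pos _).le
    rw [two_mul, pow_add]; nlinarith

lemma near_of_bounds {a : ℕ} {p q : Pt} (h1 : |q.k - p.k| ≤ a + 1)
    (h2 : |q.x - p.x| ≤ (2:ℝ)^a * (2:ℝ)^p.k) (h3 : |q.y - p.y| ≤ (2:ℝ)^a * (2:ℝ)^(-p.k)) :
    Near (a + 1) p q := by
  have h0 : (2:ℝ)^a ≤ (2:ℝ)^(a+1) - 1 := by
    rw [pow_succ]; have := one_le_two_pow_real a; linarith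
  refine ⟨by push_cast; exact h1, h2.trans ?_, h3.trans ?_⟩ <;> gcongr

lemma Near.x_le {n : ℕ} {p q : Pt} (h : Near n p q) : |q.x - p.x| ≤ (2:ℝ)^(n + p.k : ℤ) := by
  rw [zpow_two_add, zpow_natCast]
  refine h.2.1.trans ?_
  gcongr; linarith

lemma Near.y_le {n : ℕ} {p q : Pt} (h : Near n p q) : |q.y - p.y| ≤ (2:ℝ)^(n - p.k : ℤ) := by
  rw [sub_eq_add_neg (n : ℤ), zpow_two_add, zpow_natCast]
  refine h.2.2.trans ?_
  gcongr; linarith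

lemma Near.k_le {n : ℕ} {p q : Pt} (h : Near n p q) : |q.k - p.k| ≤ n := h.1

lemma near_sw {n : ℕ} {p q : Pt} (h : Near n p q) : Near n (sw p) (sw q) := by
  obtain ⟨h1, h2, h3⟩ := h
  refine ⟨?_, h3, by simpa [sw] using h2⟩
  simp only [sw]; rw [abs_sub_comm]; convert h1 using 2; ring

lemma near_tr {n : ℕ} (r : Pt) {p q : Pt} (h : Near n p q) : Near n (tr r p) (tr r q) := by
  obtain ⟨h1, h2, h3⟩ := h
  refine ⟨?_, ?_, ?_⟩
  · simpa [tr] using h1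
  · simp only [tr]
    rw [show r.x + (2:ℝ)^r.k * q.x - (r.x + (2:ℝ)^r.k * p.x) = (2:ℝ)^r.k * (q.x - p.x) by ring,
      abs_mul, abs_of_pos (zpow_two_pos _), zpow_two_add]
    have := mul_le_mul_of_nonneg_left h2 (zpow_two_pos r.k).le
    linarith
  · simp only [tr]
    rw [show r.y + (2:ℝ)^(-r.k) * q.y - (r.y + (2:ℝ)^(-r.k) * p.y) = (2:ℝ)^(-r.k) * (q.y - p.y) by
      ring, abs_mul, abs_of_pos (zpow_two_pos _), neg_add, zpow_two_add]
    have := mul_le_mul_of_nonneg_left h3 (zpow_two_pos (-r.k)).le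
    linarith

/-- `φ` and `φ'` are mutually coarsely inverse coarse equivalences with constant `L`. -/
structure CE (L : ℕ) (φ φ' : Pt → Pt) : Prop where
  fwd : ∀ n p q, Near n p q → Near (L * (n + 1)) (φ p) (φ q)
  bwd : ∀ n p q, Near n p q → Near (L * (n + 1)) (φ' p) (φ' q)
  left : ∀ p, Near L (φ' (φ p)) p
  right : ∀ p, Near L (φ (φ' p)) p

namespace CE
variable {L : ℕ} {φ φ' : Pt → Pt}

lemma symm (h : CE L φ φ') : CE L φ' φ := ⟨h.bwd, h.fwd, h.right, h.left⟩

lemma back (h : CE L φ φ') {n : ℕ} {p q : Pt} (hn : Near n (φ p) (φ q)) :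
    Near (4 * L * (n + 1)) p q := by
  have := near_trans (near_trans (near_symm (h.left p)) (h.bwd _ _ _ hn)) (h.left q)
  refine near_mono ?_ this
  nlinarith

lemma pre_tr (h : CE L φ φ') (r : Pt) : CE L (fun p => φ (tr r p)) (fun p => tr (pinv r) (φ' p)) where
  fwd n p q hn := h.fwd n _ _ (near_tr r hn)
  bwd n p q hn := near_tr _ (h.bwd n _ _ hn)
  left p := by simpa using near_tr (pinv r) (h.left (tr r p))
  right p := by simpa using h.right p

lemma post_tr (h : CE L φ φ') (r : Pt) : CE L (fun p => tr (pinv r) (φ p)) (fun p => φ' (tr r p)) :=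
  (h.symm.pre_tr r).symm

lemma pre_sw (h : CE L φ φ') : CE L (fun p => φ (sw p)) (fun p => sw (φ' p)) where
  fwd n p q hn := h.fwd n _ _ (near_sw hn)
  bwd n p q hn := near_sw (h.bwd n _ _ hn)
  left p := by simpa using near_sw (h.left (sw p))
  right p := by simpa using h.right p

lemma post_sw (h : CE L φ φ') : CE L (fun p => sw (φ p)) (fun p => φ' (sw p)) :=
  h.symm.pre_sw.symm

end CE

/-- Index of the unit cell containing `p`. -/
def cell (p : Pt) : ℤ × ℤ × ℤ := (⌊p.x * (2:ℝ)^(-p.k)⌋, ⌊p.y * (2:ℝ)^p.k⌋, p.k)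

lemma near_of_cell_eq {p q : Pt} (h : cell p = cell q) : Near 1 p q := by
  simp only [cell, Prod.mk.injEq] at h
  obtain ⟨h1, h2, h3⟩ := h
  rw [← h3] at h1 h2
  have e1 := (Int.abs_sub_lt_one_of_floor_eq_floor h1).le
  have e2 := (Int.abs_sub_lt_one_of_floor_eq_floor h2).le
  rw [← sub_mul, abs_mul, abs_of_pos (zpow_two_pos _), abs_sub_comm] at e1 e2
  refine ⟨by simp [h3], ?_, ?_⟩
  · have := mul_le_mul_of_nonneg_right e1 (zpow_two_pos p.k).le
    rw [mul_assoc, zpow_two_neg_mul] at this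
    norm_num; linarith
  · have := mul_le_mul_of_nonneg_right e2 (zpow_two_pos (-p.k)).le
    rw [mul_assoc, zpow_two_mul_neg] at this
    norm_num; norm_num at this; linarith

lemma card_Icc_floor_le (c a : ℝ) (ha : 0 ≤ a) :
    ((Finset.Icc ⌊c - a⌋ ⌊c + a⌋).card : ℝ) ≤ 2 * a + 2 := by
  have h1 := Int.floor_le (c + a)
  have h2 := Int.lt_floor_add_one (c - a)
  have h3 : ⌊c - a⌋ ≤ ⌊c + a⌋ := Int.floor_mono (by linarith)
  rw [Int.card_Icc]
  have : ((⌊c + a⌋ + 1 - ⌊c - a⌋).toNat : ℝ) = (⌊c + a⌋ + 1 - ⌊c - a⌋ : ℤ) := by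
    rw [← Int.cast_natCast, Int.toNat_of_nonneg (by omega)]
  rw [this]; push_cast; linarith

/-- A family of points of one level, lying in a horizontal box and with at most `n` members in each
unit cell, has cardinality bounded by the size of the box. -/
lemma card_box {ι : Type*} (s : Finset ι) (g : ι → Pt) (n : ℕ) (x0 y0 a b : ℝ) (k : ℤ)
    (ha : 0 ≤ a) (hb : 0 ≤ b) (hk : ∀ i ∈ s, (g i).k = k)
    (hx : ∀ i ∈ s, |(g i).x - x0| ≤ a * (2:ℝ)^k) (hy : ∀ i ∈ s, |(g i).y - y0| ≤ b * (2:ℝ)^(-k))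
    (hf : ∀ c, (s.filter fun j => cell (g j) = c).card ≤ n) :
    (s.card : ℝ) ≤ n * ((2 * a + 2) * (2 * b + 2)) := by
  classical
  set T := (Finset.Icc ⌊x0 * (2:ℝ)^(-k) - a⌋ ⌊x0 * (2:ℝ)^(-k) + a⌋) ×ˢ
    ((Finset.Icc ⌊y0 * (2:ℝ)^k - b⌋ ⌊y0 * (2:ℝ)^k + b⌋) ×ˢ ({k} : Finset ℤ)) with hT
  have hmap : ∀ i ∈ s, cell (g i) ∈ T := by
    intro i hi
    have e1 := abs_le.mp (hx i hi)
    have e2 := abs_le.mp (hy i hi)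
    have p1 := zpow_two_pos k
    have p2 := zpow_two_pos (-k)
    have p3 := zpow_two_mul_neg k
    have q1 : |((g i).x - x0) * (2:ℝ)^(-k)| ≤ a := by
      rw [abs_mul, abs_of_pos p2]
      calc _ ≤ (a * (2:ℝ)^k) * (2:ℝ)^(-k) := by gcongr; exact hx i hi
        _ = a := by rw [mul_assoc, p3, mul_one]
    have q2 : |((g i).y - y0) * (2:ℝ)^k| ≤ b := by
      rw [abs_mul, abs_of_pos p1]
      calc _ ≤ (b * (2:ℝ)^(-k)) * (2:ℝ)^k := by gcongr; exact hy i hi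
        _ = b := by rw [mul_assoc, zpow_two_neg_mul, mul_one]
    rw [abs_le] at q1 q2
    simp only [hT, cell, hk i hi, Finset.mem_product, Finset.mem_Icc, Finset.mem_singleton,
      and_true]
    refine ⟨⟨?_, ?_⟩, ?_, ?_⟩ <;> apply Int.floor_mono <;> linarith
  have h1 := Finset.card_le_mul_card_image_of_maps_to hmap n (fun b _ => hf b)
  have h2 : (T.card : ℝ) ≤ (2 * a + 2) * (2 * b + 2) := by
    rw [hT, Finset.card_product, Finset.card_product, Finset.card_singleton, mul_one]
    push_cast
    gcongr
    · exact card_Icc_floor_le _ _ ha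
    · exact card_Icc_floor_le _ _ hb
  calc (s.card : ℝ) ≤ ((n * T.card : ℕ) : ℝ) := by exact_mod_cast h1
    _ = n * T.card := by push_cast; ring
    _ ≤ _ := by gcongr

namespace CE
variable {L : ℕ} {φ φ' : Pt → Pt}

lemma near_vert (x y : ℝ) (k : ℤ) (n : ℕ) : Near n ⟨x, y, k⟩ ⟨x, y, k + n⟩ := by
  have := one_le_two_pow_real n
  have h : (0:ℝ) ≤ (2:ℝ)^n - 1 := by linarith
  refine ⟨by simp, ?_, ?_⟩ <;> simp only [sub_self, abs_zero] <;> positivity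

lemma vert_k (h : CE L φ φ') (x y : ℝ) (k : ℤ) (n : ℕ) :
    |(φ ⟨x, y, k + n⟩).k - (φ ⟨x, y, k⟩).k| ≤ L * (n + 1) := by
  have := (h.fwd n _ _ (near_vert x y k n)).k_le
  push_cast at this; exact this

lemma vert_x (h : CE L φ φ') (x y : ℝ) (k M : ℤ) (n : ℕ)
    (hM : ∀ i : ℕ, i < n → (φ ⟨x, y, k + i⟩).k ≤ M) :
    |(φ ⟨x, y, k + n⟩).x - (φ ⟨x, y, k⟩).x| ≤ n * (2:ℝ)^(2 * L + M : ℤ) := by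
  induction n with
  | zero => simp
  | succ n ih =>
    have h1 := ih (fun i hi => hM i (by omega))
    have h2 := (h.fwd 1 _ _ (near_vert x y (k + n) 1)).x_le
    have h3 : (2:ℝ)^(((L * (1 + 1) : ℕ) : ℤ) + (φ ⟨x, y, k + n⟩).k) ≤ (2:ℝ)^(2 * L + M : ℤ) := by
      apply zpow_two_mono; have := hM n (by omega); push_cast; linarith
    have h4 := abs_sub_le (φ ⟨x, y, k + n + (1:ℕ)⟩).x (φ ⟨x, y, k + n⟩).x (φ ⟨x, y, k⟩).x
    rw [show (k + ((n + 1 : ℕ) : ℤ)) = k + n + (1:ℕ) by push_cast; ring]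
    push_cast at *
    linarith

lemma vert_y (h : CE L φ φ') (x y : ℝ) (k m : ℤ) (n : ℕ)
    (hm : ∀ i : ℕ, i < n → m ≤ (φ ⟨x, y, k + i⟩).k) :
    |(φ ⟨x, y, k + n⟩).y - (φ ⟨x, y, k⟩).y| ≤ n * (2:ℝ)^(2 * L - m : ℤ) := by
  have := h.post_sw.vert_x x y k (-m) n (fun i hi => by have := hm i hi; simp only [sw_k]; omega)
  simpa [sw, sub_eq_add_neg] using this

end CE

namespace CE
variable {L : ℕ} {φ φ' : Pt → Pt}

lemma near_unit_y {y y' : ℝ} (x : ℝ) (h : |y' - y| ≤ 1) : Near 1 ⟨x, y, 0⟩ ⟨x, y', 0⟩ := by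
  refine ⟨by simp, by norm_num, by norm_num; exact h⟩

lemma dyadic_le_one {t J : ℕ} (h : J < 2 ^ t) : |(J:ℝ) / 2 ^ t| ≤ 1 := by
  rw [abs_of_nonneg (by positivity), div_le_one (by positivity)]
  exact_mod_cast h.le

lemma count_osc_level (h : CE L φ φ') (h0 : φ ⟨0, 0, 0⟩ = ⟨0, 0, 0⟩) (t s : ℕ) (m k : ℤ)
    (S : Finset ℕ) (hS : ∀ J ∈ S, J < 2 ^ t ∧
      (∀ i : ℕ, i ≤ t → m ≤ (φ ⟨0, J / 2 ^ t, i⟩).k ∧ (φ ⟨0, J / 2 ^ t, i⟩).k ≤ m + s) ∧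
      (φ ⟨0, J / 2 ^ t, t⟩).k = k) :
    (S.card : ℝ) ≤ (2 * 2 ^ (8 * L) + 1) * (16 * (t + 1) ^ 2 * 2 ^ (8 * L) * 2 ^ s) := by
  classical
  rcases S.eq_empty_or_nonempty with rfl | ⟨J0, hJ0⟩
  · simp only [Finset.card_empty, Nat.cast_zero]; positivity
  have hmk : m ≤ k ∧ k ≤ m + s := by
    obtain ⟨_, h2, h3⟩ := hS J0 hJ0
    rw [← h3]; exact h2 t le_rfl
  set a : ℝ := (t + 1) * (2:ℝ)^(4 * L + m + s - k : ℤ) with ha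
  set b : ℝ := (t + 1) * (2:ℝ)^(4 * L - m + k : ℤ) with hb
  have hpow : ∀ e : ℤ, 0 ≤ e → 1 ≤ (t + 1 : ℝ) * (2:ℝ)^e := by
    intro e he
    have : (1:ℝ) ≤ (2:ℝ)^e := one_le_zpow₀ (by norm_num) he
    have ht : (1:ℝ) ≤ t + 1 := by linarith [Nat.cast_nonneg (α := ℝ) t]
    nlinarith
  have ha1 : 1 ≤ a := hpow _ (by omega)
  have hb1 : 1 ≤ b := hpow _ (by omega)
  have hstart : ∀ J ∈ S, Near (L * (1 + 1)) ⟨0, 0, 0⟩ (φ ⟨0, J / 2 ^ t, 0⟩) := by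
    intro J hJ
    rw [← h0]
    refine h.fwd 1 _ _ (near_unit_y 0 ?_)
    rw [sub_zero]; exact dyadic_le_one (hS J hJ).1
  have key := card_box S (fun J => φ ⟨0, J / 2 ^ t, t⟩) (2 * 2 ^ (8 * L) + 1) 0 0 a b k
    (by linarith) (by linarith) (fun J hJ => (hS J hJ).2.2) ?_ ?_ ?_
  · refine key.trans ?_
    push_cast
    refine mul_le_mul_of_nonneg_left ?_ (by positivity)
    have e1 : a * b = (t + 1) ^ 2 * 2 ^ (8 * L) * 2 ^ s := by
      rw [ha, hb]
      have : (2:ℝ)^(4 * L + m + s - k : ℤ) * (2:ℝ)^(4 * L - m + k : ℤ) = 2 ^ (8 * L) * 2 ^ s := by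
        rw [← zpow_two_add, ← zpow_natCast, ← zpow_natCast, ← zpow_two_add]
        congr 1; push_cast; ring
      linear_combination (t + 1 : ℝ) ^ 2 * this
    nlinarith
  · intro J hJ
    have h1 := h.vert_x 0 (J / 2 ^ t) 0 (m + s) t
      (fun i hi => by rw [zero_add]; exact ((hS J hJ).2.1 i hi.le).2)
    have h2 := (hstart J hJ).x_le
    have h3 := (hstart J hJ).k_le
    have h4 := ((hS J hJ).2.1 0 (by omega)).2
    rw [zero_add] at h1
    push_cast at h3 h4
    simp only [sub_zero] at h2 h3 ⊢
    have e : a * (2:ℝ)^k = (t + 1) * (2:ℝ)^(4 * L + m + s : ℤ) := by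
      rw [ha, mul_assoc, ← zpow_two_add]; congr 2; ring
    rw [e]
    have h5 : (2:ℝ)^(((L * (1 + 1) : ℕ) : ℤ) + 0) ≤ (2:ℝ)^(4 * L + m + s : ℤ) := by
      apply zpow_two_mono; have := (abs_le.mp h3).1; push_cast; linarith
    have h6 : (2:ℝ)^(2 * L + (m + s) : ℤ) ≤ (2:ℝ)^(4 * L + m + s : ℤ) := by
      apply zpow_two_mono; linarith [Int.natCast_nonneg L]
    have h7 := abs_sub_abs_le_abs_sub (φ ⟨0, J / 2 ^ t, t⟩).x (φ ⟨0, J / 2 ^ t, 0⟩).x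
    have h8 : (t:ℝ) * (2:ℝ)^(2 * L + (m + s) : ℤ) ≤ t * (2:ℝ)^(4 * L + m + s : ℤ) := by gcongr
    linarith
  · intro J hJ
    have h1 := h.vert_y 0 (J / 2 ^ t) 0 m t
      (fun i hi => by rw [zero_add]; exact ((hS J hJ).2.1 i hi.le).1)
    have h2 := (hstart J hJ).y_le
    have h3 := (hstart J hJ).k_le
    have h4 := ((hS J hJ).2.1 0 (by omega)).1
    rw [zero_add] at h1
    push_cast at h3 h4
    simp only [sub_zero] at h2 h3 ⊢
    have e : b * (2:ℝ)^(-k) = (t + 1) * (2:ℝ)^(4 * L - m : ℤ) := by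
      rw [hb, mul_assoc, ← zpow_two_add]; congr 2; ring
    rw [e]
    have h5 : (2:ℝ)^((L * (1 + 1) : ℕ) : ℤ) ≤ (2:ℝ)^(4 * L - m : ℤ) := by
      apply zpow_two_mono; have := (abs_le.mp h3).2; push_cast; linarith
    have h6 : (2:ℝ)^(2 * L - m : ℤ) ≤ (2:ℝ)^(4 * L - m : ℤ) := by
      apply zpow_two_mono; linarith [Int.natCast_nonneg L]
    have h7 := abs_sub_abs_le_abs_sub (φ ⟨0, J / 2 ^ t, t⟩).y (φ ⟨0, J / 2 ^ t, 0⟩).y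
    have h8 : (t:ℝ) * (2:ℝ)^(2 * L - m : ℤ) ≤ t * (2:ℝ)^(4 * L - m : ℤ) := by gcongr
    linarith
  · intro c
    rcases (S.filter fun J : ℕ => cell (φ ⟨0, J / 2 ^ t, t⟩) = c).eq_empty_or_nonempty with
      he | ⟨J1, hJ1⟩
    · rw [he]; simp
    have hsub : (S.filter fun J : ℕ => cell (φ ⟨0, J / 2 ^ t, t⟩) = c) ⊆
        Finset.Icc (J1 - 2 ^ (8 * L)) (J1 + 2 ^ (8 * L)) := by
      intro J hJ
      rw [Finset.mem_filter] at hJ hJ1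
      have hn := (h.back (near_of_cell_eq (hJ.2.trans hJ1.2.symm))).y_le
      have : |(J1:ℝ) - J| ≤ 2 ^ (8 * L) := by
        have e : (J1:ℝ) / 2 ^ t - J / 2 ^ t = ((J1:ℝ) - J) / 2 ^ t := by ring
        have e2 : (2:ℝ)^(((4 * L * (1 + 1) : ℕ) : ℤ) - t) = 2 ^ (8 * L) / 2 ^ t := by
          rw [zpow_sub₀ (by norm_num), zpow_natCast, zpow_natCast]; congr 2; ring
        simp only at hn
        rw [e, e2, abs_div, abs_of_pos (show (0:ℝ) < 2 ^ t by positivity)] at hn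
        exact (div_le_div_iff_of_pos_right (by positivity)).mp hn
      rw [abs_le] at this
      have a1 : J1 ≤ J + 2 ^ (8 * L) := by exact_mod_cast (by linarith : (J1:ℝ) ≤ J + 2 ^ (8 * L))
      have a2 : J ≤ J1 + 2 ^ (8 * L) := by exact_mod_cast (by linarith : (J:ℝ) ≤ J1 + 2 ^ (8 * L))
      rw [Finset.mem_Icc]; omega
    refine (Finset.card_le_card hsub).trans ?_
    rw [Nat.card_Icc]; omega

lemma count_osc_origin (h : CE L φ φ') (h0 : φ ⟨0, 0, 0⟩ = ⟨0, 0, 0⟩) (t s : ℕ) :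
    (((Finset.range (2 ^ t)).filter fun J : ℕ => ∀ i : ℕ, i ≤ t → ∀ j : ℕ, j ≤ t →
      (φ ⟨0, J / 2 ^ t, i⟩).k - (φ ⟨0, J / 2 ^ t, j⟩).k ≤ s).card : ℝ) ≤
    ((6 * L + 1) ^ 2 * ((2 * 2 ^ (8 * L) + 1) * (16 * 2 ^ (8 * L)))) * (t + 1) ^ 4 * 2 ^ s := by
  classical
  set S := (Finset.range (2 ^ t)).filter fun J : ℕ => ∀ i : ℕ, i ≤ t → ∀ j : ℕ, j ≤ t →
      (φ ⟨0, J / 2 ^ t, i⟩).k - (φ ⟨0, J / 2 ^ t, j⟩).k ≤ s with hS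
  set B : ℤ := 3 * L * (t + 1) with hB
  have hB0 : 0 ≤ B := by positivity
  set K := Finset.Icc (-B) B ×ˢ Finset.Icc (-B) B with hK
  have hbd : ∀ J ∈ S, ∀ i : ℕ, i ≤ t → |(φ ⟨0, J / 2 ^ t, i⟩).k| ≤ B := by
    intro J hJ i hi
    rw [hS, Finset.mem_filter, Finset.mem_range] at hJ
    have h1 := h.vert_k 0 (J / 2 ^ t) 0 i
    have h2 := (h.fwd 1 _ _ (near_unit_y 0 (y := 0) (y' := J / 2 ^ t)
      (by rw [sub_zero]; exact dyadic_le_one hJ.1))).k_le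
    rw [h0] at h2
    rw [zero_add] at h1
    push_cast at h2
    simp only [sub_zero] at h2
    have h3 := abs_sub_abs_le_abs_sub (φ ⟨0, J / 2 ^ t, i⟩).k (φ ⟨0, J / 2 ^ t, 0⟩).k
    have h4 : (L:ℤ) * (i + 1) ≤ L * (t + 1) := by gcongr
    have h5 : (0:ℤ) ≤ L * t := by positivity
    rw [hB]; nlinarith
  have hcov : S ⊆ K.biUnion fun c => S.filter fun J : ℕ =>
      (∀ i : ℕ, i ≤ t → c.1 ≤ (φ ⟨0, J / 2 ^ t, i⟩).k ∧ (φ ⟨0, J / 2 ^ t, i⟩).k ≤ c.1 + s) ∧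
      (φ ⟨0, J / 2 ^ t, t⟩).k = c.2 := by
    intro J hJ
    obtain ⟨i0, hi0, hmin⟩ := Finset.exists_min_image (Finset.range (t + 1))
      (fun i : ℕ => (φ ⟨0, J / 2 ^ t, i⟩).k) ⟨0, by simp⟩
    rw [Finset.mem_range] at hi0
    rw [Finset.mem_biUnion]
    refine ⟨((φ ⟨0, J / 2 ^ t, i0⟩).k, (φ ⟨0, J / 2 ^ t, t⟩).k), ?_, ?_⟩
    · simp only [hK, Finset.mem_product, Finset.mem_Icc]
      exact ⟨abs_le.mp (hbd J hJ i0 (by omega)), abs_le.mp (hbd J hJ t le_rfl)⟩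
    · rw [Finset.mem_filter]
      refine ⟨hJ, fun i hi => ⟨hmin i (by rw [Finset.mem_range]; omega), ?_⟩, rfl⟩
      have := (Finset.mem_filter.mp hJ).2 i hi i0 (by omega)
      simp only; linarith
  have h1 : (S.card : ℝ) ≤ ∑ c ∈ K, ((S.filter fun J : ℕ =>
      (∀ i : ℕ, i ≤ t → c.1 ≤ (φ ⟨0, J / 2 ^ t, i⟩).k ∧ (φ ⟨0, J / 2 ^ t, i⟩).k ≤ c.1 + s) ∧
      (φ ⟨0, J / 2 ^ t, t⟩).k = c.2).card : ℝ) := by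
    exact_mod_cast (Finset.card_le_card hcov).trans Finset.card_biUnion_le
  have h2 : ∀ c ∈ K, ((S.filter fun J : ℕ =>
      (∀ i : ℕ, i ≤ t → c.1 ≤ (φ ⟨0, J / 2 ^ t, i⟩).k ∧ (φ ⟨0, J / 2 ^ t, i⟩).k ≤ c.1 + s) ∧
      (φ ⟨0, J / 2 ^ t, t⟩).k = c.2).card : ℝ) ≤
      (2 * 2 ^ (8 * L) + 1) * (16 * (t + 1) ^ 2 * 2 ^ (8 * L) * 2 ^ s) := by
    intro c _
    refine count_osc_level h h0 t s c.1 c.2 _ fun J hJ => ?_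
    rw [Finset.mem_filter, hS, Finset.mem_filter, Finset.mem_range] at hJ
    exact ⟨hJ.1.1, hJ.2.1, hJ.2.2⟩
  have h3 : (K.card : ℝ) ≤ ((6 * L + 1) * (t + 1)) ^ 2 := by
    have : ((Finset.Icc (-B) B).card : ℝ) ≤ (6 * L + 1) * (t + 1) := by
      rw [Int.card_Icc]
      have e : ((B + 1 - -B).toNat : ℤ) = 2 * B + 1 := by
        rw [Int.toNat_of_nonneg (by omega)]; ring
      have e' : ((B + 1 - -B).toNat : ℝ) = 2 * (3 * L * (t + 1)) + 1 := by
        have : (((B + 1 - -B).toNat : ℤ) : ℝ) = ((2 * B + 1 : ℤ) : ℝ) := by rw [e]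
        rw [hB] at this ⊢; push_cast at this ⊢; exact this
      rw [e']; nlinarith [Nat.cast_nonneg (α := ℝ) t]
    rw [hK, Finset.card_product, sq]; push_cast
    gcongr
  calc (S.card : ℝ) ≤ _ := h1
    _ ≤ K.card • ((2 * 2 ^ (8 * L) + 1) * (16 * (t + 1) ^ 2 * 2 ^ (8 * L) * 2 ^ s : ℝ)) :=
        Finset.sum_le_card_nsmul _ _ _ h2
    _ ≤ ((6 * L + 1) * (t + 1)) ^ 2 *
        ((2 * 2 ^ (8 * L) + 1) * (16 * (t + 1) ^ 2 * 2 ^ (8 * L) * 2 ^ s : ℝ)) := by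
        rw [nsmul_eq_mul]; gcongr
    _ = _ := by ring

/-- Few vertical segments of length `t` have image of small vertical oscillation. -/
theorem count_osc (h : CE L φ φ') (t s : ℕ) :
    (((Finset.range (2 ^ t)).filter fun J : ℕ => ∀ i : ℕ, i ≤ t → ∀ j : ℕ, j ≤ t →
      (φ ⟨0, J / 2 ^ t, i⟩).k - (φ ⟨0, J / 2 ^ t, j⟩).k ≤ s).card : ℝ) ≤
    ((6 * L + 1) ^ 2 * ((2 * 2 ^ (8 * L) + 1) * (16 * 2 ^ (8 * L)))) * (t + 1) ^ 4 * 2 ^ s := by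
  have := count_osc_origin (h.post_tr (φ ⟨0, 0, 0⟩))
    (by
      have := pinv_tr (φ ⟨0, 0, 0⟩) ⟨0, 0, 0⟩
      have e : tr (φ ⟨0, 0, 0⟩) ⟨0, 0, 0⟩ = φ ⟨0, 0, 0⟩ := by ext <;> simp [tr]
      rwa [e] at this) t s
  simpa [tr] using this

/-- For long segments, most have image of almost full vertical oscillation. -/
theorem osc_large (L : ℕ) (δ : ℝ) (hδ : 0 < δ) : ∃ t0 : ℕ, ∀ φ φ', CE L φ φ' → ∀ t : ℕ, t0 ≤ t →
    (((Finset.range (2 ^ t)).filter fun J : ℕ => ∀ i : ℕ, i ≤ t → ∀ j : ℕ, j ≤ t →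
      ((φ ⟨0, J / 2 ^ t, i⟩).k - (φ ⟨0, J / 2 ^ t, j⟩).k : ℝ) ≤ (1 - δ) * t).card : ℝ) ≤
    δ * 2 ^ t := by
  set C : ℝ := (6 * L + 1) ^ 2 * ((2 * 2 ^ (8 * L) + 1) * (16 * 2 ^ (8 * L))) with hC
  have hC0 : 0 < C := by positivity
  set r : ℝ := (2:ℝ) ^ (-δ) with hr
  have hr0 : 0 < r := by positivity
  have hr1 : r < 1 := Real.rpow_lt_one_of_one_lt_of_neg (by norm_num) (by linarith)
  have hlim : Filter.Tendsto (fun t : ℕ => ((t + 1 : ℕ) : ℝ) ^ 4 * r ^ (t + 1)) Filter.atTop (nhds 0) :=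
    (tendsto_pow_const_mul_const_pow_of_lt_one 4 hr0.le hr1).comp (Filter.tendsto_add_atTop_nat 1)
  have hev := hlim.eventually (gt_mem_nhds (show (0:ℝ) < δ * r / (2 * C) by positivity))
  obtain ⟨t0, ht0⟩ := Filter.eventually_atTop.mp hev
  refine ⟨t0, fun φ φ' h t ht => ?_⟩
  rcases lt_or_ge (1:ℝ) δ with hd | hd
  · have : (((Finset.range (2 ^ t)).filter fun J : ℕ => ∀ i : ℕ, i ≤ t → ∀ j : ℕ, j ≤ t →
      ((φ ⟨0, J / 2 ^ t, i⟩).k - (φ ⟨0, J / 2 ^ t, j⟩).k : ℝ) ≤ (1 - δ) * t).card : ℝ) ≤ 2 ^ t := by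
      have := Finset.card_filter_le (Finset.range (2 ^ t)) fun J : ℕ => ∀ i : ℕ, i ≤ t → ∀ j : ℕ,
        j ≤ t → ((φ ⟨0, J / 2 ^ t, i⟩).k - (φ ⟨0, J / 2 ^ t, j⟩).k : ℝ) ≤ (1 - δ) * t
      rw [Finset.card_range] at this
      exact_mod_cast this
    have h2 : (0:ℝ) < 2 ^ t := by positivity
    nlinarith
  set s : ℕ := ⌈(1 - δ) * t⌉₊ with hs
  have hsle : (s : ℝ) ≤ (1 - δ) * t + 1 :=
    (Nat.ceil_lt_add_one (by have : (0:ℝ) ≤ 1 - δ := by linarith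
                             positivity)).le
  have h1 := h.count_osc t s
  have hsub : ((Finset.range (2 ^ t)).filter fun J : ℕ => ∀ i : ℕ, i ≤ t → ∀ j : ℕ, j ≤ t →
      ((φ ⟨0, J / 2 ^ t, i⟩).k - (φ ⟨0, J / 2 ^ t, j⟩).k : ℝ) ≤ (1 - δ) * t) ⊆
      ((Finset.range (2 ^ t)).filter fun J : ℕ => ∀ i : ℕ, i ≤ t → ∀ j : ℕ, j ≤ t →
      (φ ⟨0, J / 2 ^ t, i⟩).k - (φ ⟨0, J / 2 ^ t, j⟩).k ≤ s) := by
    intro J hJ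
    rw [Finset.mem_filter] at hJ ⊢
    refine ⟨hJ.1, fun i hi j hj => ?_⟩
    have := (hJ.2 i hi j hj).trans (Nat.le_ceil _)
    exact_mod_cast this
  have h2 : ((2:ℝ)) ^ s ≤ 2 * (r ^ t * 2 ^ t) := by
    rw [hr, ← Real.rpow_natCast 2 s, ← Real.rpow_natCast (2 ^ (-δ)) t,
        ← Real.rpow_mul (by norm_num),
      ← Real.rpow_natCast 2 t, ← Real.rpow_add (by norm_num)]
    calc (2:ℝ) ^ (s:ℝ) ≤ (2:ℝ) ^ (1 + (-δ * t + t)) := by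
          apply Real.rpow_le_rpow_of_exponent_le (by norm_num); linarith
      _ = _ := by rw [Real.rpow_add (by norm_num), Real.rpow_one]
  have h3 := ht0 t ht
  have h4 : ((t + 1 : ℕ) : ℝ) ^ 4 * r ^ t < δ / (2 * C) := by
    rw [pow_succ r t] at h3
    have : ((t + 1 : ℕ) : ℝ) ^ 4 * r ^ t * r < δ / (2 * C) * r := by
      calc _ = ((t + 1 : ℕ) : ℝ) ^ 4 * (r ^ t * r) := by ring
        _ < _ := h3
        _ = _ := by ring
    exact lt_of_mul_lt_mul_right this hr0.le
  push_cast at h4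
  calc _ ≤ (((Finset.range (2 ^ t)).filter fun J : ℕ => ∀ i : ℕ, i ≤ t → ∀ j : ℕ, j ≤ t →
      (φ ⟨0, J / 2 ^ t, i⟩).k - (φ ⟨0, J / 2 ^ t, j⟩).k ≤ s).card : ℝ) := by
        exact_mod_cast Finset.card_le_card hsub
    _ ≤ C * (t + 1) ^ 4 * 2 ^ s := h1
    _ ≤ C * (t + 1) ^ 4 * (2 * (r ^ t * 2 ^ t)) := by gcongr
    _ = (2 * C) * (((t:ℝ) + 1) ^ 4 * r ^ t) * 2 ^ t := by ring
    _ ≤ (2 * C) * (δ / (2 * C)) * 2 ^ t := by gcongr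
    _ = δ * 2 ^ t := by field_simp

end CE

lemma sum_range_mul_eq (m q : ℕ) (f : ℕ → ℝ) :
    ∑ i ∈ Finset.range (m * q), f i =
      ∑ z ∈ Finset.range m, ∑ r ∈ Finset.range q, f (q * z + r) := by
  induction m with
  | zero => simp
  | succ m ih =>
    rw [Nat.add_mul, one_mul, Finset.sum_range_add, ih, Finset.sum_range_succ]
    simp [mul_comm]

/-- Deviation of `g` from its average over the block of length `q` containing `n`. -/
def blockDev (q : ℕ) (g : ℕ → ℝ) (n : ℕ) : ℝ :=
  g n - (∑ r ∈ Finset.range q, g (q * (n / q) + r)) / q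

lemma blockDev_zero (q n : ℕ) : blockDev q (fun _ => 0) n = 0 := by simp [blockDev]

lemma mul_add_div_of_lt {q r : ℕ} (z : ℕ) (hr : r < q) : (q * z + r) / q = z := by
  rw [Nat.mul_add_div (by omega), Nat.div_eq_of_lt hr, add_zero]

lemma sum_blockDev {q : ℕ} (hq : 0 < q) (g : ℕ → ℝ) (z : ℕ) :
    ∑ r ∈ Finset.range q, blockDev q g (q * z + r) = 0 := by
  have hq' : (q:ℝ) ≠ 0 := by positivity
  have : ∀ r ∈ Finset.range q, blockDev q g (q * z + r) =
      g (q * z + r) - (∑ r ∈ Finset.range q, g (q * z + r)) / q := by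
    intro r hr
    rw [blockDev, mul_add_div_of_lt z (Finset.mem_range.mp hr)]
  rw [Finset.sum_congr rfl this, Finset.sum_sub_distrib, Finset.sum_const, Finset.card_range,
    nsmul_eq_mul]
  field_simp; ring

lemma blockDev_le {q : ℕ} (hq : 0 < q) (g : ℕ → ℝ) (B : ℝ)
    (h : ∀ n n', n / q = n' / q → |g n - g n'| ≤ B) (n : ℕ) : |blockDev q g n| ≤ B := by
  have hq' : (0:ℝ) < q := by positivity
  have e : blockDev q g n = (∑ r ∈ Finset.range q, (g n - g (q * (n / q) + r))) / q := by
    rw [blockDev, Finset.sum_sub_distrib, Finset.sum_const, Finset.card_range, nsmul_eq_mul]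
    field_simp
  rw [e, abs_div, abs_of_pos hq', div_le_iff₀ hq']
  calc _ ≤ ∑ r ∈ Finset.range q, |g n - g (q * (n / q) + r)| := Finset.abs_sum_le_sum_abs _ _
    _ ≤ ∑ r ∈ Finset.range q, B := Finset.sum_le_sum fun r hr =>
        h _ _ (mul_add_div_of_lt _ (Finset.mem_range.mp hr)).symm
    _ = B * q := by simp [mul_comm]

lemma block_step {q M : ℕ} (D : ℕ → ℕ → ℝ) {z r : ℕ} (hr : r < q) :
    ∑ j ∈ Finset.range (M + 1), D j ((q * z + r) / q ^ (M + 1 - 1 - j)) =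
      ∑ j ∈ Finset.range M, D j (z / q ^ (M - 1 - j)) + D M (q * z + r) := by
  rw [Finset.sum_range_succ]
  congr 1
  · refine Finset.sum_congr rfl fun j hj => ?_
    rw [Finset.mem_range] at hj
    rw [show M + 1 - 1 - j = (M - 1 - j) + 1 by omega, pow_succ', ← Nat.div_div_eq_div_mul,
      mul_add_div_of_lt z hr]
  · simp

/-- Orthogonality of block deviations along a `q`-adic filtration. -/
lemma sum_sq_blockDev {q : ℕ} (hq : 0 < q) (B : ℝ) (g : ℕ → ℕ → ℝ) (M : ℕ)
    (hB : ∀ j n, |blockDev q (g j) n| ≤ B) :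
    ∑ y ∈ Finset.range (q ^ M), (∑ j ∈ Finset.range M, blockDev q (g j) (y / q ^ (M - 1 - j))) ^ 2 ≤
      M * B ^ 2 * q ^ M := by
  induction M with
  | zero => simp
  | succ M ih =>
    rw [pow_succ, sum_range_mul_eq]
    have hz : ∀ z ∈ Finset.range (q ^ M), (∑ r ∈ Finset.range q,
        (∑ j ∈ Finset.range (M + 1), blockDev q (g j) ((q * z + r) / q ^ (M + 1 - 1 - j))) ^ 2) ≤
        q * (∑ j ∈ Finset.range M, blockDev q (g j) (z / q ^ (M - 1 - j))) ^ 2 + q * B ^ 2 := by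
      intro z _
      set s := ∑ j ∈ Finset.range M, blockDev q (g j) (z / q ^ (M - 1 - j)) with hs
      have e : ∀ r ∈ Finset.range q,
          (∑ j ∈ Finset.range (M + 1), blockDev q (g j) ((q * z + r) / q ^ (M + 1 - 1 - j))) ^ 2 =
          s ^ 2 + 2 * s * blockDev q (g M) (q * z + r) + blockDev q (g M) (q * z + r) ^ 2 := by
        intro r hr
        rw [block_step (fun j => blockDev q (g j)) (Finset.mem_range.mp hr)]
        ring
      rw [Finset.sum_congr rfl e, Finset.sum_add_distrib, Finset.sum_add_distrib, ← Finset.mul_sum,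
        sum_blockDev hq, mul_zero, add_zero, Finset.sum_const, Finset.card_range, nsmul_eq_mul]
      gcongr
      calc _ ≤ ∑ r ∈ Finset.range q, B ^ 2 := Finset.sum_le_sum fun r _ => sq_le_sq' 
            (by have := (abs_le.mp (hB M (q * z + r))).1; linarith) (abs_le.mp (hB M (q * z + r))).2
        _ = q * B ^ 2 := by simp
    refine (Finset.sum_le_sum hz).trans ?_
    rw [Finset.sum_add_distrib, ← Finset.mul_sum, Finset.sum_const, Finset.card_range, nsmul_eq_mul]
    have := mul_le_mul_of_nonneg_left ih (Nat.cast_nonneg (α := ℝ) q)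
    push_cast
    rw [pow_succ (q:ℝ) M]
    linarith

lemma sum_sum_blockDev {q : ℕ} (hq : 0 < q) (g : ℕ → ℕ → ℝ) (M : ℕ) :
    ∑ y ∈ Finset.range (q ^ M), ∑ j ∈ Finset.range M, blockDev q (g j) (y / q ^ (M - 1 - j)) = 0 := by
  induction M with
  | zero => simp
  | succ M ih =>
    rw [pow_succ, sum_range_mul_eq]
    have hz : ∀ z ∈ Finset.range (q ^ M), (∑ r ∈ Finset.range q,
        (∑ j ∈ Finset.range (M + 1), blockDev q (g j) ((q * z + r) / q ^ (M + 1 - 1 - j)))) =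
        q * (∑ j ∈ Finset.range M, blockDev q (g j) (z / q ^ (M - 1 - j))) := by
      intro z _
      rw [Finset.sum_congr rfl fun r hr =>
        block_step (fun j => blockDev q (g j)) (Finset.mem_range.mp hr), Finset.sum_add_distrib,
        sum_blockDev hq]
      simp
    rw [Finset.sum_congr rfl hz, ← Finset.mul_sum, ih, mul_zero]

lemma sum_abs_blockDev {q : ℕ} (hq : 0 < q) (B : ℝ) (hB0 : 0 ≤ B) (g : ℕ → ℕ → ℝ) (M n : ℕ)
    (hn : n ≤ M) (hB : ∀ j n, |blockDev q (g j) n| ≤ B) :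
    ∑ y ∈ Finset.range (q ^ M), |∑ j ∈ Finset.range n, blockDev q (g j) (y / q ^ (M - 1 - j))| ≤
      B * √M * q ^ M := by
  set g' : ℕ → ℕ → ℝ := fun j => if j < n then g j else fun _ => 0 with hg'
  have hB' : ∀ j n, |blockDev q (g' j) n| ≤ B := by
    intro j n
    simp only [hg']
    split_ifs
    · exact hB j n
    · rw [blockDev_zero]; simpa using hB0
  have e : ∀ y, ∑ j ∈ Finset.range n, blockDev q (g j) (y / q ^ (M - 1 - j)) =
      ∑ j ∈ Finset.range M, blockDev q (g' j) (y / q ^ (M - 1 - j)) := by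
    intro y
    rw [← Finset.sum_subset (Finset.range_mono hn)]
    · refine Finset.sum_congr rfl fun j hj => ?_
      rw [Finset.mem_range] at hj
      simp [hg', hj]
    · intro j _ hj
      rw [Finset.mem_range] at hj
      simp [hg', hj, blockDev_zero]
  simp only [e]
  have h1 := sum_sq_blockDev hq B g' M hB'
  have h2 := sq_sum_le_card_mul_sum_sq (s := Finset.range (q ^ M)) (f := fun y =>
    |∑ j ∈ Finset.range M, blockDev q (g' j) (y / q ^ (M - 1 - j))|)
  simp only [sq_abs, Finset.card_range] at h2
  push_cast at h2
  refine abs_le_of_sq_le_sq' ?_ (by positivity) |>.2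
  have h3 := Real.sq_sqrt (Nat.cast_nonneg (α := ℝ) M)
  calc _ ≤ _ := h2
    _ ≤ (q:ℝ) ^ M * (M * B ^ 2 * q ^ M) := by gcongr
    _ = _ := by rw [mul_pow, mul_pow, h3]; ring

lemma sum_abs_blockDev_reverse {q : ℕ} (hq : 0 < q) (B : ℝ) (hB0 : 0 ≤ B) (g : ℕ → ℕ → ℝ) (M n : ℕ)
    (hn : n ≤ M) (hB : ∀ j n, |blockDev q (g j) n| ≤ B) :
    ∑ y ∈ Finset.range (q ^ M), |∑ j ∈ Finset.range n, blockDev q (g j) (y / q ^ j)| ≤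
      B * √M * q ^ M := by
  set g' : ℕ → ℕ → ℝ := fun j => if M - 1 - j < n then g (M - 1 - j) else fun _ => 0 with hg'
  have hB' : ∀ j n, |blockDev q (g' j) n| ≤ B := by
    intro j n
    simp only [hg']
    split_ifs
    · exact hB _ n
    · rw [blockDev_zero]; simpa using hB0
  have e : ∀ y, ∑ j ∈ Finset.range n, blockDev q (g j) (y / q ^ j) =
      ∑ j ∈ Finset.range M, blockDev q (g' j) (y / q ^ (M - 1 - j)) := by
    intro y
    have := Finset.sum_range_reflect
      (fun j => blockDev q (if j < n then g j else fun _ => 0) (y / q ^ j)) M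
    simp only [hg']
    rw [this, ← Finset.sum_subset (Finset.range_mono hn)]
    · refine Finset.sum_congr rfl fun j hj => ?_
      rw [Finset.mem_range] at hj
      simp [hj]
    · intro j _ hj
      rw [Finset.mem_range] at hj
      simp [hj, blockDev_zero]
  simp only [e]
  exact sum_abs_blockDev hq B hB0 g' M M le_rfl hB'

lemma sum_sum_blockDev_reverse {q : ℕ} (hq : 0 < q) (g : ℕ → ℕ → ℝ) (M : ℕ) :
    ∑ y ∈ Finset.range (q ^ M), ∑ j ∈ Finset.range M, blockDev q (g j) (y / q ^ j) = 0 := by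
  rw [← sum_sum_blockDev hq (fun j => g (M - 1 - j)) M]
  refine Finset.sum_congr rfl fun y _ => ?_
  exact (Finset.sum_range_reflect (fun j => blockDev q (g j) (y / q ^ j)) M).symm

/-- Average height gain of the box of size `R` based at the origin. -/
def boxGain (φ : Pt → Pt) (R : ℕ) : ℝ :=
  (∑ Y ∈ Finset.range (2 ^ R), ((φ ⟨0, Y / 2 ^ R, R⟩).k : ℝ)) / 2 ^ R -
    (∑ X ∈ Finset.range (2 ^ R), ((φ ⟨X, 0, 0⟩).k : ℝ)) / 2 ^ R

/-- Level of the image of the corner, at level `j * R`, of the cell of the line `(X, Y)`. -/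
def gridLev (φ : Pt → Pt) (R M j X Y : ℕ) : ℝ :=
  ((φ ⟨(X / (2 ^ R) ^ j : ℕ) * (2 ^ R) ^ j, (Y / (2 ^ R) ^ (M - j) : ℕ) / (2 ^ R) ^ j,
    (j * R : ℕ)⟩).k : ℝ)

/-- The corner of the box of size `R` above level `j * R` met by the line `(X, Y)`. -/
def boxBase (R M j X Y : ℕ) : Pt :=
  ⟨(X / (2 ^ R) ^ (j + 1) : ℕ) * (2 ^ R) ^ (j + 1), (Y / (2 ^ R) ^ (M - j) : ℕ) / (2 ^ R) ^ j,
    (j * R : ℕ)⟩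

def topFn (φ : Pt → Pt) (R X j n : ℕ) : ℝ :=
  ((φ ⟨(X / (2 ^ R) ^ (j + 1) : ℕ) * (2 ^ R) ^ (j + 1), n / (2 ^ R) ^ (j + 1),
    ((j + 1) * R : ℕ)⟩).k : ℝ)

def botFn (φ : Pt → Pt) (R M Y j n : ℕ) : ℝ :=
  ((φ ⟨n * (2 ^ R) ^ j, (Y / (2 ^ R) ^ (M - j) : ℕ) / (2 ^ R) ^ j, (j * R : ℕ)⟩).k : ℝ)

lemma zpow_two_natMul (j R : ℕ) : (2:ℝ) ^ (((j * R : ℕ)) : ℤ) = (2 ^ R) ^ j := by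
  rw [zpow_natCast, mul_comm, pow_mul]

lemma boxGain_boxBase (φ : Pt → Pt) (R M j X Y : ℕ) :
    boxGain (fun p => φ (tr (boxBase R M j X Y) p)) R =
      (∑ r ∈ Finset.range (2 ^ R), topFn φ R X j (2 ^ R * (Y / (2 ^ R) ^ (M - j)) + r)) / 2 ^ R -
      (∑ r ∈ Finset.range (2 ^ R),
          botFn φ R M Y j (2 ^ R * (X / (2 ^ R) ^ (j + 1)) + r)) / 2 ^ R := by
  unfold boxGain
  congr 2 <;> refine Finset.sum_congr rfl fun r _ => ?_
  · simp only [topFn, tr, boxBase]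
    rw [zpow_neg, zpow_two_natMul]
    have e1 : ∀ a : ℝ, a / (2 ^ R) ^ j + ((2 ^ R) ^ j)⁻¹ * ((r:ℝ) / 2 ^ R) =
        (2 ^ R * a + r) / (2 ^ R) ^ (j + 1) := by
      intro a; field_simp; ring
    rw [e1, mul_zero, add_zero]
    push_cast
    rw [show (j:ℤ) * R + R = (j + 1) * R by ring]
  · simp only [botFn, tr, boxBase]
    rw [zpow_two_natMul]
    push_cast
    rw [mul_zero, add_zero, add_zero]
    congr 3
    rw [pow_succ]
    congr 2
    ring

lemma gridLev_succ_sub (φ : Pt → Pt) (R M j X Y : ℕ) (hj : j < M) :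
    gridLev φ R M (j + 1) X Y - gridLev φ R M j X Y =
      blockDev (2 ^ R) (topFn φ R X j) (Y / (2 ^ R) ^ (M - 1 - j)) -
      blockDev (2 ^ R) (botFn φ R M Y j) (X / (2 ^ R) ^ j) +
      boxGain (fun p => φ (tr (boxBase R M j X Y) p)) R := by
  have e1 : Y / (2 ^ R) ^ (M - 1 - j) / 2 ^ R = Y / (2 ^ R) ^ (M - j) := by
    rw [Nat.div_div_eq_div_mul, ← pow_succ]; congr 2; omega
  have e2 : X / (2 ^ R) ^ j / 2 ^ R = X / (2 ^ R) ^ (j + 1) := by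
    rw [Nat.div_div_eq_div_mul, ← pow_succ]
  rw [boxGain_boxBase, blockDev, blockDev, e1, e2]
  have e3 : gridLev φ R M (j + 1) X Y = topFn φ R X j (Y / (2 ^ R) ^ (M - 1 - j)) := by
    simp only [gridLev, topFn]; rw [show M - (j + 1) = M - 1 - j by omega]
  have e4 : gridLev φ R M j X Y = botFn φ R M Y j (X / (2 ^ R) ^ j) := by
    simp only [gridLev, botFn]
  rw [e3, e4]; push_cast; ring

lemma abs_sub_lt_of_div_eq {q n n' : ℕ} (hq : 0 < q) (h : n / q = n' / q) :
    |(n:ℝ) - n'| ≤ q := by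
  have h1 := Nat.div_add_mod n q
  have h2 := Nat.div_add_mod n' q
  have h3 := Nat.mod_lt n hq
  have h4 := Nat.mod_lt n' hq
  rw [h] at h1
  rw [abs_le]
  constructor
  · have : n' ≤ n + q := by omega
    have : (n':ℝ) ≤ n + q := by exact_mod_cast this
    linarith
  · have : n ≤ n' + q := by omega
    have : (n:ℝ) ≤ n' + q := by exact_mod_cast this
    linarith

namespace CE
variable {L : ℕ} {φ φ' : Pt → Pt}

lemma k_real (h : CE L φ φ') {n : ℕ} {p q : Pt} (hn : Near n p q) :
    |((φ q).k : ℝ) - (φ p).k| ≤ L * (n + 1) := by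
  have := (h.fwd n _ _ hn).k_le
  exact_mod_cast this

lemma topFn_dev (h : CE L φ φ') (R X j n : ℕ) :
    |blockDev (2 ^ R) (topFn φ R X j) n| ≤ L * (R + 2) := by
  refine blockDev_le (by positivity) _ _ (fun n n' hnn => ?_) n
  have h1 := abs_sub_lt_of_div_eq (by positivity) hnn
  have hN : Near (R + 1) ⟨(X / (2 ^ R) ^ (j + 1) : ℕ) * (2 ^ R) ^ (j + 1), n' / (2 ^ R) ^ (j + 1),
    ((j + 1) * R : ℕ)⟩ ⟨(X / (2 ^ R) ^ (j + 1) : ℕ) * (2 ^ R) ^ (j + 1), n / (2 ^ R) ^ (j + 1),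
    ((j + 1) * R : ℕ)⟩ := by
    refine near_of_bounds ?_ ?_ ?_
    · simp only [sub_self, abs_zero]; positivity
    · simp only [sub_self, abs_zero]; positivity
    · simp only
      rw [← sub_div, abs_div, zpow_neg, zpow_two_natMul,
          abs_of_pos (by positivity : (0:ℝ) < (2 ^ R) ^ (j + 1)), div_eq_mul_inv]
      push_cast at h1
      gcongr
  have := h.k_real hN
  push_cast at this
  simp only [topFn]
  push_cast
  linarith

lemma botFn_dev (h : CE L φ φ') (R M Y j n : ℕ) :
    |blockDev (2 ^ R) (botFn φ R M Y j) n| ≤ L * (R + 2) := by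
  refine blockDev_le (by positivity) _ _ (fun n n' hnn => ?_) n
  have h1 := abs_sub_lt_of_div_eq (by positivity) hnn
  have hN : Near (R + 1) ⟨n' * (2 ^ R) ^ j, (Y / (2 ^ R) ^ (M - j) : ℕ) / (2 ^ R) ^ j,
      (j * R : ℕ)⟩ ⟨n * (2 ^ R) ^ j, (Y / (2 ^ R) ^ (M - j) : ℕ) / (2 ^ R) ^ j, (j * R : ℕ)⟩ := by
    refine near_of_bounds ?_ ?_ ?_
    · simp only [sub_self, abs_zero]; positivity
    · simp only
      rw [← sub_mul, abs_mul, zpow_two_natMul, abs_of_pos (by positivity : (0:ℝ) < (2 ^ R) ^ j)]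
      push_cast at h1
      gcongr
    · simp only [sub_self, abs_zero]; positivity
  have := h.k_real hN
  push_cast at this
  simp only [botFn]
  push_cast
  linarith

lemma gridLev_sub_eq (φ : Pt → Pt) (R M n X Y : ℕ) (hn : n ≤ M) :
    gridLev φ R M n X Y - gridLev φ R M 0 X Y =
      ∑ j ∈ Finset.range n, blockDev (2 ^ R) (topFn φ R X j) (Y / (2 ^ R) ^ (M - 1 - j)) -
      ∑ j ∈ Finset.range n, blockDev (2 ^ R) (botFn φ R M Y j) (X / (2 ^ R) ^ j) +
      ∑ j ∈ Finset.range n, boxGain (fun p => φ (tr (boxBase R M j X Y) p)) R := by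
  rw [← Finset.sum_range_sub (fun j => gridLev φ R M j X Y) n, ← Finset.sum_sub_distrib,
    ← Finset.sum_add_distrib]
  refine Finset.sum_congr rfl fun j hj => ?_
  exact gridLev_succ_sub φ R M j X Y (by rw [Finset.mem_range] at hj; omega)

/-- Law of large numbers: along most lines the height gain is the sum of the box gains. -/
theorem sum_abs_gridLev_sub (h : CE L φ φ') (R M n : ℕ) (hn : n ≤ M) :
    ∑ X ∈ Finset.range ((2 ^ R) ^ M), ∑ Y ∈ Finset.range ((2 ^ R) ^ M),
      |gridLev φ R M n X Y - gridLev φ R M 0 X Y -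
        ∑ j ∈ Finset.range n, boxGain (fun p => φ (tr (boxBase R M j X Y) p)) R| ≤
      2 * (L * (R + 2)) * √M * ((2 ^ R) ^ M * (2 ^ R) ^ M) := by
  have hB0 : (0:ℝ) ≤ L * (R + 2) := by positivity
  have hq : 0 < 2 ^ R := by positivity
  have hX : ∀ X, ∑ Y ∈ Finset.range ((2 ^ R) ^ M), |∑ j ∈ Finset.range n,
      blockDev (2 ^ R) (topFn φ R X j) (Y / (2 ^ R) ^ (M - 1 - j))| ≤
      L * (R + 2) * √M * (2 ^ R) ^ M := by
    intro X
    have := sum_abs_blockDev hq _ hB0 (topFn φ R X) M n hn (fun j n => h.topFn_dev R X j n)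
    push_cast at this; exact this
  have hY : ∀ Y, ∑ X ∈ Finset.range ((2 ^ R) ^ M), |∑ j ∈ Finset.range n,
      blockDev (2 ^ R) (botFn φ R M Y j) (X / (2 ^ R) ^ j)| ≤
      L * (R + 2) * √M * (2 ^ R) ^ M := by
    intro Y
    have := sum_abs_blockDev_reverse hq _ hB0 (botFn φ R M Y) M n hn (fun j n => h.botFn_dev R M Y j n)
    push_cast at this; exact this
  calc _ ≤ ∑ X ∈ Finset.range ((2 ^ R) ^ M), ∑ Y ∈ Finset.range ((2 ^ R) ^ M),
      (|∑ j ∈ Finset.range n, blockDev (2 ^ R) (topFn φ R X j) (Y / (2 ^ R) ^ (M - 1 - j))| +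
      |∑ j ∈ Finset.range n, blockDev (2 ^ R) (botFn φ R M Y j) (X / (2 ^ R) ^ j)|) := by
        refine Finset.sum_le_sum fun X _ => Finset.sum_le_sum fun Y _ => ?_
        rw [gridLev_sub_eq φ R M n X Y hn, add_sub_cancel_right]
        exact abs_sub _ _
    _ = (∑ X ∈ Finset.range ((2 ^ R) ^ M), ∑ Y ∈ Finset.range ((2 ^ R) ^ M),
      |∑ j ∈ Finset.range n, blockDev (2 ^ R) (topFn φ R X j) (Y / (2 ^ R) ^ (M - 1 - j))|) +
      ∑ Y ∈ Finset.range ((2 ^ R) ^ M), ∑ X ∈ Finset.range ((2 ^ R) ^ M),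
      |∑ j ∈ Finset.range n, blockDev (2 ^ R) (botFn φ R M Y j) (X / (2 ^ R) ^ j)| := by
        simp only [Finset.sum_add_distrib]
        congr 1
        rw [Finset.sum_comm]
    _ ≤ (∑ X ∈ Finset.range ((2 ^ R) ^ M), L * (R + 2) * √M * (2 ^ R) ^ M) +
        ∑ Y ∈ Finset.range ((2 ^ R) ^ M), L * (R + 2) * √M * (2 ^ R) ^ M :=
        add_le_add (Finset.sum_le_sum fun X _ => hX X) (Finset.sum_le_sum fun Y _ => hY Y)
    _ = _ := by
        simp only [Finset.sum_const, Finset.card_range, nsmul_eq_mul]; push_cast; ring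

/-- The gain of a large box is the average of the sums of gains of the small boxes along lines. -/
theorem boxGain_mul (φ : Pt → Pt) (R M : ℕ) :
    boxGain φ (M * R) * ((2 ^ R) ^ M * (2 ^ R) ^ M) =
      ∑ X ∈ Finset.range ((2 ^ R) ^ M), ∑ Y ∈ Finset.range ((2 ^ R) ^ M),
        ∑ j ∈ Finset.range M, boxGain (fun p => φ (tr (boxBase R M j X Y) p)) R := by
  have hq : 0 < 2 ^ R := by positivity
  have e : ∀ X Y, ∑ j ∈ Finset.range M, boxGain (fun p => φ (tr (boxBase R M j X Y) p)) R =
      gridLev φ R M M X Y - gridLev φ R M 0 X Y -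
      ∑ j ∈ Finset.range M, blockDev (2 ^ R) (topFn φ R X j) (Y / (2 ^ R) ^ (M - 1 - j)) +
      ∑ j ∈ Finset.range M, blockDev (2 ^ R) (botFn φ R M Y j) (X / (2 ^ R) ^ j) := by
    intro X Y; rw [gridLev_sub_eq φ R M M X Y le_rfl]; ring
  simp only [e, Finset.sum_add_distrib, Finset.sum_sub_distrib]
  simp only [sum_sum_blockDev hq, Finset.sum_const_zero, sub_zero]
  rw [Finset.sum_comm (f := fun X Y => ∑ j ∈ Finset.range M,
    blockDev (2 ^ R) (botFn φ R M Y j) (X / (2 ^ R) ^ j))]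
  simp only [sum_sum_blockDev_reverse hq, Finset.sum_const_zero, add_zero]
  have e1 : ∀ X ∈ Finset.range ((2 ^ R) ^ M), ∑ Y ∈ Finset.range ((2 ^ R) ^ M), gridLev φ R M M X Y =
      ∑ Y ∈ Finset.range ((2 ^ R) ^ M), ((φ ⟨0, Y / (2 ^ R) ^ M, (M * R : ℕ)⟩).k : ℝ) := by
    intro X hX
    refine Finset.sum_congr rfl fun Y _ => ?_
    rw [Finset.mem_range] at hX
    simp [gridLev, Nat.div_eq_of_lt hX]
  have e2 : ∀ X ∈ Finset.range ((2 ^ R) ^ M), ∑ Y ∈ Finset.range ((2 ^ R) ^ M), gridLev φ R M 0 X Y =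
      (2 ^ R) ^ M * ((φ ⟨X, 0, 0⟩).k : ℝ) := by
    intro X _
    have : ∀ Y ∈ Finset.range ((2 ^ R) ^ M), gridLev φ R M 0 X Y = ((φ ⟨X, 0, 0⟩).k : ℝ) := by
      intro Y hY
      rw [Finset.mem_range] at hY
      simp [gridLev, Nat.div_eq_of_lt hY]
    rw [Finset.sum_congr rfl this]; simp
  rw [Finset.sum_congr rfl e1, Finset.sum_congr rfl e2, Finset.sum_const, Finset.card_range,
    nsmul_eq_mul, ← Finset.mul_sum, boxGain]
  have e3 : (2:ℝ) ^ (M * R) = (2 ^ R) ^ M := by rw [mul_comm, pow_mul]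
  have e4 : (2:ℕ) ^ (M * R) = (2 ^ R) ^ M := by rw [mul_comm, pow_mul]
  rw [e3, e4]
  push_cast
  field_simp

end CE

/-- Corner at level `k` of the cell of the line `(X, Y)` of the box of size `N`. -/
def linePt (N k X Y : ℕ) : Pt := ⟨(X / 2 ^ k : ℕ) * 2 ^ k, (Y / 2 ^ (N - k) : ℕ) / 2 ^ k, k⟩

lemma gridLev_eq (φ : Pt → Pt) (R M j X Y : ℕ) :
    gridLev φ R M j X Y = ((φ (linePt (M * R) (j * R) X Y)).k : ℝ) := by
  rw [gridLev, linePt, ← Nat.sub_mul, mul_comm j R, mul_comm (M - j) R, pow_mul, pow_mul, pow_mul]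

lemma abs_floor_mul_sub_le (X i j : ℕ) (h : i ≤ j) :
    |(((X / 2 ^ j : ℕ) : ℝ) * 2 ^ j) - ((X / 2 ^ i : ℕ) : ℝ) * 2 ^ i| ≤ 2 ^ j := by
  have h1 := Nat.div_add_mod X (2 ^ j)
  have h2 := Nat.div_add_mod X (2 ^ i)
  have h3 := Nat.mod_lt X (show 0 < 2 ^ j by positivity)
  have h4 := Nat.mod_lt X (show 0 < 2 ^ i by positivity)
  have h5 : 2 ^ i ≤ 2 ^ j := Nat.pow_le_pow_right (by norm_num) h
  rw [abs_le]
  constructor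
  · have : X / 2 ^ i * 2 ^ i ≤ X / 2 ^ j * 2 ^ j + 2 ^ j := by
      rw [mul_comm (X / 2 ^ i), mul_comm (X / 2 ^ j)]; omega
    have : ((X / 2 ^ i : ℕ) : ℝ) * 2 ^ i ≤ ((X / 2 ^ j : ℕ) : ℝ) * 2 ^ j + 2 ^ j := by
      exact_mod_cast this
    linarith
  · have : X / 2 ^ j * 2 ^ j ≤ X / 2 ^ i * 2 ^ i + 2 ^ j := by
      rw [mul_comm (X / 2 ^ i), mul_comm (X / 2 ^ j)]; omega
    have : ((X / 2 ^ j : ℕ) : ℝ) * 2 ^ j ≤ ((X / 2 ^ i : ℕ) : ℝ) * 2 ^ i + 2 ^ j := by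
      exact_mod_cast this
    linarith

lemma floor_div_eq (N k Y : ℕ) (hk : k ≤ N) :
    ((Y / 2 ^ (N - k) : ℕ) : ℝ) / 2 ^ k = ((Y / 2 ^ (N - k) : ℕ) : ℝ) * 2 ^ (N - k) / 2 ^ N := by
  rw [show (2:ℝ) ^ N = 2 ^ (N - k) * 2 ^ k by rw [← pow_add]; congr 1; omega]
  field_simp

lemma near_linePt (N i j X Y : ℕ) (hij : i ≤ j) (hj : j ≤ N) :
    Near (j - i + 1) (linePt N i X Y) (linePt N j X Y) := by
  refine near_of_bounds ?_ ?_ ?_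
  · simp only [linePt]
    rw [abs_of_nonneg (by omega)]; omega
  · simp only [linePt]
    refine (abs_floor_mul_sub_le X i j hij).trans (le_of_eq ?_)
    rw [zpow_natCast, ← pow_add]; congr 1; omega
  · simp only [linePt]
    rw [floor_div_eq N i Y (by omega), floor_div_eq N j Y hj, ← sub_div, abs_div,
      abs_of_pos (show (0:ℝ) < 2 ^ N by positivity), abs_sub_comm, zpow_neg, zpow_natCast]
    have h1 := abs_floor_mul_sub_le Y (N - j) (N - i) (by omega)
    have e : (2:ℝ) ^ N = 2 ^ (N - i) * 2 ^ i := by rw [← pow_add]; congr 1; omega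
    have h2 : (1:ℝ) ≤ 2 ^ (j - i) := one_le_two_pow_real _
    calc _ ≤ (2:ℝ) ^ (N - i) / 2 ^ N := by gcongr
      _ = 1 * ((2:ℝ) ^ i)⁻¹ := by rw [e]; field_simp
      _ ≤ _ := by gcongr

lemma CE.boxGain_abs_le {L : ℕ} {φ φ' : Pt → Pt} (h : CE L φ φ') (R : ℕ) :
    |boxGain φ R| ≤ 2 * (L * (R + 2)) := by
  have hp : (0:ℝ) < 2 ^ R := by positivity
  have avg : ∀ (g : ℕ → ℝ) (c B : ℝ), (∀ n ∈ Finset.range (2 ^ R), |g n - c| ≤ B) →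
      |(∑ n ∈ Finset.range (2 ^ R), g n) / 2 ^ R - c| ≤ B := by
    intro g c B hg
    have e : (∑ n ∈ Finset.range (2 ^ R), g n) / 2 ^ R - c =
        (∑ n ∈ Finset.range (2 ^ R), (g n - c)) / 2 ^ R := by
      rw [Finset.sum_sub_distrib, Finset.sum_const, Finset.card_range, nsmul_eq_mul]
      push_cast; field_simp
    rw [e, abs_div, abs_of_pos hp, div_le_iff₀ hp]
    refine (Finset.abs_sum_le_sum_abs _ _).trans ((Finset.sum_le_sum hg).trans (le_of_eq ?_))
    rw [Finset.sum_const, Finset.card_range, nsmul_eq_mul]; push_cast; ring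
  have h1 := avg (fun Y => ((φ ⟨0, Y / 2 ^ R, R⟩).k : ℝ)) (φ ⟨0, 0, 0⟩).k (L * (R + 2)) (by
    intro Y hY
    rw [Finset.mem_range] at hY
    have : Near (R + 1) ⟨0, 0, 0⟩ ⟨0, Y / 2 ^ R, R⟩ := by
      refine near_of_bounds (by simp) (by simp) ?_
      simp only [sub_zero, neg_zero, zpow_zero, mul_one]
      exact (dyadic_le_one hY).trans (one_le_two_pow_real R)
    have := h.k_real this
    push_cast at this
    linarith)
  have h2 := avg (fun X => ((φ ⟨X, 0, 0⟩).k : ℝ)) (φ ⟨0, 0, 0⟩).k (L * (R + 2)) (by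
    intro X hX
    rw [Finset.mem_range] at hX
    have : Near (R + 1) ⟨0, 0, 0⟩ ⟨X, 0, 0⟩ := by
      refine near_of_bounds (by simp; positivity) ?_ (by simp)
      simp only [sub_zero, zpow_zero, mul_one]
      rw [abs_of_nonneg (by positivity)]
      exact_mod_cast hX.le
    have := h.k_real this
    push_cast at this
    linarith)
  have h3 := abs_sub_le ((∑ Y ∈ Finset.range (2 ^ R), ((φ ⟨0, Y / 2 ^ R, R⟩).k : ℝ)) / 2 ^ R)
    ((φ ⟨0, 0, 0⟩).k : ℝ) ((∑ X ∈ Finset.range (2 ^ R), ((φ ⟨X, 0, 0⟩).k : ℝ)) / 2 ^ R)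
  rw [abs_sub_comm ((φ ⟨0, 0, 0⟩).k : ℝ)] at h3
  unfold boxGain
  linarith

/-- Some box size at which no map of constant `L` gains more than `c` per unit. -/
def GainLe (L : ℕ) (c : ℝ) : Prop :=
  ∃ R : ℕ, 1 ≤ R ∧ ∀ φ φ', CE L φ φ' → boxGain φ R ≤ c * R

lemma GainLe.mono {L : ℕ} {c c' : ℝ} (h : GainLe L c) (hc : c ≤ c') : GainLe L c' := by
  obtain ⟨R, hR, h⟩ := h
  exact ⟨R, hR, fun φ φ' hφ => (h φ φ' hφ).trans (by gcongr)⟩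

lemma gainLe_trivial (L : ℕ) : GainLe L (6 * L) :=
  ⟨1, le_rfl, fun φ φ' h => by
    have := (abs_le.mp (h.boxGain_abs_le 1)).2
    push_cast at this ⊢; linarith⟩

lemma exists_extremal_slope (L : ℕ) (c : ℝ) (hc : ¬ GainLe L c) :
    ∃ l, c ≤ l ∧ (∀ ε > 0, GainLe L (l + ε)) ∧ (∀ ε > 0, ¬ GainLe L (l - ε)) := by
  have hlb : ∀ x, GainLe L x → c ≤ x := fun x hx => by
    by_contra hlt; exact hc (hx.mono (by linarith))
  have hb : BddBelow {x | GainLe L x} := ⟨c, hlb⟩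
  have hne : {x | GainLe L x}.Nonempty := ⟨_, gainLe_trivial L⟩
  refine ⟨sInf {x | GainLe L x}, le_csInf hne hlb, fun ε hε => ?_, fun ε hε hG => ?_⟩
  · obtain ⟨x, hx, hlt⟩ := exists_lt_of_csInf_lt hne (lt_add_of_pos_right _ hε)
    exact hx.mono hlt.le
  · have := csInf_le hb hG; linarith

/-- Sum over the lines of the box of size `N`. -/
def lineSum (N : ℕ) (f : ℕ → ℕ → ℝ) : ℝ :=
  ∑ X ∈ Finset.range (2 ^ N), ∑ Y ∈ Finset.range (2 ^ N), f X Y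

lemma lineSum_mono {N : ℕ} {f g : ℕ → ℕ → ℝ} (h : ∀ X < 2 ^ N, ∀ Y < 2 ^ N, f X Y ≤ g X Y) :
    lineSum N f ≤ lineSum N g :=
  Finset.sum_le_sum fun X hX => Finset.sum_le_sum fun Y hY =>
    h X (Finset.mem_range.mp hX) Y (Finset.mem_range.mp hY)

lemma lineSum_add (N : ℕ) (f g : ℕ → ℕ → ℝ) :
    lineSum N (fun X Y => f X Y + g X Y) = lineSum N f + lineSum N g := by
  simp only [lineSum, Finset.sum_add_distrib]

lemma lineSum_const (N : ℕ) (c : ℝ) : lineSum N (fun _ _ => c) = c * 4 ^ N := by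
  simp only [lineSum, Finset.sum_const, Finset.card_range, nsmul_eq_mul]
  rw [show (4:ℝ) = 2 * 2 by norm_num, mul_pow]; push_cast; ring

lemma lineSum_mul (N : ℕ) (c : ℝ) (f : ℕ → ℕ → ℝ) :
    lineSum N (fun X Y => c * f X Y) = c * lineSum N f := by
  simp only [lineSum, Finset.mul_sum]

lemma CE.lineSum_abs_sub {L : ℕ} {φ φ' : Pt → Pt} (h : CE L φ φ') (R M n : ℕ) (hn : n ≤ M) :
    lineSum (M * R) (fun X Y => |gridLev φ R M n X Y - gridLev φ R M 0 X Y -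
        ∑ j ∈ Finset.range n, boxGain (fun p => φ (tr (boxBase R M j X Y) p)) R|) ≤
      2 * (L * (R + 2)) * √M * 4 ^ (M * R) := by
  have := h.sum_abs_gridLev_sub R M n hn
  have e : ((2:ℕ) ^ R) ^ M = 2 ^ (M * R) := by rw [mul_comm, pow_mul]
  have e' : ((2:ℝ) ^ R) ^ M = 2 ^ (M * R) := by rw [mul_comm, pow_mul]
  rw [e, e', ← mul_pow, show (2:ℝ) * 2 = 4 by norm_num] at this
  exact this

lemma lineSum_boxGain (φ : Pt → Pt) (R M : ℕ) :
    lineSum (M * R) (fun X Y =>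
      ∑ j ∈ Finset.range M, boxGain (fun p => φ (tr (boxBase R M j X Y) p)) R) =
      boxGain φ (M * R) * 4 ^ (M * R) := by
  have := CE.boxGain_mul φ R M
  have e : ((2:ℕ) ^ R) ^ M = 2 ^ (M * R) := by rw [mul_comm, pow_mul]
  have e' : ((2:ℝ) ^ R) ^ M = 2 ^ (M * R) := by rw [mul_comm, pow_mul]
  rw [e, e', ← mul_pow, show (2:ℝ) * 2 = 4 by norm_num] at this
  exact this.symm

/-- At an extremal slope there are arbitrarily large boxes with almost linear heights. -/
lemma exists_near_linear (L : ℕ) (l : ℝ) (hl : 0 ≤ l) (h1 : ∀ ε > 0, GainLe L (l + ε))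
    (h2 : ∀ ε > 0, ¬ GainLe L (l - ε)) (ε : ℝ) (hε : 0 < ε) (N0 : ℕ) :
    ∃ N ≥ N0, ∃ φ φ', CE L φ φ' ∧ ∃ c : ℝ, ∀ k ≤ N,
      lineSum N (fun X Y => |((φ (linePt N k X Y)).k : ℝ) - c - l * k|) ≤ ε * N * 4 ^ N := by
  set η := ε / 10 with hη
  have hη0 : 0 < η := by positivity
  obtain ⟨R, hR, hgain⟩ := h1 η hη0
  have hRr : (1:ℝ) ≤ R := by exact_mod_cast hR
  obtain ⟨M, hM0, hM1,
      hM2⟩ : ∃ M : ℕ, N0 ≤ M ∧ 1 ≤ M ∧ 2 * (L * (R + 2)) * √M + (L * (R + 2) + l * R)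
      ≤ η * M := by
    have hA : Filter.Tendsto (fun M : ℕ => √(M:ℝ)) Filter.atTop Filter.atTop :=
      Real.tendsto_sqrt_atTop.comp tendsto_natCast_atTop_atTop
    obtain ⟨M, hM⟩ := ((hA.eventually_ge_atTop
      ((2 * (L * (R + 2)) + (L * (R + 2) + l * R)) / η)).and ((Filter.eventually_ge_atTop N0).and
      (Filter.eventually_ge_atTop 1))).exists
    refine ⟨M, hM.2.1, hM.2.2, ?_⟩
    have hs := Real.sq_sqrt (Nat.cast_nonneg (α := ℝ) M)
    have h1 : 1 ≤ √(M:ℝ) := by rw [Real.one_le_sqrt]; exact_mod_cast hM.2.2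
    have h3 := hM.1
    rw [div_le_iff₀ hη0] at h3
    have h4 : (0:ℝ) ≤ L * (R + 2) + l * R := by positivity
    nlinarith
  have hN : (M:ℝ) ≤ (M * R : ℕ) := by push_cast; nlinarith [Nat.cast_nonneg (α := ℝ) M]
  have hnot := h2 η hη0
  simp only [GainLe, not_exists, not_and, not_forall, not_le] at hnot
  obtain ⟨φ, φ', hφ, hbig⟩ := hnot (M * R) (Nat.mul_pos hM1 hR)
  refine ⟨M * R, hM0.trans (Nat.le_mul_of_pos_right _ hR), φ, φ', hφ, ?_⟩
  set N := M * R with hNdef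
  have h4 : (0:ℝ) < 4 ^ N := by positivity
  have hNr : (N:ℝ) = M * R := by push_cast [hNdef]; ring
  -- the box gains are concentrated
  have hE : ∀ b : Pt, |boxGain (fun p => φ (tr b p)) R - l * R| ≤
      η * R + ((l + η) * R - boxGain (fun p => φ (tr b p)) R) := by
    intro b
    have := hgain _ _ (hφ.pre_tr b)
    have : 0 ≤ η * R := by positivity
    rw [abs_le]; constructor <;> linarith
  have hsumE : lineSum N (fun X Y => ∑ j ∈ Finset.range M,
      |boxGain (fun p => φ (tr (boxBase R M j X Y) p)) R - l * R|) ≤ 3 * η * N * 4 ^ N := by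
    calc _ ≤ lineSum N (fun X Y => (l + 2 * η) * N + (-1) * ∑ j ∈ Finset.range M,
          boxGain (fun p => φ (tr (boxBase R M j X Y) p)) R) := by
          refine lineSum_mono fun X _ Y _ => (Finset.sum_le_sum fun j _ => hE _).trans (le_of_eq ?_)
          rw [Finset.sum_add_distrib, Finset.sum_sub_distrib, Finset.sum_const, Finset.sum_const,
            Finset.card_range, nsmul_eq_mul, nsmul_eq_mul, hNr]; ring
      _ = (l + 2 * η) * N * 4 ^ N - boxGain φ N * 4 ^ N := by
          rw [lineSum_add, lineSum_const, lineSum_mul, lineSum_boxGain]; ring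
      _ ≤ _ := by nlinarith
  have hlin : ∀ n ≤ M, lineSum N (fun X Y => |gridLev φ R M n X Y - gridLev φ R M 0 X Y -
      l * (n * R)|) ≤ 4 * η * N * 4 ^ N := by
    intro n hn
    calc _ ≤ lineSum N (fun X Y => |gridLev φ R M n X Y - gridLev φ R M 0 X Y -
          ∑ j ∈ Finset.range n, boxGain (fun p => φ (tr (boxBase R M j X Y) p)) R| +
          ∑ j ∈ Finset.range M, |boxGain (fun p => φ (tr (boxBase R M j X Y) p)) R - l * R|) := by
          refine lineSum_mono fun X _ Y _ => ?_
          have e : gridLev φ R M n X Y - gridLev φ R M 0 X Y - l * (n * R) =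
            (gridLev φ R M n X Y - gridLev φ R M 0 X Y -
            ∑ j ∈ Finset.range n, boxGain (fun p => φ (tr (boxBase R M j X Y) p)) R) +
            ∑ j ∈ Finset.range n, (boxGain (fun p => φ (tr (boxBase R M j X Y) p)) R - l * R) := by
            rw [Finset.sum_sub_distrib, Finset.sum_const, Finset.card_range, nsmul_eq_mul]; ring
          rw [e]
          refine (abs_add_le _ _).trans (add_le_add le_rfl ?_)
          refine (Finset.abs_sum_le_sum_abs _ _).trans ?_
          exact Finset.sum_le_sum_of_subset_of_nonneg (Finset.range_mono hn)
            fun _ _ _ => abs_nonneg _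
      _ ≤ 2 * (L * (R + 2)) * √M * 4 ^ N + 3 * η * N * 4 ^ N := by
          rw [lineSum_add]; exact add_le_add (hφ.lineSum_abs_sub R M n hn) hsumE
      _ ≤ _ := by
          have : 2 * (L * (R + 2)) * √M ≤ η * N := by
            have : (0:ℝ) ≤ L * (R + 2) + l * R := by positivity
            nlinarith
          nlinarith
  -- choice of the base height
  have h0 : ∀ X Y, Y < 2 ^ N → gridLev φ R M 0 X Y = ((φ ⟨X, 0, 0⟩).k : ℝ) := by
    intro X Y hY
    have : Y / (2 ^ R) ^ M = 0 := Nat.div_eq_of_lt (by rw [← pow_mul, mul_comm R]; exact hY)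
    simp [gridLev, this]
  have hMlev : ∀ X Y, X < 2 ^ N → gridLev φ R M M X Y = gridLev φ R M M 0 Y := by
    intro X Y hX
    have : X / (2 ^ R) ^ M = 0 := Nat.div_eq_of_lt (by rw [← pow_mul, mul_comm R]; exact hX)
    simp [gridLev, this]
  obtain ⟨Y0, hY0, hY0s⟩ : ∃ Y0 ∈ Finset.range (2 ^ N), ∑ X ∈ Finset.range (2 ^ N),
      |gridLev φ R M M X Y0 - gridLev φ R M 0 X Y0 - l * (M * R)| ≤ 4 * η * N * 2 ^ N := by
    refine Finset.exists_le_of_sum_le (s := Finset.range (2 ^ N)) (g := fun _ => 4 * η * N * 2 ^ N)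
      ⟨0, by simp⟩ ?_
    have := hlin M le_rfl
    rw [lineSum, Finset.sum_comm] at this
    refine this.trans (le_of_eq ?_)
    rw [Finset.sum_const, Finset.card_range, nsmul_eq_mul, show (4:ℝ) ^ N = 2 ^ N * 2 ^ N by
      rw [← mul_pow]; norm_num]
    push_cast; ring
  rw [Finset.mem_range] at hY0
  refine ⟨gridLev φ R M M 0 Y0 - l * N, fun k hk => ?_⟩
  set c := gridLev φ R M M 0 Y0 - l * N with hc
  have hbase : lineSum N (fun X Y => |gridLev φ R M 0 X Y - c|) ≤ 4 * η * N * 4 ^ N := by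
    calc _ = ∑ X ∈ Finset.range (2 ^ N), 2 ^ N *
          |gridLev φ R M M X Y0 - gridLev φ R M 0 X Y0 - l * (M * R)| := by
          refine Finset.sum_congr rfl fun X hX => ?_
          rw [Finset.mem_range] at hX
          rw [hMlev X Y0 hX, h0 X Y0 hY0]
          have : ∀ Y ∈ Finset.range (2 ^ N), |gridLev φ R M 0 X Y - c| =
              |gridLev φ R M M 0 Y0 - ((φ ⟨X, 0, 0⟩).k : ℝ) - l * (M * R)| := by
            intro Y hY
            rw [h0 X Y (Finset.mem_range.mp hY), abs_sub_comm, hc, hNr]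
            congr 1; ring
          rw [Finset.sum_congr rfl this, Finset.sum_const, Finset.card_range, nsmul_eq_mul]
          push_cast; ring
      _ ≤ 2 ^ N * (4 * η * N * 2 ^ N) := by rw [← Finset.mul_sum]; gcongr
      _ = _ := by rw [show (4:ℝ) ^ N = 2 ^ N * 2 ^ N by rw [← mul_pow]; norm_num]; ring
  set n := k / R with hn
  have hnM : n ≤ M := Nat.div_le_of_le_mul (by rw [mul_comm]; exact hk)
  have hnk : n * R ≤ k := Nat.div_mul_le_self k R
  have hnk' : k < n * R + R := by
    have := Nat.lt_div_mul_add (a := k) hR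
    exact this
  calc _ ≤ lineSum N (fun X Y => (|gridLev φ R M n X Y - gridLev φ R M 0 X Y - l * (n * R)| +
        |gridLev φ R M 0 X Y - c|) + (L * (R + 2) + l * R)) := by
        refine lineSum_mono fun X _ Y _ => ?_
        have e1 := hφ.k_real (near_linePt N (n * R) k X Y hnk hk)
        rw [← gridLev_eq] at e1
        have e2 : ((k - n * R + 1 : ℕ) : ℝ) ≤ R + 1 := by
          have : k - n * R + 1 ≤ R + 1 := by omega
          exact_mod_cast this
        have e3 : (L:ℝ) * ((k - n * R + 1 : ℕ) + 1) ≤ L * (R + 2) := by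
          apply mul_le_mul_of_nonneg_left _ (Nat.cast_nonneg _); linarith
        have e4 : (n:ℝ) * R ≤ k := by exact_mod_cast hnk
        have e5 : (k:ℝ) ≤ n * R + R := by exact_mod_cast hnk'.le
        have e6 : |l * (n * R) - l * k| ≤ l * R := by
          rw [← mul_sub, abs_mul, abs_of_nonneg hl]
          apply mul_le_mul_of_nonneg_left _ hl
          rw [abs_le]; constructor <;> linarith
        calc |((φ (linePt N k X Y)).k : ℝ) - c - l * k| =
            |(gridLev φ R M n X Y - gridLev φ R M 0 X Y - l * (n * R)) +
              (gridLev φ R M 0 X Y - c) + ((((φ (linePt N k X Y)).k : ℝ) - gridLev φ R M n X Y) +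
              (l * (n * R) - l * k))| := by congr 1; ring
          _ ≤ _ := (abs_add_le _ _).trans (add_le_add (abs_add_le _ _)
              ((abs_add_le _ _).trans (add_le_add (e1.trans e3) e6)))
    _ ≤ (4 * η * N * 4 ^ N + 4 * η * N * 4 ^ N) + (L * (R + 2) + l * R) * 4 ^ N := by
        rw [lineSum_add, lineSum_add, lineSum_const]
        exact add_le_add (add_le_add (hlin n hnM) hbase) le_rfl
    _ ≤ _ := by
        have e1 : (L * (R + 2) + l * R : ℝ) ≤ η * N := by
          have : (0:ℝ) ≤ 2 * (L * (R + 2)) * √M := by positivity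
          nlinarith
        have e2 : ε = 10 * η := by rw [hη]; ring
        rw [e2]
        have : 0 ≤ η * N := by positivity
        nlinarith

lemma card_box_levels {ι : Type*} (s : Finset ι) (g : ι → Pt) (n m : ℕ) (x0 y0 A B : ℝ) (k0 : ℤ)
    (hA : 0 ≤ A) (hB : 0 ≤ B) (hk : ∀ i ∈ s, |(g i).k - k0| ≤ m)
    (hx : ∀ i ∈ s, |(g i).x - x0| ≤ A * (2:ℝ)^k0) (hy : ∀ i ∈ s, |(g i).y - y0| ≤ B * (2:ℝ)^(-k0))
    (hf : ∀ c, (s.filter fun j => cell (g j) = c).card ≤ n) :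
    (s.card : ℝ) ≤ (2 * m + 1) * (n * ((2 * (A * 2 ^ m) + 2) * (2 * (B * 2 ^ m) + 2))) := by
  classical
  set K := Finset.Icc (k0 - m) (k0 + m) with hK
  have hKc : (K.card : ℝ) = 2 * m + 1 := by
    rw [hK, Int.card_Icc, show k0 + (m:ℤ) + 1 - (k0 - m) = ((2 * m + 1 : ℕ) : ℤ) by push_cast; ring,
      Int.toNat_natCast]
    push_cast; ring
  have hcov : s ⊆ K.biUnion fun k => s.filter fun i => (g i).k = k := by
    intro i hi
    rw [Finset.mem_biUnion]
    refine ⟨(g i).k, ?_, by simp [hi]⟩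
    have := abs_le.mp (hk i hi)
    rw [hK, Finset.mem_Icc]; constructor <;> linarith
  have h1 : (s.card : ℝ) ≤ ∑ k ∈ K, ((s.filter fun i => (g i).k = k).card : ℝ) := by
    exact_mod_cast (Finset.card_le_card hcov).trans Finset.card_biUnion_le
  have h2 : ∀ k ∈ K, ((s.filter fun i => (g i).k = k).card : ℝ) ≤
      n * ((2 * (A * 2 ^ m) + 2) * (2 * (B * 2 ^ m) + 2)) := by
    intro k hkK
    rw [hK, Finset.mem_Icc] at hkK
    refine card_box _ g n x0 y0 (A * 2 ^ m) (B * 2 ^ m) k (by positivity) (by positivity)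
      (fun i hi => (Finset.mem_filter.mp hi).2) (fun i hi => ?_) (fun i hi => ?_) (fun c => ?_)
    · refine (hx i (Finset.mem_filter.mp hi).1).trans ?_
      rw [mul_assoc, ← zpow_natCast, ← zpow_two_add]
      gcongr
      · norm_num
      · linarith
    · refine (hy i (Finset.mem_filter.mp hi).1).trans ?_
      rw [mul_assoc, ← zpow_natCast, ← zpow_two_add]
      gcongr
      · norm_num
      · linarith
    · refine (Finset.card_le_card ?_).trans (hf c)
      exact Finset.filter_subset_filter _ (Finset.filter_subset _ _)
  calc (s.card : ℝ) ≤ _ := h1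
    _ ≤ K.card • (n * ((2 * (A * 2 ^ m) + 2) * (2 * (B * 2 ^ m) + 2)) : ℝ) :=
        Finset.sum_le_card_nsmul _ _ _ h2
    _ = _ := by rw [nsmul_eq_mul, hKc]

/-- A separated set has a bounded number of points near a given point. -/
lemma card_near {S : Finset Pt} (hS : ∀ p ∈ S, ∀ q ∈ S, cell p = cell q → p = q) (p0 : Pt) (n : ℕ)
    (hn : ∀ p ∈ S, Near n p0 p) :
    (S.card : ℝ) ≤ (2 * n + 1) * ((2 * (2 ^ n * 2 ^ n) + 2) * (2 * (2 ^ n * 2 ^ n) + 2)) := by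
  have := card_box_levels S id 1 n p0.x p0.y (2 ^ n) (2 ^ n) p0.k (by positivity) (by positivity)
    (fun p hp => (hn p hp).1) (fun p hp => ?_) (fun p hp => ?_) (fun c => ?_)
  · simpa using this
  · refine (hn p hp).2.1.trans ?_
    gcongr; linarith
  · refine (hn p hp).2.2.trans ?_
    gcongr; linarith
  · rw [Finset.card_le_one]
    intro a ha b hb
    rw [Finset.mem_filter] at ha hb
    exact hS a ha.1 b hb.1 (ha.2.trans hb.2.symm)

lemma card_interval {S : Finset ℕ} {D : ℕ} (h : ∀ a ∈ S, ∀ b ∈ S,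
    a ≤ b + D) : S.card ≤ 2 * D + 1 := by
  rcases S.eq_empty_or_nonempty with rfl | ⟨a, ha⟩
  · simp
  have : S ⊆ Finset.Icc (a - D) (a + D) := by
    intro b hb
    have h1 := h a ha b hb
    have h2 := h b hb a ha
    rw [Finset.mem_Icc]; omega
  refine (Finset.card_le_card this).trans ?_
  rw [Nat.card_Icc]; omega

/-- Vertical path issued from a horizontal translate of `q`. -/
def vpath (q : Pt) (t J i : ℕ) : Pt := tr q ⟨0, J / 2 ^ t, i⟩

/-- Bound in `CE.card_pairs`. -/
def pairConst (L : ℕ) : ℝ :=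
  (2 * (8 * L : ℕ) + 1) * (((2 * (8 * L : ℕ) + 1) * ((2 * (2 ^ (8 * L) * 2 ^ (8 * L)) + 2) *
    (2 * (2 ^ (8 * L) * 2 ^ (8 * L)) + 2))) *
    ((2 * (2 ^ (8 * L) * 2 ^ (8 * L)) + 2) * (2 * (2 ^ (8 * L + 2) * 2 ^ (8 * L)) + 2))) *
    (2 * 2 ^ (16 * L + 1) + 1)

lemma pairConst_pos (L : ℕ) : 0 < pairConst L := by unfold pairConst; positivity

namespace CE
variable {L : ℕ} {φ φ' : Pt → Pt}

lemma vpath_near (h : CE L φ φ') {q q1 : Pt} {t J J1 i : ℕ}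
    (hc : cell (φ' (vpath q t J i)) = cell (φ' (vpath q1 t J1 i))) :
    Near (8 * L) (vpath q1 t J1 i) (vpath q t J i) := by
  refine near_mono ?_ (h.symm.back (near_of_cell_eq hc.symm))
  omega

lemma vpath_bounds (h : CE L φ φ') {q q1 : Pt} {t J J1 i : ℕ} (hJ : J < 2 ^ t) (hJ1 : J1 < 2 ^ t)
    (hc : cell (φ' (vpath q t J i)) = cell (φ' (vpath q1 t J1 i))) :
    |q.k - q1.k| ≤ (8 * L : ℕ) ∧ |q.x - q1.x| ≤ (2 ^ (8 * L) * 2 ^ i) * (2:ℝ) ^ q1.k ∧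
      |q.y - q1.y| ≤ 2 ^ (8 * L + 2) * (2:ℝ) ^ (-q1.k) := by
  have hn := h.vpath_near hc
  have hk : |q.k - q1.k| ≤ (8 * L : ℕ) := by
    have := hn.1; simp only [vpath, tr] at this
    rwa [add_sub_add_right_eq_sub] at this
  refine ⟨hk, ?_, ?_⟩
  · have := hn.x_le
    simp only [vpath, tr, mul_zero, add_zero] at this
    refine this.trans (le_of_eq ?_)
    rw [zpow_two_add, zpow_two_add, zpow_natCast, zpow_natCast]; ring
  · have h1 := hn.y_le
    simp only [vpath, tr] at h1
    have a1 := dyadic_le_one hJ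
    have a2 := dyadic_le_one hJ1
    rw [abs_of_nonneg (by positivity)] at a1 a2
    have b1 : (0:ℝ) ≤ (J:ℝ) / 2 ^ t := by positivity
    have b2 : (0:ℝ) ≤ (J1:ℝ) / 2 ^ t := by positivity
    have c1 : (2:ℝ) ^ (-q.k) ≤ 2 ^ (8 * L) * (2:ℝ) ^ (-q1.k) := by
      rw [← zpow_natCast, ← zpow_two_add]; apply zpow_two_mono
      have := (abs_le.mp hk).1; push_cast at this ⊢; linarith
    have c2 : (2:ℝ) ^ (((8 * L : ℕ) : ℤ) - (q1.k + i)) ≤ 2 ^ (8 * L) * (2:ℝ) ^ (-q1.k) := by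
      rw [← zpow_natCast, ← zpow_two_add]; apply zpow_two_mono; omega
    have c3 : (2:ℝ) ^ (-q1.k) ≤ 2 ^ (8 * L) * (2:ℝ) ^ (-q1.k) :=
      le_mul_of_one_le_left (zpow_two_pos _).le (one_le_two_pow_real _)
    have d1 : (2:ℝ) ^ (-q.k) * (J / 2 ^ t) ≤ (2:ℝ) ^ (-q.k) * 1 :=
      mul_le_mul_of_nonneg_left a1 (zpow_two_pos _).le
    have d2 : (2:ℝ) ^ (-q1.k) * (J1 / 2 ^ t) ≤ (2:ℝ) ^ (-q1.k) * 1 :=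
      mul_le_mul_of_nonneg_left a2 (zpow_two_pos _).le
    have d3 : 0 ≤ (2:ℝ) ^ (-q.k) * (J / 2 ^ t) := mul_nonneg (zpow_two_pos _).le b1
    have d4 : 0 ≤ (2:ℝ) ^ (-q1.k) * (J1 / 2 ^ t) := mul_nonneg (zpow_two_pos _).le b2
    have e : (2:ℝ) ^ (8 * L + 2) = 4 * 2 ^ (8 * L) := by rw [pow_add]; ring
    rw [e]
    rw [abs_le] at h1 ⊢
    constructor <;> linarith

/-- Bounded density: few vertical paths issued from a separated set meet a given cell at a given
time. -/
theorem card_pairs (h : CE L φ φ') {S : Finset Pt}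
    (hS : ∀ p ∈ S, ∀ q ∈ S, cell p = cell q → p = q) (t i : ℕ) (hi : i ≤ t) (e : ℤ × ℤ × ℤ) :
    (((S ×ˢ Finset.range (2 ^ t)).filter fun a => cell (φ' (vpath (φ a.1) t a.2 i)) = e).card : ℝ) ≤
      pairConst L * 2 ^ t := by
  classical
  set T := (S ×ˢ Finset.range (2 ^ t)).filter fun a => cell (φ' (vpath (φ a.1) t a.2 i)) = e with hT
  rcases T.eq_empty_or_nonempty with he | ⟨a1, ha1⟩
  · rw [he]; have := pairConst_pos L; simp only [Finset.card_empty, Nat.cast_zero]; positivity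
  have hmem : ∀ a ∈ T, a.1 ∈ S ∧ a.2 < 2 ^ t ∧ cell (φ' (vpath (φ a.1) t a.2 i)) = e := by
    intro a ha
    rw [hT, Finset.mem_filter, Finset.mem_product, Finset.mem_range] at ha
    exact ⟨ha.1.1, ha.1.2, ha.2⟩
  obtain ⟨g1, g2, g3⟩ := hmem a1 ha1
  set S' := T.image Prod.fst with hS'
  have hfib : ∀ p ∈ S', (T.filter fun a => a.1 = p).card ≤ (2 * 2 ^ (16 * L + 1) + 1) * 2 ^ (t - i) := by
    intro p _
    have hinj : Set.InjOn Prod.snd ((T.filter fun a => a.1 = p : Finset (Pt × ℕ)) : Set (Pt × ℕ)) := by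
      intro a ha b hb hab
      simp only [Finset.coe_filter, Set.mem_ofPred_eq] at ha hb
      exact Prod.ext (ha.2.trans hb.2.symm) hab
    rw [← Finset.card_image_of_injOn hinj]
    have : (2 * (2 ^ (16 * L + 1) * 2 ^ (t - i)) + 1) ≤ (2 * 2 ^ (16 * L + 1) + 1) * 2 ^ (t - i) := by
      have : 1 ≤ 2 ^ (t - i) := Nat.one_le_two_pow
      nlinarith
    refine (card_interval (D := 2 ^ (16 * L + 1) * 2 ^ (t - i)) ?_).trans this
    intro x hx y hy
    simp only [Finset.mem_image, Finset.mem_filter] at hx hy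
    obtain ⟨a, ⟨ha, hap⟩, rfl⟩ := hx
    obtain ⟨b, ⟨hb, hbp⟩, rfl⟩ := hy
    have hn := h.vpath_near ((hmem a ha).2.2.trans (hmem b hb).2.2.symm)
    have hy := hn.y_le
    rw [hap, hbp] at hy
    simp only [vpath, tr] at hy
    have hD : (a.2:ℝ) - b.2 ≤ 2 ^ (8 * L) * 2 ^ (t - i) := by
      have e1 : (2:ℝ) ^ (((8 * L : ℕ) : ℤ) - ((φ p).k + i)) =
          (2:ℝ) ^ (-(φ p).k) * (2 ^ (8 * L) * 2 ^ (t - i) / 2 ^ t) := by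
        rw [show (2:ℝ) ^ t = 2 ^ (t - i) * 2 ^ i by rw [← pow_add]; congr 1; omega]
        rw [sub_eq_add_neg, neg_add, zpow_two_add, zpow_two_add, zpow_natCast, zpow_neg, zpow_neg,
          zpow_natCast]
        field_simp
      rw [e1] at hy
      have e2 : (φ p).y + (2:ℝ) ^ (-(φ p).k) * (a.2 / 2 ^ t) -
          ((φ p).y + (2:ℝ) ^ (-(φ p).k) * (b.2 / 2 ^ t)) =
          (2:ℝ) ^ (-(φ p).k) * (((a.2:ℝ) - b.2) / 2 ^ t) := by ring
      rw [e2, abs_mul, abs_of_pos (zpow_two_pos _)] at hy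
      have := (le_abs_self _).trans (le_of_mul_le_mul_left hy (zpow_two_pos _))
      exact (div_le_div_iff_of_pos_right (by positivity)).mp this
    have hpow : (2:ℝ) ^ (8 * L) ≤ 2 ^ (16 * L + 1) := pow_le_pow_right₀ (by norm_num) (by omega)
    have : (a.2:ℝ) ≤ b.2 + 2 ^ (16 * L + 1) * 2 ^ (t - i) := by
      have : (2:ℝ) ^ (8 * L) * 2 ^ (t - i) ≤ 2 ^ (16 * L + 1) * 2 ^ (t - i) := by gcongr
      linarith
    exact_mod_cast this
  have hS'sub : ∀ p ∈ S', p ∈ S ∧ ∃ J < 2 ^ t, cell (φ' (vpath (φ p) t J i)) = e := by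
    intro p hp
    obtain ⟨a, ha, rfl⟩ := Finset.mem_image.mp hp
    exact ⟨(hmem a ha).1, a.2, (hmem a ha).2.1, (hmem a ha).2.2⟩
  have hcell : ∀ c, (S'.filter fun p => cell (φ p) = c).card ≤
      (2 * (8 * L) + 1) * ((2 * (2 ^ (8 * L) * 2 ^ (8 * L)) + 2) *
        (2 * (2 ^ (8 * L) * 2 ^ (8 * L)) + 2)) := by
    intro c
    rcases (S'.filter fun p => cell (φ p) = c).eq_empty_or_nonempty with he | ⟨p0, hp0⟩
    · rw [he]; simp
    have := card_near (S := S'.filter fun p => cell (φ p) = c)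
      (fun p hp q hq => hS p (hS'sub p (Finset.mem_filter.mp hp).1).1 q
        (hS'sub q (Finset.mem_filter.mp hq).1).1) p0 (8 * L) (fun p hp => by
        refine near_mono ?_ (h.back (near_of_cell_eq
          ((Finset.mem_filter.mp hp0).2.trans (Finset.mem_filter.mp hp).2.symm)))
        omega)
    exact_mod_cast this
  have hcount := card_box_levels S' φ _ (8 * L) (φ a1.1).x (φ a1.1).y (2 ^ (8 * L) * 2 ^ i)
    (2 ^ (8 * L + 2)) (φ a1.1).k (by positivity) (by positivity)
    (fun p hp => ?_) (fun p hp => ?_) (fun p hp => ?_) hcell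
  · have hT1 : T.card ≤ ((2 * 2 ^ (16 * L + 1) + 1) * 2 ^ (t - i)) * S'.card :=
      Finset.card_le_mul_card_image_of_maps_to
        (fun a ha => Finset.mem_image_of_mem _ ha) _ hfib
    have hT2 : (T.card : ℝ) ≤ ((2 * 2 ^ (16 * L + 1) + 1) * 2 ^ (t - i)) * S'.card := by
      exact_mod_cast hT1
    refine hT2.trans ?_
    have hi1 : (1:ℝ) ≤ 2 ^ i := one_le_two_pow_real i
    have ht : (2:ℝ) ^ t = 2 ^ (t - i) * 2 ^ i := by rw [← pow_add]; congr 1; omega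
    have hx : (2 * (2 ^ (8 * L) * 2 ^ i * 2 ^ (8 * L)) + 2 : ℝ) ≤
        (2 * (2 ^ (8 * L) * 2 ^ (8 * L)) + 2) * 2 ^ i := by nlinarith
    calc _ ≤ ((2 * 2 ^ (16 * L + 1) + 1) * 2 ^ (t - i)) * ((2 * (8 * L : ℕ) + 1) *
          ((((2 * (8 * L) + 1) * ((2 * (2 ^ (8 * L) * 2 ^ (8 * L)) + 2) *
          (2 * (2 ^ (8 * L) * 2 ^ (8 * L)) + 2)) : ℕ) : ℝ) *
          (((2 * (2 ^ (8 * L) * 2 ^ (8 * L)) + 2) * 2 ^ i) *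
          (2 * (2 ^ (8 * L + 2) * 2 ^ (8 * L)) + 2)))) := by
          gcongr
          refine hcount.trans ?_
          gcongr
      _ = _ := by
          rw [pairConst, ht]; push_cast; ring
  · obtain ⟨_, J, hJ, hc⟩ := hS'sub p hp
    exact (h.vpath_bounds hJ g2 (hc.trans g3.symm)).1
  · obtain ⟨_, J, hJ, hc⟩ := hS'sub p hp
    exact (h.vpath_bounds hJ g2 (hc.trans g3.symm)).2.1
  · obtain ⟨_, J, hJ, hc⟩ := hS'sub p hp
    exact (h.vpath_bounds hJ g2 (hc.trans g3.symm)).2.2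

end CE

/-- Lattice point of level `k`. -/
def gridPt (k a b : ℕ) : Pt := ⟨a * 2 ^ k, b / 2 ^ k, k⟩

lemma cell_gridPt (k a b : ℕ) : cell (gridPt k a b) = ((a:ℤ), (b:ℤ), (k:ℤ)) := by
  simp only [cell, gridPt, zpow_neg, zpow_natCast]
  rw [mul_assoc, mul_inv_cancel₀ (by positivity), mul_one, div_mul_cancel₀ _ (by positivity)]
  simp

lemma lineSum_cells (N k : ℕ) (hk : k ≤ N) (g : ℕ → ℕ → ℝ) :
    lineSum N (fun X Y => g (X / 2 ^ k) (Y / 2 ^ (N - k))) =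
      2 ^ N * ∑ a ∈ Finset.range (2 ^ (N - k)), ∑ b ∈ Finset.range (2 ^ k), g a b := by
  have e1 : 2 ^ N = 2 ^ (N - k) * 2 ^ k := by rw [← pow_add]; congr 1; omega
  have e2 : 2 ^ N = 2 ^ k * 2 ^ (N - k) := by rw [e1, mul_comm]
  have hY : ∀ a, ∑ Y ∈ Finset.range (2 ^ N), g a (Y / 2 ^ (N - k)) =
      2 ^ (N - k) * ∑ b ∈ Finset.range (2 ^ k), g a b := by
    intro a
    rw [e2, sum_range_mul_eq, Finset.mul_sum]
    refine Finset.sum_congr rfl fun b _ => ?_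
    rw [Finset.sum_congr rfl fun r hr => by rw [mul_add_div_of_lt b (Finset.mem_range.mp hr)]]
    simp
  unfold lineSum
  simp only [hY]
  rw [e1, sum_range_mul_eq]
  rw [show (2:ℝ) ^ N = 2 ^ (N - k) * 2 ^ k by exact_mod_cast e1, mul_comm ((2:ℝ) ^ (N - k)),
    mul_assoc, Finset.mul_sum, Finset.mul_sum]
  refine Finset.sum_congr rfl fun a _ => ?_
  rw [Finset.sum_congr rfl fun r hr => by rw [mul_add_div_of_lt a (Finset.mem_range.mp hr)]]
  simp

lemma card_bad_cells {N k : ℕ} (hk : k ≤ N) (hN : 1 ≤ N) (g : ℕ → ℕ → ℝ) {θ : ℝ} (hθ : 0 < θ)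
    (h : lineSum N (fun X Y => |g (X / 2 ^ k) (Y / 2 ^ (N - k))|) ≤ θ ^ 2 * N * 4 ^ N) :
    (((Finset.range (2 ^ (N - k)) ×ˢ Finset.range (2 ^ k)).filter fun c =>
      θ * N < |g c.1 c.2|).card : ℝ) ≤ θ * 2 ^ N := by
  rw [lineSum_cells N k hk (fun a b => |g a b|), ← Finset.sum_product'] at h
  have hNr : (1:ℝ) ≤ N := by exact_mod_cast hN
  have h2 : (0:ℝ) < 2 ^ N := by positivity
  have h4 : (4:ℝ) ^ N = 2 ^ N * 2 ^ N := by rw [← mul_pow]; norm_num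
  set P := Finset.range (2 ^ (N - k)) ×ˢ Finset.range (2 ^ k)
  have h1 : ((P.filter fun c => θ * N < |g c.1 c.2|).card : ℝ) * (θ * N) ≤
      ∑ c ∈ P, |g c.1 c.2| := by
    rw [← nsmul_eq_mul]
    refine (Finset.card_nsmul_le_sum _ _ _ fun c hc => (Finset.mem_filter.mp hc).2.le).trans ?_
    exact Finset.sum_le_sum_of_subset_of_nonneg (Finset.filter_subset _ _) fun _ _ _ => abs_nonneg _
  have h3 : ∑ c ∈ P, |g c.1 c.2| ≤ θ ^ 2 * N * 2 ^ N := by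
    rw [h4] at h
    have : 2 ^ N * ∑ c ∈ P, |g c.1 c.2| ≤ 2 ^ N * (θ ^ 2 * N * 2 ^ N) := by linarith
    exact le_of_mul_le_mul_left this h2
  have h5 : 0 < θ * N := by positivity
  refine le_of_mul_le_mul_right (h1.trans (h3.trans (le_of_eq ?_))) h5
  ring

/-- Lattice points in the core of the box of size `N`, of level in `[m, 2m)`. -/
def corePts (N m : ℕ) : Finset Pt :=
  open Classical in
  ((Finset.Ico m (2 * m)).sigma fun k => Finset.Ico (2 ^ (N - 2 - k)) (3 * 2 ^ (N - 2 - k)) ×ˢ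
    Finset.Ico (2 ^ (k - 2)) (3 * 2 ^ (k - 2))).image fun i => gridPt i.1 i.2.1 i.2.2

lemma mem_corePts {N m : ℕ} {p : Pt} (hp : p ∈ corePts N m) : ∃ k a b : ℕ, (m ≤ k ∧ k < 2 * m) ∧
    (2 ^ (N - 2 - k) ≤ a ∧ a < 3 * 2 ^ (N - 2 - k)) ∧ (2 ^ (k - 2) ≤ b ∧ b < 3 * 2 ^ (k - 2)) ∧
    p = gridPt k a b := by
  simp only [corePts, Finset.mem_image, Finset.mem_sigma, Finset.mem_product, Finset.mem_Ico] at hp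
  obtain ⟨⟨k, a, b⟩, ⟨h1, h2, h3⟩, rfl⟩ := hp
  exact ⟨k, a, b, h1, h2, h3, rfl⟩

lemma corePts_sep {N m : ℕ} : ∀ p ∈ corePts N m, ∀ q ∈ corePts N m, cell p = cell q → p = q := by
  intro p hp q hq hpq
  obtain ⟨k, a, b, -, -, -, rfl⟩ := mem_corePts hp
  obtain ⟨k', a', b', -, -, -, rfl⟩ := mem_corePts hq
  rw [cell_gridPt, cell_gridPt] at hpq
  simp only [Prod.mk.injEq, Nat.cast_inj] at hpq
  obtain ⟨rfl, rfl, rfl⟩ := hpq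
  rfl

lemma card_corePts {N m : ℕ} (hm : 2 ≤ m) (hN : 2 * m + 2 ≤ N) :
    (corePts N m).card = m * 2 ^ (N - 2) := by
  classical
  rw [corePts, Finset.card_image_of_injOn]
  · rw [Finset.card_sigma]
    have : ∀ k ∈ Finset.Ico m (2 * m), (Finset.Ico (2 ^ (N - 2 - k)) (3 * 2 ^ (N - 2 - k)) ×ˢ
        Finset.Ico (2 ^ (k - 2)) (3 * 2 ^ (k - 2))).card = 2 ^ (N - 2) := by
      intro k hk
      rw [Finset.mem_Ico] at hk
      rw [Finset.card_product, Nat.card_Ico, Nat.card_Ico]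
      rw [show 3 * 2 ^ (N - 2 - k) - 2 ^ (N - 2 - k) = 2 ^ (N - 2 - k + 1) by rw [pow_succ]; omega,
        show 3 * 2 ^ (k - 2) - 2 ^ (k - 2) = 2 ^ (k - 2 + 1) by rw [pow_succ]; omega, ← pow_add]
      congr 1; omega
    rw [Finset.sum_congr rfl this, Finset.sum_const, Nat.card_Ico, smul_eq_mul]
    congr 1; omega
  · rintro ⟨k, a, b⟩ - ⟨k', a', b'⟩ - hpq
    have := congrArg cell hpq
    simp only [cell_gridPt, Prod.mk.injEq, Nat.cast_inj] at this
    obtain ⟨rfl, rfl, rfl⟩ := this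
    rfl

lemma exists_grid_cell {N m n : ℕ} {p q : Pt} (hp : p ∈ corePts N m) (hN : 3 * m ≤ N) (hn : n + 2 ≤ m)
    (h : Near n p q) : ∃ k ≤ N, ∃ a < 2 ^ (N - k), ∃ b < 2 ^ k, (k:ℤ) = q.k ∧
      cell q = cell (gridPt k a b) := by
  obtain ⟨k, a, b, hk, ha, hb, rfl⟩ := mem_corePts hp
  obtain ⟨hqk, hqx, hqy⟩ : _ ∧ _ ∧ _ := ⟨h.k_le, h.x_le, h.y_le⟩
  simp only [gridPt] at hqk hqx hqy
  rw [abs_le] at hqk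
  obtain ⟨k', hk'⟩ : ∃ k' : ℕ, (k':ℤ) = q.k := ⟨q.k.toNat, Int.toNat_of_nonneg (by omega)⟩
  have hk'N : k' ≤ N := by omega
  have hx0 : 0 ≤ q.x ∧ q.x < 2 ^ N := by
    have e1 : (2:ℝ) ^ ((n:ℤ) + k) ≤ 2 ^ (N - 2) := by
      rw [← zpow_natCast]; apply zpow_two_mono; omega
    have e2 : (2:ℝ) ^ (N - 2) ≤ a * 2 ^ k := by
      rw [show N - 2 = (N - 2 - k) + k by omega, pow_add]; gcongr; exact_mod_cast ha.1
    have e3 : (a:ℝ) * 2 ^ k < 3 * 2 ^ (N - 2) := by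
      have : (2:ℝ) ^ (N - 2) = 2 ^ (N - 2 - k) * 2 ^ k := by rw [← pow_add]; congr 1; omega
      rw [this, ← mul_assoc]
      have : (a:ℝ) < 3 * 2 ^ (N - 2 - k) := by exact_mod_cast ha.2
      gcongr
    have e4 : (2:ℝ) ^ N = 4 * 2 ^ (N - 2) := by
      rw [show (4:ℝ) = 2 ^ 2 by norm_num, ← pow_add]; congr 1; omega
    rw [abs_le] at hqx
    constructor <;> linarith
  have hy0 : 0 ≤ q.y ∧ q.y < 1 := by
    have e1 : (2:ℝ) ^ ((n:ℤ) - k) ≤ 1 / 4 := by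
      rw [show (1:ℝ) / 4 = (2:ℝ) ^ (-2 : ℤ) by norm_num]; apply zpow_two_mono; omega
    have e4 : (2:ℝ) ^ k = 4 * 2 ^ (k - 2) := by
      rw [show (4:ℝ) = 2 ^ 2 by norm_num, ← pow_add]; congr 1; omega
    have e2 : 1 / 4 ≤ (b:ℝ) / 2 ^ k := by
      rw [div_le_div_iff₀ (by norm_num) (by positivity), e4]
      have : ((2:ℝ) ^ (k - 2)) ≤ b := by exact_mod_cast hb.1
      linarith
    have e3 : (b:ℝ) / 2 ^ k < 3 / 4 := by
      rw [div_lt_div_iff₀ (by positivity) (by norm_num), e4]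
      have : (b:ℝ) < 3 * 2 ^ (k - 2) := by exact_mod_cast hb.2
      linarith
    rw [abs_le] at hqy
    constructor <;> linarith
  have hxf : 0 ≤ ⌊q.x * (2:ℝ)^(-q.k)⌋ ∧ ⌊q.x * (2:ℝ)^(-q.k)⌋ < 2 ^ (N - k') := by
    constructor
    · exact Int.floor_nonneg.mpr (mul_nonneg hx0.1 (zpow_two_pos _).le)
    · rw [Int.floor_lt]; push_cast
      rw [← hk', zpow_neg, zpow_natCast, ← div_eq_mul_inv, div_lt_iff₀ (by positivity), ← pow_add]
      rw [show N - k' + k' = N by omega]; exact hx0.2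
  have hyf : 0 ≤ ⌊q.y * (2:ℝ)^q.k⌋ ∧ ⌊q.y * (2:ℝ)^q.k⌋ < 2 ^ k' := by
    constructor
    · exact Int.floor_nonneg.mpr (mul_nonneg hy0.1 (zpow_two_pos _).le)
    · rw [Int.floor_lt]; push_cast
      rw [← hk', zpow_natCast]
      have : (0:ℝ) < 2 ^ k' := by positivity
      nlinarith [hy0.2]
  refine ⟨k', hk'N, ⌊q.x * (2:ℝ)^(-q.k)⌋.toNat, ?_, ⌊q.y * (2:ℝ)^q.k⌋.toNat, ?_, hk', ?_⟩
  · have := hxf.2; zify; rw [Int.toNat_of_nonneg hxf.1]; exact this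
  · have := hyf.2; zify; rw [Int.toNat_of_nonneg hyf.1]; exact this
  · rw [cell_gridPt, Int.toNat_of_nonneg hxf.1, Int.toNat_of_nonneg hyf.1, hk']; rfl

lemma near_vpath (q : Pt) {t J i : ℕ} (hJ : J < 2 ^ t) (hi : i ≤ t) :
    Near (t + 1) q (vpath q t J i) := by
  have : Near (t + 1) (⟨0, 0, 0⟩ : Pt) ⟨0, J / 2 ^ t, i⟩ := by
    have h1 : (1:ℝ) ≤ 2 ^ t := one_le_two_pow_real t
    refine ⟨?_, ?_, ?_⟩
    · simp only [sub_zero, Nat.abs_cast]; exact_mod_cast hi.trans (Nat.le_succ t)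
    · simp [pow_succ]; linarith
    · simp only [sub_zero, neg_zero, zpow_zero, mul_one]
      refine (CE.dyadic_le_one hJ).trans ?_
      rw [pow_succ]; linarith
  have h2 := near_tr q this
  simpa [vpath, tr] using h2

lemma near_vpath_step (q : Pt) (t J : ℕ) {i j s : ℕ} (hij : i ≤ j) (hs : j ≤ i + s) :
    Near s (vpath q t J i) (vpath q t J j) := by
  refine near_tr q ?_
  have h := CE.near_vert 0 ((J:ℝ) / 2 ^ t) i (j - i)
  have e : ((i:ℤ) + ((j - i : ℕ) : ℤ)) = j := by omega
  rw [e] at h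
  exact near_mono (by omega) h

namespace CE
variable {L : ℕ} {φ φ' : Pt → Pt}

lemma card_pairs_mem (h : CE L φ φ') {S : Finset Pt}
    (hS : ∀ p ∈ S, ∀ q ∈ S, cell p = cell q → p = q) (t : ℕ) (I : Finset ℕ)
    (hI : ∀ i ∈ I, i ≤ t) (E : Finset (ℤ × ℤ × ℤ)) :
    (((S ×ˢ Finset.range (2 ^ t)).filter fun a =>
      ∃ i ∈ I, cell (φ' (vpath (φ a.1) t a.2 i)) ∈ E).card : ℝ) ≤
      I.card * E.card * (pairConst L * 2 ^ t) := by
  classical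
  have hsub : ((S ×ˢ Finset.range (2 ^ t)).filter fun a =>
      ∃ i ∈ I, cell (φ' (vpath (φ a.1) t a.2 i)) ∈ E) ⊆
      (I ×ˢ E).biUnion fun c => (S ×ˢ Finset.range (2 ^ t)).filter fun a =>
        cell (φ' (vpath (φ a.1) t a.2 c.1)) = c.2 := by
    intro a ha
    obtain ⟨h1, i, hi, hE⟩ := Finset.mem_filter.mp ha
    exact Finset.mem_biUnion.mpr ⟨(i, _), Finset.mem_product.mpr ⟨hi, hE⟩,
      Finset.mem_filter.mpr ⟨h1, rfl⟩⟩
  have h1 := (Finset.card_le_card hsub).trans Finset.card_biUnion_le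
  have h2 : (((S ×ˢ Finset.range (2 ^ t)).filter fun a =>
      ∃ i ∈ I, cell (φ' (vpath (φ a.1) t a.2 i)) ∈ E).card : ℝ) ≤
      ∑ c ∈ I ×ˢ E, (((S ×ˢ Finset.range (2 ^ t)).filter fun a =>
        cell (φ' (vpath (φ a.1) t a.2 c.1)) = c.2).card : ℝ) := by exact_mod_cast h1
  refine h2.trans ((Finset.sum_le_card_nsmul _ _ (pairConst L * 2 ^ t) fun c hc => ?_).trans ?_)
  · exact h.card_pairs hS t c.1 (hI _ (Finset.mem_product.mp hc).1) c.2
  · rw [nsmul_eq_mul, Finset.card_product]; push_cast; exact le_rfl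

/-- A path avoiding the bad cells at all checkpoints has small oscillation. -/
lemma slope_of_good_path (h : CE L φ φ') {N m t s J : ℕ} {p : Pt} {c l β : ℝ} {δ : ℝ} (hl : 0 ≤ l)
    (hs : 1 ≤ s)
    (hp : p ∈ corePts N m) (hN : 3 * m ≤ N) (hm : L * (t + 4) + 2 ≤ m) (hJ : J < 2 ^ t)
    (E : Finset (ℤ × ℤ × ℤ))
    (hE : ∀ k ≤ N, ∀ a < 2 ^ (N - k), ∀ b < 2 ^ k, cell (gridPt k a b) ∉ E →
      |((φ (gridPt k a b)).k : ℝ) - c - l * k| ≤ β)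
    (hgood : ∀ μ ≤ t / s, cell (φ' (vpath (φ p) t J (s * μ))) ∉ E)
    (hosc : ∃ i ≤ t, ∃ j ≤ t, (1 - δ) * t <
      ((φ' (vpath (φ p) t J i)).k - (φ' (vpath (φ p) t J j)).k : ℝ)) :
    l * ((1 - δ) * t - 2 * (L * (s + 1))) ≤ t + 2 * β + 6 * L := by
  set u : ℕ → Pt := fun i => φ' (vpath (φ p) t J i) with hu
  have key : ∀ μ ≤ t / s, |((φ p).k : ℝ) + (s * μ : ℕ) - c - l * (u (s * μ)).k| ≤ β + 3 * L := by
    intro μ hμ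
    have hi : s * μ ≤ t := (Nat.mul_le_mul_left s hμ).trans (Nat.mul_div_le t s)
    have hn : Near (L * (t + 4)) p (u (s * μ)) := by
      have := near_trans (near_symm (h.left p)) (h.bwd _ _ _ (near_vpath (φ p) hJ hi))
      exact near_mono (by ring_nf; omega) this
    obtain ⟨k, hk, a, ha, b, hb, hkq, hcell⟩ := exists_grid_cell hp hN hm hn
    have h1 := hE k hk a ha b hb (hcell ▸ hgood μ hμ)
    have h2 := h.k_real (near_of_cell_eq hcell)
    have h3 := h.right (vpath (φ p) t J (s * μ)) |>.k_le
    have h4 : |((vpath (φ p) t J (s * μ)).k : ℝ) - (φ (u (s * μ))).k| ≤ L := by exact_mod_cast h3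
    have h5 : (vpath (φ p) t J (s * μ)).k = (φ p).k + (s * μ : ℕ) := rfl
    rw [h5] at h4
    have h6 : ((u (s * μ)).k : ℝ) = k := by rw [← hkq]; simp
    rw [h6]
    push_cast at h2 h4 ⊢
    rw [abs_le] at *
    constructor <;> linarith [h1.1, h1.2, h2.1, h2.2, h4.1, h4.2]
  have step : ∀ i ≤ t, ∃ μ ≤ t / s, |((u i).k : ℝ) - (u (s * μ)).k| ≤ L * (s + 1) := by
    intro i hi
    refine ⟨i / s, Nat.div_le_div_right hi, ?_⟩
    have : i ≤ s * (i / s) + s := by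
      have := Nat.div_add_mod i s
      have := Nat.mod_lt i (show 0 < s by omega)
      omega
    exact h.symm.k_real (near_vpath_step (φ p) t J (Nat.mul_div_le i s) this)
  obtain ⟨i, hi, j, hj, hij⟩ := hosc
  obtain ⟨μ, hμ, h1⟩ := step i hi
  obtain ⟨ν, hν, h2⟩ := step j hj
  have h3 := key μ hμ
  have h4 := key ν hν
  have h5 : ((s * μ : ℕ) : ℝ) ≤ t := by
    exact_mod_cast (Nat.mul_le_mul_left s hμ).trans (Nat.mul_div_le t s)
  have h6 : (0:ℝ) ≤ ((s * ν : ℕ) : ℝ) := Nat.cast_nonneg _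
  have h7 : (1 - δ) * t - 2 * (L * (s + 1)) ≤ ((u (s * μ)).k : ℝ) - (u (s * ν)).k := by
    rw [abs_le] at h1 h2
    have : (1 - δ) * t < ((u i).k : ℝ) - (u j).k := hij
    linarith [h1.1, h1.2, h2.1, h2.2]
  have h8 := mul_le_mul_of_nonneg_left h7 hl
  rw [abs_le] at h3 h4
  linarith [h3.1, h3.2, h4.1, h4.2]

end CE

lemma card_filter_product_le {α β : Type*} (S : Finset α) (T : Finset β) (P : α → β → Prop)
    [DecidablePred fun a : α × β => P a.1 a.2] [∀ a, DecidablePred (P a)] (B : ℝ)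
    (h : ∀ a ∈ S, ((T.filter (P a)).card : ℝ) ≤ B) :
    (((S ×ˢ T).filter fun a => P a.1 a.2).card : ℝ) ≤ S.card * B := by
  rw [Finset.card_filter, Finset.sum_product]
  push_cast
  rw [← nsmul_eq_mul]
  refine Finset.sum_le_card_nsmul _ _ _ fun a ha => ?_
  have := h a ha
  rw [Finset.card_filter] at this
  exact_mod_cast this

lemma exists_not_of_card_lt {α : Type*} (S : Finset α) (P Q : α → Prop) [DecidablePred P]
    [DecidablePred Q] {x y : ℝ} (h1 : ((S.filter P).card : ℝ) ≤ x) (h2 : ((S.filter Q).card : ℝ) ≤ y)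
    (h : x + y < S.card) : ∃ a ∈ S, ¬ P a ∧ ¬ Q a := by
  classical
  by_contra! hc
  have : S ⊆ S.filter P ∪ S.filter Q := fun a ha => by
    by_cases hP : P a
    · exact Finset.mem_union_left _ (Finset.mem_filter.mpr ⟨ha, hP⟩)
    · exact Finset.mem_union_right _ (Finset.mem_filter.mpr ⟨ha, hc a ha hP⟩)
  have h3 := (Finset.card_le_card this).trans (Finset.card_union_le _ _)
  have h4 : (S.card : ℝ) ≤ (S.filter P).card + (S.filter Q).card := by exact_mod_cast h3
  linarith

/-- In an almost linear box, some vertical path of the target pulls back to a path of large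
oscillation meeting only good cells. -/
lemma CE.slope_le_of_near_linear {L : ℕ} {φ φ' : Pt → Pt} (h : CE L φ φ') {N m t s K : ℕ}
    {c l θ δ : ℝ} (hl : 0 ≤ l) (hθ : 0 < θ) (hδ : δ ≤ 1 / 8) (hs : 1 ≤ s) (hm2 : 2 ≤ m)
    (hmN : 3 * m ≤ N) (hNm : N ≤ 4 * m) (hm : L * (t + 4) + 2 ≤ m) (hts : t / s ≤ K)
    (hθK : θ * (128 * (K + 1) * pairConst L) ≤ 1)
    (hlin : ∀ k ≤ N, lineSum N (fun X Y => |((φ (linePt N k X Y)).k : ℝ) - c - l * k|) ≤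
      θ ^ 2 * N * 4 ^ N)
    (hosc : ∀ ψ ψ', CE L ψ ψ' → (((Finset.range (2 ^ t)).filter fun J : ℕ => ∀ i : ℕ, i ≤ t →
      ∀ j : ℕ, j ≤ t → ((ψ ⟨0, J / 2 ^ t, i⟩).k - (ψ ⟨0, J / 2 ^ t, j⟩).k : ℝ) ≤
        (1 - δ) * t).card : ℝ) ≤ δ * 2 ^ t) :
    l * ((1 - δ) * t - 2 * (L * (s + 1))) ≤ t + 2 * (θ * N) + 6 * L := by
  classical
  set S := corePts N m with hSdef
  set E : Finset (ℤ × ℤ × ℤ) := (Finset.range (N + 1)).biUnion fun k =>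
    ((Finset.range (2 ^ (N - k)) ×ˢ Finset.range (2 ^ k)).filter fun c' =>
      θ * N < |((φ (gridPt k c'.1 c'.2)).k : ℝ) - c - l * k|).image
        fun c' => cell (gridPt k c'.1 c'.2) with hE
  have hEcard : (E.card : ℝ) ≤ (N + 1) * (θ * 2 ^ N) := by
    have h1 : E.card ≤ ∑ k ∈ Finset.range (N + 1),
        ((Finset.range (2 ^ (N - k)) ×ˢ Finset.range (2 ^ k)).filter fun c' =>
          θ * N < |((φ (gridPt k c'.1 c'.2)).k : ℝ) - c - l * k|).card :=
      Finset.card_biUnion_le.trans (Finset.sum_le_sum fun k _ => Finset.card_image_le)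
    have h2 : (E.card : ℝ) ≤ ∑ k ∈ Finset.range (N + 1),
        (((Finset.range (2 ^ (N - k)) ×ˢ Finset.range (2 ^ k)).filter fun c' =>
          θ * N < |((φ (gridPt k c'.1 c'.2)).k : ℝ) - c - l * k|).card : ℝ) := by exact_mod_cast h1
    refine h2.trans ((Finset.sum_le_card_nsmul _ _ (θ * 2 ^ N) fun k hk => ?_).trans ?_)
    · have hk' : k ≤ N := by rw [Finset.mem_range] at hk; omega
      exact card_bad_cells hk' (by omega) (fun a b => ((φ (gridPt k a b)).k : ℝ) - c - l * k) hθ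
        (hlin k hk')
    · rw [nsmul_eq_mul, Finset.card_range]; push_cast; exact le_rfl
  have hEgood : ∀ k ≤ N, ∀ a < 2 ^ (N - k), ∀ b < 2 ^ k, cell (gridPt k a b) ∉ E →
      |((φ (gridPt k a b)).k : ℝ) - c - l * k| ≤ θ * N := by
    intro k hk a ha b hb hnot
    by_contra hlt
    push Not at hlt
    refine hnot (Finset.mem_biUnion.mpr ⟨k, Finset.mem_range.mpr (by omega),
      Finset.mem_image.mpr ⟨(a, b), Finset.mem_filter.mpr ⟨?_, hlt⟩, rfl⟩⟩)
    exact Finset.mem_product.mpr ⟨Finset.mem_range.mpr ha, Finset.mem_range.mpr hb⟩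
  set I : Finset ℕ := (Finset.range (t / s + 1)).image fun μ => s * μ with hI
  have hIcard : (I.card : ℝ) ≤ K + 1 := by
    have : I.card ≤ K + 1 := Finset.card_image_le.trans (by rw [Finset.card_range]; omega)
    exact_mod_cast this
  have hIt : ∀ i ∈ I, i ≤ t := by
    intro i hi
    obtain ⟨μ, hμ, rfl⟩ := Finset.mem_image.mp hi
    rw [Finset.mem_range] at hμ
    exact (Nat.mul_le_mul_left s (by omega)).trans (Nat.mul_div_le t s)
  have b1 := h.card_pairs_mem (S := S) corePts_sep t I hIt E
  have b2 := card_filter_product_le S (Finset.range (2 ^ t)) (fun (p : Pt) (J : ℕ) => ∀ i : ℕ,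
      i ≤ t →
    ∀ j : ℕ, j ≤ t → ((φ' (vpath (φ p) t J i)).k - (φ' (vpath (φ p) t J j)).k : ℝ) ≤
      (1 - δ) * t) (δ * 2 ^ t) (fun p _ => by
      refine le_trans ?_ (hosc _ _ (h.symm.pre_tr (φ p)))
      refine Nat.cast_le.mpr (Finset.card_le_card fun J hJ => ?_)
      rw [Finset.mem_filter] at hJ ⊢
      exact hJ)
  have hcard : ((S ×ˢ Finset.range (2 ^ t)).card : ℝ) = m * 2 ^ (N - 2) * 2 ^ t := by
    rw [Finset.card_product, card_corePts hm2 (by omega), Finset.card_range]; push_cast; rfl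
  have hSc : (S.card : ℝ) = m * 2 ^ (N - 2) := by rw [card_corePts hm2 (by omega)]; push_cast; rfl
  have hlt : (I.card : ℝ) * E.card * (pairConst L * 2 ^ t) + S.card * (δ * 2 ^ t) <
      (S ×ˢ Finset.range (2 ^ t)).card := by
    rw [hcard, hSc]
    have hP := pairConst_pos L
    have e4 : (2:ℝ) ^ N = 4 * 2 ^ (N - 2) := by
      rw [show (4:ℝ) = 2 ^ 2 by norm_num, ← pow_add]; congr 1; omega
    have hN1 : ((N:ℝ) + 1) ≤ 8 * m := by
      have : (N + 1 : ℕ) ≤ 8 * m := by omega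
      exact_mod_cast this
    have hm0 : (0:ℝ) < m := by exact_mod_cast (show 0 < m by omega)
    have hA : (0:ℝ) < 2 ^ (N - 2) := by positivity
    have hT : (0:ℝ) < 2 ^ t := by positivity
    have c1 : (I.card : ℝ) * E.card * (pairConst L * 2 ^ t) ≤
        (K + 1) * ((8 * m) * (θ * (4 * 2 ^ (N - 2)))) * (pairConst L * 2 ^ t) := by
      have : (E.card : ℝ) ≤ (8 * m) * (θ * (4 * 2 ^ (N - 2))) := by
        refine hEcard.trans ?_
        rw [e4]; gcongr
      gcongr
    have c2 : (K + 1) * ((8 * m) * (θ * (4 * 2 ^ (N - 2)))) * (pairConst L * 2 ^ t) =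
        (θ * (128 * (K + 1) * pairConst L)) / 4 * (m * 2 ^ (N - 2) * 2 ^ t) := by ring
    have c3 : (m:ℝ) * 2 ^ (N - 2) * (δ * 2 ^ t) ≤ 1 / 8 * (m * 2 ^ (N - 2) * 2 ^ t) := by
      rw [show (m:ℝ) * 2 ^ (N - 2) * (δ * 2 ^ t) = δ * (m * 2 ^ (N - 2) * 2 ^ t) by ring]
      gcongr
    have hpos : (0:ℝ) < m * 2 ^ (N - 2) * 2 ^ t := by positivity
    rw [c2] at c1
    nlinarith
  obtain ⟨⟨p, J⟩, ha, n1, n2⟩ := exists_not_of_card_lt _ _ _ b1 b2 hlt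
  obtain ⟨hp, hJ⟩ := Finset.mem_product.mp ha
  push Not at n1 n2
  refine h.slope_of_good_path hl hs hp hmN hm (Finset.mem_range.mp hJ) E hEgood
    (fun μ hμ => n1 _ (Finset.mem_image.mpr ⟨μ, Finset.mem_range.mpr (by omega), rfl⟩)) ?_
  obtain ⟨i, hi, j, hj, hij⟩ := n2
  exact ⟨i, hi, j, hj, hij⟩

theorem gainLe_one (L : ℕ) (δ0 : ℝ) (hδ0 : 0 < δ0) : GainLe L (1 + δ0) := by
  by_contra hnot
  obtain ⟨l, hl1, hG, hnG⟩ := exists_extremal_slope L _ hnot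
  set δ : ℝ := δ0 / (8 * (1 + δ0)) with hδ
  have hδpos : 0 < δ := by positivity
  have hδ8 : δ ≤ 1 / 8 := by
    rw [hδ, div_le_div_iff₀ (by positivity) (by norm_num)]; linarith
  have hδeq : δ * (8 * (1 + δ0)) = δ0 := by rw [hδ]; field_simp
  obtain ⟨t0, ht0⟩ := CE.osc_large L δ hδpos
  obtain ⟨K, hK⟩ := exists_nat_ge (4 * L / δ + 1)
  have hK1 : 1 ≤ K := by
    have : (0:ℝ) ≤ 4 * L / δ := by positivity
    exact_mod_cast (show (1:ℝ) ≤ K by linarith)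
  have hKδ : 4 * L ≤ K * δ := by
    have : 4 * L / δ ≤ K := by linarith
    rwa [div_le_iff₀ hδpos] at this
  obtain ⟨Q, hQ⟩ := exists_nat_ge (128 * (K + 1) * pairConst L + 96 * (L + 1) / δ)
  have hP := pairConst_pos L
  have hQ0 : (0:ℝ) < Q := lt_of_lt_of_le (by positivity) hQ
  set θ : ℝ := 1 / Q with hθ
  have hθpos : 0 < θ := by positivity
  have hθ1 : θ * (128 * (K + 1) * pairConst L) ≤ 1 := by
    rw [hθ, div_mul_eq_mul_div, one_mul, div_le_one hQ0]
    have : 0 ≤ 96 * ((L:ℝ) + 1) / δ := by positivity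
    linarith
  have hθ2 : 96 * (L + 1) * θ ≤ δ := by
    rw [hθ, mul_one_div, div_le_iff₀ hQ0]
    have h1 : 96 * ((L:ℝ) + 1) / δ ≤ Q := by
      have : 0 ≤ 128 * ((K:ℝ) + 1) * pairConst L := by positivity
      linarith
    rw [div_le_iff₀ hδpos] at h1; linarith
  obtain ⟨t1, ht1⟩ := exists_nat_ge (6 * L / δ)
  obtain ⟨D, hD⟩ : ∃ D, D = 24 * (L + 1) * K := ⟨_, rfl⟩
  have hD24 : 24 ≤ D := by rw [hD]; nlinarith [Nat.mul_le_mul (show 1 ≤ L + 1 by omega) hK1]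
  obtain ⟨N, hN, φ, φ', h, c, hlin⟩ := exists_near_linear L l (by linarith) hG hnG (θ ^ 2)
    (by positivity) (D * (t0 + t1 + 1) + 96 * (L + 1))
  obtain ⟨s, hs⟩ : ∃ s, s = N / D := ⟨_, rfl⟩
  obtain ⟨t, ht⟩ : ∃ t, t = K * s := ⟨_, rfl⟩
  have hDpos : 0 < D := by omega
  have hs1 : t0 + t1 + 1 ≤ s := by
    rw [hs, Nat.le_div_iff_mul_le hDpos]; nlinarith
  have hts : s ≤ t := by rw [ht]; nlinarith
  have hDs : D * s ≤ N := hs ▸ Nat.mul_div_le N D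
  have hDs2 : N < D * s + D := by
    have := Nat.div_add_mod N D; have := Nat.mod_lt N hDpos
    rw [← hs] at *; omega
  have h24 : 24 * (L + 1) * t ≤ N := by rw [ht, ← mul_assoc, ← hD]; exact hDs
  have hm : L * (t + 4) + 2 ≤ N / 3 := by
    have e1 : 24 * (L * (t + 4)) ≤ 24 * (L + 1) * t + 96 * L := by nlinarith
    omega
  have hmain := h.slope_le_of_near_linear (N := N) (m := N / 3) (t := t) (s := s) (K := K) (c := c)
    (l := l) (θ := θ) (δ := δ) (by linarith) hθpos hδ8 (by omega) (by omega) (by omega) (by omega) hm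
    (by rw [ht, Nat.mul_div_cancel _ (by omega)]) hθ1 hlin
    (fun ψ ψ' hψ => ht0 ψ ψ' hψ t (by omega))
  have hN48 : (N:ℝ) ≤ 48 * (L + 1) * t := by
    have : N ≤ 48 * (L + 1) * t := by
      have : D ≤ D * s := Nat.le_mul_of_pos_right _ (by omega)
      have e : 48 * (L + 1) * t = 2 * (D * s) := by rw [ht, hD]; ring
      omega
    exact_mod_cast this
  have htr : (t:ℝ) = K * s := by rw [ht]; push_cast; rfl
  have hs0 : (1:ℝ) ≤ s := by exact_mod_cast (show 1 ≤ s by omega)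
  have ht1' : (t1:ℝ) ≤ t := by exact_mod_cast (show t1 ≤ t by omega)
  have f1 : 6 * L ≤ δ * t := by
    have : 6 * L / δ ≤ t := ht1.trans ht1'
    rw [div_le_iff₀ hδpos] at this; linarith
  have f2 : 2 * (L * ((s:ℝ) + 1)) ≤ δ * t := by
    have : 4 * L * s ≤ K * δ * s := by gcongr
    have h3 : (L:ℝ) ≤ L * s := by nlinarith [(Nat.cast_nonneg L : (0:ℝ) ≤ L)]
    rw [htr]; linarith
  have f3 : 2 * (θ * N) ≤ δ * t := by
    have : θ * N ≤ θ * (48 * (L + 1) * t) := by gcongr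
    have h4 : 96 * (L + 1) * θ * t ≤ δ * t := by gcongr
    linarith
  have htpos : (0:ℝ) < t := by
    have : (0:ℝ) < K := by exact_mod_cast hK1
    rw [htr]; positivity
  have g1 : (1 + δ0) * ((1 - 2 * δ) * t) ≤ l * ((1 - δ) * t - 2 * (L * (s + 1))) := by
    have h5 : (1 - 2 * δ) * t ≤ (1 - δ) * t - 2 * (L * (s + 1)) := by linarith
    have h6 : 0 ≤ (1 - 2 * δ) * t := mul_nonneg (by linarith) htpos.le
    have h7 : 0 ≤ l := by linarith
    exact mul_le_mul hl1 h5 h6 h7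
  have g2 : (1 + δ0) * ((1 - 2 * δ) * t) = t + δ0 * t - δ0 / 4 * t := by
    have : (1 + δ0) * δ = δ0 / 8 := by linarith
    linear_combination (-2 * t) * this
  have g3 : δ * t ≤ δ0 / 8 * t := by
    have : δ ≤ δ0 / 8 := by
      have : 0 ≤ δ * δ0 := by positivity
      linarith
    gcongr
  have g4 : 0 < δ0 * t := by positivity
  linarith

/-- A coarsely 1-Lipschitz sequence with almost maximal oscillation is almost linear. -/
lemma exists_sign {u : ℕ → ℝ} {N s : ℕ} {ε : ℝ} (hs : 1 ≤ s) (hsε : s ≤ ε * N)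
    (hlip : ∀ i j, i ≤ j → j ≤ N → j ≤ i + s → |u j - u i| ≤ ε * N)
    (hv : ∀ v ≤ N / s, ∀ w ≤ N / s,
      |u (s * v) - u (s * w)| ≤ |((s * v : ℕ) : ℝ) - (s * w : ℕ)| + 5 * (ε * N))
    (hosc : ∃ i ≤ N, ∃ j ≤ N, (1 - ε) * N < u i - u j) :
    ∃ σ : ℝ, (σ = 1 ∨ σ = -1) ∧ ∀ k ≤ N, |u k - u 0 - σ * k| ≤ 40 * (ε * N) := by
  have hk : ∀ k ≤ N, |u k - u (s * (k / s))| ≤ ε * N ∧ s * (k / s) ≤ k ∧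
      (k:ℝ) - (s * (k / s) : ℕ) ≤ ε * N := by
    intro k hk
    have h1 := Nat.div_add_mod k s
    have h2 := Nat.mod_lt k (show 0 < s by omega)
    have h3 : s * (k / s) ≤ k := Nat.mul_div_le k s
    refine ⟨hlip _ _ h3 hk (by omega), h3, ?_⟩
    have : (k:ℝ) ≤ (s * (k / s) : ℕ) + s := by exact_mod_cast (show k ≤ s * (k / s) + s by omega)
    linarith
  have hall : ∀ k ≤ N, ∀ l ≤ N, |u k - u l| ≤ |(k:ℝ) - l| + 9 * (ε * N) := by
    intro k hkN l hlN
    obtain ⟨a1, a2, a3⟩ := hk k hkN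
    obtain ⟨b1, b2, b3⟩ := hk l hlN
    have c := hv _ (Nat.div_le_div_right hkN) _ (Nat.div_le_div_right hlN)
    have a2' : ((s * (k / s) : ℕ) : ℝ) ≤ k := by exact_mod_cast a2
    have b2' : ((s * (l / s) : ℕ) : ℝ) ≤ l := by exact_mod_cast b2
    have d : |((s * (k / s) : ℕ) : ℝ) - (s * (l / s) : ℕ)| ≤ |(k:ℝ) - l| + 2 * (ε * N) := by
      have := abs_le.mp (le_refl |(k:ℝ) - l|)
      rw [abs_le]; constructor <;> linarith
    rw [abs_le] at a1 b1 c ⊢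
    constructor <;> linarith
  obtain ⟨i, hi, j, hj, hij⟩ := hosc
  have hiN : (i:ℝ) ≤ N := by exact_mod_cast hi
  have hjN : (j:ℝ) ≤ N := by exact_mod_cast hj
  have hi0 : (0:ℝ) ≤ i := Nat.cast_nonneg i
  have hj0 : (0:ℝ) ≤ j := Nat.cast_nonneg j
  have hεN : 0 ≤ ε * N := (Nat.cast_nonneg s).trans hsε
  have h1 := (abs_le.mp (hall i hi j hj)).2
  rcases le_total (j:ℝ) i with hji | hji
  · rw [abs_of_nonneg (by linarith)] at h1
    refine ⟨1, Or.inl rfl, fun k hk => ?_⟩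
    have hkN : (k:ℝ) ≤ N := by exact_mod_cast hk
    have h2 := (abs_le.mp (hall k hk 0 (Nat.zero_le _))).2
    have h3 := (abs_le.mp (hall i hi k hk)).2
    have h4 := (abs_le.mp (hall j hj 0 (Nat.zero_le _))).1
    have h5 : |(i:ℝ) - k| ≤ N - k + 10 * (ε * N) := by rw [abs_le]; constructor <;> linarith
    simp only [Nat.cast_zero, sub_zero, Nat.abs_cast] at h2 h4
    rw [abs_le]; constructor <;> linarith
  · rw [abs_of_nonpos (by linarith)] at h1
    refine ⟨-1, Or.inr rfl, fun k hk => ?_⟩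
    have hkN : (k:ℝ) ≤ N := by exact_mod_cast hk
    have h2 := (abs_le.mp (hall k hk 0 (Nat.zero_le _))).1
    have h3 := (abs_le.mp (hall j hj k hk)).1
    have h4 := (abs_le.mp (hall i hi 0 (Nat.zero_le _))).2
    have h5 : |(j:ℝ) - k| ≤ N - k + 10 * (ε * N) := by rw [abs_le]; constructor <;> linarith
    simp only [Nat.cast_zero, sub_zero, Nat.abs_cast] at h2 h4
    rw [abs_le]; constructor <;> linarith

lemma GainLe.two_sided {L : ℕ} {c : ℝ} (h : GainLe L c) :
    ∃ R : ℕ, 1 ≤ R ∧ ∀ φ φ', CE L φ φ' → |boxGain φ R| ≤ c * R := by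
  obtain ⟨R, hR, h⟩ := h
  refine ⟨R, hR, fun φ φ' hφ => abs_le.mpr ⟨?_, h φ φ' hφ⟩⟩
  have := h _ _ hφ.post_sw
  have e : boxGain (fun p => sw (φ p)) R = - boxGain φ R := by
    simp only [boxGain, sw_k, Int.cast_neg, Finset.sum_neg_distrib]; ring
  rw [e] at this; linarith

/-- Level of the image of the point at level `k` of the vertical line `(X, Y)` of the box of
size `N`. -/
def lineLev (φ : Pt → Pt) (N X Y k : ℕ) : ℝ := ((φ ⟨X, Y / 2 ^ N, k⟩).k : ℝ)

lemma near_line_linePt {N k : ℕ} (hk : k ≤ N) (X Y : ℕ) :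
    Near 1 (⟨X, Y / 2 ^ N, k⟩ : Pt) (linePt N k X Y) := by
  have aux : ∀ i, |((X / 2 ^ i : ℕ) : ℝ) * 2 ^ i - X| ≤ 2 ^ i := by
    intro i
    simpa using abs_floor_mul_sub_le X 0 i (Nat.zero_le _)
  refine near_of_bounds (a := 0) ?_ ?_ ?_
  · simp [linePt]
  · simp only [linePt, pow_zero, one_mul, zpow_natCast]
    exact aux k
  · simp only [linePt, pow_zero, one_mul]
    rw [floor_div_eq N k Y hk, ← sub_div, abs_div, abs_of_pos (show (0:ℝ) < 2 ^ N by positivity),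
      zpow_neg, zpow_natCast]
    have h1 := abs_floor_mul_sub_le Y 0 (N - k) (Nat.zero_le _)
    simp only [pow_zero, Nat.div_one, mul_one] at h1
    have e : (2:ℝ) ^ N = 2 ^ (N - k) * 2 ^ k := by rw [← pow_add]; congr 1; omega
    calc _ ≤ (2:ℝ) ^ (N - k) / 2 ^ N := by gcongr
      _ = _ := by rw [e]; field_simp

lemma card_filter_mul_le_lineSum (N : ℕ) (f : ℕ → ℕ → ℝ) {b : ℝ} (hf : ∀ X Y, 0 ≤ f X Y) :
    (((Finset.range (2 ^ N) ×ˢ Finset.range (2 ^ N)).filter fun c => b < f c.1 c.2).card : ℝ) * b ≤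
      lineSum N f := by
  rw [lineSum, ← Finset.sum_product', ← nsmul_eq_mul]
  refine (Finset.card_nsmul_le_sum _ _ _ fun c hc => (Finset.mem_filter.mp hc).2.le).trans ?_
  exact Finset.sum_le_sum_of_subset_of_nonneg (Finset.filter_subset _ _) fun _ _ _ => hf _ _

namespace CE
variable {L : ℕ} {φ φ' : Pt → Pt}

lemma lineLev_lip (h : CE L φ φ') (N X Y : ℕ) {i j : ℕ} (hij : i ≤ j) :
    |lineLev φ N X Y j - lineLev φ N X Y i| ≤ L * ((j - i : ℕ) + 1) := by
  have h1 := near_vert (X:ℝ) (Y / 2 ^ N) i (j - i)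
  rw [show ((i:ℤ) + ((j - i : ℕ) : ℤ)) = j by omega] at h1
  exact h.k_real h1

lemma lineLev_sub_linePt (h : CE L φ φ') {N k : ℕ} (hk : k ≤ N) (X Y : ℕ) :
    |((φ (linePt N k X Y)).k : ℝ) - lineLev φ N X Y k| ≤ 2 * L := by
  have := h.k_real (near_line_linePt hk X Y)
  rw [lineLev]; push_cast at this; linarith

lemma lineLev_gain (h : CE L φ φ') {R : ℕ} {ε η : ℝ} (hR : ∀ φ φ', CE L φ φ' →
    |boxGain φ R| ≤ (1 + ε) * R) (hε : 0 ≤ ε) {M X Y : ℕ} {n n' : ℕ} (hnn : n ≤ n') (hn : n' ≤ M)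
    (hD : |gridLev φ R M n X Y - gridLev φ R M 0 X Y -
        ∑ j ∈ Finset.range n, boxGain (fun p => φ (tr (boxBase R M j X Y) p)) R| ≤ η)
    (hD' : |gridLev φ R M n' X Y - gridLev φ R M 0 X Y -
        ∑ j ∈ Finset.range n', boxGain (fun p => φ (tr (boxBase R M j X Y) p)) R| ≤ η) :
    |lineLev φ (M * R) X Y (n' * R) - lineLev φ (M * R) X Y (n * R)| ≤
      (n' * R : ℕ) - (n * R : ℕ) + (ε * (M * R : ℕ) + 2 * η + 4 * L) := by
  have h1 := h.lineLev_sub_linePt (Nat.mul_le_mul_right R hn) X Y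
  have h2 := h.lineLev_sub_linePt (Nat.mul_le_mul_right R (hnn.trans hn)) X Y
  rw [← gridLev_eq] at h1 h2
  have h3 : |∑ j ∈ Finset.Ico n n', boxGain (fun p => φ (tr (boxBase R M j X Y) p)) R| ≤
      (n' - n : ℕ) * ((1 + ε) * R) := by
    refine (Finset.abs_sum_le_sum_abs _ _).trans ((Finset.sum_le_card_nsmul _ _ _
      fun j _ => hR _ _ (h.pre_tr _)).trans (le_of_eq ?_))
    rw [Nat.card_Ico, nsmul_eq_mul]
  rw [Finset.sum_Ico_eq_sub _ hnn, Nat.cast_sub hnn] at h3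
  have h4 : ((n':ℝ) - n) * (ε * R) ≤ ε * (M * R : ℕ) := by
    have : (n':ℝ) - n ≤ M := by
      have : (n':ℝ) ≤ M := by exact_mod_cast hn
      have : (0:ℝ) ≤ n := Nat.cast_nonneg n
      linarith
    have := mul_le_mul_of_nonneg_right this (show 0 ≤ ε * R by positivity)
    push_cast; linarith
  push_cast at h4 ⊢
  rw [abs_le] at h1 h2 h3 hD hD' ⊢
  constructor <;> linarith

lemma card_small_osc (h : CE L φ φ') {N : ℕ} {ε : ℝ}
    (hosc : ∀ ψ ψ', CE L ψ ψ' → (((Finset.range (2 ^ N)).filter fun J : ℕ => ∀ i : ℕ, i ≤ N →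
      ∀ j : ℕ, j ≤ N → ((ψ ⟨0, J / 2 ^ N, i⟩).k - (ψ ⟨0, J / 2 ^ N, j⟩).k : ℝ) ≤
        (1 - ε) * N).card : ℝ) ≤ ε * 2 ^ N) :
    (((Finset.range (2 ^ N) ×ˢ Finset.range (2 ^ N)).filter fun c => ∀ i : ℕ, i ≤ N →
      ∀ j : ℕ, j ≤ N → lineLev φ N c.1 c.2 i - lineLev φ N c.1 c.2 j ≤ (1 - ε) * N).card : ℝ) ≤
      ε * 4 ^ N := by
  have := card_filter_product_le (Finset.range (2 ^ N)) (Finset.range (2 ^ N))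
    (fun X Y => ∀ i : ℕ, i ≤ N →
      ∀ j : ℕ, j ≤ N → lineLev φ N X Y i - lineLev φ N X Y j ≤ (1 - ε) * N) (ε * 2 ^ N) (by
    intro X _
    refine le_trans ?_ (hosc _ _ (h.pre_tr ⟨X, 0, 0⟩))
    refine Nat.cast_le.mpr (Finset.card_le_card fun J hJ => ?_)
    rw [Finset.mem_filter] at hJ ⊢
    refine ⟨hJ.1, fun i hi j hj => ?_⟩
    have := hJ.2 i hi j hj
    simpa [tr, lineLev] using this)
  refine this.trans (le_of_eq ?_)
  rw [Finset.card_range, show (4:ℝ) = 2 * 2 by norm_num, mul_pow]; push_cast; ring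

end CE

/-- Most vertical lines of a large box are mapped to paths which go almost straight up or almost
straight down. -/
theorem good_lines (L : ℕ) (δ : ℝ) (hδ : 0 < δ) : ∃ R : ℕ, 1 ≤ R ∧ ∃ M1 : ℕ, ∀ M ≥ M1, ∀ φ φ',
    CE L φ φ' → ∃ B : Finset (ℕ × ℕ), (B.card : ℝ) ≤ δ * 4 ^ (M * R) ∧
      ∀ X < 2 ^ (M * R), ∀ Y < 2 ^ (M * R), (X, Y) ∉ B → ∃ σ : ℝ, (σ = 1 ∨ σ = -1) ∧
        ∀ k ≤ M * R, |lineLev φ (M * R) X Y k - lineLev φ (M * R) X Y 0 - σ * k| ≤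
          δ * (M * R : ℕ) := by
  classical
  obtain ⟨ε, hε⟩ : ∃ ε, ε = δ / 40 := ⟨_, rfl⟩
  have hε0 : 0 < ε := by rw [hε]; positivity
  obtain ⟨R, hR, hgain⟩ := (gainLe_one L ε hε0).two_sided
  obtain ⟨t0, ht0⟩ := CE.osc_large L ε hε0
  obtain ⟨V, hV⟩ := exists_nat_ge ((2 * L + 2) / ε)
  have hV0 : (0:ℝ) < V := lt_of_lt_of_le (by positivity) hV
  have hV1 : 1 ≤ V := by exact_mod_cast hV0
  rw [div_le_iff₀ hε0] at hV
  obtain ⟨M1, hM1⟩ := exists_nat_ge ((2 * (L * (R + 2)) * (2 * V + 1) / ε ^ 2) ^ 2)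
  obtain ⟨M2, hM2⟩ := exists_nat_ge (2 * L / ε)
  rw [div_le_iff₀ hε0] at hM2
  refine ⟨R, hR, M1 + M2 + V + t0, fun M hM φ φ' h => ?_⟩
  obtain ⟨N, hN⟩ : ∃ N, N = M * R := ⟨_, rfl⟩
  obtain ⟨w, hw⟩ : ∃ w, w = M / V := ⟨_, rfl⟩
  have hw1 : 1 ≤ w := by rw [hw, Nat.le_div_iff_mul_le hV1]; omega
  have hwV : w * V ≤ M := by rw [hw]; exact Nat.div_mul_le_self M V
  have hMw : M < w * V + V := by
    have h1 := Nat.div_add_mod M V; have h2 := Nat.mod_lt M hV1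
    rw [← hw, mul_comm V w] at h1; omega
  have hMdiv : M / w ≤ 2 * V := by
    rw [Nat.div_le_iff_le_mul_add_pred hw1]
    have : V ≤ w * V := Nat.le_mul_of_pos_left _ hw1
    have : w * (2 * V) = 2 * (w * V) := by ring
    omega
  have hMN : M ≤ N := by rw [hN]; exact Nat.le_mul_of_pos_right _ hR
  have hNpos : (0:ℝ) < N := by exact_mod_cast (show 0 < N by omega)
  have hsN : ((w * R : ℕ) : ℝ) * (2 * L + 2) ≤ ε * N := by
    have h1 : ((w * R : ℕ) : ℝ) * V ≤ N := by
      have : w * R * V ≤ N := by rw [hN, mul_right_comm]; exact Nat.mul_le_mul_right R hwV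
      exact_mod_cast this
    calc ((w * R : ℕ) : ℝ) * (2 * L + 2) ≤ ((w * R : ℕ) : ℝ) * (V * ε) := by gcongr
      _ = ε * (((w * R : ℕ) : ℝ) * V) := by ring
      _ ≤ _ := by gcongr
  have hs1 : (1:ℝ) ≤ (w * R : ℕ) := by exact_mod_cast Nat.mul_pos hw1 hR
  have hLN : 2 * L ≤ ε * N := by
    have : (M2:ℝ) ≤ N := by exact_mod_cast (show M2 ≤ N by omega)
    nlinarith
  have hL0 : (0:ℝ) ≤ L := Nat.cast_nonneg L
  rw [← hN]
  set P := Finset.range (2 ^ N) ×ˢ Finset.range (2 ^ N) with hP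
  set D : ℕ → ℕ × ℕ → ℝ := fun n c => |gridLev φ R M n c.1 c.2 - gridLev φ R M 0 c.1 c.2 -
        ∑ j ∈ Finset.range n, boxGain (fun p => φ (tr (boxBase R M j c.1 c.2) p)) R| with hD
  set B1 := P.filter fun c => ∀ i : ℕ, i ≤ N →
      ∀ j : ℕ, j ≤ N → lineLev φ N c.1 c.2 i - lineLev φ N c.1 c.2 j ≤ (1 - ε) * N with hB1
  set B2 := (Finset.range (M / w + 1)).biUnion fun v => P.filter fun c => ε * N < D (v * w) c with hB2
  have c1 : (B1.card : ℝ) ≤ ε * 4 ^ N := by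
    refine le_trans ?_ (h.card_small_osc (N := N) (ε := ε) fun ψ ψ' hψ => ?_)
    · refine Nat.cast_le.mpr (Finset.card_le_card fun J hJ => ?_)
      rw [hB1, Finset.mem_filter] at hJ
      rw [Finset.mem_filter]; exact hJ
    · exact ht0 ψ ψ' hψ N (by omega)
  have c2 : (B2.card : ℝ) ≤ ε * 4 ^ N := by
    have h4 : (0:ℝ) < 4 ^ N := by positivity
    have hone : ∀ v ∈ Finset.range (M / w + 1),
        ((P.filter fun c => ε * N < D (v * w) c).card : ℝ) ≤ ε / (2 * V + 1) * 4 ^ N := by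
      intro v hv
      rw [Finset.mem_range] at hv
      have hvw : v * w ≤ M := (Nat.mul_le_mul_right w (by omega)).trans (Nat.div_mul_le_self M w)
      have e1 := card_filter_mul_le_lineSum N (fun X Y => D (v * w) (X, Y)) (b := ε * N)
        (fun _ _ => abs_nonneg _)
      have e2 := h.lineSum_abs_sub R M (v * w) hvw
      rw [← hN] at e2
      have e3 := e1.trans e2
      have hsq : √(M:ℝ) * √(M:ℝ) = M := Real.mul_self_sqrt (Nat.cast_nonneg M)
      have hroot : 2 * (L * (R + 2)) * (2 * V + 1) ≤ √(M:ℝ) * ε ^ 2 := by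
        rw [← div_le_iff₀ (by positivity)]
        refine Real.le_sqrt_of_sq_le (hM1.trans ?_)
        exact_mod_cast (show M1 ≤ M by omega)
      have hMNr : (M:ℝ) ≤ N := by exact_mod_cast hMN
      have e4 : 2 * (L * ((R:ℝ) + 2)) * √M * (2 * V + 1) ≤ ε ^ 2 * N := by
        calc 2 * (L * ((R:ℝ) + 2)) * √M * (2 * V + 1) = √M * (2 * (L * (R + 2)) * (2 * V + 1)) := by
              ring
          _ ≤ √M * (√M * ε ^ 2) := by gcongr
          _ = ε ^ 2 * M := by linear_combination ε ^ 2 * hsq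
          _ ≤ _ := by gcongr
      rw [div_mul_eq_mul_div, le_div_iff₀ (by positivity)]
      refine le_of_mul_le_mul_right ?_ (show 0 < ε * N by positivity)
      calc _ = ((P.filter fun c => ε * N < D (v * w) c).card : ℝ) * (ε * N) * (2 * V + 1) := by ring
        _ ≤ 2 * (L * (R + 2)) * √M * 4 ^ N * (2 * V + 1) := by
            refine mul_le_mul_of_nonneg_right ?_ (by positivity)
            refine le_trans (le_of_eq ?_) e3
            congr 2
        _ = 2 * (L * (R + 2)) * √M * (2 * V + 1) * 4 ^ N := by ring
        _ ≤ ε ^ 2 * N * 4 ^ N := by gcongr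
        _ = _ := by ring
    have e5 : (B2.card : ℝ) ≤ ∑ v ∈ Finset.range (M / w + 1),
        ((P.filter fun c => ε * N < D (v * w) c).card : ℝ) := by
      exact_mod_cast Finset.card_biUnion_le
    refine e5.trans ((Finset.sum_le_card_nsmul _ _ _ hone).trans ?_)
    rw [nsmul_eq_mul, Finset.card_range]
    have : ((M / w + 1 : ℕ) : ℝ) ≤ 2 * V + 1 := by exact_mod_cast Nat.succ_le_succ hMdiv
    calc _ ≤ (2 * V + 1) * (ε / (2 * V + 1) * 4 ^ N) := by gcongr
      _ = _ := by field_simp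
  refine ⟨B1 ∪ B2, ?_, fun X hX Y hY hXY => ?_⟩
  · have : ((B1 ∪ B2).card : ℝ) ≤ B1.card + B2.card := by exact_mod_cast Finset.card_union_le _ _
    have h4 : (0:ℝ) < ε * 4 ^ N := by positivity
    have : δ * 4 ^ N = 40 * (ε * 4 ^ N) := by rw [hε]; ring
    linarith
  rw [Finset.notMem_union] at hXY
  have hXYP : (X, Y) ∈ P := Finset.mem_product.mpr ⟨Finset.mem_range.mpr hX,
      Finset.mem_range.mpr hY⟩
  have hosc : ∃ i ≤ N, ∃ j ≤ N, (1 - ε) * N < lineLev φ N X Y i - lineLev φ N X Y j := by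
    by_contra! hc
    exact hXY.1 (Finset.mem_filter.mpr ⟨hXYP, hc⟩)
  have hDv : ∀ v ≤ M / w, D (v * w) (X, Y) ≤ ε * N := by
    intro v hv
    by_contra! hc
    exact hXY.2 (Finset.mem_biUnion.mpr ⟨v, Finset.mem_range.mpr (by omega),
      Finset.mem_filter.mpr ⟨hXYP, hc⟩⟩)
  have hdiv : N / (w * R) = M / w := by rw [hN, Nat.mul_div_mul_right _ _ (by omega)]
  have := exists_sign (u := lineLev φ N X Y) (N := N) (s := w * R) (ε := ε)
    (by exact_mod_cast hs1) (by nlinarith) (fun i j hij hj hs => ?_) (fun v hv v' hv' => ?_) hosc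
  · obtain ⟨σ, h1, h2⟩ := this
    refine ⟨σ, h1, fun k hk => (h2 k hk).trans (le_of_eq ?_)⟩
    rw [hε]; ring
  · refine (h.lineLev_lip N X Y hij).trans ?_
    have : ((j - i : ℕ) : ℝ) ≤ (w * R : ℕ) := by exact_mod_cast (show j - i ≤ w * R by omega)
    calc (L:ℝ) * ((j - i : ℕ) + 1) ≤ L * ((w * R : ℕ) + (w * R : ℕ)) := by gcongr
      _ ≤ _ := by linarith
  · rw [hdiv] at hv hv'
    have main : ∀ v v', v ≤ v' → v' ≤ M / w →
        |lineLev φ N X Y (w * R * v') - lineLev φ N X Y (w * R * v)| ≤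
        |((w * R * v' : ℕ) : ℝ) - (w * R * v : ℕ)| + 5 * (ε * N) := by
      intro v v' hvv hv'
      have hvw : v' * w ≤ M := (Nat.mul_le_mul_right w hv').trans (Nat.div_mul_le_self M w)
      have := h.lineLev_gain hgain hε0.le (Nat.mul_le_mul_right w hvv) hvw (hDv v (hvv.trans hv'))
        (hDv v' hv')
      rw [← hN] at this
      rw [show w * R * v' = v' * w * R by ring, show w * R * v = v * w * R by ring]
      refine this.trans ?_
      have := le_abs_self (((v' * w * R : ℕ) : ℝ) - (v * w * R : ℕ))
      linarith
    rcases le_total v v' with hvv | hvv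
    · rw [abs_sub_comm, abs_sub_comm ((w * R * v : ℕ) : ℝ)]
      exact main v v' hvv hv'
    · exact main v' v hvv hv

lemma exists_lt_not_mem_three {n : ℕ} (hn : 0 < n) (A B C : Finset ℕ) (hA : 8 * A.card ≤ n)
    (hB : 8 * B.card ≤ n) (hC : 8 * C.card ≤ n) : ∃ a < n, a ∉ A ∧ a ∉ B ∧ a ∉ C := by
  classical
  have h1 : (A ∪ B ∪ C).card ≤ A.card + B.card + C.card :=
    (Finset.card_union_le _ _).trans (Nat.add_le_add_right (Finset.card_union_le _ _) _)
  obtain ⟨a, ha, hn⟩ := Finset.exists_mem_notMem_of_card_lt_card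
    (show (A ∪ B ∪ C).card < (Finset.range n).card by rw [Finset.card_range]; omega)
  simp only [Finset.mem_union, not_or] at hn
  exact ⟨a, Finset.mem_range.mp ha, hn.1.1, hn.1.2, hn.2⟩

lemma card_atypical {n : ℕ} (B : Finset (ℕ × ℕ)) (π : ℕ → ℕ → ℕ × ℕ)
    (hπ : ∀ a b a' b', π a b = π a' b' → a = a' ∧ b = b') :
    n * ((Finset.range n).filter fun a =>
      n < 8 * ((Finset.range n).filter fun b => π a b ∈ B).card).card ≤ 8 * B.card := by
  classical
  set T := (Finset.range n).filter fun a =>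
      n < 8 * ((Finset.range n).filter fun b => π a b ∈ B).card
  have h1 : ∑ a ∈ T, ((Finset.range n).filter fun b => π a b ∈ B).card ≤ B.card := by
    rw [← Finset.card_sigma]
    refine Finset.card_le_card_of_injOn (fun c => π c.1 c.2) ?_ ?_
    · rintro ⟨a, b⟩ h
      simp only [Finset.coe_sigma, Set.mem_sigma_iff, Finset.mem_coe, Finset.mem_filter] at h
      exact h.2.2
    · rintro ⟨a, b⟩ - ⟨a', b'⟩ - h
      obtain ⟨rfl, rfl⟩ := hπ _ _ _ _ h
      rfl
  have h2 : T.card * n ≤ ∑ a ∈ T, 8 * ((Finset.range n).filter fun b => π a b ∈ B).card := by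
    rw [← smul_eq_mul]
    exact Finset.card_nsmul_le_sum _ _ _ fun a ha => (Finset.mem_filter.mp ha).2.le
  rw [← Finset.mul_sum] at h2
  rw [mul_comm]
  omega

/-- Two families of local coincidences on most of a square force a global coincidence. -/
lemma sign_coherent {n w : ℕ} (hn : 0 < n) (B : Finset (ℕ × ℕ)) (σ : ℕ → ℕ → ℝ)
    (hB : 64 * B.card ≤ n * n) (hw : 8 * (2 * w + 1) ≤ n)
    (hx : ∀ X < n, ∀ X' < n, ∀ Y < n, ∀ Y' < n, (X, Y) ∉ B → (X, Y') ∉ B → (X', Y) ∉ B →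
      (X', Y') ∉ B → (X' + w < X ∨ X + w < X') → σ X Y = σ X Y')
    (hy : ∀ X < n, ∀ X' < n, ∀ Y < n, ∀ Y' < n, (X, Y) ∉ B → (X, Y') ∉ B → (X', Y) ∉ B →
      (X', Y') ∉ B → (Y' + w < Y ∨ Y + w < Y') → σ X Y = σ X' Y) :
    ∃ (s : ℝ) (B' : Finset (ℕ × ℕ)), B'.card ≤ 17 * B.card ∧
      (∃ X < n, ∃ Y < n, (X, Y) ∉ B') ∧ ∀ X < n, ∀ Y < n, (X, Y) ∉ B' →
      (X, Y) ∉ B ∧ σ X Y = s ∧ ∀ X' < n, ∀ Y' < n, (X', Y') ∉ B' →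
        ∃ Y'' < n, (X, Y'') ∉ B' ∧ (X', Y'') ∉ B' := by
  classical
  set bx : ℕ → Finset ℕ := fun X => (Finset.range n).filter fun Y => (X, Y) ∈ B with hbx
  set By : ℕ → Finset ℕ := fun Y => (Finset.range n).filter fun X => (X, Y) ∈ B with hby
  set TX := (Finset.range n).filter fun X => n < 8 * (bx X).card with hTX
  set TY := (Finset.range n).filter fun Y => n < 8 * (By Y).card with hTY
  have cX : n * TX.card ≤ 8 * B.card := card_atypical B (fun a b => (a, b)) (by simp)
  have cY : n * TY.card ≤ 8 * B.card := card_atypical B (fun a b => (b, a)) (by simp)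
  have cY8 : 8 * TY.card ≤ n := by
    refine Nat.le_of_mul_le_mul_left ?_ hn
    calc n * (8 * TY.card) = 8 * (n * TY.card) := by ring
      _ ≤ 8 * (8 * B.card) := Nat.mul_le_mul_left 8 cY
      _ ≤ n * n := by omega
  have cX8 : 8 * TX.card ≤ n := by
    refine Nat.le_of_mul_le_mul_left ?_ hn
    calc n * (8 * TX.card) = 8 * (n * TX.card) := by ring
      _ ≤ 8 * (8 * B.card) := Nat.mul_le_mul_left 8 cX
      _ ≤ n * n := by omega
  have hint : ∀ a : ℕ, 8 * (Finset.Icc (a - w) (a + w)).card ≤ n := by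
    intro a; rw [Nat.card_Icc]; omega
  have typX : ∀ X < n, X ∉ TX → 8 * (bx X).card ≤ n := by
    intro X hX h
    by_contra! hc
    exact h (Finset.mem_filter.mpr ⟨Finset.mem_range.mpr hX, hc⟩)
  have typY : ∀ Y < n, Y ∉ TY → 8 * (By Y).card ≤ n := by
    intro Y hY h
    by_contra! hc
    exact h (Finset.mem_filter.mpr ⟨Finset.mem_range.mpr hY, hc⟩)
  have nbx : ∀ X Y, Y < n → Y ∉ bx X → (X, Y) ∉ B := fun X Y hY h hc =>
    h (Finset.mem_filter.mpr ⟨Finset.mem_range.mpr hY, hc⟩)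
  have nby : ∀ X Y, X < n → X ∉ By Y → (X, Y) ∉ B := fun X Y hX h hc =>
    h (Finset.mem_filter.mpr ⟨Finset.mem_range.mpr hX, hc⟩)
  have eqY : ∀ X < n, ∀ Y < n, ∀ Y' < n, Y ∉ TY → Y' ∉ TY → (X, Y) ∉ B → (X, Y') ∉ B →
      σ X Y = σ X Y' := by
    intro X hX Y hY Y' hY' h1 h2 h3 h4
    obtain ⟨X', hX', a1, a2, a3⟩ := exists_lt_not_mem_three hn _ _ _ (typY Y hY h1) (typY Y' hY' h2)
      (hint X)
    rw [Finset.mem_Icc] at a3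
    exact hx X hX X' hX' Y hY Y' hY' h3 h4 (nby _ _ hX' a1) (nby _ _ hX' a2) (by omega)
  have eqX : ∀ Y < n, ∀ X < n, ∀ X' < n, X ∉ TX → X' ∉ TX → (X, Y) ∉ B → (X', Y) ∉ B →
      σ X Y = σ X' Y := by
    intro Y hY X hX X' hX' h1 h2 h3 h4
    obtain ⟨Y', hY', a1, a2, a3⟩ := exists_lt_not_mem_three hn _ _ _ (typX X hX h1) (typX X' hX' h2)
      (hint Y)
    rw [Finset.mem_Icc] at a3
    exact hy X hX X' hX' Y hY Y' hY' h3 (nbx _ _ hY' a1) h4 (nbx _ _ hY' a2) (by omega)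
  set B' := B ∪ TX ×ˢ Finset.range n ∪ Finset.range n ×ˢ TY with hB'
  have memB' : ∀ X < n, ∀ Y < n, (X, Y) ∉ B' ↔ (X, Y) ∉ B ∧ X ∉ TX ∧ Y ∉ TY := by
    intro X hX Y hY
    simp only [hB', Finset.mem_union, Finset.mem_product, Finset.mem_range, hX, hY, not_or,
      and_true, true_and]
    tauto
  have link : ∀ X < n, ∀ X' < n, X ∉ TX → X' ∉ TX →
      ∃ Y'' < n, (X, Y'') ∉ B' ∧ (X', Y'') ∉ B' := by
    intro X hX X' hX' h1 h2
    obtain ⟨Y, hY, a1, a2,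
        a3⟩ := exists_lt_not_mem_three hn _ _ _ (typX X hX h1) (typX X' hX' h2) cY8
    exact ⟨Y, hY, (memB' _ hX _ hY).mpr ⟨nbx _ _ hY a1, h1, a3⟩,
      (memB' _ hX' _ hY).mpr ⟨nbx _ _ hY a2, h2, a3⟩⟩
  have alleq : ∀ X < n, ∀ Y < n, (X, Y) ∉ B' → ∀ X' < n, ∀ Y' < n, (X', Y') ∉ B' →
      σ X Y = σ X' Y' := by
    intro X hX Y hY h X' hX' Y' hY' h'
    obtain ⟨b1, b2, b3⟩ := (memB' _ hX _ hY).mp h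
    obtain ⟨c1, c2, c3⟩ := (memB' _ hX' _ hY').mp h'
    obtain ⟨Y'', hY'', d1, d2⟩ := link X hX X' hX' b2 c2
    obtain ⟨d1, -, d3⟩ := (memB' _ hX _ hY'').mp d1
    obtain ⟨d2, -, -⟩ := (memB' _ hX' _ hY'').mp d2
    rw [eqY X hX Y hY Y'' hY'' b3 d3 b1 d1, eqX Y'' hY'' X hX X' hX' b2 c2 d1 d2,
      eqY X' hX' Y'' hY'' Y' hY' d3 c3 d2 c1]
  obtain ⟨X0, hX0, e1, -, -⟩ := exists_lt_not_mem_three hn _ _ _ cX8 cX8 cX8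
  obtain ⟨Y0, hY0, f1, f2⟩ := link X0 hX0 X0 hX0 e1 e1
  refine ⟨σ X0 Y0, B', ?_, ⟨X0, hX0, Y0, hY0, f1⟩, fun X hX Y hY h => ⟨((memB' _ hX _ hY).mp h).1,
    alleq X hX Y hY h X0 hX0 Y0 hY0 f1, fun X' hX' Y' hY' h' =>
      link X hX X' hX' ((memB' _ hX _ hY).mp h).2.1 ((memB' _ hX' _ hY').mp h').2.1⟩⟩
  have : B'.card ≤ B.card + TX.card * n + n * TY.card := by
    refine (Finset.card_union_le _ _).trans (Nat.add_le_add ((Finset.card_union_le _ _).trans ?_) ?_)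
    · rw [Finset.card_product, Finset.card_range]
    · rw [Finset.card_product, Finset.card_range]
  rw [mul_comm TX.card] at this
  omega

/-- A version of `good_lines` for boxes of arbitrary large height. -/
theorem good_lines_all (L : ℕ) (δ : ℝ) (hδ : 0 < δ) : ∃ N1 : ℕ, ∀ N ≥ N1, ∀ φ φ',
    CE L φ φ' → ∃ B : Finset (ℕ × ℕ), (B.card : ℝ) ≤ δ * 4 ^ N ∧
      ∀ X < 2 ^ N, ∀ Y < 2 ^ N, (X, Y) ∉ B → ∃ σ : ℝ, (σ = 1 ∨ σ = -1) ∧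
        ∀ k ≤ N, |lineLev φ N X Y k - lineLev φ N X Y 0 - σ * k| ≤ δ * N := by
  classical
  obtain ⟨R, hR, M1, hM1⟩ := good_lines L (δ / 2) (by positivity)
  obtain ⟨V, hV⟩ := exists_nat_ge ((4 * L + (L * (R + 1) + R)) / (δ / 2))
  rw [div_le_iff₀ (by positivity)] at hV
  refine ⟨(M1 + 1) * R + V, fun N hN φ φ' h => ?_⟩
  have hM : M1 ≤ N / R := by
    rw [Nat.le_div_iff_mul_le (by omega)]; nlinarith
  have hrR : N % R < R := Nat.mod_lt _ (by omega)
  have hNe : N = N / R * R + N % R := (Nat.div_add_mod' N R).symm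
  obtain ⟨N0, hN0⟩ : ∃ N0, N0 = N / R * R := ⟨_, rfl⟩
  obtain ⟨r, hr⟩ : ∃ r, r = N % R := ⟨_, rfl⟩
  have key := fun a : ℕ => hM1 (N / R) hM _ _ (h.pre_tr ⟨a * 2 ^ N0, 0, 0⟩)
  rw [← hr] at hrR
  rw [← hN0, ← hr] at hNe
  rw [← hN0] at key
  choose B hBc hB using key
  have hVN : (V:ℝ) ≤ N := by exact_mod_cast (by omega : V ≤ N)
  have h2N : (2:ℕ) ^ N = 2 ^ N0 * 2 ^ r := by rw [hNe, pow_add]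
  refine ⟨((Finset.range (2 ^ N)) ×ˢ (Finset.range (2 ^ N))).filter fun c =>
    (c.1 % 2 ^ N0, c.2 / 2 ^ r) ∈ B (c.1 / 2 ^ N0), ?_, ?_⟩
  · have hc : (((Finset.range (2 ^ N)) ×ˢ (Finset.range (2 ^ N))).filter fun c =>
        (c.1 % 2 ^ N0, c.2 / 2 ^ r) ∈ B (c.1 / 2 ^ N0)).card ≤
        (((Finset.range (2 ^ r)) ×ˢ (Finset.range (2 ^ r))).sigma fun ab => B ab.1).card := by
      refine Finset.card_le_card_of_injOn
        (fun c => ⟨(c.1 / 2 ^ N0, c.2 % 2 ^ r), (c.1 % 2 ^ N0, c.2 / 2 ^ r)⟩) ?_ ?_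
      · intro c hc
        simp only [Finset.coe_filter, Finset.mem_product, Finset.mem_range, Set.mem_ofPred_eq] at hc
        simp only [Finset.coe_sigma, Set.mem_sigma_iff, Finset.coe_product, Finset.coe_range,
          Set.mem_prod, Set.mem_Iio, Finset.mem_coe]
        refine ⟨⟨?_, Nat.mod_lt _ (by positivity)⟩, hc.2⟩
        rw [Nat.div_lt_iff_lt_mul (by positivity), mul_comm, ← h2N]; exact hc.1.1
      · intro c _ d _ hcd
        simp only [Sigma.mk.injEq, Prod.mk.injEq, heq_eq_eq] at hcd
        obtain ⟨⟨h1, h2⟩, h3, h4⟩ := hcd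
        ext
        · rw [← Nat.div_add_mod c.1 (2 ^ N0), ← Nat.div_add_mod d.1 (2 ^ N0), h1, h3]
        · rw [← Nat.div_add_mod c.2 (2 ^ r), ← Nat.div_add_mod d.2 (2 ^ r), h2, h4]
    rw [Finset.card_sigma] at hc
    have hc' : ((∑ a ∈ (Finset.range (2 ^ r)) ×ˢ (Finset.range (2 ^ r)), (B a.1).card : ℕ) : ℝ) ≤
        δ / 2 * 4 ^ N := by
      push_cast
      refine (Finset.sum_le_card_nsmul _ _ _ fun a _ => hBc a.1).trans (le_of_eq ?_)
      rw [Finset.card_product, Finset.card_range, nsmul_eq_mul, hNe, pow_add,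
        show (4:ℝ) = 2 * 2 by norm_num, mul_pow, mul_pow]
      push_cast; ring
    refine (Nat.cast_le.mpr hc).trans (hc'.trans ?_)
    gcongr; linarith
  · intro X hX Y hY hXY
    have hXY' : (X % 2 ^ N0, Y / 2 ^ r) ∉ B (X / 2 ^ N0) := by
      simpa [hX, hY] using hXY
    obtain ⟨σ, hσ, hk⟩ := hB (X / 2 ^ N0) (X % 2 ^ N0) (Nat.mod_lt _ (by positivity)) (Y / 2 ^ r)
      (by rw [Nat.div_lt_iff_lt_mul (by positivity), ← h2N]; exact hY) hXY'
    have cmp : ∀ k ≤ N0, |lineLev φ N X Y k - lineLev (fun p => φ (tr ⟨(X / 2 ^ N0 : ℕ) * 2 ^ N0, 0,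
        0⟩ p))
        N0 (X % 2 ^ N0) (Y / 2 ^ r) k| ≤ 2 * L := by
      intro k hk
      have hx : ((X / 2 ^ N0 : ℕ) : ℝ) * 2 ^ N0 + (X % 2 ^ N0 : ℕ) = X := by
        exact_mod_cast Nat.div_add_mod' X (2 ^ N0)
      have e2 : (2:ℝ) ^ N = 2 ^ N0 * 2 ^ r := by exact_mod_cast h2N
      have n1 : Near 1 ⟨X, (Y / 2 ^ r : ℕ) / 2 ^ N0, k⟩ ⟨X, Y / 2 ^ N, k⟩ := by
        refine near_of_bounds (a := 0) (by simp) (by simp) ?_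
        simp only [pow_zero, one_mul, zpow_neg, zpow_natCast]
        have hy : ((Y / 2 ^ r : ℕ) : ℝ) * 2 ^ r + (Y % 2 ^ r : ℕ) = Y := by
          exact_mod_cast Nat.div_add_mod' Y (2 ^ r)
        have hy2 : ((Y % 2 ^ r : ℕ) : ℝ) ≤ 2 ^ r := by
          exact_mod_cast (Nat.mod_lt Y (by positivity : 0 < 2 ^ r)).le
        have : (Y:ℝ) / 2 ^ N - (Y / 2 ^ r : ℕ) / 2 ^ N0 = (Y % 2 ^ r : ℕ) / (2 ^ N0 * 2 ^ r) := by
          rw [e2, ← hy]; field_simp; ring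
        rw [this, abs_of_nonneg (by positivity)]
        rw [div_le_iff₀ (by positivity), ← div_eq_inv_mul, le_div_iff₀ (by positivity)]
        have : (2:ℝ) ^ k ≤ 2 ^ N0 := pow_le_pow_right₀ (by norm_num) hk
        calc ((Y % 2 ^ r : ℕ) : ℝ) * 2 ^ k ≤ 2 ^ r * 2 ^ N0 := by gcongr
          _ = _ := mul_comm _ _
      have := h.k_real n1
      simp only [lineLev, tr, zpow_zero, one_mul, neg_zero, zero_add, hx]
      push_cast at this ⊢; linarith
    refine ⟨σ, hσ, fun k hkN => ?_⟩
    have hs : |σ| = 1 := by rcases hσ with rfl | rfl <;> simp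
    obtain ⟨j, hj⟩ : ∃ j, j = min k N0 := ⟨_, rfl⟩
    have hjN : j ≤ N0 := by omega
    have hjk : j ≤ k := by omega
    have a1 := cmp j hjN
    have a2 := cmp 0 (Nat.zero_le _)
    have a3 := hk j hjN
    have a4 := h.lineLev_lip N X Y hjk
    have a5 : ((k - j : ℕ) : ℝ) ≤ R := by exact_mod_cast (by omega : k - j ≤ R)
    have a6 : |σ * k - σ * j| ≤ R := by
      rw [← mul_sub, abs_mul, hs, one_mul, ← Nat.cast_sub hjk, abs_of_nonneg (by positivity)]
      exact a5
    have a7 : (N0 : ℝ) ≤ N := by exact_mod_cast (by omega : N0 ≤ N)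
    have a8 : δ / 2 * N0 ≤ δ / 2 * N := by gcongr
    have a9 : (L:ℝ) * ((k - j : ℕ) + 1) ≤ L * (R + 1) := by gcongr
    have a10 : (V:ℝ) * (δ / 2) ≤ N * (δ / 2) := by gcongr
    rw [abs_le] at a1 a2 a3 a4 a6 ⊢
    constructor <;> linarith

namespace CE
variable {L : ℕ} {φ φ' : Pt → Pt}

/-- Two vertical segments joined at the top: horizontal displacement of the image. -/
lemma arch_y (h : CE L φ φ') {x x' y : ℝ} {N : ℕ} (m : ℤ) (hx : |x' - x| ≤ 2 ^ N)
    (h1 : ∀ k : ℕ, k ≤ N → m ≤ (φ ⟨x, y, k⟩).k) (h2 : ∀ k : ℕ, k ≤ N → m ≤ (φ ⟨x', y, k⟩).k) :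
    |(φ ⟨x', y, 0⟩).y - (φ ⟨x, y, 0⟩).y| ≤ (2 * N + 1) * (2:ℝ) ^ (2 * L - m : ℤ) := by
  have n1 : Near 1 ⟨x, y, N⟩ ⟨x', y, N⟩ :=
    near_of_bounds (a := 0) (by simp) (by simpa using hx) (by simp)
  have n2 := (h.fwd _ _ _ n1).y_le
  have n3 : (2:ℝ) ^ (((L * (1 + 1) : ℕ) : ℤ) - (φ ⟨x, y, N⟩).k) ≤ (2:ℝ) ^ (2 * L - m : ℤ) := by
    apply zpow_two_mono; have := h1 N le_rfl; push_cast; linarith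
  have n4 := h.vert_y x y 0 m N (by simpa using fun i hi => h1 i (le_of_lt hi))
  have n5 := h.vert_y x' y 0 m N (by simpa using fun i hi => h2 i (le_of_lt hi))
  simp only [zero_add] at n4 n5
  rw [abs_le] at n2 n4 n5 ⊢
  constructor <;> linarith

lemma arch_x (h : CE L φ φ') {x x' y : ℝ} {N : ℕ} (M : ℤ) (hx : |x' - x| ≤ 2 ^ N)
    (h1 : ∀ k : ℕ, k ≤ N → (φ ⟨x, y, k⟩).k ≤ M) (h2 : ∀ k : ℕ, k ≤ N → (φ ⟨x', y, k⟩).k ≤ M) :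
    |(φ ⟨x', y, 0⟩).x - (φ ⟨x, y, 0⟩).x| ≤ (2 * N + 1) * (2:ℝ) ^ (2 * L + M : ℤ) := by
  have := h.post_sw.arch_y (-M) hx (y := y) (by simpa using h1) (by simpa using h2)
  simpa [sw] using this

end CE

lemma near_unit_x {x x' : ℝ} (y : ℝ) {N : ℕ} (hx : |x' - x| ≤ 2 ^ N) :
    Near 1 ⟨x, y, N⟩ ⟨x', y, N⟩ :=
  near_of_bounds (a := 0) (by simp) (by simpa using hx) (by simp)

namespace CE
variable {L : ℕ} {φ φ' : Pt → Pt}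

lemma near_one_k (h : CE L φ φ') {p q : Pt} (hn : Near 1 p q) : |(φ q).k - (φ p).k| ≤ 2 * L := by
  have := (h.fwd 1 p q hn).k_le
  push_cast at this; linarith

/-- If over `x` both an upward line and a downward line start, and likewise the two corresponding
lines over `x'` are straight, then `x` and `x'` are close. -/
lemma mix (h : CE L φ φ') {x x' y y' : ℝ} {N E a : ℕ} {s s' : ℤ} (hx : |x' - x| ≤ 2 ^ N)
    (hy : |y' - y| ≤ 1) (hN : 4 * E + 8 * L < N) (ha : (2 * N + 3) * (2:ℝ) ^ (6 * L + 3 * E) ≤ 2 ^ a)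
    (hs : s = 1 ∨ s = -1) (hs' : s' = 1 ∨ s' = -1)
    (g1 : ∀ k : ℕ, k ≤ N → |(φ ⟨x, y, k⟩).k - (φ ⟨x, y, 0⟩).k - k| ≤ E)
    (g2 : ∀ k : ℕ, k ≤ N → |(φ ⟨x, y', k⟩).k - (φ ⟨x, y', 0⟩).k + k| ≤ E)
    (g3 : ∀ k : ℕ, k ≤ N → |(φ ⟨x', y, k⟩).k - (φ ⟨x', y, 0⟩).k - s * k| ≤ E)
    (g4 : ∀ k : ℕ, k ≤ N → |(φ ⟨x', y', k⟩).k - (φ ⟨x', y', 0⟩).k - s' * k| ≤ E) :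
    |x' - x| ≤ 2 ^ (4 * L * (a + 2)) := by
  have c1 := h.near_one_k (near_unit_y x hy)
  have c2 := h.near_one_k (near_unit_y x' hy)
  have c3 := h.near_one_k (near_unit_x y hx)
  have c4 := h.near_one_k (near_unit_x y' hx)
  have d1 := (h.fwd _ _ _ (near_unit_y x hy)).x_le
  have d2 := (h.fwd _ _ _ (near_unit_y x' hy)).x_le
  obtain ⟨β, hβ⟩ : ∃ β, β = (φ ⟨x, y, 0⟩).k := ⟨_, rfl⟩
  have hs3 : s = 1 ∧ s' = -1 := by
    have := g1 N le_rfl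
    have := g2 N le_rfl
    have := g3 N le_rfl
    have := g4 N le_rfl
    rcases hs with rfl | rfl <;> rcases hs' with rfl | rfl <;>
      first
      | exact ⟨rfl, rfl⟩
      | (exfalso; simp only [abs_le] at *; omega)
  obtain ⟨rfl, rfl⟩ := hs3
  have e1 := g1 N le_rfl
  have e2 := g2 N le_rfl
  have e3 := g3 N le_rfl
  have e4 := g4 N le_rfl
  have e30 : |(φ ⟨x', y, 0⟩).k - β| ≤ 2 * E + 2 * L := by
    rw [abs_le] at *; omega
  have e40 : (φ ⟨x', y', 0⟩).k ≤ β + 2 * E + 4 * L := by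
    rw [abs_le] at *; omega
  have e20 : (φ ⟨x, y', 0⟩).k ≤ β + 2 * L := by
    rw [abs_le] at *; omega
  have hyb := h.arch_y (y := y) (β - 3 * E - 4 * L) hx
    (fun k hk => by have := g1 k hk; rw [abs_le] at this; omega)
    (fun k hk => by have := g3 k hk; rw [abs_le] at this e30; omega)
  have hxb := h.arch_x (y := y') (β + 3 * E + 4 * L) hx
    (fun k hk => by have := g2 k hk; rw [abs_le] at this; omega)
    (fun k hk => by have := g4 k hk; rw [abs_le] at this; omega)
  have hd1 : (2:ℝ) ^ (((L * (1 + 1) : ℕ) : ℤ) + (φ ⟨x, y, 0⟩).k) ≤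
      (2:ℝ) ^ (2 * L + (β + 3 * E + 4 * L) : ℤ) := by
    apply zpow_two_mono; push_cast; omega
  have hd2 : (2:ℝ) ^ (((L * (1 + 1) : ℕ) : ℤ) + (φ ⟨x', y, 0⟩).k) ≤
      (2:ℝ) ^ (2 * L + (β + 3 * E + 4 * L) : ℤ) := by
    apply zpow_two_mono; push_cast; rw [abs_le] at e30; omega
  have k1 : (2:ℝ) ^ (2 * L + (β + 3 * E + 4 * L) : ℤ) = (2:ℝ) ^ (6 * L + 3 * E) * (2:ℝ) ^ β := by
    rw [← zpow_natCast, ← zpow_two_add]; congr 1; push_cast; ring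
  have k2 : (2:ℝ) ^ (2 * L - (β - 3 * E - 4 * L) : ℤ) = (2:ℝ) ^ (6 * L + 3 * E) * (2:ℝ) ^ (-β) := by
    rw [← zpow_natCast, ← zpow_two_add]; congr 1; push_cast; ring
  rw [k1] at hxb hd1 hd2
  rw [k2] at hyb
  have haE : 6 * L + 3 * E ≤ a := by
    have : (2:ℝ) ^ (6 * L + 3 * E) ≤ 2 ^ a := by
      refine le_trans ?_ ha
      have : (0:ℝ) < (2:ℝ) ^ (6 * L + 3 * E) := by positivity
      have hN0 : (0:ℝ) ≤ N := by positivity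
      nlinarith
    exact (pow_le_pow_iff_right₀ (by norm_num : (1:ℝ) < 2)).mp this
  have hA : (2 * N + 3) * ((2:ℝ) ^ (6 * L + 3 * E) * (2:ℝ) ^ β) ≤ 2 ^ a * (2:ℝ) ^ β := by
    rw [← mul_assoc]; gcongr
  have hB : (2 * N + 3) * ((2:ℝ) ^ (6 * L + 3 * E) * (2:ℝ) ^ (-β)) ≤ 2 ^ a * (2:ℝ) ^ (-β) := by
    rw [← mul_assoc]; gcongr
  have p1 : (0:ℝ) < (2:ℝ) ^ (6 * L + 3 * E) * (2:ℝ) ^ (-β) := by positivity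
  have near : Near (a + 1) (φ ⟨x, y, 0⟩) (φ ⟨x', y, 0⟩) := by
    refine near_of_bounds ?_ ?_ ?_
    · rw [← hβ]; refine e30.trans ?_; omega
    · rw [← hβ]
      refine le_trans ?_ hA
      rw [abs_le] at d1 d2 hxb ⊢
      constructor <;> linarith
    · rw [← hβ]
      refine le_trans hyb (le_trans ?_ hB)
      linarith
  have := (h.back near).x_le
  rwa [add_zero, zpow_natCast, show a + 1 + 1 = a + 2 from rfl] at this

end CE

/-- The image of the vertical segment over `(x, y)` of height `N` is, up to `E`, straight of
slope `s`. -/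
def Straight (φ : Pt → Pt) (E N : ℕ) (x y : ℝ) (s : ℤ) : Prop :=
  ∀ k : ℕ, k ≤ N → |(φ ⟨x, y, k⟩).k - (φ ⟨x, y, 0⟩).k - s * k| ≤ E

lemma flip_line (φ : Pt → Pt) {N k : ℕ} (hk : k ≤ N) (X Y : ℕ) :
    φ (tr ⟨0, 0, N⟩ (sw ⟨Y, X / 2 ^ N, k⟩)) = φ ⟨X, Y / 2 ^ N, (N - k : ℕ)⟩ := by
  congr 1
  ext
  · simp only [tr, sw, zpow_natCast, zero_add]; field_simp
  · simp only [tr, sw, zpow_natCast, zero_add, zpow_neg]; field_simp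
  · simp only [tr, sw]; omega

lemma Straight.flip {φ : Pt → Pt} {E N X Y : ℕ} {s : ℤ} (h : Straight φ E N X (Y / 2 ^ N) s) :
    Straight (fun p => φ (tr ⟨0, 0, N⟩ (sw p))) (2 * E) N Y (X / 2 ^ N) (-s) := by
  intro k hk
  have h1 := h (N - k) (Nat.sub_le _ _)
  have h2 := h N le_rfl
  have h3 := flip_line φ hk X Y
  have h4 := flip_line φ (Nat.zero_le N) X Y
  simp only [Nat.cast_zero, Nat.sub_zero] at h4
  simp only [h3, h4]
  rw [Nat.cast_sub hk] at h1 ⊢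
  rw [abs_le] at *
  rw [mul_sub] at h1
  push_cast
  constructor <;> linarith

lemma Straight.mono {φ : Pt → Pt} {E E' N : ℕ} {x y : ℝ} {s : ℤ} (h : Straight φ E N x y s)
    (hE : E ≤ E') : Straight φ E' N x y s :=
  fun k hk => (h k hk).trans (by exact_mod_cast hE)

namespace CE
variable {L : ℕ} {φ φ' : Pt → Pt}

lemma mix_straight (h : CE L φ φ') {x x' y y' : ℝ} {N E a : ℕ} {s1 s2 s3 s4 : ℤ}
    (hx : |x' - x| ≤ 2 ^ N)
    (hy : |y' - y| ≤ 1) (hN : 4 * E + 8 * L < N) (ha : (2 * N + 3) * (2:ℝ) ^ (6 * L + 3 * E) ≤ 2 ^ a)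
    (hs1 : s1 = 1 ∨ s1 = -1) (hs2 : s2 = 1 ∨ s2 = -1) (hs : s1 ≠ s2)
    (hs3 : s3 = 1 ∨ s3 = -1) (hs4 : s4 = 1 ∨ s4 = -1)
    (g1 : Straight φ E N x y s1) (g2 : Straight φ E N x y' s2)
    (g3 : Straight φ E N x' y s3) (g4 : Straight φ E N x' y' s4) :
    |x' - x| ≤ 2 ^ (4 * L * (a + 2)) := by
  rcases hs1 with rfl | rfl <;> rcases hs2 with rfl | rfl
  · exact absurd rfl hs
  · exact h.mix hx hy hN ha hs3 hs4 (by simpa [Straight] using g1) (by simpa [Straight] using g2) g3 g4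
  · exact h.mix hx (by rwa [abs_sub_comm]) hN ha hs4 hs3 (by simpa [Straight] using g2)
      (by simpa [Straight] using g1) g4 g3
  · exact absurd rfl hs

end CE

lemma abs_natCast_sub_le {N X X' : ℕ} (hX : X < 2 ^ N) (hX' : X' < 2 ^ N) :
    |(X' : ℝ) - X| ≤ 2 ^ N := by
  have h1 : (X:ℝ) ≤ 2 ^ N := by exact_mod_cast hX.le
  have h2 : (X':ℝ) ≤ 2 ^ N := by exact_mod_cast hX'.le
  rw [abs_le]; constructor <;> linarith [(Nat.cast_nonneg X : (0:ℝ) ≤ X),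
      (Nat.cast_nonneg X' : (0:ℝ) ≤ X')]

lemma abs_dyadic_sub_le {N Y Y' : ℕ} (hY : Y < 2 ^ N) (hY' : Y' < 2 ^ N) :
    |(Y' : ℝ) / 2 ^ N - Y / 2 ^ N| ≤ 1 := by
  rw [← sub_div, abs_div, abs_of_pos (by positivity : (0:ℝ) < 2 ^ N), div_le_one (by positivity)]
  exact abs_natCast_sub_le hY hY'

lemma abs_sub_gt_of_far {w X X' : ℕ} (h : X' + w < X ∨ X + w < X') : (w:ℝ) < |(X':ℝ) - X| := by
  rcases h with h | h
  · have : (X':ℝ) + w < X := by exact_mod_cast h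
    rw [abs_sub_comm]; exact lt_of_lt_of_le (by linarith) (le_abs_self _)
  · have : (X:ℝ) + w < X' := by exact_mod_cast h
    exact lt_of_lt_of_le (by linarith) (le_abs_self _)

lemma exists_box_constants (L : ℕ) {δ : ℝ} (hδ : 0 < δ) : ∃ ε > 0, 17 * ε ≤ δ ∧ 64 * ε ≤ 1 ∧
    ∃ N1 : ℕ, ∀ N ≥ N1, ∃ E : ℕ, ε * N ≤ E ∧ ((3 * E + 6 * L : ℕ) : ℝ) ≤ δ * N ∧
      4 * (2 * E) + 8 * L < N ∧
      (2 * N + 3) * (2:ℝ) ^ (6 * L + 3 * (2 * E)) ≤ 2 ^ (6 * L + 8 * E) ∧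
      8 * (2 * 2 ^ (4 * L * (6 * L + 8 * E + 2)) + 1) ≤ 2 ^ N := by
  obtain ⟨ε, hε, he1, he2⟩ : ∃ ε > 0, 17 * ε ≤ δ ∧ ε * (64 * (L + 1)) ≤ 1 := by
    refine ⟨min (δ / 17) (1 / (64 * (L + 1))), by positivity, ?_, ?_⟩
    · have := min_le_left (δ / 17) (1 / (64 * (L + 1) : ℝ)); linarith
    · rw [← le_div_iff₀ (by positivity)]; exact min_le_right _ _
  have hL0 : (0:ℝ) ≤ L := Nat.cast_nonneg L
  have heL : 0 ≤ ε * L := by positivity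
  refine ⟨ε, hε, he1, by linarith, ?_⟩
  obtain ⟨V1, hV1⟩ := exists_nat_ge ((3 + 6 * L) / (δ / 2))
  obtain ⟨V2, hV2⟩ := exists_nat_ge (4 / ε ^ 2)
  rw [div_le_iff₀ (by positivity)] at hV1 hV2
  refine ⟨V1 + V2 + 4 * (4 * L * (6 * L + 10) + 8 * L + 30), fun N hN => ⟨⌈ε * N⌉₊, Nat.le_ceil _,
      ?_⟩⟩
  obtain ⟨E, hE⟩ : ∃ E, E = ⌈ε * N⌉₊ := ⟨_, rfl⟩
  rw [← hE]
  have hE1 : ε * N ≤ E := hE ▸ Nat.le_ceil _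
  have hE2 : (E:ℝ) ≤ ε * N + 1 := by
    rw [hE]; exact (Nat.ceil_lt_add_one (by positivity)).le
  have hNV1 : (V1:ℝ) ≤ N := by exact_mod_cast (by omega : V1 ≤ N)
  have hNV2 : (V2:ℝ) ≤ N := by exact_mod_cast (by omega : V2 ≤ N)
  have hN3 : 4 * (4 * L * (6 * L + 10) + 8 * L + 30) ≤ (N:ℝ) := by
    exact_mod_cast (by omega : 4 * (4 * L * (6 * L + 10) + 8 * L + 30) ≤ N)
  have hN0 : (0:ℝ) ≤ N := Nat.cast_nonneg N
  have hLE : (L + 1) * (E:ℝ) ≤ N / 64 + (L + 1) := by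
    have : (L + 1) * (E:ℝ) ≤ (L + 1) * (ε * N + 1) := by gcongr
    have h2 : (ε * (64 * (L + 1))) * N ≤ 1 * N := by gcongr
    linarith
  have hE0 : (0:ℝ) ≤ E := Nat.cast_nonneg E
  have hLE0 : (0:ℝ) ≤ L * E := by positivity
  have hLL : (0:ℝ) ≤ L * L := by positivity
  refine ⟨?_, ?_, ?_, ?_⟩
  · push_cast
    have h1 : V1 * (δ / 2) ≤ N * (δ / 2) := by gcongr
    have h2 : 17 * ε * N ≤ δ * N := by gcongr
    linarith
  · have : ((4 * (2 * E) + 8 * L : ℕ) : ℝ) < N := by push_cast; linarith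
    exact_mod_cast this
  · rw [show 6 * L + 8 * E = 2 * E + (6 * L + 3 * (2 * E)) by ring, pow_add _ (2 * E)]
    gcongr
    have h1 : (E:ℝ) + 1 ≤ 2 ^ E := by exact_mod_cast Nat.lt_two_pow_self
    have h2 : ((E:ℝ) + 1) ^ 2 ≤ (2 ^ E) ^ 2 := by gcongr
    rw [← pow_mul, mul_comm E 2] at h2
    refine le_trans ?_ h2
    have h3 : (ε * N) ^ 2 ≤ (E:ℝ) ^ 2 := by gcongr
    have h4 : V2 * ε ^ 2 * N ≤ N * ε ^ 2 * N := by gcongr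
    have h5 : 4 * (N:ℝ) ≤ V2 * ε ^ 2 * N := by gcongr
    linarith
  · have h1 : 5 + 4 * L * (6 * L + 8 * E + 2) ≤ N := by
      have : ((5 + 4 * L * (6 * L + 8 * E + 2) : ℕ) : ℝ) ≤ N := by push_cast; linarith
      exact_mod_cast this
    have h2 : 2 ^ 5 * 2 ^ (4 * L * (6 * L + 8 * E + 2)) ≤ 2 ^ N := by
      rw [← pow_add]; exact Nat.pow_le_pow_right (by norm_num) h1
    have h3 : 1 ≤ 2 ^ (4 * L * (6 * L + 8 * E + 2)) := Nat.one_le_two_pow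
    omega

/-- On a large box a coarse equivalence is, up to sign, close to preserving levels, apart from
a small proportion of the vertical lines. -/
theorem box_linear (L : ℕ) (δ : ℝ) (hδ : 0 < δ) : ∃ N1 : ℕ, ∀ N ≥ N1, ∃ E : ℕ, (E:ℝ) ≤ δ * N ∧
    ∀ φ φ', CE L φ φ' → ∃ (s h : ℤ) (B : Finset (ℕ × ℕ)), (s = 1 ∨ s = -1) ∧
      (B.card : ℝ) ≤ δ * 4 ^ N ∧ ∀ X < 2 ^ N, ∀ Y < 2 ^ N, (X, Y) ∉ B →
        ∀ k : ℕ, k ≤ N → |(φ ⟨X, Y / 2 ^ N, k⟩).k - h - s * k| ≤ E := by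
  obtain ⟨ε, hε, he1, he2, N1, hN1⟩ := exists_box_constants L hδ
  obtain ⟨N2, hN2⟩ := good_lines_all L ε hε
  refine ⟨N1 + N2, fun N hN => ?_⟩
  obtain ⟨E, hE1, hE2, hE3, ha, hw⟩ := hN1 N (by omega)
  refine ⟨3 * E + 6 * L, hE2, fun φ φ' h => ?_⟩
  obtain ⟨B, hBc, hB⟩ := hN2 N (by omega) φ φ' h
  have hB2 : ∀ X Y : ℕ, ∃ s : ℤ, (s = 1 ∨ s = -1) ∧ (X < 2 ^ N → Y < 2 ^ N → (X, Y) ∉ B →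
      Straight φ E N X (Y / 2 ^ N) s) := by
    intro X Y
    by_cases hc : X < 2 ^ N ∧ Y < 2 ^ N ∧ (X, Y) ∉ B
    · obtain ⟨σ, hσ, hk⟩ := hB X hc.1 Y hc.2.1 hc.2.2
      obtain ⟨s, hs, rfl⟩ : ∃ s : ℤ, (s = 1 ∨ s = -1) ∧ (s:ℝ) = σ := by
        rcases hσ with rfl | rfl
        · exact ⟨1, by simp, by simp⟩
        · exact ⟨-1, by simp, by simp⟩
      refine ⟨s, hs, fun _ _ _ k hkN => ?_⟩
      have := (hk k hkN).trans hE1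
      simp only [lineLev, Nat.cast_zero] at this
      exact_mod_cast this
    · exact ⟨1, by simp, fun a b c => absurd ⟨a, b, c⟩ hc⟩
  choose σ hσ1 hσ using hB2
  obtain ⟨a, haa⟩ : ∃ a, a = 6 * L + 8 * E := ⟨_, rfl⟩
  rw [← haa] at ha hw
  have h64 : 64 * B.card ≤ 2 ^ N * 2 ^ N := by
    have : 64 * (B.card : ℝ) ≤ 4 ^ N := by
      have : 64 * ε * 4 ^ N ≤ 1 * (4:ℝ) ^ N := by gcongr
      linarith
    have : (64 * (B.card : ℝ)) ≤ 2 ^ N * 2 ^ N := by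
      rwa [← mul_pow, show (2:ℝ) * 2 = 4 by norm_num]
    exact_mod_cast this
  obtain ⟨s, B', hB'c, ⟨X0, hX0, Y0, hY0, hXY0⟩, hB'⟩ := sign_coherent (n := 2 ^ N)
    (w := 2 ^ (4 * L * (a + 2))) (by positivity) B (fun X Y => (σ X Y : ℝ)) h64 hw (by
      intro X hX X' hX' Y hY Y' hY' h1 h2 h3 h4 hf
      by_contra hne
      have := h.mix_straight (E := 2 * E) (abs_natCast_sub_le hX hX') (abs_dyadic_sub_le hY hY')
        hE3 ha (hσ1 X Y) (hσ1 X Y') (fun hh => hne (by rw [hh])) (hσ1 X' Y) (hσ1 X' Y')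
        ((hσ X Y hX hY h1).mono (by omega)) ((hσ X Y' hX hY' h2).mono (by omega))
        ((hσ X' Y hX' hY h3).mono (by omega)) ((hσ X' Y' hX' hY' h4).mono (by omega))
      have h5 := abs_sub_gt_of_far hf
      push_cast at h5; linarith) (by
      intro X hX X' hX' Y hY Y' hY' h1 h2 h3 h4 hf
      by_contra hne
      have neg1 : ∀ s : ℤ, s = 1 ∨ s = -1 → -s = 1 ∨ -s = -1 := by
        rintro s (rfl | rfl) <;> simp
      have := (h.pre_tr ⟨0, 0, N⟩).pre_sw.mix_straight (E := 2 * E) (abs_natCast_sub_le hY hY')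
        (abs_dyadic_sub_le hX hX')
        hE3 ha (neg1 _ (hσ1 X Y)) (neg1 _ (hσ1 X' Y)) (fun hh => hne (by rw [neg_inj.mp hh]))
        (neg1 _ (hσ1 X Y')) (neg1 _ (hσ1 X' Y'))
        (hσ X Y hX hY h1).flip (hσ X' Y hX' hY h3).flip
        (hσ X Y' hX hY' h2).flip (hσ X' Y' hX' hY' h4).flip
      have h5 := abs_sub_gt_of_far hf
      push_cast at h5; linarith)
  obtain ⟨-, hs0, hlink⟩ := hB' X0 hX0 Y0 hY0 hXY0
  have hsig : ∀ X < 2 ^ N, ∀ Y < 2 ^ N, (X, Y) ∉ B' → Straight φ E N X (Y / 2 ^ N) (σ X0 Y0) := by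
    intro X hX Y hY hXY
    obtain ⟨h1, h2, -⟩ := hB' X hX Y hY hXY
    have : σ X Y = σ X0 Y0 := by exact_mod_cast h2.trans hs0.symm
    rw [← this]; exact hσ X Y hX hY h1
  refine ⟨σ X0 Y0, (φ ⟨X0, Y0 / 2 ^ N, 0⟩).k, B', hσ1 X0 Y0, ?_, ?_⟩
  · have : (B'.card : ℝ) ≤ 17 * B.card := by exact_mod_cast hB'c
    have h2 : 17 * ε * 4 ^ N ≤ δ * (4:ℝ) ^ N := by gcongr
    linarith
  · intro X hX Y hY hXY k hk
    obtain ⟨Y2, hY2, l1, l2⟩ := hlink X hX Y hY hXY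
    have a1 := hsig X hX Y hY hXY k hk
    have a2 := hsig X0 hX0 Y2 hY2 l1 N le_rfl
    have a3 := hsig X hX Y2 hY2 l2 N le_rfl
    have b1 := h.near_one_k (CE.near_unit_y X (abs_dyadic_sub_le hY hY2))
    have b2 := h.near_one_k (near_unit_x (Y2 / 2 ^ N) (abs_natCast_sub_le hX hX0))
    have b3 := h.near_one_k (CE.near_unit_y X0 (abs_dyadic_sub_le hY0 hY2))
    rw [abs_le] at a1 a2 a3 b1 b2 b3 ⊢
    push_cast
    constructor <;> linarith

namespace CE
variable {L : ℕ} {φ φ' : Pt → Pt}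

lemma vert_nat_y (h : CE L φ φ') {x y : ℝ} {i j S : ℕ} (m : ℤ) (hij : i ≤ j) (hj : j ≤ S)
    (hm : ∀ k : ℕ, i ≤ k → k < j → m ≤ (φ ⟨x, y, k⟩).k) :
    |(φ ⟨x, y, j⟩).y - (φ ⟨x, y, i⟩).y| ≤ S * (2:ℝ) ^ (2 * L - m : ℤ) := by
  have := h.vert_y x y i m (j - i) (fun n hn => by
    have := hm (i + n) (by omega) (by omega); push_cast at this; exact this)
  rw [show (i:ℤ) + (j - i : ℕ) = j by omega] at this
  refine this.trans ?_
  gcongr; omega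

lemma vert_nat_x (h : CE L φ φ') {x y : ℝ} {i j S : ℕ} (M : ℤ) (hij : i ≤ j) (hj : j ≤ S)
    (hm : ∀ k : ℕ, i ≤ k → k < j → (φ ⟨x, y, k⟩).k ≤ M) :
    |(φ ⟨x, y, j⟩).x - (φ ⟨x, y, i⟩).x| ≤ S * (2:ℝ) ^ (2 * L + M : ℤ) := by
  have := h.post_sw.vert_nat_y (-M) hij hj (x := x) (y := y) (by simpa using hm)
  simpa [sw] using this

lemma near_one_y (h : CE L φ φ') {p q : Pt} (hn : Near 1 p q) {m : ℤ} (hm : m ≤ (φ p).k) :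
    |(φ q).y - (φ p).y| ≤ (2:ℝ) ^ (2 * L - m : ℤ) := by
  refine (h.fwd 1 p q hn).y_le.trans (zpow_two_mono ?_)
  push_cast; linarith

lemma near_one_x (h : CE L φ φ') {p q : Pt} (hn : Near 1 p q) {M : ℤ} (hM : (φ p).k ≤ M) :
    |(φ q).x - (φ p).x| ≤ (2:ℝ) ^ (2 * L + M : ℤ) := by
  refine (h.fwd 1 p q hn).x_le.trans (zpow_two_mono ?_)
  push_cast; linarith

/-- Two straight upward lines over distinct `y, y'` prevent the lines over the origin from
staying far above the base of the box. -/
lemma leaf (h : CE L φ φ') {x y y' : ℝ} {S E a z : ℕ} {b : ℤ} (hx : |x| ≤ 2 ^ S)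
    (hy : |y' - y| ≤ 1) (hyy : 1 / 4 ≤ |y' - y|) (hz : z = 4 * L * (a + 2) + 3) (hzS : z ≤ S)
    (ha : (4 * S + 3) * (2:ℝ) ^ (2 * L + 2 * E) ≤ 2 ^ a)
    (g1 : ∀ k : ℕ, k ≤ S → |(φ ⟨x, y, k⟩).k - b - k| ≤ E)
    (g2 : ∀ k : ℕ, k ≤ S → |(φ ⟨x, y', k⟩).k - b - k| ≤ E) :
    ∃ k : ℕ, k ≤ S ∧ ((φ ⟨0, y, k⟩).k < b + z ∨ (φ ⟨0, y', k⟩).k < b + z) := by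
  by_contra! hcon
  obtain ⟨m, hm⟩ : ∃ m : ℤ, m = b + z - E := ⟨_, rfl⟩
  have lo1 : ∀ k : ℕ, z ≤ k → k ≤ S → m ≤ (φ ⟨x, y, k⟩).k := fun k h1 h2 => by
    have := g1 k h2; rw [abs_le] at this; omega
  have lo2 : ∀ k : ℕ, z ≤ k → k ≤ S → m ≤ (φ ⟨x, y', k⟩).k := fun k h1 h2 => by
    have := g2 k h2; rw [abs_le] at this; omega
  have lo3 : ∀ k : ℕ, k ≤ S → m ≤ (φ ⟨0, y, k⟩).k := fun k h1 => by have := (hcon k h1).1; omega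
  have lo4 : ∀ k : ℕ, k ≤ S → m ≤ (φ ⟨0, y', k⟩).k := fun k h1 => by have := (hcon k h1).2; omega
  have up1 : ∀ k : ℕ, k ≤ z → (φ ⟨x, y, k⟩).k ≤ b + z + E := fun k h1 => by
    have := g1 k (by omega); rw [abs_le] at this; omega
  have up2 : ∀ k : ℕ, k ≤ z → (φ ⟨x, y', k⟩).k ≤ b + z + E := fun k h1 => by
    have := g2 k (by omega); rw [abs_le] at this; omega
  have hx' : |x - 0| ≤ 2 ^ S := by simpa using hx
  have y1 := h.vert_nat_y m hzS le_rfl fun k h1 h2 => lo1 k h1 h2.le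
  have y2 := h.near_one_y (near_unit_x y hx') (lo3 S le_rfl)
  have y3 := h.vert_nat_y m (Nat.zero_le S) le_rfl fun k _ h2 => lo3 k h2.le
  have y4 := h.near_one_y (near_unit_y 0 hy) (by simpa using lo3 0 (Nat.zero_le _))
  have y5 := h.vert_nat_y m (Nat.zero_le S) le_rfl fun k _ h2 => lo4 k h2.le
  have y6 := h.near_one_y (near_unit_x y' hx') (lo4 S le_rfl)
  have y7 := h.vert_nat_y m hzS le_rfl fun k h1 h2 => lo2 k h1 h2.le
  have x1 := h.vert_nat_x (b + z + E) (Nat.zero_le z) hzS fun k _ h2 => up1 k h2.le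
  have x2 := h.near_one_x (near_unit_y x hy) (by simpa using up1 0 (Nat.zero_le _))
  have x3 := h.vert_nat_x (b + z + E) (Nat.zero_le z) hzS fun k _ h2 => up2 k h2.le
  have b1 := g1 z hzS
  have b2 := g2 z hzS
  obtain ⟨f, hf⟩ : ∃ f, f = (φ ⟨x, y, z⟩).k := ⟨_, rfl⟩
  rw [← hf] at b1
  rw [abs_le] at b1 b2
  simp only [Nat.cast_zero] at y3 y5 x1 x3
  have k1 : (2:ℝ) ^ (2 * L - m : ℤ) ≤ (2:ℝ) ^ (2 * L + 2 * E) * (2:ℝ) ^ (-f) := by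
    rw [← zpow_natCast, ← zpow_two_add]; apply zpow_two_mono; push_cast; omega
  have k2 : (2:ℝ) ^ (2 * L + (b + z + E) : ℤ) ≤ (2:ℝ) ^ (2 * L + 2 * E) * (2:ℝ) ^ f := by
    rw [← zpow_natCast, ← zpow_two_add]; apply zpow_two_mono; push_cast; omega
  have haE : 2 * L + 2 * E ≤ a := by
    have : (2:ℝ) ^ (2 * L + 2 * E) ≤ 2 ^ a := by
      refine le_trans ?_ ha
      have : (0:ℝ) < (2:ℝ) ^ (2 * L + 2 * E) := by positivity
      have hN0 : (0:ℝ) ≤ S := by positivity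
      nlinarith
    exact (pow_le_pow_iff_right₀ (by norm_num : (1:ℝ) < 2)).mp this
  obtain ⟨v, hv⟩ : ∃ v, v = (2:ℝ) ^ (2 * L - m : ℤ) := ⟨_, rfl⟩
  obtain ⟨w, hw⟩ : ∃ w, w = (2:ℝ) ^ (2 * L + (b + z + E) : ℤ) := ⟨_, rfl⟩
  have hv0 : 0 < v := by rw [hv]; positivity
  have hw0 : 0 < w := by rw [hw]; positivity
  rw [← hv] at y1 y2 y3 y4 y5 y6 y7 k1
  rw [← hw] at x1 x2 x3 k2
  have hA : (4 * S + 3) * w ≤ 2 ^ a * (2:ℝ) ^ f := by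
    calc (4 * S + 3) * w ≤ (4 * S + 3) * ((2:ℝ) ^ (2 * L + 2 * E) * (2:ℝ) ^ f) := by gcongr
      _ = (4 * S + 3) * (2:ℝ) ^ (2 * L + 2 * E) * (2:ℝ) ^ f := by ring
      _ ≤ _ := by gcongr
  have hB : (4 * S + 3) * v ≤ 2 ^ a * (2:ℝ) ^ (-f) := by
    calc (4 * S + 3) * v ≤ (4 * S + 3) * ((2:ℝ) ^ (2 * L + 2 * E) * (2:ℝ) ^ (-f)) := by gcongr
      _ = (4 * S + 3) * (2:ℝ) ^ (2 * L + 2 * E) * (2:ℝ) ^ (-f) := by ring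
      _ ≤ _ := by gcongr
  have hSw : 0 ≤ S * w := by positivity
  have near : Near (a + 1) (φ ⟨x, y, z⟩) (φ ⟨x, y', z⟩) := by
    refine near_of_bounds ?_ ?_ ?_
    · rw [← hf, abs_le]; constructor <;> omega
    · rw [← hf]
      refine le_trans ?_ hA
      rw [abs_le] at x1 x2 x3 ⊢
      constructor <;> linarith
    · rw [← hf]
      refine le_trans ?_ hB
      rw [abs_le] at y1 y2 y3 y4 y5 y6 y7 ⊢
      constructor <;> linarith
  have hc := (h.back near).y_le
  have hc2 : |y' - y| ≤ (2:ℝ) ^ (-3 : ℤ) := by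
    refine hc.trans (zpow_two_mono ?_)
    simp only [hz]; push_cast; linarith
  norm_num at hc2
  linarith

end CE

/-- Proportion `1 - δ` of the vertical lines of the box of height `N` at the origin have straight
images of slope `s` starting at level `b`, up to `δ N`. -/
def BoxData (φ : Pt → Pt) (δ : ℝ) (N : ℕ) (s b : ℤ) (B : Finset (ℕ × ℕ)) : Prop :=
  (B.card : ℝ) ≤ δ * 4 ^ N ∧ ∃ E : ℕ, (E : ℝ) ≤ δ * N ∧ ∀ X < 2 ^ N, ∀ Y < 2 ^ N, (X, Y) ∉ B →
    ∀ k : ℕ, k ≤ N → |(φ ⟨X, Y / 2 ^ N, k⟩).k - b - s * k| ≤ E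

lemma near_coarser_line {N N' k : ℕ} (hN : N ≤ N') (hk : k ≤ N) (x : ℝ) (Y : ℕ) :
    Near 1 ⟨x, (Y / 2 ^ (N' - N) : ℕ) / 2 ^ N, k⟩ ⟨x, Y / 2 ^ N', k⟩ := by
  obtain ⟨r, rfl⟩ := Nat.exists_eq_add_of_le hN
  rw [Nat.add_sub_cancel_left]
  refine near_of_bounds (a := 0) (by simp) (by simp) ?_
  simp only [pow_zero, one_mul, zpow_neg, zpow_natCast]
  have hy : ((Y / 2 ^ r : ℕ) : ℝ) * 2 ^ r + (Y % 2 ^ r : ℕ) = Y := by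
    exact_mod_cast Nat.div_add_mod' Y (2 ^ r)
  have hy2 : ((Y % 2 ^ r : ℕ) : ℝ) ≤ 2 ^ r := by
    exact_mod_cast (Nat.mod_lt Y (by positivity : 0 < 2 ^ r)).le
  have : (Y:ℝ) / 2 ^ (N + r) - (Y / 2 ^ r : ℕ) / 2 ^ N = (Y % 2 ^ r : ℕ) / (2 ^ N * 2 ^ r) := by
    rw [pow_add, ← hy]; field_simp; ring
  rw [this, abs_of_nonneg (by positivity)]
  rw [div_le_iff₀ (by positivity), ← div_eq_inv_mul, le_div_iff₀ (by positivity)]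
  have : (2:ℝ) ^ k ≤ 2 ^ N := pow_le_pow_right₀ (by norm_num) hk
  calc ((Y % 2 ^ r : ℕ) : ℝ) * 2 ^ k ≤ 2 ^ r * 2 ^ N := by gcongr
    _ = _ := mul_comm _ _

lemma BoxData.sign_succ {L : ℕ} {φ φ' : Pt → Pt} (h : CE L φ φ') {δ : ℝ} (hδ : δ ≤ 1 / 100) {N : ℕ}
    (hN : 4 * L + 10 ≤ N) {s s' b b' : ℤ} {B B' : Finset (ℕ × ℕ)} (hs : s = 1 ∨ s = -1)
    (hs' : s' = 1 ∨ s' = -1) (h1 : BoxData φ δ N s b B) (h2 : BoxData φ δ (N + 1) s' b' B') :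
    s = s' := by
  classical
  obtain ⟨hB, E, hE, hl⟩ := h1
  obtain ⟨hB', E', hE', hl'⟩ := h2
  obtain ⟨X, hX, Y, hY, hXY, hXY'⟩ : ∃ X < 2 ^ N, ∃ Y < 2 ^ (N + 1), (X, Y / 2) ∉ B ∧ (X,
      Y) ∉ B' := by
    by_contra! hcon
    have hsub : Finset.range (2 ^ N) ×ˢ Finset.range (2 ^ (N + 1)) ⊆
        (B.biUnion fun c => {(c.1, 2 * c.2), (c.1, 2 * c.2 + 1)}) ∪ B' := by
      rintro ⟨X, Y⟩ hc
      simp only [Finset.mem_product, Finset.mem_range] at hc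
      rw [Finset.mem_union]
      by_cases hb : (X, Y / 2) ∈ B
      · left
        refine Finset.mem_biUnion.mpr ⟨_, hb, ?_⟩
        simp only [Finset.mem_insert, Finset.mem_singleton, Prod.mk.injEq, true_and]
        omega
      · right; exact hcon X hc.1 Y hc.2 hb
    have hc := (Finset.card_le_card hsub).trans (Finset.card_union_le _ _)
    have hc2 : (B.biUnion fun c => {(c.1, 2 * c.2), (c.1, 2 * c.2 + 1)}).card ≤ B.card * 2 :=
      Finset.card_biUnion_le_card_mul _ _ _ fun c _ => Finset.card_le_two
    rw [Finset.card_product, Finset.card_range, Finset.card_range] at hc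
    have hc3 : (((2 ^ N * 2 ^ (N + 1) : ℕ)) : ℝ) ≤ ((B.card * 2 + B'.card : ℕ) : ℝ) := by
      exact_mod_cast hc.trans (by omega)
    have e : (((2 ^ N * 2 ^ (N + 1) : ℕ)) : ℝ) = 2 * 4 ^ N := by
      push_cast; rw [show (4:ℝ) = 2 * 2 by norm_num, mul_pow]; ring
    rw [e] at hc3
    push_cast at hc3
    rw [pow_succ] at hB'
    have h4 : (0:ℝ) < 4 ^ N := by positivity
    have : δ * (4:ℝ) ^ N ≤ 1 / 100 * 4 ^ N := by gcongr
    linarith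
  have l1 := fun k hk => hl X hX (Y / 2) (by omega) hXY k hk
  have l2 := fun k hk => hl' X (hX.trans (Nat.pow_lt_pow_right (by norm_num) (Nat.lt_succ_self N)))
    Y hY hXY' k hk
  have n0 := h.near_one_k (near_coarser_line (Nat.le_succ N) (Nat.zero_le N) (X:ℝ) Y)
  have n1 := h.near_one_k (near_coarser_line (Nat.le_succ N) le_rfl (X:ℝ) Y)
  have a0 := l1 0 (Nat.zero_le _)
  have a1 := l1 N le_rfl
  have c0 := l2 0 (Nat.zero_le _)
  have c1 := l2 N (Nat.le_succ N)
  simp only [Nat.succ_sub (le_refl N), Nat.sub_self, zero_add, pow_one,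
      Nat.succ_eq_add_one] at n0 n1
  have hN0 : (0:ℝ) ≤ N := Nat.cast_nonneg N
  have hE1 : 100 * E ≤ N := by
    have : δ * N ≤ 1 / 100 * N := by gcongr
    have : (100:ℝ) * E ≤ N := by linarith
    exact_mod_cast this
  have hE1' : 100 * E' ≤ N + 1 := by
    have : δ * (N + 1 : ℕ) ≤ 1 / 100 * (N + 1 : ℕ) := by gcongr
    have : (100:ℝ) * E' ≤ (N + 1 : ℕ) := by linarith
    exact_mod_cast this
  simp only [Nat.cast_zero, mul_zero, sub_zero] at a0 c0 n0
  rw [abs_le] at n0 n1 a0 a1 c0 c1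
  rcases hs with rfl | rfl <;> rcases hs' with rfl | rfl <;> first | rfl | (exfalso; omega)

theorem box_sign (L : ℕ) {δ : ℝ} (hδ : 0 < δ) (hδ1 : δ ≤ 1 / 100) : ∃ N1 : ℕ, ∀ φ φ', CE L φ φ' →
    ∃ s : ℤ, (s = 1 ∨ s = -1) ∧ ∀ N ≥ N1, ∃ b B, BoxData φ δ N s b B := by
  obtain ⟨N1, hN1⟩ := box_linear L δ hδ
  refine ⟨N1 + (4 * L + 10), fun φ φ' h => ?_⟩
  have key : ∀ N ≥ N1, ∃ s b B, (s = 1 ∨ s = -1) ∧ BoxData φ δ N s b B := fun N hN => by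
    obtain ⟨E, hE, hb⟩ := hN1 N hN
    obtain ⟨s, b, B, hs, hB, hl⟩ := hb φ φ' h
    exact ⟨s, b, B, hs, hB, E, hE, hl⟩
  obtain ⟨s, b, B, hs, hB⟩ := key (N1 + (4 * L + 10)) (by omega)
  refine ⟨s, hs, fun N hN => ?_⟩
  induction N, hN using Nat.le_induction with
  | base => exact ⟨b, B, hB⟩
  | succ N hN ih =>
    obtain ⟨b0, B0, h0⟩ := ih
    obtain ⟨s1, b1, B1, hs1, h1⟩ := key (N + 1) (by omega)
    rw [h0.sign_succ h hδ1 (by omega) hs hs1 h1]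
    exact ⟨b1, B1, h1⟩

lemma exists_avoiding {j m q : ℕ} (c : ℕ) (bad : ℕ → Finset ℕ) {η : ℝ}
    (hbad : ∀ i, 1 ≤ i → i ≤ j → ((bad i).card : ℝ) ≤ η * 2 ^ (i * m))
    (hq : j * η * 2 ^ (j * m) < q) :
    ∃ Y, c ≤ Y ∧ Y < c + q ∧ ∀ i, 1 ≤ i → i ≤ j → Y / 2 ^ (j * m - i * m) ∉ bad i := by
  classical
  by_contra! hcon
  have hsub : Finset.Ico c (c + q) ⊆ (Finset.Icc 1 j).biUnion fun i =>
      ((bad i) ×ˢ (Finset.range (2 ^ (j * m - i * m)))).image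
        fun d => d.1 * 2 ^ (j * m - i * m) + d.2 := by
    intro Y hY
    rw [Finset.mem_Ico] at hY
    obtain ⟨i, h1, h2, h3⟩ := hcon Y hY.1 hY.2
    refine Finset.mem_biUnion.mpr ⟨i, Finset.mem_Icc.mpr ⟨h1, h2⟩, Finset.mem_image.mpr
      ⟨(Y / 2 ^ (j * m - i * m), Y % 2 ^ (j * m - i * m)), ?_, Nat.div_add_mod' _ _⟩⟩
    simp only [Finset.mem_product, Finset.mem_range]
    exact ⟨h3, Nat.mod_lt _ (by positivity)⟩
  have h1 := (Finset.card_le_card hsub).trans Finset.card_biUnion_le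
  rw [Nat.card_Ico, Nat.add_sub_cancel_left] at h1
  have h2 : ((∑ i ∈ Finset.Icc 1 j, (((bad i) ×ˢ (Finset.range (2 ^ (j * m - i * m)))).image
      fun d => d.1 * 2 ^ (j * m - i * m) + d.2).card : ℕ) : ℝ) ≤ j * (η * 2 ^ (j * m)) := by
    push_cast
    refine (Finset.sum_le_card_nsmul _ _ (η * 2 ^ (j * m)) fun i hi => ?_).trans (le_of_eq ?_)
    · rw [Finset.mem_Icc] at hi
      have hle : i * m ≤ j * m := Nat.mul_le_mul_right m hi.2
      have h3 : ((((bad i) ×ˢ (Finset.range (2 ^ (j * m - i * m)))).image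
          fun d => d.1 * 2 ^ (j * m - i * m) + d.2).card : ℝ) ≤ (bad i).card * 2 ^ (j * m - i * m) := by
        refine (Nat.cast_le.mpr Finset.card_image_le).trans (le_of_eq ?_)
        rw [Finset.card_product, Finset.card_range]; push_cast; ring
      refine h3.trans ?_
      calc ((bad i).card : ℝ) * 2 ^ (j * m - i * m) ≤ η * 2 ^ (i * m) * 2 ^ (j * m - i * m) := by
            gcongr; exact hbad i hi.1 hi.2
        _ = η * 2 ^ (j * m) := by rw [mul_assoc, ← pow_add]; congr 2; omega
    · simp
  have h3 : (q:ℝ) ≤ _ := (Nat.cast_le.mpr h1).trans h2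
  linarith

namespace CE
variable {L : ℕ} {φ φ' : Pt → Pt}

/-- The base level of the box at the origin is not much lower than the level of the image of the
origin. -/
theorem base_le (h : CE L φ φ') {K m E a z : ℕ} {δ : ℝ} (hδ : 0 < δ) (hK : 1 ≤ K) (hm : 2 ≤ m)
    (hδK : 64 * K * δ ≤ 1) (hE : δ * (K * m : ℕ) ≤ E)
    (ha : (4 * (K * m : ℕ) + 3) * (2:ℝ) ^ (2 * L + 2 * E) ≤ 2 ^ a) (hz : z = 4 * L * (a + 2) + 3)
    (b : ℕ → ℤ) (B : ℕ → Finset (ℕ × ℕ))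
    (hB : ∀ j, 1 ≤ j → j ≤ K → BoxData φ δ (j * m) 1 (b j) (B j)) :
    (φ ⟨0, 0, 0⟩).k ≤ b K + (z + 2 * (E + 4 * L + L * (m + 1)) + (E + 6 * L) +
      L * (z + 2 * (E + 4 * L + L * (m + 1)) + 1) : ℕ) := by
  classical
  obtain ⟨F0, hF0⟩ : ∃ F0, F0 = (φ ⟨0, 0, 0⟩).k := ⟨_, rfl⟩
  rw [← hF0]
  have hline : ∀ j, 1 ≤ j → j ≤ K → ∀ X < 2 ^ (j * m), ∀ Y < 2 ^ (j * m), (X, Y) ∉ B j →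
      ∀ k : ℕ, k ≤ j * m → |(φ ⟨X, Y / 2 ^ (j * m), k⟩).k - b j - k| ≤ E := by
    intro j hj1 hj2 X hX Y hY hXY k hk
    obtain ⟨-, E', hE', hl⟩ := hB j hj1 hj2
    have h1 := hl X hX Y hY hXY k hk
    have h2 : E' ≤ E := by
      have : δ * (j * m : ℕ) ≤ δ * (K * m : ℕ) := by gcongr
      exact_mod_cast (hE'.trans this).trans hE
    rw [one_mul] at h1
    exact h1.trans (by exact_mod_cast h2)
  obtain ⟨bad,
      hbad⟩ : ∃ bad : ℕ → Finset ℕ, bad = fun j => (Finset.range (2 ^ (j * m))).filter fun Y =>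
      2 ^ (j * m) < 8 * ((Finset.range (2 ^ (j * m))).filter fun X => (X, Y) ∈ B j).card := ⟨_, rfl⟩
  have hbadc : ∀ j, 1 ≤ j → j ≤ K → ((bad j).card : ℝ) ≤ 8 * δ * 2 ^ (j * m) := by
    intro j hj1 hj2
    have h1 : 2 ^ (j * m) * (bad j).card ≤ 8 * (B j).card := by
      rw [hbad]; exact card_atypical (B j) (fun a b => (b, a)) (by simp)
    have h2 := (hB j hj1 hj2).1
    have h3 : (2:ℝ) ^ (j * m) * (bad j).card ≤ 8 * (B j).card := by exact_mod_cast h1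
    rw [show (4:ℝ) = 2 * 2 by norm_num, mul_pow] at h2
    have h4 : (0:ℝ) < 2 ^ (j * m) := by positivity
    refine le_of_mul_le_mul_left ?_ h4
    linarith
  have hgoodX : ∀ j, 1 ≤ j → j ≤ K → ∀ Y < 2 ^ (j * m), Y ∉ bad j →
      8 * ((Finset.range (2 ^ (j * m))).filter fun X => (X, Y) ∈ B j).card ≤ 2 ^ (j * m) := by
    intro j _ _ Y hY hYb
    by_contra hc
    exact hYb (by rw [hbad]; simpa [hY] using hc)
  obtain ⟨G, hG⟩ : ∃ G : ℕ → ℕ → Prop, G = fun j Y => Y < 2 ^ (j * m) ∧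
    ∀ i, 1 ≤ i → i ≤ j → Y / 2 ^ (j * m - i * m) ∉ bad i := ⟨_, rfl⟩
  have hlev : ∀ j, j ≤ K → ∀ Y, G j Y → ∀ i, 1 ≤ i → i ≤ j →
      |(φ ⟨0, Y / 2 ^ (j * m), (i * m : ℕ)⟩).k - (b i + (i * m : ℕ))| ≤ E + 4 * L := by
    intro j hj Y hY i hi1 hi2
    rw [hG] at hY
    have hij : i * m ≤ j * m := Nat.mul_le_mul_right m hi2
    have hYi : Y / 2 ^ (j * m - i * m) < 2 ^ (i * m) := by
      rw [Nat.div_lt_iff_lt_mul (by positivity), ← pow_add, Nat.add_sub_cancel' hij]; exact hY.1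
    obtain ⟨X, hX, hX1, -, -⟩ := exists_lt_not_mem_three (n := 2 ^ (i * m)) (by positivity) _ ∅ ∅
      (hgoodX i hi1 (hi2.trans hj) _ hYi (hY.2 i hi1 hi2)) (by simp) (by simp)
    have l1 := hline i hi1 (hi2.trans hj) X hX _ hYi (by simpa [hX] using hX1) (i * m) le_rfl
    have l2 := h.near_one_k (near_coarser_line hij le_rfl (X:ℝ) Y)
    have hX0 : |(X:ℝ) - 0| ≤ 2 ^ (i * m) := by
      rw [sub_zero, abs_of_nonneg (by positivity)]; exact_mod_cast hX.le
    have l3 := h.near_one_k (near_unit_x ((Y:ℝ) / 2 ^ (j * m)) hX0)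
    rw [abs_le] at l1 l2 l3 ⊢
    constructor <;> linarith
  have hexG : ∀ j, 1 ≤ j → j ≤ K → ∀ c, c + 2 ^ (j * m - 2) ≤ 2 ^ (j * m) →
      ∃ Y, c ≤ Y ∧ Y < c + 2 ^ (j * m - 2) ∧ G j Y := by
    intro j hj1 hj2 c hc
    obtain ⟨Y, h1, h2, h3⟩ := exists_avoiding (j := j) (m := m) (q := 2 ^ (j * m - 2)) c bad
      (η := 8 * δ) (fun i hi1 hi2 => hbadc i hi1 (hi2.trans hj2)) (by
        have h2 : 2 ≤ j * m := by nlinarith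
        have h3 : (2:ℝ) ^ (j * m) = 2 ^ (j * m - 2) * 4 := by
          rw [show (4:ℝ) = 2 ^ 2 by norm_num, ← pow_add]; congr 1; omega
        have h4 : (j:ℝ) ≤ K := by exact_mod_cast hj2
        rw [h3]; push_cast
        have h5 : (0:ℝ) < 2 ^ (j * m - 2) := by positivity
        have h6 : j * (8 * δ) * 4 ≤ 1 / 2 := by
          have : (j:ℝ) * δ ≤ K * δ := by gcongr
          linarith
        calc j * (8 * δ) * ((2:ℝ) ^ (j * m - 2) * 4) = (j * (8 * δ) * 4) * 2 ^ (j * m - 2) := by ring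
          _ ≤ 1 / 2 * 2 ^ (j * m - 2) := by gcongr
          _ < _ := by linarith)
    refine ⟨Y, h1, h2, ?_⟩
    rw [hG]; exact ⟨by omega, h3⟩
  have hbase : ∀ j, 1 ≤ j → ∀ Y, G j Y → |(φ ⟨0, Y / 2 ^ (j * m), 0⟩).k - F0| ≤ 2 * L := by
    intro j _ Y hY
    rw [hG] at hY
    rw [hF0]
    refine h.near_one_k (near_unit_y 0 ?_)
    simpa using abs_dyadic_sub_le (N := j * m) (by positivity : 0 < 2 ^ (j * m)) hY.1
  have hzS : ∀ j, 1 ≤ j → j ≤ K → ∃ Y, G j Y ∧ ∃ k : ℕ, k ≤ j * m ∧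
      (φ ⟨0, Y / 2 ^ (j * m), k⟩).k ≤ b j + z + E + 4 * L := by
    intro j hj1 hj2
    have h2 : 2 ≤ j * m := by nlinarith
    have h3 : (2:ℕ) ^ (j * m) = 2 ^ (j * m - 2) * 4 := by
      rw [show (4:ℕ) = 2 ^ 2 by norm_num, ← pow_add]; congr 1; omega
    obtain ⟨Y, -, hY1, hY⟩ := hexG j hj1 hj2 0 (by omega)
    rcases lt_or_ge (j * m) z with hlt | hge
    · refine ⟨Y, hY, j * m, le_rfl, ?_⟩
      have := hlev j hj2 Y hY j hj1 le_rfl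
      rw [abs_le] at this
      omega
    · obtain ⟨Y', hY1', hY2', hY'⟩ := hexG j hj1 hj2 (2 * 2 ^ (j * m - 2)) (by omega)
      have hYG := hY; have hYG' := hY'
      rw [hG] at hY hY'
      have e1 := hY.2 j hj1 le_rfl
      have e2 := hY'.2 j hj1 le_rfl
      rw [Nat.sub_self, pow_zero, Nat.div_one] at e1 e2
      obtain ⟨X, hX, hX1, hX2,
          -⟩ := exists_lt_not_mem_three (n := 2 ^ (j * m)) (by positivity) _ _ ∅
        (hgoodX j hj1 hj2 _ hY.1 e1) (hgoodX j hj1 hj2 _ hY'.1 e2) (by simp)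
      have l1 := hline j hj1 hj2 X hX Y hY.1 (by simpa [hX] using hX1)
      have l2 := hline j hj1 hj2 X hX Y' hY'.1 (by simpa [hX] using hX2)
      have hX0 : |(X:ℝ)| ≤ 2 ^ (j * m) := by
        rw [abs_of_nonneg (by positivity)]; exact_mod_cast hX.le
      have hfar : (1:ℝ) / 4 ≤ |(Y':ℝ) / 2 ^ (j * m) - Y / 2 ^ (j * m)| := by
        rw [← sub_div]
        refine le_trans ?_ (le_abs_self _)
        rw [le_div_iff₀ (by positivity)]
        have h4 : (2:ℝ) ^ (j * m) = 2 ^ (j * m - 2) * 4 := by exact_mod_cast h3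
        have h5 : (2:ℝ) * 2 ^ (j * m - 2) ≤ Y' := by exact_mod_cast hY1'
        have h6 : (Y:ℝ) ≤ 2 ^ (j * m - 2) := by exact_mod_cast (by omega : Y ≤ 2 ^ (j * m - 2))
        linarith
      have haj : (4 * (j * m : ℕ) + 3) * (2:ℝ) ^ (2 * L + 2 * E) ≤ 2 ^ a := by
        refine le_trans ?_ ha
        gcongr
      obtain ⟨k, hk, hk2⟩ := h.leaf hX0 (abs_dyadic_sub_le hY.1 hY'.1) hfar hz hge haj l1 l2
      rcases hk2 with hk2 | hk2
      · exact ⟨Y, hYG, k, hk, by omega⟩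
      · exact ⟨Y', hYG', k, hk, by omega⟩
  obtain ⟨α, hα⟩ : ∃ α : ℕ → ℤ, α = fun i => if i = 0 then F0 else b i + (i * m : ℕ) := ⟨_, rfl⟩
  have hα0 : α 0 = F0 := by rw [hα]; simp
  have hαi : ∀ i, 1 ≤ i → α i = b i + (i * m : ℕ) := fun i hi => by
    rw [hα]; exact if_neg (by omega)
  have hlo : ∀ j, 1 ≤ j → j ≤ K → ∃ i ≤ j,
      α i ≤ b j + z + 2 * (E + 4 * L + L * (m + 1)) := by
    intro j hj1 hj2
    obtain ⟨Y, hY, k, hk, hle⟩ := hzS j hj1 hj2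
    have hi : k / m ≤ j := Nat.div_le_of_le_mul (by rwa [mul_comm])
    refine ⟨k / m, hi, ?_⟩
    have hkm : k / m * m ≤ k := Nat.div_mul_le_self k m
    have hkm2 : k < k / m * m + m := by
      have := Nat.div_add_mod' k m; have := Nat.mod_lt k (by omega : 0 < m); omega
    have h1 := h.vert_k 0 (Y / 2 ^ (j * m)) (k / m * m : ℕ) (k - k / m * m)
    rw [show ((k / m * m : ℕ) : ℤ) + (k - k / m * m : ℕ) = k by omega] at h1
    have h2 : (L:ℤ) * ((k - k / m * m : ℕ) + 1) ≤ L * (m + 1) := by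
      gcongr; omega
    have h3 : α (k / m) ≤ (φ ⟨0, Y / 2 ^ (j * m), (k / m * m : ℕ)⟩).k + (E + 4 * L) := by
      rcases Nat.eq_zero_or_pos (k / m) with h0 | h0
      · have := hbase j hj1 Y hY
        rw [h0, hα0, zero_mul, Nat.cast_zero]
        rw [abs_le] at this; omega
      · have := hlev j hj2 Y hY (k / m) h0 hi
        rw [hαi _ h0]
        rw [abs_le] at this; linarith
    rw [abs_le] at h1
    linarith
  have hlow : ∀ j, 1 ≤ j → j ≤ K → F0 ≤ α j + (E + 6 * L) + L * ((j * m : ℕ) + 1) := by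
    intro j hj1 hj2
    obtain ⟨Y, hY, -⟩ := hzS j hj1 hj2
    have h1 := hbase j hj1 Y hY
    have h2 := hlev j hj2 Y hY j hj1 le_rfl
    have h3 := h.vert_k 0 (Y / 2 ^ (j * m)) 0 (j * m)
    rw [zero_add] at h3
    rw [hαi j hj1]
    rw [abs_le] at h1 h2 h3
    linarith
  obtain ⟨j, hj, hmin⟩ := Finset.exists_min_image (Finset.range (K + 1)) α ⟨0, by simp⟩
  simp only [Finset.mem_range, Nat.lt_succ_iff] at hj hmin
  obtain ⟨i, hi, hiK⟩ := hlo K hK le_rfl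
  have m1 := hmin i hi
  have hL0 : (0:ℤ) ≤ L * (z + 2 * (E + 4 * L + L * (m + 1)) + 1) := by positivity
  push_cast
  rcases Nat.eq_zero_or_pos j with rfl | hj0
  · rw [hα0] at m1
    linarith
  · obtain ⟨i', hi', hij⟩ := hlo j hj0 hj
    have m2 := hmin i' (hi'.trans hj)
    have m3 := hαi j hj0
    have m4 : ((j * m : ℕ) : ℤ) ≤ z + 2 * (E + 4 * L + L * (m + 1)) := by linarith
    have m5 := hlow j hj0 hj
    have m6 : (L:ℤ) * ((j * m : ℕ) + 1) ≤ L * (z + 2 * (E + 4 * L + L * (m + 1)) + 1) := by gcongr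
    linarith

end CE

lemma BoxData.flip {φ : Pt → Pt} {δ : ℝ} {N : ℕ} {s b : ℤ} {B : Finset (ℕ × ℕ)}
    (h : BoxData φ δ N s b B) :
    BoxData (fun p => sw (φ (tr ⟨0, 0, N⟩ (sw p)))) δ N s (-b - s * N) (B.image Prod.swap) := by
  obtain ⟨hB, E, hE, hl⟩ := h
  refine ⟨le_trans (Nat.cast_le.mpr Finset.card_image_le) hB, E, hE, fun X hX Y hY hXY k hk => ?_⟩
  have hYX : (Y, X) ∉ B := fun hc => hXY (Finset.mem_image.mpr ⟨(Y, X), hc, rfl⟩)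
  have h1 := hl Y hY X hX hYX (N - k) (Nat.sub_le _ _)
  rw [← flip_line φ hk Y X, Nat.cast_sub hk] at h1
  simp only [sw] at h1 ⊢
  rw [← abs_neg]
  convert h1 using 2
  ring

lemma BoxData.neg {φ : Pt → Pt} {δ : ℝ} {N : ℕ} {s b : ℤ} {B : Finset (ℕ × ℕ)}
    (h : BoxData φ δ N s b B) : BoxData (fun p => sw (φ p)) δ N (-s) (-b) B := by
  obtain ⟨hB, E, hE, hl⟩ := h
  refine ⟨hB, E, hE, fun X hX Y hY hXY k hk => ?_⟩
  have h1 := hl X hX Y hY hXY k hk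
  rw [sw_k, ← abs_neg]
  convert h1 using 2
  ring

lemma BoxData.sign_eq {φ : Pt → Pt} {δ : ℝ} (hδ : δ ≤ 1 / 100) {N : ℕ} (hN : 1 ≤ N)
    {s s' b b' : ℤ} {B B' : Finset (ℕ × ℕ)} (hs : s = 1 ∨ s = -1)
    (hs' : s' = 1 ∨ s' = -1) (h1 : BoxData φ δ N s b B) (h2 : BoxData φ δ N s' b' B') : s = s' := by
  classical
  obtain ⟨hB, E, hE, hl⟩ := h1
  obtain ⟨hB', E', hE', hl'⟩ := h2
  have h4 : (0:ℝ) < 4 ^ N := by positivity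
  obtain ⟨X, hX, Y, hY, hXY, hXY'⟩ : ∃ X < 2 ^ N, ∃ Y < 2 ^ N, (X, Y) ∉ B ∧ (X, Y) ∉ B' := by
    by_contra! hcon
    have hsub : Finset.range (2 ^ N) ×ˢ Finset.range (2 ^ N) ⊆ B ∪ B' := by
      rintro ⟨X, Y⟩ hc
      simp only [Finset.mem_product, Finset.mem_range] at hc
      rw [Finset.mem_union]
      by_cases hb : (X, Y) ∈ B
      · exact Or.inl hb
      · exact Or.inr (hcon X hc.1 Y hc.2 hb)
    have hc := (Finset.card_le_card hsub).trans (Finset.card_union_le _ _)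
    rw [Finset.card_product, Finset.card_range, ← mul_pow] at hc
    have hc' : ((4:ℝ) ^ N) ≤ B.card + B'.card := by exact_mod_cast hc
    have := mul_le_mul_of_nonneg_right hδ h4.le
    linarith
  have e0 := hl X hX Y hY hXY 0 (Nat.zero_le _)
  have e1 := hl X hX Y hY hXY N le_rfl
  have e0' := hl' X hX Y hY hXY' 0 (Nat.zero_le _)
  have e1' := hl' X hX Y hY hXY' N le_rfl
  have hNr : (1:ℝ) ≤ N := by exact_mod_cast hN
  have hE4 : E + E' < N := by
    have : (E + E' : ℝ) < N := by nlinarith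
    exact_mod_cast this
  rw [abs_le] at e0 e1 e0' e1'
  rcases hs with rfl | rfl <;> rcases hs' with rfl | rfl <;> first | rfl | (exfalso; omega)

namespace CE
variable {L : ℕ} {φ φ' : Pt → Pt}

lemma rise_of_box (h : CE L φ φ') {δ : ℝ} (hδ : 0 < δ) {N1 : ℕ} (hδ1 : δ ≤ 1 / 100)
    (hN1 : ∀ φ φ', CE L φ φ' → ∃ s : ℤ, (s = 1 ∨ s = -1) ∧ ∀ N ≥ N1, ∃ b B, BoxData φ δ N s b B)
    {K m E a z : ℕ} (hK : 1 ≤ K) (hm : 2 ≤ m) (hmN : N1 ≤ m) (hδK : 64 * K * δ ≤ 1)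
    (hE : δ * (K * m : ℕ) ≤ E) (ha : (4 * (K * m : ℕ) + 3) * (2:ℝ) ^ (2 * L + 2 * E) ≤ 2 ^ a)
    (hz : z = 4 * L * (a + 2) + 3)
    (hs : ∀ N ≥ N1, ∃ b B, BoxData φ δ N 1 b B) :
    (φ ⟨0, 0, 0⟩).k + (K * m : ℕ) ≤ (φ ⟨0, 0, (K * m : ℕ)⟩).k +
      2 * (z + 2 * (E + 4 * L + L * (m + 1)) + (E + 6 * L)
        + L * (z + 2 * (E + 4 * L + L * (m + 1)) + 1) : ℕ) := by
  have hjm : ∀ j, 1 ≤ j → N1 ≤ j * m := fun j hj => hmN.trans (Nat.le_mul_of_pos_left m hj)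
  choose! b B hB using hs
  have hψ : CE L (fun p => sw (φ (tr ⟨0, 0, (K * m : ℕ)⟩ (sw p)))) _ :=
    ((h.pre_tr ⟨0, 0, (K * m : ℕ)⟩).pre_sw).post_sw
  obtain ⟨s, hs1, hs⟩ := hN1 _ _ hψ
  obtain ⟨c, C, hC⟩ := hs _ (hjm K hK)
  have hs2 := (hB _ (hjm K hK)).flip.sign_eq hδ1 (by nlinarith) (Or.inl rfl) hs1 hC
  subst hs2
  choose! c C hC using hs
  have A1 := h.base_le hδ hK hm hδK hE ha hz (fun j => b (j * m)) (fun j => B (j * m))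
    (fun j hj _ => hB _ (hjm j hj))
  have A2 := hψ.base_le hδ hK hm hδK hE ha hz
    (fun j => if j = K then -(b (K * m)) - 1 * (K * m : ℕ) else c (j * m))
    (fun j => if j = K then (B (K * m)).image Prod.swap else C (j * m))
    (fun j hj _ => by
      by_cases hjK : j = K
      · subst hjK
        simp only [if_true]
        exact (hB _ (hjm j hj)).flip
      · simp only [if_neg hjK]
        exact hC _ (hjm j hj))
  simp only [if_true] at A2
  have e : (tr ⟨0, 0, ((K * m : ℕ) : ℤ)⟩ (sw ⟨0, 0, 0⟩)) = ⟨0, 0, (K * m : ℕ)⟩ := by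
    simp [tr, sw]
  rw [sw_k, e] at A2
  linarith

end CE

lemma exists_rise_constants (L N1 : ℕ) : ∀ K, 1 ≤ K → ∃ e0, ∀ e : ℕ, e0 ≤ e → N1 ≤ 64 * e ∧
    (4 * (K * (64 * e) : ℕ) + 3) * (2:ℝ) ^ (2 * L + 2 * e) ≤ 2 ^ (2 * L + 4 * e) := by
  intro K hK
  refine ⟨N1 + 1024 * K, fun e he => ⟨by omega, ?_⟩⟩
  have h1 : (2:ℝ) ^ (2 * L + 4 * e) = 2 ^ (2 * e) * 2 ^ (2 * L + 2 * e) := by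
    rw [← pow_add]; congr 1; ring
  rw [h1]
  gcongr
  have h2 : (e:ℕ) + 1 ≤ 2 ^ e := Nat.lt_two_pow_self
  have h3 : (e + 1) * (e + 1) ≤ 2 ^ (2 * e) := by
    rw [two_mul, pow_add]; exact Nat.mul_le_mul h2 h2
  have h4 : 4 * (K * (64 * e)) + 3 ≤ (e + 1) * (e + 1) := by nlinarith
  exact_mod_cast h4.trans h3

theorem CE.rise (L : ℕ) : ∃ T0 : ℕ, ∀ φ φ', CE L φ φ' → ∃ s : ℤ, (s = 1 ∨ s = -1) ∧ ∀ T : ℕ, T0 ≤ T →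
    (T : ℤ) ≤ 2 * (s * ((φ ⟨0, 0, T⟩).k - (φ ⟨0, 0, 0⟩).k)) := by
  obtain ⟨K, hK⟩ : ∃ K : ℕ, K = (L + 1) * (200 * L + 100) * (L + 1) := ⟨_, rfl⟩
  have hK1 : 100 ≤ K := by rw [hK]; nlinarith [Nat.zero_le (L * L), Nat.zero_le (L * L * L)]
  have hKr : (100:ℝ) ≤ K := by exact_mod_cast hK1
  obtain ⟨δ, hδe⟩ : ∃ δ : ℝ, δ = 1 / (64 * K) := ⟨_, rfl⟩
  have hδ : 0 < δ := by rw [hδe]; positivity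
  have hδK : 64 * K * δ = 1 := by rw [hδe]; field_simp
  have hδ1 : δ ≤ 1 / 100 := by nlinarith
  obtain ⟨N1, hN1⟩ := box_sign L hδ hδ1
  obtain ⟨e0, he0⟩ := exists_rise_constants L N1 K (by omega)
  have main : ∀ φ φ', CE L φ φ' → (∀ N ≥ N1, ∃ b B, BoxData φ δ N 1 b B) →
      ∀ T : ℕ, 64 * K * (e0 + 1 + 4 * (L + 1)) ≤ T →
        (T : ℤ) ≤ 2 * (1 * ((φ ⟨0, 0, T⟩).k - (φ ⟨0, 0, 0⟩).k)) := by
    intro φ φ' h hs T hT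
    obtain ⟨e, he⟩ : ∃ e, e = T / (64 * K) := ⟨_, rfl⟩
    obtain ⟨r, hr⟩ : ∃ r, r = T % (64 * K) := ⟨_, rfl⟩
    have hr1 : r < 64 * K := by rw [hr]; exact Nat.mod_lt _ (by omega)
    have hTe : T = K * (64 * e) + r := by
      rw [he, hr]; have := Nat.div_add_mod T (64 * K); linarith
    have hee : e0 + 1 + 4 * (L + 1) ≤ e := by
      rw [he, Nat.le_div_iff_mul_le (by omega)]; linarith
    obtain ⟨hc1, hc2⟩ := he0 e (by omega)
    have hE : δ * (K * (64 * e) : ℕ) ≤ e := by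
      push_cast
      have : δ * (K * (64 * e)) = (64 * K * δ) * e := by ring
      rw [this, hδK, one_mul]
    have h1 := h.rise_of_box hδ hδ1 hN1 (by omega) (by omega) hc1 hδK.le hE hc2 rfl hs
    have h2 := h.vert_k 0 0 (K * (64 * e) : ℕ) r
    rw [show (((K * (64 * e) : ℕ) : ℤ) + r) = T by rw [hTe]; push_cast; ring] at h2
    rw [abs_le] at h2
    have h3 : 2 * (4 * L * (2 * L + 4 * e + 2) + 3 + 2 * (e + 4 * L + L * (64 * e + 1)) + (e + 6 * L)
        + L * (4 * L * (2 * L + 4 * e + 2) + 3 + 2 * (e + 4 * L + L * (64 * e + 1)) + 1)) ≤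
        16 * (K * e) := by
      have g1 : 4 * L * (2 * L + 4 * e + 2) + 3 ≤ 20 * (L * e) + e := by
        have : L * (2 * L + 4 * e + 2) ≤ L * (5 * e) := Nat.mul_le_mul_left _ (by omega)
        linarith
      have g2 : e + 4 * L + L * (64 * e + 1) ≤ 3 * e + 64 * (L * e) := by
        linarith
      have g3 : (L + 1) * (4 * L * (2 * L + 4 * e + 2) + 3) ≤ (L + 1) * (20 * (L * e) + e) :=
        Nat.mul_le_mul_left _ g1
      have g4 : (L + 1) * (e + 4 * L + L * (64 * e + 1)) ≤ (L + 1) * (3 * e + 64 * (L * e)) :=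
        Nat.mul_le_mul_left _ g2
      have g5 : (L + 1) * (200 * L + 100) * 1 * e ≤ (L + 1) * (200 * L + 100) * (L + 1) * e := by
        gcongr; omega
      have g6 : 0 ≤ L * L * e := Nat.zero_le _
      have g7 : 0 ≤ L * e := Nat.zero_le _
      rw [hK]
      linarith
    have h4 : L * (r + 1) ≤ L * (64 * K) := Nat.mul_le_mul_left _ hr1
    have h5 : 64 * K * (4 * (L + 1)) ≤ 64 * K * e := Nat.mul_le_mul_left _ (by omega)
    have h3' := (Int.ofNat_le.mpr h3)
    have h4' := (Int.ofNat_le.mpr h4)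
    have h5' := (Int.ofNat_le.mpr h5)
    have hr1' := (Int.ofNat_lt.mpr hr1)
    have hTe' := congrArg (Nat.cast (R := ℤ)) hTe
    simp only [Nat.cast_mul, Nat.cast_add, Nat.cast_ofNat,
        Nat.cast_one] at h1 h2 h3' h4' h5' hTe' hr1'
    linarith
  refine ⟨64 * K * (e0 + 1 + 4 * (L + 1)), fun φ φ' h => ?_⟩
  obtain ⟨s, hs1, hs⟩ := hN1 φ φ' h
  refine ⟨s, hs1, fun T hT => ?_⟩
  rcases hs1 with rfl | rfl
  · exact main φ φ' h hs T hT
  · have := main _ _ h.post_sw (fun N hN => by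
      obtain ⟨b, B, hB⟩ := hs N hN
      exact ⟨-b, B, hB.neg⟩) T hT
    simp only [sw_k] at this
    linarith

/-- The level of `φ` rises (`s = 1`) or falls (`s = -1`) linearly along vertical lines. -/
def RiseAt (φ : Pt → Pt) (T0 : ℕ) (s : ℤ) (x y : ℝ) (k : ℤ) : Prop :=
  ∀ T : ℕ, T0 ≤ T → (T : ℤ) ≤ 2 * (s * ((φ ⟨x, y, k + T⟩).k - (φ ⟨x, y, k⟩).k))

lemma RiseAt.sign_eq_of_close {φ : Pt → Pt} {T0 : ℕ} {s s' : ℤ} {x y x' y' : ℝ} {k k' : ℤ}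
    (hs : s = 1 ∨ s = -1) (hs' : s' = 1 ∨ s' = -1)
    (h : RiseAt φ T0 s x y k) (h' : RiseAt φ T0 s' x' y' k') (T T' D : ℕ) (hT : T0 ≤ T) (hT' : T0 ≤ T')
    (hD : |((φ ⟨x', y', k' + T'⟩).k - (φ ⟨x', y', k'⟩).k) - ((φ ⟨x, y, k + T⟩).k - (φ ⟨x, y,
        k⟩).k)| ≤ D)
    (hTD : 2 * D < T + T') : s = s' := by
  have h1 := h T hT
  have h2 := h' T' hT'
  rw [abs_le] at hD
  rcases hs with rfl | rfl <;> rcases hs' with rfl | rfl <;> first | rfl | (exfalso; omega)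

theorem CE.rise_all (L : ℕ) : ∃ T0 : ℕ, ∀ φ φ', CE L φ φ' → ∃ s : ℤ, (s = 1 ∨ s = -1) ∧
    ∀ x y k, RiseAt φ T0 s x y k := by
  obtain ⟨T0, hT0⟩ := CE.rise L
  refine ⟨T0, fun φ φ' h => ?_⟩
  have key : ∀ p : Pt, ∃ s : ℤ, (s = 1 ∨ s = -1) ∧ RiseAt φ T0 s p.x p.y p.k := fun p => by
    obtain ⟨s, hs, hs2⟩ := hT0 _ _ (h.pre_tr p)
    refine ⟨s, hs, fun T hT => ?_⟩
    simpa [tr] using hs2 T hT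
  choose s hs hsr using key
  have vert1 : ∀ (x y : ℝ) (k : ℤ) (n : ℕ), s ⟨x, y, k⟩ = s ⟨x, y, k + n⟩ := fun x y k n => by
    refine (hsr ⟨x, y, k⟩).sign_eq_of_close (hs _) (hs _) (hsr ⟨x, y, k + n⟩)
      (T0 + L * (n + 1) + n + 1) (T0 + L * (n + 1) + 1) (L * (n + 1)) (by omega) (by omega) ?_ (by omega)
    have h1 := h.vert_k x y k n
    rw [show k + n + ((T0 + L * (n + 1) + 1 : ℕ) : ℤ) = k + ((T0 + L * (n + 1) + n + 1 : ℕ) : ℤ) by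
      push_cast; ring]
    rw [abs_le] at h1 ⊢
    simp only [Nat.cast_mul, Nat.cast_add, Nat.cast_one] at h1 ⊢
    constructor <;> linarith
  have vert : ∀ (x y : ℝ) (k k' : ℤ), s ⟨x, y, k⟩ = s ⟨x, y, k'⟩ := fun x y k k' => by
    rcases le_total k k' with hk | hk
    · have := vert1 x y k (k' - k).toNat
      rwa [Int.toNat_of_nonneg (by omega), add_sub_cancel] at this
    · have := vert1 x y k' (k - k').toNat
      rw [Int.toNat_of_nonneg (by omega), add_sub_cancel] at this
      exact this.symm
  have horx : ∀ (x x' y : ℝ), s ⟨x, y, 0⟩ = s ⟨x', y, 0⟩ := fun x x' y => by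
    obtain ⟨N, hN⟩ := pow_unbounded_of_one_lt |x' - x| (by norm_num : (1:ℝ) < 2)
    obtain ⟨D, hD⟩ : ∃ D : ℕ, D = ((φ ⟨x', y, 0⟩).k - (φ ⟨x, y, 0⟩).k).natAbs := ⟨_, rfl⟩
    obtain ⟨T, hT⟩ : ∃ T, T = N + T0 + D + 2 * L + 1 := ⟨_, rfl⟩
    refine (hsr ⟨x, y, 0⟩).sign_eq_of_close (hs _) (hs _) (hsr ⟨x', y, 0⟩) T T (D + 2 * L)
      (by omega) (by omega) ?_ (by omega)
    have h1 := h.near_one_k (near_unit_x y (x := x) (x' := x') (N := T)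
      (hN.le.trans (pow_le_pow_right₀ (by norm_num) (by omega))))
    simp only [zero_add]
    rw [abs_le] at h1 ⊢
    push_cast
    omega
  have hory : ∀ (x y y' : ℝ), s ⟨x, y, 0⟩ = s ⟨x, y', 0⟩ := fun x y y' => by
    obtain ⟨N, hN⟩ := pow_unbounded_of_one_lt |y' - y| (by norm_num : (1:ℝ) < 2)
    obtain ⟨D, hD⟩ : ∃ D : ℕ, D = ((φ ⟨x, y', 0⟩).k - (φ ⟨x, y, 0⟩).k).natAbs := ⟨_, rfl⟩
    obtain ⟨T, hT⟩ : ∃ T, T = N + T0 + D + 2 * L + 1 := ⟨_, rfl⟩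
    rw [vert x y 0 (-T), vert x y' 0 (-T)]
    refine (hsr ⟨x, y, -T⟩).sign_eq_of_close (hs _) (hs _) (hsr ⟨x, y', -T⟩) T T (D + 2 * L)
      (by omega) (by omega) ?_ (by omega)
    have h1 := (h.pre_sw).near_one_k (near_unit_x x (x := y) (x' := y') (N := T)
      (hN.le.trans (pow_le_pow_right₀ (by norm_num) (by omega))))
    simp only [neg_add_cancel]
    simp only [sw] at h1
    rw [abs_le] at h1 ⊢
    push_cast
    omega
  refine ⟨s ⟨0, 0, 0⟩, hs _, fun x y k => ?_⟩
  rw [horx 0 x 0, hory x 0 y, vert x y 0 k]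
  exact hsr ⟨x, y, k⟩

open Filter Topology

lemma zpow_two_add_le {a b c : ℤ} (ha : a ≤ c) (hb : b ≤ c) : (2:ℝ) ^ a + (2:ℝ) ^ b ≤ (2:ℝ) ^ (c + 1) := by
  have h1 := zpow_two_mono ha
  have h2 := zpow_two_mono hb
  rw [zpow_two_add c 1, zpow_one]
  linarith

/-- The level of `φ` rises along vertical lines, at a definite rate. -/
def Up (φ : Pt → Pt) (T : ℕ) : Prop := ∀ x y k, (φ ⟨x, y, k⟩).k + 1 ≤ (φ ⟨x, y, k + T⟩).k

lemma RiseAt.up {φ : Pt → Pt} {T0 : ℕ} (h : ∀ x y k, RiseAt φ T0 1 x y k) : Up φ (T0 + 2) := by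
  intro x y k
  have := h x y k (T0 + 2) (by omega)
  push_cast at this ⊢
  linarith

namespace Up
variable {φ : Pt → Pt} {T : ℕ}

lemma conj_sw (h : Up φ T) : Up (fun p => sw (φ (sw p))) T := by
  intro x y k
  have := h y x (-k - T)
  simp only [sw]
  rw [sub_add_cancel] at this
  rw [neg_add']
  linarith

lemma iterate (h : Up φ T) (x y : ℝ) (k : ℤ) (j : ℕ) :
    (φ ⟨x, y, k - j * T⟩).k + j ≤ (φ ⟨x, y, k⟩).k := by
  induction j with
  | zero => simp
  | succ j ih =>
    have := h x y (k - (j + 1 : ℕ) * T)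
    rw [show k - ((j + 1 : ℕ) : ℤ) * T + T = k - j * T by push_cast; ring] at this
    push_cast at this ⊢
    linarith

end Up

lemma near_vert_down (x y : ℝ) (k : ℤ) (n : ℕ) : Near n ⟨x, y, k⟩ ⟨x, y, k - n⟩ := by
  have h := one_le_two_pow_real n
  have h0 : (0:ℝ) ≤ (2:ℝ)^n - 1 := by linarith
  refine ⟨by simp, ?_, ?_⟩ <;> simp only [sub_self, abs_zero] <;> positivity

namespace CE
variable {L : ℕ} {φ φ' : Pt → Pt} {T : ℕ}

/-- The boundary map of a coarse equivalence preserving the vertical direction. -/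
lemma exists_bdry (h : CE L φ φ') (hu : Up φ T) : ∃ ψ : ℝ → ℝ, ∀ x y k,
    |(φ ⟨x, y, k⟩).x - ψ x| ≤ (2:ℝ) ^ ((L * (T + 1) + 1 : ℕ) + (φ ⟨x, y, k⟩).k) := by
  have step : ∀ x y k (j : ℕ), dist (φ ⟨x, y, k - j * T⟩).x (φ ⟨x, y, k - (j + 1 : ℕ) * T⟩).x ≤
      (2:ℝ) ^ ((L * (T + 1) + 1 : ℕ) + (φ ⟨x, y, k⟩).k) / 2 / 2 ^ j := by
    intro x y k j
    have h1 := (h.fwd _ _ _ (near_vert_down x y (k - j * T) T)).x_le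
    rw [show k - (j:ℤ) * T - T = k - (j + 1 : ℕ) * T by push_cast; ring] at h1
    rw [dist_comm, Real.dist_eq]
    refine h1.trans ?_
    have h2 := hu.iterate x y k j
    rw [div_div, ← pow_succ', ← zpow_natCast, ← zpow_sub₀ (by norm_num)]
    apply zpow_two_mono
    push_cast
    linarith
  have lim : ∀ x y k, ∃ l, Tendsto (fun j : ℕ => (φ ⟨x, y,
      k - j * T⟩).x) atTop (𝓝 l) := fun x y k =>
    cauchySeq_tendsto_of_complete (cauchySeq_of_le_geometric_two (step x y k))
  choose l hl using lim
  have hind : ∀ x y k, l x y k = l x 0 0 := by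
    intro x y k
    obtain ⟨a, ha⟩ := pow_unbounded_of_one_lt (|y| * (2:ℝ) ^ k) (by norm_num : (1:ℝ) < 2)
    obtain ⟨b, hb⟩ : ∃ b : ℕ, b = a + k.natAbs := ⟨_, rfl⟩
    have hnear : ∀ j : ℕ, Near (b + 1) ⟨x, y, k - j * T⟩ ⟨x, 0, 0 - j * T⟩ := by
      intro j
      refine near_of_bounds ?_ (by simp only [sub_self, abs_zero]; positivity) ?_
      · simp only [hb]
        rw [abs_le]; push_cast
        constructor <;> linarith [neg_abs_le k, le_abs_self k]
      · simp only [zero_sub, abs_neg]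
        have h1 : |y| ≤ (2:ℝ) ^ a * 2 ^ (-k) := by
          have := mul_le_mul_of_nonneg_right ha.le (zpow_two_pos (-k)).le
          rwa [mul_assoc, zpow_two_mul_neg, mul_one] at this
        refine h1.trans ?_
        gcongr
        · norm_num
        · omega
        · norm_num
        · have : (0:ℤ) ≤ j * T := by positivity
          linarith
    have hz : Tendsto (fun j : ℕ => (2:ℝ) ^ ((L * (b + 2) : ℕ) + (φ ⟨x, y,
        k⟩).k) * (1 / 2) ^ j) atTop (𝓝 0) := by
      rw [← mul_zero ((2:ℝ) ^ ((L * (b + 2) : ℕ) + (φ ⟨x, y, k⟩).k))]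
      exact (tendsto_pow_atTop_nhds_zero_of_lt_one (by norm_num) (by norm_num)).const_mul _
    have hd : Tendsto (fun j : ℕ => (φ ⟨x, 0, 0 - j * T⟩).x - (φ ⟨x, y,
        k - j * T⟩).x) atTop (𝓝 0) := by
      refine squeeze_zero_norm (fun j => ?_) hz
      have h1 := (h.fwd _ _ _ (hnear j)).x_le
      rw [Real.norm_eq_abs]
      refine h1.trans ?_
      have h2 := hu.iterate x y k j
      rw [one_div, inv_pow, ← zpow_natCast, ← zpow_neg, ← zpow_two_add]
      apply zpow_two_mono
      push_cast
      linarith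
    have := tendsto_nhds_unique hd ((hl x 0 0).sub (hl x y k))
    linarith
  refine ⟨fun x => l x 0 0, fun x y k => ?_⟩
  change |_ - l x 0 0| ≤ _
  rw [← Real.dist_eq, ← hind x y k]
  simpa using dist_le_of_le_geometric_two_of_tendsto₀ (step x y k) (hl x y k)

lemma bdry_lip (h : CE L φ φ') {C : ℕ} {ψ : ℝ → ℝ}
    (hψ : ∀ x y k, |(φ ⟨x, y, k⟩).x - ψ x| ≤ (2:ℝ) ^ (C + (φ ⟨x, y, k⟩).k))
    {x x' : ℝ} {k : ℤ} (y : ℝ) (hx : |x' - x| ≤ 2 ^ (k + 1)) :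
    |ψ x' - ψ x| ≤ (2:ℝ) ^ ((C + 3 * L + 2 : ℕ) + (φ ⟨x, y, k⟩).k) := by
  have hn : Near 2 ⟨x, y, k⟩ ⟨x', y, k⟩ := near_of_bounds (a := 1) (by simp)
    (by rwa [pow_one, mul_comm, ← zpow_add_one₀ (by norm_num)])
    (by simp only [sub_self, abs_zero]; positivity)
  have h1 := h.fwd _ _ _ hn
  have h2 := h1.k_le
  have h3 := h1.x_le
  have h4 := hψ x y k
  have h5 := hψ x' y k
  have e1 := zpow_two_add_le (a := C + (φ ⟨x, y, k⟩).k) (b := C + (φ ⟨x', y, k⟩).k)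
    (c := C + 3 * L + (φ ⟨x, y, k⟩).k) (by omega) (by rw [abs_le] at h2; push_cast at h2; linarith)
  have e2 := zpow_two_add_le (a := C + 3 * L + (φ ⟨x, y, k⟩).k + 1) (b := (L * (2 + 1) : ℕ) + (φ ⟨x,
      y, k⟩).k)
    (c := C + 3 * L + (φ ⟨x, y, k⟩).k + 1) (by omega) (by push_cast; linarith)
  rw [show ((C + 3 * L + 2 : ℕ) : ℤ) + (φ ⟨x, y, k⟩).k = C + 3 * L + (φ ⟨x, y,
      k⟩).k + 1 + 1 by push_cast; ring]
  rw [abs_le] at h3 h4 h5 ⊢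
  constructor <;> linarith

lemma bdry_expand (h : CE L φ φ') (hT : 1 ≤ T) (hu : Up φ T) {C a j : ℕ} {ψ ψ2 : ℝ → ℝ}
    (hψ : ∀ x y k, |(φ ⟨x, y, k⟩).x - ψ x| ≤ (2:ℝ) ^ (C + (φ ⟨x, y, k⟩).k))
    (hψ2 : ∀ x y k, |(φ ⟨x, y, k⟩).y - ψ2 y| ≤ (2:ℝ) ^ (C - (φ ⟨x, y, k⟩).k))
    (ha : a = C + 2 * L + 2) (hj : j = 4 * L * (a + 2) + 3 * L)
    {x x' : ℝ} {k : ℤ} (y : ℝ) (hx : |x' - x| ≤ 2 ^ (k + 1)) (hx2 : 2 ^ k < |x' - x|) :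
    (2:ℝ) ^ ((φ ⟨x, y, k⟩).k - (L * (j * T + 1) : ℕ)) ≤ |ψ x' - ψ x| := by
  by_contra! hcon
  have hn : Near 2 ⟨x, y, k⟩ ⟨x', y, k⟩ := near_of_bounds (a := 1) (by simp)
    (by rwa [pow_one, mul_comm, ← zpow_add_one₀ (by norm_num)])
    (by simp only [sub_self, abs_zero]; positivity)
  have h1 := (h.fwd _ _ _ hn).k_le
  have h2 := hu.iterate x y k j
  have h3 := h.vert_k x y (k - j * T) (j * T)
  rw [show k - (j:ℤ) * T + (j * T : ℕ) = k by push_cast; ring] at h3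
  have hex : ∃ i : ℕ, (φ ⟨x', y, k - i⟩).k ≤ (φ ⟨x, y, k - j * T⟩).k := by
    obtain ⟨i, hi⟩ : ∃ i : ℕ, i = ((φ ⟨x', y, k⟩).k - (φ ⟨x, y, k - j * T⟩).k).toNat := ⟨_, rfl⟩
    refine ⟨i * T, ?_⟩
    have := hu.iterate x' y k i
    push_cast
    omega
  obtain ⟨i, hi, hmin⟩ : ∃ i : ℕ, (φ ⟨x', y, k - i⟩).k ≤ (φ ⟨x, y, k - j * T⟩).k ∧
      ∀ i' < i, ¬ (φ ⟨x', y, k - i'⟩).k ≤ (φ ⟨x, y, k - j * T⟩).k :=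
    ⟨Nat.find hex, Nat.find_spec hex, fun i' hi' => Nat.find_min hex hi'⟩
  have hi2 : (φ ⟨x, y, k - j * T⟩).k - 2 * L ≤ (φ ⟨x', y, k - i⟩).k := by
    rcases Nat.eq_zero_or_pos i with rfl | hi0
    · rw [Nat.cast_zero, sub_zero]
      rw [abs_le] at h1
      have : 0 ≤ L * (a + 2) := Nat.zero_le _
      have hj' : 3 * L ≤ j := by rw [hj]; nlinarith
      push_cast at h1
      omega
    · have h4 := hmin (i - 1) (by omega)
      have h5 := h.vert_k x' y (k - i) 1
      rw [show k - (i:ℤ) + (1:ℕ) = k - (i - 1 : ℕ) by omega] at h5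
      rw [abs_le] at h5
      push_cast at h5
      omega
  obtain ⟨f, hf⟩ : ∃ f, f = (φ ⟨x, y, k - j * T⟩).k := ⟨_, rfl⟩
  obtain ⟨f', hf'⟩ : ∃ f', f' = (φ ⟨x', y, k - i⟩).k := ⟨_, rfl⟩
  have b1 := hψ x y (k - j * T)
  have b2 := hψ x' y (k - i)
  have b3 := hψ2 x y (k - j * T)
  have b4 := hψ2 x' y (k - i)
  rw [← hf] at b1 b3 hi hi2 h3 h2
  rw [← hf'] at b2 b4 hi hi2
  have hF : (φ ⟨x, y, k⟩).k - (L * (j * T + 1) : ℕ) ≤ f := by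
    rw [abs_le] at h3; push_cast at h3 ⊢; linarith
  have hnear : Near (a + 1) (φ ⟨x, y, k - j * T⟩) (φ ⟨x', y, k - i⟩) := by
    refine near_of_bounds ?_ ?_ ?_
    · rw [← hf, ← hf', abs_le, ha]; push_cast; omega
    · rw [← hf, ← zpow_natCast, ← zpow_two_add, ha]
      have e1 := zpow_two_add_le (a := C + f) (b := C + f') (c := C + 2 * L + f) (by omega) (by omega)
      have e2 := zpow_two_add_le (a := C + 2 * L + f + 1) (b := (φ ⟨x, y,
          k⟩).k - (L * (j * T + 1) : ℕ))
        (c := C + 2 * L + f + 1) le_rfl (by omega)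
      rw [show ((C + 2 * L + 2 : ℕ) : ℤ) + f = C + 2 * L + f + 1 + 1 by push_cast; ring]
      have := hcon.le
      rw [abs_le] at b1 b2 this ⊢
      constructor <;> linarith
    · rw [← hf, ← zpow_natCast, ← zpow_two_add, ha]
      have e1 := zpow_two_add_le (a := C - f) (b := C - f') (c := C + 2 * L - f) (by omega) (by omega)
      have e2 := zpow_two_mono (a := C + 2 * L - f + 1) (b := (C + 2 * L + 2 : ℕ) + -f) (by omega)
      rw [abs_le] at b3 b4 ⊢
      constructor <;> linarith
  have hb := (h.back hnear).x_le
  have := zpow_two_mono (a := (4 * L * (a + 1 + 1) : ℕ) + (k - j * T)) (b := k) (by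
    have g1 : (j:ℤ) * 1 ≤ j * T := by gcongr; exact_mod_cast hT
    have g2 : 4 * L * (a + 2) ≤ j := by omega
    have g3 := (Int.ofNat_le.mpr g2)
    rw [show a + 1 + 1 = a + 2 from rfl]
    simp only [Nat.cast_mul, Nat.cast_add, Nat.cast_ofNat] at g3 ⊢
    linarith)
  linarith

end CE

/-- `ψ` is the boundary map of `φ` in the first horizontal direction. -/
structure Half (W : ℕ) (φ : Pt → Pt) (ψ : ℝ → ℝ) : Prop where
  x_le : ∀ x y k, |(φ ⟨x, y, k⟩).x - ψ x| ≤ (2:ℝ) ^ (W + (φ ⟨x, y, k⟩).k)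
  lip : ∀ {x x' : ℝ} {k : ℤ} (y : ℝ), |x' - x| ≤ 2 ^ (k + 1) →
    |ψ x' - ψ x| ≤ (2:ℝ) ^ (W + (φ ⟨x, y, k⟩).k)
  expand : ∀ {x x' : ℝ} {k : ℤ} (y : ℝ), |x' - x| ≤ 2 ^ (k + 1) → 2 ^ k < |x' - x| →
    (2:ℝ) ^ ((φ ⟨x, y, k⟩).k - W) ≤ |ψ x' - ψ x|

lemma exists_halves (L T : ℕ) (hT : 1 ≤ T) : ∃ W : ℕ, ∀ φ φ', CE L φ φ' → Up φ T →
    ∃ ψ ψ2, Half W φ ψ ∧ Half W (fun p => sw (φ (sw p))) ψ2 := by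
  obtain ⟨C, hC⟩ : ∃ C, C = L * (T + 1) + 1 := ⟨_, rfl⟩
  obtain ⟨a, ha⟩ : ∃ a, a = C + 2 * L + 2 := ⟨_, rfl⟩
  obtain ⟨j, hj⟩ : ∃ j, j = 4 * L * (a + 2) + 3 * L := ⟨_, rfl⟩
  refine ⟨(C + 3 * L + 2) + L * (j * T + 1), fun φ φ' h hu => ?_⟩
  have h2 := h.pre_sw.post_sw
  obtain ⟨ψ, hψ⟩ := h.exists_bdry hu
  obtain ⟨ψ2, hψ2⟩ := h2.exists_bdry hu.conj_sw
  rw [← hC] at hψ hψ2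
  have key : ∀ φ φ', CE L φ φ' → Up φ T → ∀ ψ ψ2 : ℝ → ℝ,
      (∀ x y k, |(φ ⟨x, y, k⟩).x - ψ x| ≤ (2:ℝ) ^ (C + (φ ⟨x, y, k⟩).k)) →
      (∀ x y k, |(φ ⟨x, y, k⟩).y - ψ2 y| ≤ (2:ℝ) ^ (C - (φ ⟨x, y, k⟩).k)) →
      Half ((C + 3 * L + 2) + L * (j * T + 1)) φ ψ := by
    intro φ φ' h hu ψ ψ2 hψ hψ2
    refine ⟨fun x y k => (hψ x y k).trans (zpow_two_mono ?_), fun {x x' k} y hx =>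
      (h.bdry_lip hψ y hx).trans (zpow_two_mono ?_), fun {x x' k} y hx hx2 =>
      (zpow_two_mono ?_).trans (h.bdry_expand hT hu hψ hψ2 ha hj y hx hx2)⟩
    · push_cast; have : (0:ℤ) ≤ L * (j * T + 1) := by positivity
      linarith
    · push_cast; have : (0:ℤ) ≤ L * (j * T + 1) := by positivity
      linarith
    · push_cast; linarith
  refine ⟨ψ, ψ2, key φ φ' h hu ψ ψ2 hψ fun x y k => ?_,
      key _ _ h2 hu.conj_sw ψ2 ψ hψ2 fun x y k => ?_⟩
  · have := hψ2 y x (-k)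
    simpa [sw, sub_eq_add_neg] using this
  · have := hψ y x (-k)
    simpa [sw, sub_eq_add_neg] using this

lemma zpow_two_le_iff {a b : ℤ} : (2:ℝ) ^ a ≤ 2 ^ b ↔ a ≤ b := zpow_le_zpow_iff_right₀ (by norm_num)

lemma zpow_two_lt_succ (k : ℤ) : (2:ℝ) ^ k < 2 ^ (k + 1) :=
  zpow_lt_zpow_right₀ (by norm_num) (by omega)

lemma exists_zpow_two_lt {r : ℝ} (hr : 0 < r) : ∃ k : ℤ, (2:ℝ) ^ k < r ∧ r ≤ 2 ^ (k + 1) := by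
  obtain ⟨k, hk⟩ := exists_mem_Ioc_zpow hr (by norm_num : (1:ℝ) < 2)
  exact ⟨k, hk⟩

namespace Half
variable {W T : ℕ} {φ : Pt → Pt} {ψ : ℝ → ℝ}

lemma level_y (h : Half W φ ψ) (x y y' : ℝ) (k : ℤ) :
    (φ ⟨x, y, k⟩).k ≤ (φ ⟨x, y', k⟩).k + 2 * W := by
  have e : |x + (2:ℝ) ^ (k + 1) - x| = 2 ^ (k + 1) := by
    rw [add_sub_cancel_left, abs_of_pos (zpow_two_pos _)]
  have h1 := (h.expand y e.le ((zpow_two_lt_succ k).trans_eq e.symm)).trans (h.lip y' e.le)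
  rw [zpow_two_le_iff] at h1
  linarith

lemma injective (h : Half W φ ψ) : Function.Injective ψ := by
  intro x x' hx
  by_contra hne
  obtain ⟨k, hk1, hk2⟩ := exists_zpow_two_lt (r := |x' - x|) (by
    rw [abs_pos]; exact sub_ne_zero.mpr (Ne.symm hne))
  have := h.expand 0 hk2 hk1
  rw [hx, sub_self, abs_zero] at this
  exact absurd this (not_le.mpr (zpow_two_pos _))

lemma continuous (h : Half W φ ψ) (hu : Up φ T) : Continuous ψ := by
  rw [Metric.continuous_iff]
  intro x ε hε
  obtain ⟨m, hm, -⟩ := exists_zpow_two_lt hε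
  obtain ⟨i, hi⟩ : ∃ i : ℕ, (W + (φ ⟨x, 0, 0⟩).k - m) ≤ i := ⟨_, Int.self_le_toNat _⟩
  refine ⟨2 ^ ((0:ℤ) - i * T + 1), zpow_two_pos _, fun x' hx' => ?_⟩
  rw [Real.dist_eq] at hx' ⊢
  refine ((h.lip 0 hx'.le).trans (zpow_two_mono ?_)).trans_lt hm
  have := hu.iterate x 0 0 i
  linarith

lemma mono_or_anti (h : Half W φ ψ) (hu : Up φ T) : StrictMono ψ ∨ StrictAnti ψ :=
  (h.continuous hu).strictMono_of_inj h.injective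

end Half

lemma mul_le_abs_sub {ψ : ℝ → ℝ} (hψ : StrictMono ψ ∨ StrictAnti ψ) {s c d : ℝ} (hs : 0 ≤ s)
    (hc : ∀ x, c ≤ |ψ (x + s) - ψ x|) (hd : ∀ x, |ψ (x + s) - ψ x| ≤ d) (n : ℕ) :
    n * c ≤ |ψ (n * s) - ψ 0| ∧ |ψ (n * s) - ψ 0| ≤ n * d := by
  have key : ∀ g : ℝ → ℝ, StrictMono g → (∀ x, c ≤ |g (x + s) - g x|) → (∀ x,
      |g (x + s) - g x| ≤ d) →
      n * c ≤ |g (n * s) - g 0| ∧ |g (n * s) - g 0| ≤ n * d := by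
    intro g hg hc hd
    rw [abs_of_nonneg (sub_nonneg.mpr (hg.monotone (by positivity)))]
    induction n with
    | zero => simp
    | succ n ih =>
      have h1 := hc (n * s)
      have h2 := hd (n * s)
      rw [abs_of_nonneg (sub_nonneg.mpr (hg.monotone (by linarith)))] at h1 h2
      push_cast
      rw [add_one_mul, add_one_mul, add_one_mul]
      constructor <;> linarith
  rcases hψ with hψ | hψ
  · exact key ψ hψ hc hd
  · have := key (fun x => -ψ x) hψ.neg (fun x => by rw [← abs_neg]; convert hc x using 2; ring)
      (fun x => by rw [← abs_neg]; convert hd x using 2; ring)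
    rw [← abs_neg (ψ (n * s) - ψ 0)]
    rwa [show -ψ (n * s) - -ψ 0 = -(ψ (n * s) - ψ 0) by ring] at this

lemma Half.level {W T : ℕ} {φ : Pt → Pt} {ψ : ℝ → ℝ} (h : Half W φ ψ) (hu : Up φ T)
    (hx : ∀ x k, |(φ ⟨x, 0, k⟩).k - (φ ⟨0, 0, k⟩).k| ≤ 2 * W) (k : ℤ) (n : ℕ) :
    |(φ ⟨0, 0, k + n⟩).k - (φ ⟨0, 0, k⟩).k - n| ≤ 4 * W := by
  have e : ∀ x : ℝ, |x + (2:ℝ) ^ (k + 1) - x| = 2 ^ (k + 1) := fun x => by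
    rw [add_sub_cancel_left, abs_of_pos (zpow_two_pos _)]
  obtain ⟨h1, h2⟩ := mul_le_abs_sub (h.mono_or_anti hu) (s := 2 ^ (k + 1))
    (c := 2 ^ ((φ ⟨0, 0, k⟩).k - 3 * W)) (d := 2 ^ (3 * W + (φ ⟨0, 0, k⟩).k)) (zpow_two_pos _).le
    (fun x => (zpow_two_mono (by have := hx x k; rw [abs_le] at this; linarith)).trans
      (h.expand 0 (e x).le ((zpow_two_lt_succ k).trans_eq (e x).symm)))
    (fun x => (h.lip 0 (e x).le).trans
      (zpow_two_mono (by have := hx x k; rw [abs_le] at this; linarith))) (2 ^ n)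
  have e2 : |((2 ^ n : ℕ) : ℝ) * 2 ^ (k + 1) - 0| = 2 ^ (k + n + 1) := by
    rw [sub_zero, abs_of_pos (by positivity)]
    push_cast
    rw [← zpow_natCast, ← zpow_two_add]; congr 1; ring
  have h3 := h1.trans (h.lip 0 (k := k + n) e2.le)
  have h4 := (h.expand 0 (k := k + n) e2.le ((zpow_two_lt_succ _).trans_eq e2.symm)).trans h2
  push_cast at h3 h4
  rw [← zpow_natCast, ← zpow_two_add, zpow_two_le_iff] at h3 h4
  rw [abs_le]
  constructor <;> linarith

lemma Half.bilip {W D : ℕ} {φ : Pt → Pt} {ψ : ℝ → ℝ} {κ : ℤ} (h : Half W φ ψ)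
    (hk : ∀ p, |(φ p).k - (p.k + κ)| ≤ D) (x x' : ℝ) :
    (2:ℝ) ^ (κ - (W + D + 1)) * |x' - x| ≤ |ψ x' - ψ x| ∧
    |ψ x' - ψ x| ≤ (2:ℝ) ^ (κ + (W + D + 1)) * |x' - x| := by
  rcases eq_or_ne x x' with rfl | hne
  · simp
  obtain ⟨k, hk1, hk2⟩ := exists_zpow_two_lt (r := |x' - x|) (by
    rw [abs_pos]; exact sub_ne_zero.mpr (Ne.symm hne))
  have h1 := h.expand 0 hk2 hk1
  have h2 := h.lip 0 hk2
  have h3 := hk ⟨x, 0, k⟩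
  rw [abs_le] at h3
  simp only at h3
  constructor
  · refine le_trans ?_ h1
    calc (2:ℝ) ^ (κ - (W + D + 1)) * |x' - x| ≤ 2 ^ (κ - (W + D + 1)) * 2 ^ (k + 1) := by gcongr
      _ ≤ _ := by rw [← zpow_two_add]; apply zpow_two_mono; linarith
  · refine h2.trans ?_
    calc (2:ℝ) ^ (W + (φ ⟨x, 0, k⟩).k) ≤ 2 ^ (κ + (W + D + 1)) * 2 ^ k := by
          rw [← zpow_two_add]; apply zpow_two_mono; linarith
      _ ≤ _ := by gcongr

/-- The boundary data of a coarse equivalence of translation length `κ`. -/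
structure Bd (C : ℕ) (φ : Pt → Pt) (κ : ℤ) (ψ₁ ψ₂ : ℝ → ℝ) : Prop where
  k_le : ∀ p, |(φ p).k - (p.k + κ)| ≤ C
  x_le : ∀ p, |(φ p).x - ψ₁ p.x| ≤ (2:ℝ) ^ (C + (p.k + κ))
  y_le : ∀ p, |(φ p).y - ψ₂ p.y| ≤ (2:ℝ) ^ (C - (p.k + κ))
  lip₁ : ∀ x x', |ψ₁ x' - ψ₁ x| ≤ (2:ℝ) ^ (κ + C) * |x' - x|
  expand₁ : ∀ x x', (2:ℝ) ^ (κ - C) * |x' - x| ≤ |ψ₁ x' - ψ₁ x|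
  lip₂ : ∀ x x', |ψ₂ x' - ψ₂ x| ≤ (2:ℝ) ^ (-κ + C) * |x' - x|
  expand₂ : ∀ x x', (2:ℝ) ^ (-κ - C) * |x' - x| ≤ |ψ₂ x' - ψ₂ x|

theorem exists_bd (L T : ℕ) (hT : 1 ≤ T) : ∃ C : ℕ, ∀ φ φ', CE L φ φ' → Up φ T →
    ∃ ψ₁ ψ₂, Bd C φ (φ ⟨0, 0, 0⟩).k ψ₁ ψ₂ := by
  obtain ⟨W, hW⟩ := exists_halves L T hT
  refine ⟨10 * W + 1, fun φ φ' h hu => ?_⟩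
  obtain ⟨ψ₁, ψ₂, h1, h2⟩ := hW φ φ' h hu
  have hx : ∀ x x' y k, (φ ⟨x, y, k⟩).k ≤ (φ ⟨x', y, k⟩).k + 2 * W := fun x x' y k => by
    have := h2.level_y y x' x (-k)
    simp only [sw, neg_neg] at this
    linarith
  have hy := h1.level_y
  have hlev : ∀ k : ℤ, |(φ ⟨0, 0, k⟩).k - (k + (φ ⟨0, 0, 0⟩).k)| ≤ 4 * W := fun k => by
    have hl := h1.level hu (fun x k => by rw [abs_le]; constructor <;> linarith [hx x 0 0 k, hx 0 x 0 k])
    rcases le_total 0 k with hk | hk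
    · have := hl 0 k.toNat
      rw [Int.toNat_of_nonneg hk, zero_add] at this
      rw [abs_le] at this ⊢; constructor <;> linarith
    · have := hl k (-k).toNat
      rw [Int.toNat_of_nonneg (by omega), add_neg_cancel] at this
      rw [abs_le] at this ⊢; constructor <;> linarith
  have hk : ∀ p, |(φ p).k - (p.k + (φ ⟨0, 0, 0⟩).k)| ≤ (8 * W : ℕ) := fun ⟨x, y, k⟩ => by
    have := hlev k
    rw [abs_le] at this ⊢
    push_cast
    constructor <;> linarith [hx x 0 y k, hx 0 x y k, hy 0 y 0 k, hy 0 0 y k]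
  have hk2 : ∀ p, |((fun p => sw (φ (sw p))) p).k - (p.k + -(φ ⟨0, 0,
      0⟩).k)| ≤ (8 * W : ℕ) := fun p => by
    have := hk (sw p)
    simp only [sw_k] at this ⊢
    rw [← abs_neg]; convert this using 2; ring
  have b1 := h1.bilip hk
  have b2 := h2.bilip hk2
  have eC : ((10 * W + 1 : ℕ) : ℤ) = 10 * W + 1 := by push_cast; ring
  refine ⟨ψ₁, ψ₂, fun p => (hk p).trans (by push_cast; linarith), fun p => ?_, fun p => ?_,
    fun x x' => (b1 x x').2.trans ?_, fun x x' => le_trans ?_ (b1 x x').1,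
    fun x x' => (b2 x x').2.trans ?_, fun x x' => le_trans ?_ (b2 x x').1⟩
  · refine (h1.x_le p.x p.y p.k).trans (zpow_two_mono ?_)
    have := hk p; rw [abs_le] at this; push_cast at this ⊢; linarith
  · have := h2.x_le p.y p.x (-p.k)
    simp only [sw, neg_neg] at this
    refine this.trans (zpow_two_mono ?_)
    have := hk p; rw [abs_le] at this; push_cast at this ⊢; linarith
  all_goals
    gcongr
    · norm_num
    · push_cast; linarith

/-- A quasi-action of `Γ` on the model by left translation, in orbit form. -/
structure QA (Γ : Type*) [Group Γ] (f : Γ → Pt) (A : ℕ) : Prop where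
  near_mul : ∀ n a b, Near n (f a) (f b) → ∀ γ, Near (A * (n + 1)) (f (γ * a)) (f (γ * b))
  onto : ∀ p, ∃ a, Near A (f a) p
  finite : ∀ n p, {γ | Near n p (f γ)}.Finite

namespace QA
variable {Γ : Type*} [Group Γ] {f : Γ → Pt} {A : ℕ}

/-- A coarse inverse of the orbit map. -/
def inv (h : QA Γ f A) (p : Pt) : Γ := (h.onto p).choose

lemma inv_near (h : QA Γ f A) (p : Pt) : Near A (f (h.inv p)) p := (h.onto p).choose_spec

/-- The coarse equivalence of the model by which `γ` acts. -/
def act (h : QA Γ f A) (γ : Γ) (p : Pt) : Pt := f (γ * h.inv p)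

lemma act_near (h : QA Γ f A) (γ a : Γ) : Near (A * (A + 1)) (h.act γ (f a)) (f (γ * a)) :=
  h.near_mul _ _ _ (h.inv_near (f a)) γ

lemma act_mul (h : QA Γ f A) (γ γ' : Γ) (p : Pt) :
    Near (A * (A + 1)) (h.act γ (h.act γ' p)) (h.act (γ * γ') p) := by
  have := h.act_near γ (γ' * h.inv p)
  rwa [← mul_assoc] at this

lemma act_one (h : QA Γ f A) (p : Pt) : Near A (h.act 1 p) p := by
  have := h.inv_near p
  rwa [act, one_mul]

lemma ce (h : QA Γ f A) (γ : Γ) : CE (A * (3 * A + 1) + A) (h.act γ) (h.act γ⁻¹) := by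
  have fwd : ∀ γ n p q, Near n p q → Near ((A * (3 * A + 1) + A) * (n + 1)) (h.act γ p) (h.act γ q) := by
    intro γ n p q hn
    have h1 := near_trans (near_trans (h.inv_near p) hn) (near_symm (h.inv_near q))
    refine near_mono ?_ (h.near_mul _ _ _ h1 γ)
    nlinarith [Nat.zero_le (A * A * n), Nat.zero_le (A * n)]
  have left : ∀ γ p, Near (A * (3 * A + 1) + A) (h.act γ⁻¹ (h.act γ p)) p := by
    intro γ p
    have h1 := near_trans (h.act_mul γ⁻¹ γ p) (by rw [inv_mul_cancel]; exact h.act_one p)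
    refine near_mono ?_ h1
    nlinarith [Nat.zero_le (A * A)]
  refine ⟨fwd γ, fwd γ⁻¹, left γ, fun q => ?_⟩
  have := left γ⁻¹ q
  rwa [inv_inv] at this

lemma exists_card_le (h : QA Γ f A) : ∃ M : ℕ, ∀ (s : Finset Γ) (c : ℤ × ℤ × ℤ),
    (∀ γ ∈ s, cell (f γ) = c) → s.card ≤ M := by
  refine ⟨(h.finite (A * 2) (f 1)).toFinset.card, fun s c hs => ?_⟩
  rcases s.eq_empty_or_nonempty with rfl | ⟨a, ha⟩
  · simp
  refine Finset.card_le_card_of_injOn (fun γ => a⁻¹ * γ) (fun γ hγ => ?_)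
    (fun x _ y _ hxy => mul_left_cancel hxy)
  rw [Set.Finite.coe_toFinset]
  have h1 : Near 1 (f a) (f γ) := near_of_cell_eq ((hs a ha).trans (hs γ hγ).symm)
  have h2 := h.near_mul _ _ _ h1 a⁻¹
  rwa [inv_mul_cancel] at h2

lemma sw (h : QA Γ f A) : QA Γ (fun γ => SolQI.sw (f γ)) A where
  near_mul n a b hn γ := near_sw (h.near_mul n a b (by simpa using near_sw hn) γ)
  onto p := by
    obtain ⟨a, ha⟩ := h.onto (SolQI.sw p)
    exact ⟨a, by simpa using near_sw ha⟩
  finite n p := (h.finite n (SolQI.sw p)).subset fun γ hγ => by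
    have h1 : Near n p (SolQI.sw (f γ)) := hγ
    simpa using near_sw h1

/-- The orbit points in a large box. -/
def box (f : Γ → Pt) (n : ℕ) : Set Γ := {γ | |(f γ).k| ≤ n ∧ |(f γ).x| ≤ 4 ^ n ∧ |(f γ).y| ≤ 4 ^ n}

lemma box_finite (h : QA Γ f A) (n : ℕ) : (box f n).Finite := by
  refine (h.finite (2 * n + 1) ⟨0, 0, 0⟩).subset fun γ hγ => ?_
  obtain ⟨h1, h2, h3⟩ := hγ
  have e : (4:ℝ) ^ n = 2 ^ (2 * n) := by rw [pow_mul]; norm_num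
  refine near_of_bounds ?_ ?_ ?_
  · simp only [sub_zero]; push_cast; linarith
  · simpa [← e] using h2
  · simpa [← e] using h3

end QA

lemma exists_near (p q : Pt) : ∃ n, Near n p q := by
  obtain ⟨a, ha⟩ := pow_unbounded_of_one_lt (|q.x - p.x| * (2:ℝ) ^ (-p.k)) one_lt_two
  obtain ⟨b, hb⟩ := pow_unbounded_of_one_lt (|q.y - p.y| * (2:ℝ) ^ p.k) one_lt_two
  have hp := zpow_two_pos p.k
  have hn := zpow_two_pos (-p.k)
  have h1 := mul_le_mul_of_nonneg_right ha.le hp.le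
  have h2 := mul_le_mul_of_nonneg_right hb.le hn.le
  rw [mul_assoc, zpow_two_neg_mul, mul_one] at h1
  rw [mul_assoc, zpow_two_mul_neg, mul_one] at h2
  refine ⟨a + b + (q.k - p.k).natAbs + 1,
      near_of_bounds (by push_cast; omega) (h1.trans ?_) (h2.trans ?_)⟩
    <;> gcongr <;> first | omega | norm_num

lemma card_le_levels {ι : Type*} (s : Finset ι) (g : ι → ℤ) (K : Finset ℤ) (B : ℝ)
    (hK : ∀ i ∈ s, g i ∈ K) (h : ∀ k ∈ K, ((s.filter fun i => g i = k).card : ℝ) ≤ B) :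
    (s.card : ℝ) ≤ K.card * B := by
  rw [Finset.card_eq_sum_card_fiberwise hK]
  push_cast
  refine (Finset.sum_le_sum h).trans ?_
  simp

namespace QA
variable {Γ : Type*} [Group Γ] {f : Γ → Pt} {A M : ℕ}

/-- The finite set of orbit points in a large box. -/
def boxF (h : QA Γ f A) (n : ℕ) : Finset Γ := (h.box_finite n).toFinset

lemma mem_boxF (h : QA Γ f A) {n : ℕ} {γ : Γ} :
    γ ∈ h.boxF n ↔ |(f γ).k| ≤ n ∧ |(f γ).x| ≤ 4 ^ n ∧ |(f γ).y| ≤ 4 ^ n := by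
  simp [boxF, box]

lemma card_shell_le (h : QA Γ f A) (hM : ∀ (s : Finset Γ) (c : ℤ × ℤ × ℤ),
    (∀ γ ∈ s, cell (f γ) = c) → s.card ≤ M) (n r : ℕ) (s : Finset Γ) (hs : s ⊆ h.boxF n)
    (hx : ∀ γ ∈ s, (4:ℝ) ^ n - 2 ^ r * (2:ℝ) ^ (f γ).k < |(f γ).x|) :
    (s.card : ℝ) ≤ 64 * M * 2 ^ r * 16 ^ n := by
  classical
  have key : ∀ t ⊆ s, (∃ σ : ℝ, (σ = 1 ∨ σ = -1) ∧ ∀ γ ∈ t, |(f γ).x| = σ * (f γ).x) →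
      (t.card : ℝ) ≤ ((Finset.Icc (-(n:ℤ)) n).card : ℝ) * (16 * M * 2 ^ r * 8 ^ n) := by
    rintro t ht ⟨σ, hσ, hσt⟩
    refine card_le_levels t (fun γ => (f γ).k) _ _ (fun γ hγ => ?_) fun k hk => ?_
    · have := (h.mem_boxF.1 (hs (ht hγ))).1
      rw [abs_le] at this; rw [Finset.mem_Icc]; exact this
    rw [Finset.mem_Icc] at hk
    have hk' : (2:ℝ) ^ k ≤ 2 ^ n := by
      rw [← zpow_natCast]; exact zpow_two_mono hk.2
    have hkl : 1 ≤ (4:ℝ) ^ n * (2:ℝ) ^ k := by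
      have : (4:ℝ) ^ n * (2:ℝ) ^ k = 2 ^ (2 * (n:ℤ) + k) := by
        rw [zpow_two_add, zpow_mul]; norm_num
      rw [this]; exact one_le_zpow₀ (by norm_num) (by omega)
    have h8 : (4:ℝ) ^ n * 2 ^ n = 8 ^ n := by rw [← mul_pow]; norm_num
    have hr := one_le_two_pow_real r
    have hcard := card_box (t.filter fun γ => (f γ).k = k) f M (σ * 4 ^ n) 0 (2 ^ r)
      ((4:ℝ) ^ n * (2:ℝ) ^ k) k (by positivity) (by positivity)
      (fun γ hγ => (Finset.mem_filter.1 hγ).2) (fun γ hγ => ?_) (fun γ hγ => ?_)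
      (fun c => hM _ c fun γ hγ => (Finset.mem_filter.1 hγ).2)
    · refine hcard.trans ?_
      have e1 : (2 * (2:ℝ) ^ r + 2) ≤ 4 * 2 ^ r := by linarith
      have e2 : 2 * ((4:ℝ) ^ n * (2:ℝ) ^ k) + 2 ≤ 4 * 8 ^ n := by
        rw [← h8]
        have := mul_le_mul_of_nonneg_left hk' (by positivity : (0:ℝ) ≤ 4 ^ n)
        linarith
      calc (M:ℝ) * ((2 * 2 ^ r + 2) * (2 * ((4:ℝ) ^ n * (2:ℝ) ^ k) + 2))
          ≤ M * ((4 * 2 ^ r) * (4 * 8 ^ n)) := by gcongr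
        _ = _ := by ring
    · obtain ⟨hγt, hγk⟩ := Finset.mem_filter.1 hγ
      have h1 := hx γ (ht hγt)
      have h2 := (h.mem_boxF.1 (hs (ht hγt))).2.1
      rw [hσt γ hγt] at h1 h2
      rw [hγk] at h1
      rcases hσ with rfl | rfl <;> rw [abs_le] <;> constructor <;>
        nlinarith [zpow_two_pos k]
    · obtain ⟨hγt, hγk⟩ := Finset.mem_filter.1 hγ
      have h2 := (h.mem_boxF.1 (hs (ht hγt))).2.2
      rw [mul_assoc, zpow_two_mul_neg, mul_one, sub_zero]
      exact h2
  have h1 := key (s.filter fun γ => 0 ≤ (f γ).x) (Finset.filter_subset _ _)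
    ⟨1, Or.inl rfl, fun γ hγ => by rw [abs_of_nonneg (Finset.mem_filter.1 hγ).2, one_mul]⟩
  have h2 := key (s.filter fun γ => ¬ 0 ≤ (f γ).x) (Finset.filter_subset _ _)
    ⟨-1, Or.inr rfl, fun γ hγ => by
      rw [abs_of_neg (not_le.1 (Finset.mem_filter.1 hγ).2), neg_one_mul]⟩
  have h3 : ((s.filter fun γ => 0 ≤ (f γ).x).card : ℝ) + (s.filter fun γ => ¬ 0 ≤ (f γ).x).card
      = s.card := by
    exact_mod_cast Finset.card_filter_add_card_filter_not _
  have h4 : ((Finset.Icc (-(n:ℤ)) n).card : ℝ) ≤ 2 * 2 ^ n := by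
    have : (Finset.Icc (-(n:ℤ)) n).card ≤ 2 * 2 ^ n := by
      rw [Int.card_Icc]
      have := @Nat.lt_two_pow_self n
      omega
    exact_mod_cast this
  have h5 := mul_le_mul_of_nonneg_right h4 (by positivity : (0:ℝ) ≤ 16 * M * 2 ^ r * 8 ^ n)
  have h6 : (2:ℝ) ^ n * 8 ^ n = 16 ^ n := by rw [← mul_pow]; norm_num
  rw [← h3, ← h6]
  linarith

lemma card_cap_le (h : QA Γ f A) (hM : ∀ (s : Finset Γ) (c : ℤ × ℤ × ℤ),
    (∀ γ ∈ s, cell (f γ) = c) → s.card ≤ M) (n r : ℕ) (s : Finset Γ) (hs : s ⊆ h.boxF n)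
    (hx : ∀ γ ∈ s, (n:ℤ) - r < |(f γ).k|) :
    (s.card : ℝ) ≤ 2 * r * (16 * M * 16 ^ n) := by
  classical
  have h1 : (s.card : ℝ) ≤
      ((Finset.Icc (-(n:ℤ)) (-n + r - 1) ∪ Finset.Icc ((n:ℤ) - r + 1) n).card : ℝ) *
        (16 * M * 16 ^ n) := by
    refine card_le_levels s (fun γ => (f γ).k) _ _ (fun γ hγ => ?_) fun k hk => ?_
    · have h1 := (h.mem_boxF.1 (hs hγ)).1
      have h2 := hx γ hγ
      rw [abs_le] at h1; rw [lt_abs] at h2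
      rw [Finset.mem_union, Finset.mem_Icc, Finset.mem_Icc]; omega
    rcases (s.filter fun γ => (f γ).k = k).eq_empty_or_nonempty with h0 | ⟨γ₀, hγ₀⟩
    · rw [h0, Finset.card_empty, Nat.cast_zero]; positivity
    obtain ⟨hγs, rfl⟩ := Finset.mem_filter.1 hγ₀
    obtain ⟨k, hkk⟩ : ∃ k, k = (f γ₀).k := ⟨_, rfl⟩
    have hk := abs_le.1 (h.mem_boxF.1 (hs hγs)).1
    rw [← hkk] at hk ⊢
    have hkl : ∀ j : ℤ, -(n:ℤ) ≤ j → 1 ≤ (4:ℝ) ^ n * (2:ℝ) ^ j := by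
      intro j hj
      have : (4:ℝ) ^ n * (2:ℝ) ^ j = 2 ^ (2 * (n:ℤ) + j) := by
        rw [zpow_two_add, zpow_mul]; norm_num
      rw [this]; exact one_le_zpow₀ (by norm_num) (by omega)
    have hcard := card_box (s.filter fun γ => (f γ).k = k) f M 0 0 ((4:ℝ) ^ n * (2:ℝ) ^ (-k))
      ((4:ℝ) ^ n * (2:ℝ) ^ k) k (by positivity) (by positivity)
      (fun γ hγ => (Finset.mem_filter.1 hγ).2) (fun γ hγ => ?_) (fun γ hγ => ?_)
      (fun c => hM _ c fun γ hγ => (Finset.mem_filter.1 hγ).2)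
    · refine hcard.trans ?_
      have e1 := hkl (-k) (by omega)
      have e2 := hkl k (by omega)
      have e3 : (16:ℝ) ^ n = 4 ^ n * 4 ^ n := by rw [← mul_pow]; norm_num
      calc (M:ℝ) * ((2 * ((4:ℝ) ^ n * (2:ℝ) ^ (-k)) + 2) * (2 * ((4:ℝ) ^ n * (2:ℝ) ^ k) + 2))
          ≤ M * ((4 * ((4:ℝ) ^ n * (2:ℝ) ^ (-k))) * (4 * ((4:ℝ) ^ n * (2:ℝ) ^ k))) := by
            gcongr <;> linarith
        _ = 16 * M * (4 ^ n * 4 ^ n) * ((2:ℝ) ^ k * (2:ℝ) ^ (-k)) := by ring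
        _ = _ := by rw [zpow_two_mul_neg, e3, mul_one]
    · have h2 := (h.mem_boxF.1 (hs (Finset.mem_filter.1 hγ).1)).2.1
      rw [mul_assoc, zpow_two_neg_mul, mul_one, sub_zero]
      exact h2
    · have h2 := (h.mem_boxF.1 (hs (Finset.mem_filter.1 hγ).1)).2.2
      rw [mul_assoc, zpow_two_mul_neg, mul_one, sub_zero]
      exact h2
  refine h1.trans ?_
  gcongr
  have : (Finset.Icc (-(n:ℤ)) (-n + r - 1) ∪ Finset.Icc ((n:ℤ) - r + 1) n).card ≤ 2 * r := by
    refine (Finset.card_union_le _ _).trans ?_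
    rw [Int.card_Icc, Int.card_Icc]; omega
  exact_mod_cast this

lemma exists_near_mul_right (h : QA Γ f A) (γ' : Γ) : ∃ r, ∀ γ, Near r (f γ) (f (γ * γ')) := by
  obtain ⟨n, hn⟩ := exists_near (f 1) (f γ')
  exact ⟨_, fun γ => by simpa using h.near_mul n 1 γ' hn γ⟩

lemma card_boundary_le (h : QA Γ f A) (γ' : Γ) : ∃ C : ℝ, ∀ n, ∀ s ⊆ h.boxF n,
    (∀ γ ∈ s, γ * γ' ∉ h.boxF n) → (s.card : ℝ) ≤ C * 16 ^ n := by
  classical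
  obtain ⟨r, hr⟩ := h.exists_near_mul_right γ'
  obtain ⟨M, hM⟩ := h.exists_card_le
  obtain ⟨M', hM'⟩ := h.sw.exists_card_le
  refine ⟨32 * r * M + 64 * M * 2 ^ r + 64 * M' * 2 ^ r, fun n s hs hs' => ?_⟩
  have e1 := h.card_cap_le hM n r (s.filter fun γ => (n:ℤ) - r < |(f γ).k|)
    ((Finset.filter_subset _ _).trans hs) fun γ hγ => (Finset.mem_filter.1 hγ).2
  have e2 := h.card_shell_le hM n r
    (s.filter fun γ => (4:ℝ) ^ n - 2 ^ r * (2:ℝ) ^ (f γ).k < |(f γ).x|)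
    ((Finset.filter_subset _ _).trans hs) fun γ hγ => (Finset.mem_filter.1 hγ).2
  have e3 := h.sw.card_shell_le hM' n r
    (s.filter fun γ => (4:ℝ) ^ n - 2 ^ r * (2:ℝ) ^ (-(f γ).k) < |(f γ).y|)
    (fun γ hγ => by
      have := h.mem_boxF.1 (hs (Finset.mem_filter.1 hγ).1)
      rw [mem_boxF]; simp only [SolQI.sw, abs_neg]; tauto) fun γ hγ => (Finset.mem_filter.1 hγ).2
  have hsub : s ⊆ (s.filter fun γ => (n:ℤ) - r < |(f γ).k|) ∪
      ((s.filter fun γ => (4:ℝ) ^ n - 2 ^ r * (2:ℝ) ^ (f γ).k < |(f γ).x|) ∪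
      (s.filter fun γ => (4:ℝ) ^ n - 2 ^ r * (2:ℝ) ^ (-(f γ).k) < |(f γ).y|)) := by
    intro γ hγ
    by_contra hcon
    simp only [Finset.mem_union, Finset.mem_filter, hγ, true_and, not_or, not_lt] at hcon
    obtain ⟨c1, c2, c3⟩ := hcon
    refine hs' γ hγ (h.mem_boxF.2 ⟨?_, ?_, ?_⟩)
    · have := (hr γ).k_le
      rw [abs_le] at *; omega
    · have := (hr γ).x_le
      rw [zpow_two_add, zpow_natCast] at this
      rw [abs_le] at *; constructor <;> linarith
    · have := (hr γ).y_le
      rw [sub_eq_add_neg (r:ℤ), zpow_two_add, zpow_natCast] at this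
      rw [abs_le] at *; constructor <;> linarith
  have e4 := Finset.card_le_card hsub
  have e5 := e4.trans (Finset.card_union_le _ _)
  have e6 := e5.trans (Nat.add_le_add_left (Finset.card_union_le _ _) _)
  have e7 : (s.card : ℝ) ≤ _ := Nat.cast_le.2 e6
  rw [Nat.cast_add, Nat.cast_add] at e7
  linarith

end QA

namespace QA
variable {Γ : Type*} [Group Γ] {f : Γ → Pt} {A M : ℕ}

lemma le_card_boxF (h : QA Γ f A) (N n : ℕ) (hn : n = (2 * A + 1) * (N + 3)) :
    N * 2 ^ (4 * n - 8 * A - 6) ≤ (h.boxF n).card := by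
  classical
  obtain ⟨lv, hlv⟩ : ∃ lv : ℕ → ℕ, lv = fun κ => (2 * A + 1) * κ := ⟨_, rfl⟩
  have hlv' : ∀ κ ∈ Finset.Icc 1 N, lv κ + 6 * A + 3 ≤ n := by
    intro κ hκ
    rw [Finset.mem_Icc] at hκ
    have := Nat.mul_le_mul_left (2 * A + 1) hκ.2
    rw [hlv, hn]; simp only; linarith
  obtain ⟨D, hD⟩ : ∃ D : Finset (Σ _ : ℕ, ℕ × ℕ), D = (Finset.Icc 1 N).sigma fun κ =>
    Finset.range (2 ^ (2 * n - lv κ - (4 * A + 3))) ×ˢ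
      Finset.range (2 ^ (2 * n + lv κ - (4 * A + 3))) := ⟨_, rfl⟩
  have hDc : D.card = N * 2 ^ (4 * n - 8 * A - 6) := by
    rw [hD, Finset.card_sigma, Finset.sum_congr rfl fun κ hκ => ?_, Finset.sum_const,
      Nat.card_Icc, smul_eq_mul, Nat.add_sub_cancel]
    rw [Finset.card_product, Finset.card_range, Finset.card_range, ← pow_add]
    congr 1
    have := hlv' κ hκ
    omega
  obtain ⟨P, hP⟩ : ∃ P : (Σ _ : ℕ, ℕ × ℕ) → Pt, P = fun d =>
    ⟨d.2.1 * (2:ℝ) ^ (4 * A + 2 + lv d.1 : ℤ), d.2.2 * (2:ℝ) ^ (4 * A + 2 - lv d.1 : ℤ), lv d.1⟩ :=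
    ⟨_, rfl⟩
  have hb : ∀ d, |(f (h.inv (P d))).k - lv d.1| ≤ A ∧
      |(f (h.inv (P d))).x - (P d).x| ≤ (2:ℝ) ^ (2 * A + lv d.1 : ℤ) ∧
      |(f (h.inv (P d))).y - (P d).y| ≤ (2:ℝ) ^ (2 * A - lv d.1 : ℤ) := by
    intro d
    have h1 := h.inv_near (P d)
    have hk : |(f (h.inv (P d))).k - lv d.1| ≤ A := by
      have := h1.k_le
      rw [abs_sub_comm]; simpa [hP] using this
    have hk' := abs_le.1 hk
    refine ⟨hk, ?_, ?_⟩
    · rw [abs_sub_comm]; exact h1.x_le.trans (zpow_two_mono (by omega))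
    · rw [abs_sub_comm]; exact h1.y_le.trans (zpow_two_mono (by omega))
  rw [← hDc]
  refine Finset.card_le_card_of_injOn (fun d => h.inv (P d)) (fun d hd => ?_) ?_
  · rw [Finset.mem_coe, hD, Finset.mem_sigma, Finset.mem_product, Finset.mem_range,
      Finset.mem_range] at hd
    obtain ⟨h1, h2, h3⟩ := hd
    have h4 := hlv' _ h1
    obtain ⟨b1, b2, b3⟩ := hb d
    have e4 : (4:ℝ) ^ n = 2 ^ (2 * n - 1 + 1 : ℤ) := by
      rw [sub_add_cancel, zpow_mul, zpow_natCast]; norm_num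
    have x1 : |(P d).x| ≤ (2:ℝ) ^ (2 * n - 1 : ℤ) := by
      rw [hP, abs_of_nonneg (by positivity)]
      have : (d.2.1 : ℝ) ≤ 2 ^ (2 * n - lv d.1 - (4 * A + 3)) := by exact_mod_cast h2.le
      calc _ ≤ (2:ℝ) ^ (2 * n - lv d.1 - (4 * A + 3)) * (2:ℝ) ^ (4 * A + 2 + lv d.1 : ℤ) :=
            mul_le_mul_of_nonneg_right this (zpow_two_pos _).le
        _ = _ := by rw [← zpow_natCast, ← zpow_two_add]; congr 1; omega
    have y1 : |(P d).y| ≤ (2:ℝ) ^ (2 * n - 1 : ℤ) := by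
      rw [hP, abs_of_nonneg (by positivity)]
      have : (d.2.2 : ℝ) ≤ 2 ^ (2 * n + lv d.1 - (4 * A + 3)) := by exact_mod_cast h3.le
      calc _ ≤ (2:ℝ) ^ (2 * n + lv d.1 - (4 * A + 3)) * (2:ℝ) ^ (4 * A + 2 - lv d.1 : ℤ) :=
            mul_le_mul_of_nonneg_right this (zpow_two_pos _).le
        _ = _ := by rw [← zpow_natCast, ← zpow_two_add]; congr 1; omega
    rw [Finset.mem_coe, h.mem_boxF, e4]
    refine ⟨?_, ?_, ?_⟩
    · rw [abs_le] at b1 ⊢; simp only; omega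
    · have := zpow_two_add_le (a := 2 * A + lv d.1) (b := 2 * n - 1) (c := 2 * n - 1) (by omega) le_rfl
      have h5 := abs_add_le ((f (h.inv (P d))).x - (P d).x) (P d).x
      rw [sub_add_cancel] at h5
      linarith
    · have := zpow_two_add_le (a := 2 * A - lv d.1) (b := 2 * n - 1) (c := 2 * n - 1) (by omega) le_rfl
      have h5 := abs_add_le ((f (h.inv (P d))).y - (P d).y) (P d).y
      rw [sub_add_cancel] at h5
      linarith
  · have grid : ∀ (i j : ℕ) (e : ℤ) (c : ℝ), |c - i * (2:ℝ) ^ (4 * A + 2 + e : ℤ)| ≤ (2:ℝ) ^ (2 * A + e) →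
        |c - j * (2:ℝ) ^ (4 * A + 2 + e : ℤ)| ≤ (2:ℝ) ^ (2 * A + e) → i = j := by
      intro i j e c h1 h2
      have h3 : (2:ℝ) ^ (2 * A + e) + (2:ℝ) ^ (2 * A + e) < (2:ℝ) ^ (4 * A + 2 + e : ℤ) :=
        (zpow_two_add_le le_rfl le_rfl).trans_lt (zpow_lt_zpow_right₀ (by norm_num) (by omega))
      have h4 : |((i:ℤ) - j : ℤ) * (2:ℝ) ^ (4 * A + 2 + e : ℤ)| < 1 * (2:ℝ) ^ (4 * A + 2 + e : ℤ) := by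
        push_cast
        rw [abs_le] at h1 h2; rw [abs_lt, one_mul]; constructor <;> linarith
      rw [abs_mul, abs_of_pos (zpow_two_pos _), mul_lt_mul_iff_left₀ (zpow_two_pos _)] at h4
      have h5 : |(i:ℤ) - j| < 1 := by exact_mod_cast h4
      rw [abs_lt] at h5; omega
    rintro ⟨κ, i, j⟩ hd ⟨κ', i', j'⟩ hd' heq
    obtain ⟨b1, b2, b3⟩ := hb ⟨κ, i, j⟩
    obtain ⟨c1, c2, c3⟩ := hb ⟨κ', i', j'⟩
    simp only at heq
    rw [← heq] at c1 c2 c3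
    have hκ : κ = κ' := by
      simp only [hlv] at b1 c1
      rw [abs_le] at b1 c1
      push_cast at b1 c1
      have h1 : (2 * (A:ℤ) + 1) * (κ - κ') < (2 * A + 1) * 1 := by linarith
      have h2 : (2 * (A:ℤ) + 1) * (κ' - κ) < (2 * A + 1) * 1 := by linarith
      have h3 := lt_of_mul_lt_mul_left h1 (by positivity)
      have h4 := lt_of_mul_lt_mul_left h2 (by positivity)
      omega
    subst hκ
    rw [hP] at b2 b3 c2 c3
    have h1 := grid i i' (lv κ) _ b2 c2
    have h2 := grid j j' (-lv κ) _ b3 c3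
    rw [h1, h2]

/-- Averages over the large boxes. -/
def avg (h : QA Γ f A) (N : ℕ) (u : Γ → ℝ) : ℝ :=
  (∑ γ ∈ h.boxF ((2 * A + 1) * (N + 3)), u γ) / (h.boxF ((2 * A + 1) * (N + 3))).card

lemma card_boxF_pos (h : QA Γ f A) {N : ℕ} (hN : 1 ≤ N) :
    0 < (h.boxF ((2 * A + 1) * (N + 3))).card :=
  lt_of_lt_of_le (by positivity) (h.le_card_boxF N _ rfl)

lemma avg_mem (h : QA Γ f A) {N : ℕ} (hN : 1 ≤ N) {u : Γ → ℝ} {a b : ℝ}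
    (hu : ∀ γ, u γ ∈ Set.Icc a b) : h.avg N u ∈ Set.Icc a b := by
  have hc : (0:ℝ) < (h.boxF ((2 * A + 1) * (N + 3))).card := by exact_mod_cast h.card_boxF_pos hN
  constructor
  · rw [avg, le_div_iff₀ hc, mul_comm, ← nsmul_eq_mul]
    exact Finset.card_nsmul_le_sum _ _ _ fun γ _ => (hu γ).1
  · rw [avg, div_le_iff₀ hc, mul_comm b, ← nsmul_eq_mul]
    exact Finset.sum_le_card_nsmul _ _ _ fun γ _ => (hu γ).2

lemma avg_mul_right (h : QA Γ f A) (γ' : Γ) {u : Γ → ℝ} {B : ℝ} (hu : ∀ γ, |u γ| ≤ B) :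
    Tendsto (fun N => h.avg N (fun γ => u (γ * γ')) - h.avg N u) atTop (𝓝 0) := by
  classical
  obtain ⟨C, hC⟩ := h.card_boundary_le γ'
  have hB : 0 ≤ B := (abs_nonneg _).trans (hu 1)
  have hlim : Tendsto (fun N : ℕ => (2 * B * C * 2 ^ (8 * A + 6)) / (N:ℝ)) atTop (𝓝 0) :=
    tendsto_const_div_atTop_nhds_zero_nat _
  refine squeeze_zero_norm' ?_ hlim
  filter_upwards [eventually_ge_atTop 1] with N hN
  obtain ⟨n, hn⟩ : ∃ n, n = (2 * A + 1) * (N + 3) := ⟨_, rfl⟩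
  have hc : (0:ℝ) < (h.boxF n).card := by rw [hn]; exact_mod_cast h.card_boxF_pos hN
  have hcl := h.le_card_boxF N n hn
  rw [avg, avg, ← hn, ← sub_div, Real.norm_eq_abs, abs_div, abs_of_pos hc]
  obtain ⟨F, hF⟩ : ∃ F, F = h.boxF n := ⟨_, rfl⟩
  obtain ⟨G, hG⟩ : ∃ G, G = F.map (mulRightEmbedding γ') := ⟨_, rfl⟩
  have e1 : ∑ γ ∈ F, u (γ * γ') = ∑ γ ∈ G, u γ := by rw [hG, Finset.sum_map]; rfl
  have e2 : (G \ F).card = (F \ G).card := Finset.card_sdiff_comm (by rw [hG, Finset.card_map])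
  have e3 : ((G \ F).card : ℝ) ≤ C * 16 ^ n := by
    have h1 : G \ F = (F.filter fun γ => γ * γ' ∉ F).map (mulRightEmbedding γ') := by
      ext γ
      simp only [hG, Finset.mem_sdiff, Finset.mem_map, Finset.mem_filter, mulRightEmbedding_apply]
      constructor
      · rintro ⟨⟨a, ha, rfl⟩, h2⟩; exact ⟨a, ⟨ha, h2⟩, rfl⟩
      · rintro ⟨a, ⟨ha, h2⟩, rfl⟩; exact ⟨⟨a, ha, rfl⟩, h2⟩
    rw [h1, Finset.card_map]
    exact hC n _ (hF ▸ Finset.filter_subset _ _) fun γ hγ => hF ▸ (Finset.mem_filter.1 hγ).2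
  have e4 : ∀ H : Finset Γ, |∑ γ ∈ H, u γ| ≤ H.card * B := by
    intro H
    refine (Finset.abs_sum_le_sum_abs _ _).trans ?_
    rw [← nsmul_eq_mul]
    exact Finset.sum_le_card_nsmul _ _ _ fun γ _ => hu γ
  rw [← hF, e1, ← Finset.sum_sdiff_sub_sum_sdiff]
  have e5 : |∑ γ ∈ G \ F, u γ - ∑ γ ∈ F \ G, u γ| ≤ 2 * B * (C * 16 ^ n) := by
    have a1 := e4 (G \ F)
    have a2 := e4 (F \ G)
    rw [← e2] at a2
    have a3 := mul_le_mul_of_nonneg_right e3 hB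
    refine (abs_sub _ _).trans ?_
    linarith
  have hnn : 0 ≤ 2 * B * (C * 16 ^ n) := (abs_nonneg _).trans e5
  have hN' : (0:ℝ) < N := by exact_mod_cast hN
  rw [hF, div_le_div_iff₀ hc hN']
  have e6 : (N:ℝ) * 16 ^ n ≤ 2 ^ (8 * A + 6) * (h.boxF n).card := by
    have : (16:ℕ) ^ n = 2 ^ (8 * A + 6) * 2 ^ (4 * n - 8 * A - 6) := by
      rw [← pow_add, show (16:ℕ) = 2 ^ 4 by norm_num, ← pow_mul]
      congr 1
      have : (2 * A + 1) * 3 ≤ n := by rw [hn]; gcongr; omega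
      omega
    have h2 : N * 16 ^ n ≤ 2 ^ (8 * A + 6) * (h.boxF n).card := by
      rw [this]; calc _ = 2 ^ (8 * A + 6) * (N * 2 ^ (4 * n - 8 * A - 6)) := by ring
        _ ≤ _ := by gcongr
    exact_mod_cast h2
  have hBC : 0 ≤ 2 * B * C := by
    have h16 : (0:ℝ) < 16 ^ n := by positivity
    by_contra hneg
    have := mul_neg_of_neg_of_pos (not_le.1 hneg) h16
    linarith
  calc _ ≤ 2 * B * (C * 16 ^ n) * N := by rw [← hF]; gcongr
    _ = 2 * B * C * (N * 16 ^ n) := by ring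
    _ ≤ 2 * B * C * (2 ^ (8 * A + 6) * (h.boxF n).card) := by gcongr
    _ = _ := by ring

/-- A right-invariant mean. -/
def mean (h : QA Γ f A) (u : Γ → ℝ) : ℝ :=
  limUnder (hyperfilter ℕ : Filter ℕ) fun N => h.avg N u

lemma tendsto_mean (h : QA Γ f A) {u : Γ → ℝ} {a b : ℝ} (hu : ∀ γ, u γ ∈ Set.Icc a b) :
    Tendsto (fun N => h.avg N u) (hyperfilter ℕ) (𝓝 (h.mean u)) ∧ h.mean u ∈ Set.Icc a b := by
  have hev : ∀ᶠ N in (hyperfilter ℕ : Filter ℕ), h.avg N u ∈ Set.Icc a b := by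
    have := Nat.hyperfilter_le_atTop (eventually_ge_atTop 1)
    filter_upwards [this] with N hN using h.avg_mem hN hu
  obtain ⟨x, hx, hlx⟩ := isCompact_Icc.ultrafilter_le_nhds
    ((hyperfilter ℕ).map fun N => h.avg N u) (Filter.le_principal_iff.2 hev)
  have ht := tendsto_nhds_limUnder (f := (hyperfilter ℕ : Filter ℕ)) (g := fun N => h.avg N u) ⟨x,
      hlx⟩
  exact ⟨ht, isClosed_Icc.mem_of_tendsto ht hev⟩

lemma mean_mem (h : QA Γ f A) {u : Γ → ℝ} {a b : ℝ} (hu : ∀ γ, u γ ∈ Set.Icc a b) :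
    h.mean u ∈ Set.Icc a b := (h.tendsto_mean hu).2

lemma mean_add (h : QA Γ f A) {u v : Γ → ℝ} {a b c d : ℝ} (hu : ∀ γ, u γ ∈ Set.Icc a b)
    (hv : ∀ γ, v γ ∈ Set.Icc c d) : h.mean (fun γ => u γ + v γ) = h.mean u + h.mean v := by
  have h1 := (h.tendsto_mean hu).1.add (h.tendsto_mean hv).1
  refine Tendsto.limUnder_eq (h1.congr fun N => ?_)
  rw [avg, avg, avg, Finset.sum_add_distrib, add_div]

lemma mean_mul (h : QA Γ f A) {u : Γ → ℝ} {a b : ℝ} (c : ℝ) (hu : ∀ γ, u γ ∈ Set.Icc a b) :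
    h.mean (fun γ => c * u γ) = c * h.mean u := by
  refine Tendsto.limUnder_eq (((h.tendsto_mean hu).1.const_mul c).congr fun N => ?_)
  rw [avg, avg, ← Finset.mul_sum, mul_div_assoc]

lemma mean_mul_right (h : QA Γ f A) (γ' : Γ) {u : Γ → ℝ} {B : ℝ} (hu : ∀ γ, |u γ| ≤ B) :
    h.mean (fun γ => u (γ * γ')) = h.mean u := by
  have h1 := (h.tendsto_mean fun γ => abs_le.1 (hu γ)).1
  have h2 := (h.avg_mul_right γ' hu).mono_left Nat.hyperfilter_le_atTop
  refine Tendsto.limUnder_eq ?_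
  simpa using h2.add h1

end QA

namespace QA
variable {Γ : Type*} [Group Γ] {f : Γ → Pt} {A : ℕ}

lemma restrict (h : QA Γ f A) (G : Subgroup Γ) [G.FiniteIndex] :
    ∃ A', QA G (fun g => f g) A' := by
  classical
  choose r hr using fun γ' => h.exists_near_mul_right γ'
  obtain ⟨R, hR⟩ : ∃ R, ∀ q : Γ ⧸ G, r q.out ≤ R := by
    obtain ⟨R, hR⟩ := (Set.finite_range fun q : Γ ⧸ G => r q.out).bddAbove
    exact ⟨R, fun q => hR ⟨q, rfl⟩⟩
  refine ⟨A + (2 * R + A), fun n a b hn γ => ?_, fun p => ?_, fun n p => ?_⟩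
  · refine near_mono ?_ (h.near_mul n a b hn γ)
    gcongr; omega
  · obtain ⟨a, ha⟩ := h.onto p
    have hg : a * ((a⁻¹ : Γ) : Γ ⧸ G).out ∈ G := by
      have := (QuotientGroup.eq (s := G)).1 (QuotientGroup.out_eq' ((a⁻¹ : Γ) : Γ ⧸ G)).symm
      simpa using this
    refine ⟨⟨_, hg⟩, near_mono (Nat.le_add_left _ _) (near_trans (near_symm ?_) ha)⟩
    exact near_mono (hR _) (hr _ a)
  · exact (h.finite n p).preimage Subtype.val_injective.injOn

lemma exists_level (h : QA Γ f A) : ∃ C : ℤ, ∀ γ, ∃ s κ : ℤ, (s = 1 ∨ s = -1) ∧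
    ∀ a, |(f (γ * a)).k - (s * (f a).k + κ)| ≤ C := by
  obtain ⟨T0, hT0⟩ := CE.rise_all (A * (3 * A + 1) + A)
  obtain ⟨C, hC⟩ := exists_bd (A * (3 * A + 1) + A) (T0 + 2) (by omega)
  refine ⟨C + (A * (A + 1) : ℕ), fun γ => ?_⟩
  have hn := fun a => abs_le.1 (h.act_near γ a).k_le
  obtain ⟨s, hs, hr⟩ := hT0 _ _ (h.ce γ)
  rcases hs with rfl | rfl
  · obtain ⟨ψ₁, ψ₂, hb⟩ := hC _ _ (h.ce γ) (RiseAt.up hr)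
    refine ⟨1, (h.act γ ⟨0, 0, 0⟩).k, Or.inl rfl, fun a => ?_⟩
    have h1 := abs_le.1 (hb.k_le (f a))
    have h2 := hn a
    rw [abs_le]; constructor <;> linarith
  · have hr' : ∀ x y k, RiseAt (fun p => SolQI.sw (h.act γ p)) T0 1 x y k := by
      intro x y k T hT
      have := hr x y k T hT
      simp only [SolQI.sw]; linarith
    obtain ⟨ψ₁, ψ₂, hb⟩ := hC _ _ (h.ce γ).post_sw (RiseAt.up hr')
    refine ⟨-1, -(SolQI.sw (h.act γ ⟨0, 0, 0⟩)).k, Or.inr rfl, fun a => ?_⟩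
    have h1 := abs_le.1 (hb.k_le (f a))
    have h2 := hn a
    simp only [SolQI.sw] at h1 ⊢
    rw [abs_le]; constructor <;> linarith

lemma level_unique (h : QA Γ f A) {u : Γ → ℤ} {s s' κ κ' C C' : ℤ}
    (h1 : ∀ a, |u a - (s * (f a).k + κ)| ≤ C) (h2 : ∀ a, |u a - (s' * (f a).k + κ')| ≤ C') :
    s = s' := by
  obtain ⟨D, hD⟩ : ∃ D, D = C + C' + |κ - κ'| := ⟨_, rfl⟩
  have h3 : ∀ a, |(s - s') * (f a).k| ≤ D := by
    intro a
    have e1 := abs_le.1 (h1 a)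
    have e2 := abs_le.1 (h2 a)
    have e3 := neg_abs_le (κ - κ')
    have e4 := le_abs_self (κ - κ')
    rw [abs_le]; constructor <;> linarith
  obtain ⟨a, ha⟩ := h.onto ⟨0, 0, A + D + 1⟩
  have e1 := abs_le.1 ha.k_le
  have e2 : D + 1 ≤ |(f a).k| := le_trans (by simp only at e1; linarith) (le_abs_self _)
  have e3 := h3 a
  rw [abs_mul] at e3
  by_contra hne
  have e4 : 1 ≤ |s - s'| := Int.one_le_abs (sub_ne_zero.2 hne)
  have := mul_le_mul_of_nonneg_right e4 (abs_nonneg (f a).k)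
  linarith

/-- The sign with which a group element acts on levels is a homomorphism. -/
lemma exists_signHom (h : QA Γ f A) : ∃ (s : Γ →* ℤˣ) (C : ℤ), ∀ γ, ∃ κ : ℤ,
    ∀ a, |(f (γ * a)).k - ((s γ : ℤ) * (f a).k + κ)| ≤ C := by
  obtain ⟨C, hC⟩ := h.exists_level
  have hC' : ∀ γ, ∃ (s : ℤˣ) (κ : ℤ), ∀ a, |(f (γ * a)).k - ((s : ℤ) * (f a).k + κ)| ≤ C := by
    intro γ
    obtain ⟨s, κ, hs, hk⟩ := hC γ
    rcases hs with rfl | rfl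
    · exact ⟨1, κ, by simpa using hk⟩
    · exact ⟨-1, κ, by simpa using hk⟩
  choose s κ hs using hC'
  refine ⟨MonoidHom.mk' s fun γ γ' => ?_, C, fun γ => ⟨κ γ, hs γ⟩⟩
  have h1 : ∀ a, |(f (γ * γ' * a)).k - ((s γ * s γ' : ℤ) * (f a).k + ((s γ : ℤ) * κ γ' + κ γ))| ≤
      C + C := by
    intro a
    have e1 := hs γ (γ' * a)
    have e2 := hs γ' a
    rw [← mul_assoc] at e1
    have e3 : |(s γ : ℤ) * ((f (γ' * a)).k - ((s γ' : ℤ) * (f a).k + κ γ'))| ≤ C := by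
      rw [abs_mul]
      rcases Int.units_eq_one_or (s γ) with e | e <;> simpa [e] using e2
    rw [abs_le] at *
    constructor <;> linarith
  exact Units.ext (by simpa using h.level_unique (hs (γ * γ')) h1)

end QA

/-- Each group element acts, through the orbit map `f`, as translation by `κ` on levels and through
`ψ` on the first horizontal coordinate, uniformly coarsely. -/
structure HQ {Γ : Type*} [Group Γ] (f : Γ → Pt) (C : ℕ) (κ : Γ → ℤ) (ψ : Γ → ℝ → ℝ) : Prop where
  k_le : ∀ γ a, |(f (γ * a)).k - ((f a).k + κ γ)| ≤ C
  x_le : ∀ γ a, |(f (γ * a)).x - ψ γ (f a).x| ≤ (2:ℝ) ^ (C + ((f a).k + κ γ))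
  lip : ∀ γ x x', |ψ γ x' - ψ γ x| ≤ (2:ℝ) ^ (κ γ + C) * |x' - x|
  expand : ∀ γ x x', (2:ℝ) ^ (κ γ - C) * |x' - x| ≤ |ψ γ x' - ψ γ x|

lemma QA.exists_hq {Γ : Type*} [Group Γ] {f : Γ → Pt} {A : ℕ} (h : QA Γ f A)
    (hs : ∀ γ, ∃ κ C : ℤ, ∀ a, |(f (γ * a)).k - ((f a).k + κ)| ≤ C) :
    ∃ C κ ψ₁ ψ₂, HQ f C κ ψ₁ ∧ HQ (fun a => SolQI.sw (f a)) C (fun γ => -κ γ) ψ₂ := by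
  obtain ⟨T0, hT0⟩ := CE.rise_all (A * (3 * A + 1) + A)
  obtain ⟨C, hC⟩ := exists_bd (A * (3 * A + 1) + A) (T0 + 2) (by omega)
  have hup : ∀ γ, ∃ κ ψ₁ ψ₂, Bd C (h.act γ) κ ψ₁ ψ₂ := by
    intro γ
    have hn := fun a => abs_le.1 (h.act_near γ a).k_le
    obtain ⟨s, hs', hr⟩ := hT0 _ _ (h.ce γ)
    rcases hs' with rfl | rfl
    · obtain ⟨ψ₁, ψ₂, hb⟩ := hC _ _ (h.ce γ) (RiseAt.up hr)
      exact ⟨_, ψ₁, ψ₂, hb⟩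
    exfalso
    have hr' : ∀ x y k, RiseAt (fun p => SolQI.sw (h.act γ p)) T0 1 x y k := by
      intro x y k T hT
      have := hr x y k T hT
      simp only [SolQI.sw]; linarith
    obtain ⟨ψ₁, ψ₂, hb⟩ := hC _ _ (h.ce γ).post_sw (RiseAt.up hr')
    obtain ⟨κ, C', hκ⟩ := hs γ
    have := h.level_unique (u := fun a => (f (γ * a)).k) (s := 1) (s' := -1) (κ := κ) (C := C')
      (κ' := -(SolQI.sw (h.act γ ⟨0, 0, 0⟩)).k) (C' := C + (A * (A + 1) : ℕ))
      (by simpa using hκ) (fun a => by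
        have h1 := abs_le.1 (hb.k_le (f a))
        have h2 := hn a
        simp only [SolQI.sw] at h1 ⊢
        rw [abs_le]; constructor <;> linarith)
    omega
  choose κ ψ₁ ψ₂ hb using hup
  obtain ⟨n, hn⟩ : ∃ n, n = A * (A + 1) := ⟨_, rfl⟩
  have hnear : ∀ γ a, Near n (h.act γ (f a)) (f (γ * a)) := fun γ a => hn ▸ h.act_near γ a
  have hk : ∀ γ a, |(f (γ * a)).k - ((f a).k + κ γ)| ≤ (n + C + 1 : ℕ) := fun γ a => by
    have h1 := abs_le.1 ((hb γ).k_le (f a))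
    have h2 := abs_le.1 (hnear γ a).k_le
    rw [abs_le]; push_cast; constructor <;> linarith
  refine ⟨n + C + 1, κ, ψ₁, ψ₂, ⟨hk, fun γ a => ?_, fun γ x x' => ?_,
    fun γ x x' => ?_⟩, ⟨fun γ a => ?_, fun γ a => ?_, fun γ x x' => ?_, fun γ x x' => ?_⟩⟩
  · have h1 := abs_le.1 ((hb γ).k_le (f a))
    have h2 := (hnear γ a).x_le.trans (zpow_two_mono
      (show (n:ℤ) + (h.act γ (f a)).k ≤ n + C + ((f a).k + κ γ) by linarith))
    have h3 := ((hb γ).x_le (f a)).trans (zpow_two_mono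
      (show (C:ℤ) + ((f a).k + κ γ) ≤ n + C + ((f a).k + κ γ) by linarith))
    have h4 := abs_add_le ((f (γ * a)).x - (h.act γ (f a)).x) ((h.act γ (f a)).x - ψ₁ γ (f a).x)
    rw [sub_add_sub_cancel] at h4
    have h5 : (2:ℝ) ^ (((n + C + 1 : ℕ) : ℤ) + ((f a).k + κ γ)) =
        (2:ℝ) ^ (n + C + ((f a).k + κ γ) : ℤ) * 2 := by
      rw [← zpow_add_one₀ (by norm_num)]; congr 1; push_cast; ring
    rw [h5]; linarith
  · exact ((hb γ).lip₁ x x').trans (mul_le_mul_of_nonneg_right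
      (zpow_two_mono (by push_cast; linarith)) (abs_nonneg _))
  · exact (mul_le_mul_of_nonneg_right
      (zpow_two_mono (by push_cast; linarith)) (abs_nonneg _)).trans ((hb γ).expand₁ x x')
  · have := abs_le.1 (hk γ a)
    simp only [SolQI.sw]
    rw [abs_le]; constructor <;> linarith
  · simp only [SolQI.sw]
    rw [show ((n + C + 1 : ℕ) : ℤ) + (-(f a).k + -κ γ) = ((n + C + 1 : ℕ) : ℤ) - ((f a).k + κ γ) by ring]
    have h1 := abs_le.1 ((hb γ).k_le (f a))
    have h2 := (hnear γ a).y_le.trans (zpow_two_mono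
      (show (n:ℤ) - (h.act γ (f a)).k ≤ n + C - ((f a).k + κ γ) by linarith))
    have h3 := ((hb γ).y_le (f a)).trans (zpow_two_mono
      (show (C:ℤ) - ((f a).k + κ γ) ≤ n + C - ((f a).k + κ γ) by linarith))
    have h4 := abs_add_le ((f (γ * a)).y - (h.act γ (f a)).y) ((h.act γ (f a)).y - ψ₂ γ (f a).y)
    rw [sub_add_sub_cancel] at h4
    have h5 : (2:ℝ) ^ (((n + C + 1 : ℕ) : ℤ) - ((f a).k + κ γ)) =
        (2:ℝ) ^ (n + C - ((f a).k + κ γ) : ℤ) * 2 := by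
      rw [← zpow_add_one₀ (by norm_num)]; congr 1; push_cast; ring
    rw [h5]; linarith
  · exact ((hb γ).lip₂ x x').trans (mul_le_mul_of_nonneg_right
      (zpow_two_mono (by push_cast; linarith)) (abs_nonneg _))
  · exact (mul_le_mul_of_nonneg_right
      (zpow_two_mono (by push_cast; linarith)) (abs_nonneg _)).trans ((hb γ).expand₂ x x')

section
variable {Γ : Type*} [Group Γ] {f : Γ → Pt} {A C : ℕ} {κ : Γ → ℤ} {ψ : Γ → ℝ → ℝ}

lemma eq_of_abs_le_zpow {u v D : ℝ} (h : ∀ k : ℤ, |u - v| ≤ D * (2:ℝ) ^ k) : u = v := by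
  by_contra hne
  have h0 : 0 < |u - v| := abs_pos.2 (sub_ne_zero.2 hne)
  have hD : 0 < D := by
    have := h 0
    rw [zpow_zero, mul_one] at this
    linarith
  obtain ⟨k, hk, -⟩ := exists_zpow_two_lt (div_pos h0 hD)
  have := h k
  rw [lt_div_iff₀ hD] at hk
  linarith

lemma QA.exists_approx (h : QA Γ f A) (x : ℝ) (k : ℤ) : ∃ a, |(f a).x - x| ≤ (2:ℝ) ^ (2 * A + k) ∧
    |(f a).k - k| ≤ A := by
  obtain ⟨a, ha⟩ := h.onto ⟨x, 0, k⟩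
  have h1 := ha.k_le
  have h2 := ha.x_le
  simp only at h1 h2
  rw [abs_sub_comm] at h1 h2
  refine ⟨a, h2.trans (zpow_two_mono ?_), h1⟩
  rw [abs_le] at h1; linarith

namespace HQ

lemma restrict (q : HQ f C κ ψ) (G : Subgroup Γ) :
    HQ (fun g : G => f g) C (fun g => κ g) (fun g => ψ g) where
  k_le γ a := q.k_le γ a
  x_le γ a := q.x_le γ a
  lip γ := q.lip γ
  expand γ := q.expand γ

lemma injective (q : HQ f C κ ψ) (γ : Γ) : Function.Injective (ψ γ) := by
  intro x x' hxx
  have := q.expand γ x x'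
  rw [hxx, sub_self, abs_zero] at this
  have h1 : |x' - x| ≤ 0 := by
    by_contra hneg
    have := mul_pos (zpow_two_pos (κ γ - C)) (not_le.1 hneg)
    linarith
  have := abs_nonpos_iff.1 h1
  linarith

lemma continuous (q : HQ f C κ ψ) (γ : Γ) : Continuous (ψ γ) := by
  have : LipschitzWith ⟨(2:ℝ) ^ (κ γ + C), (zpow_two_pos _).le⟩ (ψ γ) :=
    LipschitzWith.of_dist_le_mul fun x y => by
      rw [Real.dist_eq, Real.dist_eq]; exact q.lip γ y x
  exact this.continuous

lemma strictMono_or (q : HQ f C κ ψ) (γ : Γ) : StrictMono (ψ γ) ∨ StrictAnti (ψ γ) :=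
  (q.continuous γ).strictMono_of_inj (q.injective γ)

lemma κ_mul (q : HQ f C κ ψ) (γ γ' : Γ) : |κ (γ * γ') - κ γ - κ γ'| ≤ 3 * C := by
  have h1 := abs_le.1 (q.k_le (γ * γ') 1)
  have h2 := abs_le.1 (q.k_le γ (γ' * 1))
  have h3 := abs_le.1 (q.k_le γ' 1)
  rw [← mul_assoc] at h2
  rw [abs_le]; constructor <;> linarith

lemma ψ_mul (h : QA Γ f A) (q : HQ f C κ ψ) (γ γ' : Γ) (x : ℝ) :
    ψ (γ * γ') x = ψ γ (ψ γ' x) := by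
  refine eq_of_abs_le_zpow (D := (2:ℝ) ^ (κ (γ * γ') + C) * (2:ℝ) ^ (2 * A : ℤ) +
    (2:ℝ) ^ (C + A + κ (γ * γ') : ℤ) + (2:ℝ) ^ (C + C + A + κ γ' + κ γ : ℤ) +
    (2:ℝ) ^ (κ γ + C) * ((2:ℝ) ^ (C + A + κ γ' : ℤ) + (2:ℝ) ^ (κ γ' + C) * (2:ℝ) ^ (2 * A : ℤ)))
    fun k => ?_
  obtain ⟨a, hx, hk⟩ := h.exists_approx x k
  have hk' := abs_le.1 hk
  have c1 := (q.lip (γ * γ') (f a).x x).trans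
    (mul_le_mul_of_nonneg_left (abs_sub_comm (f a).x x ▸ hx) (zpow_two_pos _).le)
  have c2 := (q.x_le (γ * γ') a).trans (zpow_two_mono
    (show _ ≤ (C + A + κ (γ * γ') : ℤ) + k by linarith))
  have k1 := abs_le.1 (q.k_le γ' a)
  have c3 := (q.x_le γ (γ' * a)).trans (zpow_two_mono
    (show _ ≤ (C + C + A + κ γ' + κ γ : ℤ) + k by linarith))
  have c4 := (q.x_le γ' a).trans (zpow_two_mono
    (show _ ≤ (C + A + κ γ' : ℤ) + k by linarith))
  have c5 := (q.lip γ' x (f a).x).trans (mul_le_mul_of_nonneg_left hx (zpow_two_pos _).le)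
  have c6 := (q.lip γ (ψ γ' x) (f (γ' * a)).x).trans (mul_le_mul_of_nonneg_left
    ((abs_sub_le _ (ψ γ' (f a).x) _).trans (add_le_add c4 c5)) (zpow_two_pos _).le)
  rw [← mul_assoc] at c3
  simp only [zpow_two_add _ k] at c1 c2 c3 c4 c5 c6
  rw [abs_le] at *
  constructor <;> linarith

/-- The subgroup of elements preserving the orientation of the first horizontal coordinate has
finite index. -/
lemma exists_orientation (h : QA Γ f A) (q : HQ f C κ ψ) :
    ∃ o : Γ →* ℤˣ, ∀ γ, o γ = 1 → StrictMono (ψ γ) := by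
  classical
  have hor : ∀ γ, ∃ s : ℤˣ, (s = 1 ∧ StrictMono (ψ γ)) ∨ (s = -1 ∧ StrictAnti (ψ γ)) := fun γ => by
    rcases q.strictMono_or γ with h1 | h1
    · exact ⟨1, Or.inl ⟨rfl, h1⟩⟩
    · exact ⟨-1, Or.inr ⟨rfl, h1⟩⟩
  have hexcl : ∀ g : ℝ → ℝ, StrictMono g → StrictAnti g → False := fun g h1 h2 =>
    lt_asymm (h1 one_pos) (h2 one_pos)
  choose s hs using hor
  refine ⟨MonoidHom.mk' s fun γ γ' => ?_, fun γ hγ => ?_⟩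
  · have hc : ψ (γ * γ') = ψ γ ∘ ψ γ' := funext fun x => q.ψ_mul h γ γ' x
    rcases hs γ with ⟨e1, m1⟩ | ⟨e1, m1⟩ <;> rcases hs γ' with ⟨e2, m2⟩ | ⟨e2, m2⟩ <;>
      rcases hs (γ * γ') with ⟨e3, m3⟩ | ⟨e3, m3⟩ <;> rw [hc] at m3 <;> rw [e1, e2, e3] <;>
      first
      | rfl
      | exact (hexcl _ m3 (m1.comp_strictAnti m2)).elim
      | exact (hexcl _ m3 (m1.comp_strictMono m2)).elim
      | exact (hexcl _ (m1.comp m2) m3).elim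
  · rcases hs γ with ⟨-, m⟩ | ⟨e, -⟩
    · exact m
    · have hγ' : s γ = 1 := hγ
      rw [hγ'] at e
      exact absurd e (by decide)

/-- The level cocycle is within bounded distance of a homomorphism. -/
lemma exists_hom (h : QA Γ f A) (q : HQ f C κ ψ) : ∃ η : Γ → ℝ,
    (∀ γ γ', η (γ * γ') = η γ + η γ') ∧ ∀ γ, |η γ - κ γ| ≤ 3 * C := by
  have hb : ∀ γ' γ, |(κ (γ * γ') : ℝ) - κ γ - κ γ'| ≤ 3 * C := fun γ' γ => by
    exact_mod_cast q.κ_mul γ γ'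
  have hI : ∀ γ' γ, (κ (γ * γ') : ℝ) - κ γ ∈ Set.Icc ((κ γ' : ℝ) - 3 * C) (κ γ' + 3 * C) := by
    intro γ' γ
    have := abs_le.1 (hb γ' γ)
    constructor <;> linarith
  refine ⟨fun γ' => h.mean fun γ => (κ (γ * γ') : ℝ) - κ γ, fun γ' γ'' => ?_, fun γ' => ?_⟩
  · simp only
    have hbd : ∀ γ, |(κ (γ * γ'') : ℝ) - κ γ| ≤ |(κ γ'' : ℝ)| + 3 * C := fun γ => by
      have h1 := abs_le.1 (hb γ'' γ)
      have h2 := neg_abs_le (κ γ'' : ℝ)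
      have h3 := le_abs_self (κ γ'' : ℝ)
      rw [abs_le]; constructor <;> linarith
    rw [← h.mean_mul_right γ' hbd, ← h.mean_add (hI γ') (fun γ => hI γ'' (γ * γ'))]
    congr 1
    funext γ
    rw [mul_assoc]; ring
  · have := h.mean_mem (hI γ')
    rw [abs_le]; constructor <;> linarith [this.1, this.2]

/-- Averaging straightens the action on the first horizontal coordinate to an affine one. -/
lemma exists_affine (h : QA Γ f A) (q : HQ f C κ ψ) (hψ : ∀ γ, StrictMono (ψ γ)) (η : Γ → ℝ)
    (hη : ∀ γ γ', η (γ * γ') = η γ + η γ') (D : ℝ) (hD : ∀ γ, |η γ - κ γ| ≤ D) :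
    ∃ (Θ : ℝ → ℝ) (c c' : ℝ), 0 < c ∧ 0 < c' ∧
      (∀ x x', x ≤ x' → c * (x' - x) ≤ Θ x' - Θ x ∧ Θ x' - Θ x ≤ c' * (x' - x)) ∧
      ∀ γ x, Θ (ψ γ x) = Θ (ψ γ 0) + (2:ℝ) ^ η γ * Θ x := by
  obtain ⟨u, hu⟩ : ∃ u : ℝ → ℝ → Γ → ℝ, u = fun x x' γ => (2:ℝ) ^ (-η γ) * (ψ γ x' - ψ γ x) :=
    ⟨_, rfl⟩
  have hI : ∀ x x', x ≤ x' → ∀ γ, u x x' γ ∈ Set.Icc ((2:ℝ) ^ (-D - C) * (x' - x))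
      ((2:ℝ) ^ (D + C) * (x' - x)) := by
    intro x x' hx γ
    have h1 := q.expand γ x x'
    have h2 := q.lip γ x x'
    rw [abs_of_nonneg (sub_nonneg.2 ((hψ γ).monotone hx)), abs_of_nonneg (sub_nonneg.2 hx),
      ← Real.rpow_intCast] at h1 h2
    push_cast at h1 h2
    have h3 := abs_le.1 (hD γ)
    have h4 : 0 ≤ x' - x := sub_nonneg.2 hx
    have h5 : (0:ℝ) < (2:ℝ) ^ (-η γ) := by positivity
    rw [hu]
    constructor
    · refine le_trans ?_ (mul_le_mul_of_nonneg_left h1 h5.le)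
      rw [← mul_assoc, ← Real.rpow_add two_pos]
      exact mul_le_mul_of_nonneg_right
        (Real.rpow_le_rpow_of_exponent_le one_le_two (by linarith)) h4
    · refine (mul_le_mul_of_nonneg_left h2 h5.le).trans ?_
      rw [← mul_assoc, ← Real.rpow_add two_pos]
      exact mul_le_mul_of_nonneg_right
        (Real.rpow_le_rpow_of_exponent_le one_le_two (by linarith)) h4
  have hbd : ∀ x x', ∃ B, ∀ γ, |u x x' γ| ≤ B := by
    intro x x'
    rcases le_total x x' with hx | hx
    · refine ⟨(2:ℝ) ^ (D + C) * (x' - x), fun γ => ?_⟩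
      have h1 := hI x x' hx γ
      have h2 : 0 ≤ (2:ℝ) ^ (-D - C) * (x' - x) := mul_nonneg (by positivity) (sub_nonneg.2 hx)
      rw [abs_of_nonneg (h2.trans h1.1)]; exact h1.2
    · refine ⟨(2:ℝ) ^ (D + C) * (x - x'), fun γ => ?_⟩
      have h1 := hI x' x hx γ
      have h2 : 0 ≤ (2:ℝ) ^ (-D - C) * (x - x') := mul_nonneg (by positivity) (sub_nonneg.2 hx)
      have h3 : u x x' γ = -u x' x γ := by rw [hu]; ring
      rw [h3, abs_neg, abs_of_nonneg (h2.trans h1.1)]; exact h1.2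
  have hIcc : ∀ x x', ∃ a b, ∀ γ, u x x' γ ∈ Set.Icc a b := fun x x' => by
    obtain ⟨B, hB⟩ := hbd x x'
    exact ⟨-B, B, fun γ => abs_le.1 (hB γ)⟩
  have hadd : ∀ x x' x'', h.mean (u x x'') = h.mean (u x x') + h.mean (u x' x'') := by
    intro x x' x''
    obtain ⟨a, b, hab⟩ := hIcc x x'
    obtain ⟨a', b', hab'⟩ := hIcc x' x''
    rw [← h.mean_add hab hab']
    congr 1
    funext γ
    rw [hu]; ring
  refine ⟨fun x => h.mean (u 0 x), (2:ℝ) ^ (-D - C), (2:ℝ) ^ (D + C), by positivity, by positivity,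
    fun x x' hx => ?_, fun γ' x => ?_⟩
  · simp only
    rw [hadd 0 x x', add_sub_cancel_left]
    exact h.mean_mem (hI x x' hx)
  · simp only
    rw [hadd 0 (ψ γ' 0) (ψ γ' x)]
    congr 1
    obtain ⟨B, hB⟩ := hbd 0 x
    obtain ⟨a, b, hab⟩ := hIcc 0 x
    rw [← h.mean_mul_right γ' hB, ← h.mean_mul _ (fun γ => hab (γ * γ'))]
    congr 1
    funext γ
    rw [hu]
    simp only
    rw [← q.ψ_mul h, ← q.ψ_mul h, ← mul_assoc, ← Real.rpow_add two_pos, hη]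
    congr 2
    ring

end HQ

end

section
variable {Γ : Type*} [Group Γ] {f : Γ → Pt} {A C : ℕ} {κ : Γ → ℤ} {ψ : Γ → ℝ → ℝ}

lemma HQ.exists_x_near (q : HQ f C κ ψ) : ∃ D, 0 ≤ D ∧
    ∀ a, |(f a).x - ψ a 0| ≤ D * (2:ℝ) ^ (f a).k := by
  refine ⟨(2:ℝ) ^ (2 * C) + (2:ℝ) ^ (2 * C - (f 1).k : ℤ) * |(f 1).x|, by positivity, fun a => ?_⟩
  have h0 := abs_le.1 (q.k_le a 1)
  have h1 := q.x_le a 1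
  have h2 := q.lip a 0 (f 1).x
  rw [mul_one] at h0 h1
  rw [sub_zero] at h2
  have h3 := h1.trans (zpow_two_mono (show _ ≤ ((2 * C : ℕ) : ℤ) + (f a).k by push_cast; linarith))
  have h4 := h2.trans (mul_le_mul_of_nonneg_right (zpow_two_mono
    (show _ ≤ (2 * C - (f 1).k : ℤ) + (f a).k by linarith)) (abs_nonneg _))
  rw [zpow_two_add, zpow_natCast] at h3
  rw [zpow_two_add] at h4
  have h5 := abs_sub_le (f a).x (ψ a (f 1).x) (ψ a 0)
  linarith

/-- An affine coordinate for the action on the first horizontal direction, comparable with the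
orbit map. -/
lemma HQ.exists_axis (h : QA Γ f A) (q : HQ f C κ ψ) (hψ : ∀ γ, StrictMono (ψ γ)) (η : Γ → ℝ)
    (hη : ∀ γ γ', η (γ * γ') = η γ + η γ') (D : ℝ) (hD : ∀ γ, |η γ - κ γ| ≤ D)
    (D' : ℝ) (hD' : ∀ γ, |η γ - (f γ).k| ≤ D') :
    ∃ r : Γ → ℝ, (∀ γ γ', r (γ * γ') = r γ + (2:ℝ) ^ η γ * r γ') ∧
      (∀ R : ℝ, ∃ R', ∀ a, |r a| ≤ R → (f a).k ≤ R → |(f a).x| ≤ R') ∧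
      ∃ R, ∀ X, ∃ x, ∀ a, |x - (f a).x| ≤ (2:ℝ) ^ (A + (f a).k : ℤ) →
        (2:ℝ) ^ (-η a) * |X - r a| ≤ R := by
  obtain ⟨Θ, c, c', hc, hc', hΘ, haff⟩ := q.exists_affine h hψ η hη D hD
  obtain ⟨E, hE0, hE⟩ := q.exists_x_near
  have hΘ0 : Θ 0 = 0 := by
    have := haff 1 0
    have hp : (0:ℝ) < (2:ℝ) ^ η 1 := by positivity
    have h2 : (2:ℝ) ^ η 1 * Θ 0 = 0 := by linarith
    exact (mul_eq_zero.1 h2).resolve_left hp.ne'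
  have hab : ∀ x x', c * |x' - x| ≤ |Θ x' - Θ x| ∧ |Θ x' - Θ x| ≤ c' * |x' - x| := by
    have key : ∀ x x', x ≤ x' → c * |x' - x| ≤ |Θ x' - Θ x| ∧ |Θ x' - Θ x| ≤ c' * |x' - x| := by
      intro x x' hx
      have h1 := hΘ x x' hx
      have h2 : 0 ≤ x' - x := sub_nonneg.2 hx
      have h3 := (mul_nonneg hc.le h2).trans h1.1
      rwa [abs_of_nonneg h2, abs_of_nonneg h3]
    intro x x'
    rcases le_total x x' with hx | hx
    · exact key x x' hx
    · rw [abs_sub_comm x', abs_sub_comm (Θ x')]; exact key x' x hx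
  have hcont : Continuous Θ := by
    have : LipschitzWith ⟨c', hc'.le⟩ Θ := LipschitzWith.of_dist_le_mul fun x y => by
      rw [Real.dist_eq, Real.dist_eq]; exact (hab y x).2
    exact this.continuous
  have hsurj : ∀ X, ∃ x, Θ x = X := by
    intro X
    have hX : 0 ≤ |X| / c := by positivity
    refine mem_range_of_exists_le_of_exists_ge hcont ⟨-(|X| / c), ?_⟩ ⟨|X| / c, ?_⟩
    · have := (hΘ (-(|X| / c)) 0 (by linarith)).1
      rw [hΘ0, zero_sub, zero_sub, neg_neg, mul_div_cancel₀ _ hc.ne'] at this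
      have := neg_abs_le X
      linarith
    · have := (hΘ 0 (|X| / c) hX).1
      rw [hΘ0, sub_zero, sub_zero, mul_div_cancel₀ _ hc.ne'] at this
      have := le_abs_self X
      linarith
  refine ⟨fun γ => Θ (ψ γ 0), fun γ γ' => ?_, fun R => ?_, c' * (2 ^ A + E) * (2:ℝ) ^ D',
      fun X => ?_⟩
  · simp only
    rw [q.ψ_mul h, haff]
  · obtain ⟨K, hK⟩ := exists_nat_ge R
    refine ⟨R / c + E * 2 ^ K, fun a h1 h2 => ?_⟩
    simp only at h1
    have h3 := (hab 0 (ψ a 0)).1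
    rw [hΘ0, sub_zero, sub_zero] at h3
    have h4 : |ψ a 0| ≤ R / c := by rw [le_div_iff₀ hc]; linarith
    have h5 : (f a).k ≤ K := by exact_mod_cast h2.trans hK
    have h6 := zpow_two_mono h5
    rw [zpow_natCast] at h6
    have h7 := (hE a).trans (mul_le_mul_of_nonneg_left h6 hE0)
    have h8 := abs_add_le ((f a).x - ψ a 0) (ψ a 0)
    rw [sub_add_cancel] at h8
    linarith
  · obtain ⟨x, rfl⟩ := hsurj X
    refine ⟨x, fun a ha => ?_⟩
    simp only
    rw [zpow_two_add, zpow_natCast] at ha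
    have h1 := (abs_sub_le x (f a).x (ψ a 0)).trans (add_le_add ha (hE a))
    have h2 := (hab (ψ a 0) x).2.trans (mul_le_mul_of_nonneg_left h1 hc'.le)
    have h3 : (2:ℝ) ^ (-η a) * (2:ℝ) ^ (f a).k ≤ (2:ℝ) ^ D' := by
      rw [← Real.rpow_intCast, ← Real.rpow_add two_pos]
      have := abs_le.1 (hD' a)
      exact Real.rpow_le_rpow_of_exponent_le one_le_two (by linarith)
    have h4 : (0:ℝ) < (2:ℝ) ^ (-η a) := by positivity
    calc _ ≤ (2:ℝ) ^ (-η a) * (c' * (2 ^ A * (2:ℝ) ^ (f a).k + E * (2:ℝ) ^ (f a).k)) := by gcongr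
      _ = c' * (2 ^ A + E) * ((2:ℝ) ^ (-η a) * (2:ℝ) ^ (f a).k) := by ring
      _ ≤ _ := by gcongr

end

/-- `ρ` is a homomorphism to `Sol` with finite kernel and with image a lattice. -/
structure IsLatticeMap {G : Type*} [Group G] (ρ : G → ℝ × ℝ × ℝ) : Prop where
  map_mul : ∀ a b, ρ (a * b) = solMul (ρ a) (ρ b)
  finite_ker : {a | ρ a = (0, 0, 0)}.Finite
  discrete : ∀ p ∈ Set.range ρ, ∃ ε > (0:ℝ), ∀ q ∈ Set.range ρ, dist q p < ε → q = p
  cocompact : ∃ Kc : Set (ℝ × ℝ × ℝ), IsCompact Kc ∧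
    ∀ g : ℝ × ℝ × ℝ, ∃ l ∈ Set.range ρ, ∃ k ∈ Kc, g = solMul l k

lemma IsLatticeMap.map_one {G : Type*} [Group G] {ρ : G → ℝ × ℝ × ℝ} (h : IsLatticeMap ρ) :
    ρ 1 = (0, 0, 0) := by
  have h1 := h.map_mul 1 1
  rw [mul_one] at h1
  simp only [solMul, Prod.ext_iff] at h1
  obtain ⟨h2, h3, h4⟩ := h1
  have p1 := Real.exp_pos ((ρ 1).2.2 / 2)
  have p2 := Real.exp_pos (-(ρ 1).2.2 / 2)
  refine Prod.ext ?_ (Prod.ext ?_ ?_)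
  · exact (mul_eq_zero.1 (by linarith : Real.exp ((ρ 1).2.2 / 2) * (ρ 1).1 = 0)).resolve_left p1.ne'
  · exact (mul_eq_zero.1 (by linarith : Real.exp (-(ρ 1).2.2 / 2) * (ρ 1).2.1 = 0)).resolve_left p2.ne'
  · simp only; linarith

/-- The kernel of a homomorphism to `Sol`. -/
def IsLatticeMap.ker {G : Type*} [Group G] {ρ : G → ℝ × ℝ × ℝ} (h : IsLatticeMap ρ) :
    Subgroup G where
  carrier := {a | ρ a = (0, 0, 0)}
  one_mem' := h.map_one
  mul_mem' {a b} ha hb := by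
    rw [mem_ofPred_eq] at *
    rw [h.map_mul, ha, hb]; simp [solMul]
  inv_mem' {a} ha := by
    rw [mem_ofPred_eq] at *
    have h1 := h.map_mul a a⁻¹
    rw [mul_inv_cancel, h.map_one, ha] at h1
    simpa [solMul] using h1.symm

lemma IsLatticeMap.ker_normal {G : Type*} [Group G] {ρ : G → ℝ × ℝ × ℝ} (h : IsLatticeMap ρ) :
    h.ker.Normal where
  conj_mem a ha g := by
    change ρ (g * a * g⁻¹) = (0, 0, 0)
    have ha : ρ a = (0, 0, 0) := ha
    have h1 : ρ (g * a) = ρ g := by rw [h.map_mul, ha]; simp [solMul]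
    rw [h.map_mul, h1, ← h.map_mul, mul_inv_cancel, h.map_one]

lemma discrete_of_finite_bounded {G : Type*} (ρ : G → ℝ × ℝ × ℝ)
    (h : ∀ R : ℝ, {a | ‖ρ a‖ ≤ R}.Finite) (p : ℝ × ℝ × ℝ) :
    ∃ ε > (0:ℝ), ∀ q ∈ Set.range ρ, dist q p < ε → q = p := by
  have hfin : (ρ '' {a | ‖ρ a‖ ≤ ‖p‖ + 1} \ {p}).Finite := ((h _).image ρ).sdiff
  obtain ⟨ε, hε, hb⟩ := Metric.isOpen_iff.1 hfin.isClosed.isOpen_compl p (by simp)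
  refine ⟨min ε 1, by positivity, ?_⟩
  rintro _ ⟨a, rfl⟩ hd
  by_contra hne
  refine hb (Metric.mem_ball.2 (hd.trans_le (min_le_left _ _))) ⟨⟨a, ?_, rfl⟩, hne⟩
  have h1 := hd.trans_le (min_le_right _ _)
  rw [dist_eq_norm] at h1
  have h2 := norm_add_le (ρ a - p) p
  rw [sub_add_cancel] at h2
  change ‖ρ a‖ ≤ _
  linarith

theorem exists_isLatticeMap {Γ : Type*} [Group Γ] {f : Γ → Pt} {A C : ℕ} {κ : Γ → ℤ}
    {ψ₁ ψ₂ : Γ → ℝ → ℝ} (h : QA Γ f A) (q₁ : HQ f C κ ψ₁)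
    (q₂ : HQ (fun a => sw (f a)) C (fun γ => -κ γ) ψ₂)
    (h₁ : ∀ γ, StrictMono (ψ₁ γ)) (h₂ : ∀ γ, StrictMono (ψ₂ γ)) :
    ∃ ρ : Γ → ℝ × ℝ × ℝ, IsLatticeMap ρ := by
  obtain ⟨η, hη, hκ⟩ := q₁.exists_hom h
  obtain ⟨D, hDdef⟩ : ∃ D : ℝ, D = 4 * C + |((f 1).k : ℝ)| := ⟨_, rfl⟩
  have hD : ∀ γ, |η γ - (f γ).k| ≤ D := by
    intro γ
    have e1 : |((f γ).k : ℝ) - ((f 1).k + κ γ)| ≤ C := by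
      have := q₁.k_le γ 1
      rw [mul_one] at this
      exact_mod_cast this
    have e2 := abs_le.1 (hκ γ)
    have e3 := neg_abs_le ((f 1).k : ℝ)
    have e4 := le_abs_self ((f 1).k : ℝ)
    rw [abs_le] at *; constructor <;> linarith
  obtain ⟨r, hr, hrb, R₁, hR₁⟩ := q₁.exists_axis h h₁ η hη _ hκ D hD
  obtain ⟨r', hr', hrb', R₂, hR₂⟩ := q₂.exists_axis h.sw h₂ (fun γ => -η γ)
    (fun γ γ' => by rw [hη]; ring) (3 * C)
    (fun γ => by push_cast; rw [← neg_sub', abs_neg]; exact hκ γ) D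
    (fun γ => by simp only [sw]; push_cast; rw [← neg_sub', abs_neg]; exact hD γ)
  obtain ⟨t, ht⟩ : ∃ t, t = 2 * Real.log 2 := ⟨_, rfl⟩
  have ht0 : 0 < t := by rw [ht]; have := Real.log_pos one_lt_two; linarith
  have hexp : ∀ s : ℝ, Real.exp (t * s / 2) = (2:ℝ) ^ s := fun s => by
    rw [Real.rpow_def_of_pos two_pos, ht]; congr 1; ring
  have hexp' : ∀ s : ℝ, Real.exp (-(t * s) / 2) = (2:ℝ) ^ (-s) := fun s => by
    rw [← hexp]; congr 1; ring
  obtain ⟨ρ, hρ⟩ : ∃ ρ : Γ → ℝ × ℝ × ℝ, ρ = fun γ => (r γ, r' γ, t * η γ) := ⟨_, rfl⟩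
  have hfin : ∀ R : ℝ, {a | ‖ρ a‖ ≤ R}.Finite := by
    intro R
    obtain ⟨X, hX⟩ := hrb (max R (R / t + D))
    obtain ⟨Y, hY⟩ := hrb' (max R (R / t + D))
    obtain ⟨a, ha⟩ := pow_unbounded_of_one_lt X one_lt_two
    obtain ⟨b, hb⟩ := pow_unbounded_of_one_lt Y one_lt_two
    obtain ⟨n, hn⟩ := exists_nat_ge (R / t + D)
    refine (h.finite (a + b + n + 1) ⟨0, 0, 0⟩).subset fun γ hγ => ?_
    have hγ' : ‖ρ γ‖ ≤ R := hγ
    rw [hρ, Prod.norm_def, Prod.norm_def] at hγ'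
    simp only [sup_le_iff, Real.norm_eq_abs] at hγ'
    obtain ⟨g1, g2, g3⟩ := hγ'
    rw [abs_mul, abs_of_pos ht0, mul_comm, ← le_div_iff₀ ht0] at g3
    have g4 : |((f γ).k : ℝ)| ≤ R / t + D := by
      have := abs_sub_abs_le_abs_sub ((f γ).k : ℝ) (η γ)
      have := hD γ
      rw [abs_sub_comm] at this
      linarith
    have g5 := hX γ (g1.trans (le_max_left _ _)) (((le_abs_self _).trans g4).trans (le_max_right _ _))
    have g6 := hY γ (g2.trans (le_max_left _ _)) (by
      simp only [sw]; push_cast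
      exact ((neg_le_abs _).trans g4).trans (le_max_right _ _))
    simp only [sw] at g6
    have g7 : |(f γ).k| ≤ n := by exact_mod_cast g4.trans hn
    refine near_of_bounds ?_ ?_ ?_
    · simp only [sub_zero]; push_cast; omega
    · simp only [sub_zero, zpow_zero, mul_one]
      exact (g5.trans ha.le).trans (pow_le_pow_right₀ one_le_two (by omega))
    · simp only [sub_zero, neg_zero, zpow_zero, mul_one]
      exact (g6.trans hb.le).trans (pow_le_pow_right₀ one_le_two (by omega))
  refine ⟨ρ, fun a b => ?_, (hfin 0).subset fun a ha => ?_,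
    fun p _ => discrete_of_finite_bounded ρ hfin p,
    Set.Icc (-R₁) R₁ ×ˢ Set.Icc (-R₂) R₂ ×ˢ Set.Icc (-(t * (D + A + 1))) (t * (D + A + 1)),
    isCompact_Icc.prod (isCompact_Icc.prod isCompact_Icc), ?_⟩
  · rw [hρ]
    simp only [solMul, hexp, hexp', hr, hr', hη, mul_add]
  · have ha' : ρ a = (0, 0, 0) := ha
    change ‖ρ a‖ ≤ 0
    rw [ha']; simp
  · rintro ⟨X, Y, Z⟩
    obtain ⟨x, hx⟩ := hR₁ X
    obtain ⟨y, hy⟩ := hR₂ Y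
    obtain ⟨a, ha⟩ := h.onto ⟨x, y, ⌊Z / t⌋⟩
    have a1 := hx a ha.x_le
    have a2 := hy a (by simpa [sw, ← sub_eq_add_neg] using ha.y_le)
    have a3 : |((⌊Z / t⌋ : ℤ) : ℝ) - (f a).k| ≤ A := by exact_mod_cast ha.k_le
    have a4 := Int.floor_le (Z / t)
    have a5 := Int.lt_floor_add_one (Z / t)
    have a6 : |Z / t - η a| ≤ D + A + 1 := by
      have := abs_le.1 (hD a)
      rw [abs_le] at *; constructor <;> linarith
    have a7 : |Z - t * η a| ≤ t * (D + A + 1) := by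
      have : Z - t * η a = t * (Z / t - η a) := by field_simp
      rw [this, abs_mul, abs_of_pos ht0]; gcongr
    have c1 : (2:ℝ) ^ η a * (2:ℝ) ^ (-η a) = 1 := by
      rw [← Real.rpow_add two_pos, add_neg_cancel, Real.rpow_zero]
    rw [neg_neg] at a2
    rw [← abs_of_pos (by positivity : (0:ℝ) < (2:ℝ) ^ (-η a)), ← abs_mul] at a1
    rw [← abs_of_pos (by positivity : (0:ℝ) < (2:ℝ) ^ (η a)), ← abs_mul] at a2
    refine ⟨ρ a, ⟨a, rfl⟩, ((2:ℝ) ^ (-η a) * (X - r a), (2:ℝ) ^ (η a) * (Y - r' a), Z - t * η a),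
      ⟨abs_le.1 a1, abs_le.1 a2, abs_le.1 a7⟩, ?_⟩
    rw [hρ]
    simp only [solMul, hexp, hexp', ← mul_assoc, c1, mul_comm ((2:ℝ) ^ (-η a)) ((2:ℝ) ^ (η a)),
        one_mul]
    refine Prod.ext ?_ (Prod.ext ?_ ?_) <;> simp only <;> ring

/-- A group quasi-acting on the model by left translation is virtually a lattice. -/
theorem QA.exists_isLatticeMap {Γ : Type*} [Group Γ] {f : Γ → Pt} {A : ℕ} (h : QA Γ f A) :
    ∃ G : Subgroup Γ, G.FiniteIndex ∧ ∃ ρ : G → ℝ × ℝ × ℝ, IsLatticeMap ρ := by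
  obtain ⟨s, c, hs⟩ := h.exists_signHom
  have : s.ker.FiniteIndex := Subgroup.finiteIndex_ker s
  obtain ⟨A₁, h₁⟩ := h.restrict s.ker
  obtain ⟨C, κ, ψ₁, ψ₂, q₁, q₂⟩ := h₁.exists_hq fun γ => by
    obtain ⟨k, hk⟩ := hs γ
    refine ⟨k, c, fun a => ?_⟩
    have e := hk a
    rw [MonoidHom.mem_ker.1 γ.2, Units.val_one, one_mul] at e
    exact e
  obtain ⟨o₁, ho₁⟩ := q₁.exists_orientation h₁
  obtain ⟨o₂, ho₂⟩ := q₂.exists_orientation h₁.sw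
  have : o₁.ker.FiniteIndex := Subgroup.finiteIndex_ker o₁
  have : o₂.ker.FiniteIndex := Subgroup.finiteIndex_ker o₂
  obtain ⟨A₂, h₂⟩ := h₁.restrict (o₁.ker ⊓ o₂.ker)
  obtain ⟨ρ, hρ⟩ := SolQI.exists_isLatticeMap h₂ (q₁.restrict _) (q₂.restrict _)
    (fun γ => ho₁ γ γ.2.1) (fun γ => ho₂ γ γ.2.2)
  refine ⟨(o₁.ker ⊓ o₂.ker).map s.ker.subtype, ⟨?_⟩, ?_⟩
  · rw [Subgroup.index_map_subtype]
    exact mul_ne_zero Subgroup.FiniteIndex.index_ne_zero Subgroup.FiniteIndex.index_ne_zero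
  let e := (o₁.ker ⊓ o₂.ker).equivMapOfInjective s.ker.subtype s.ker.subtype_injective
  have hr : range (fun a => ρ (e.symm a)) = range ρ := e.symm.surjective.range_comp ρ
  refine ⟨fun a => ρ (e.symm a), ⟨fun a b => by rw [map_mul, hρ.map_mul], ?_, ?_, ?_⟩⟩
  · exact (hρ.finite_ker.preimage e.symm.injective.injOn)
  · rw [hr]; exact hρ.discrete
  · rw [hr]; exact hρ.cocompact

section
open MeasureTheory

section PiecewiseC1
variable {E F : Type*} [NormedAddCommGroup E] [NormedSpace ℝ E] [NormedAddCommGroup F]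
  [NormedSpace ℝ F]

lemma piecewiseC1_clm {γ : ℝ → E} (h : PiecewiseC1 γ) (φ : E →L[ℝ] F) :
    PiecewiseC1 (fun t => φ (γ t)) := by
  obtain ⟨n, τ, h0, h1, h2, h3⟩ := h
  exact ⟨n, τ, h0, h1, h2, fun i hi => φ.contDiff.comp_contDiffOn (h3 i hi)⟩

lemma piecewiseC1_of_contDiff {γ : ℝ → E} (h : ContDiff ℝ 1 γ) : PiecewiseC1 γ :=
  ⟨1, fun i => i, by simp, by simp, fun i _ => by simp, fun i _ => h.contDiffOn⟩

lemma piecewiseC1_regular {g : ℝ → ℝ} (h : PiecewiseC1 g) :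
    ContinuousOn g (Icc 0 1) ∧ IntervalIntegrable (deriv g) volume 0 1 ∧
      ∃ s : Set ℝ, s.Countable ∧ ∀ t ∈ Ioo (0:ℝ) 1 \ s, DifferentiableAt ℝ g t := by
  obtain ⟨n, τ, h0, h1, h2, h3⟩ := h
  refine ⟨?_, ?_, range τ, countable_range τ, ?_⟩
  · have key : ∀ m ≤ n, 0 ≤ τ m ∧ ContinuousOn g (Icc 0 (τ m)) := by
      intro m
      induction m with
      | zero => intro _; rw [h0]; simp
      | succ m ih =>
        intro hm
        obtain ⟨i1, i2⟩ := ih (by omega)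
        have h4 := h2 m (by omega)
        refine ⟨i1.trans h4, ?_⟩
        rw [← Icc_union_Icc_eq_Icc i1 h4]
        exact i2.union_of_isClosed (h3 m (by omega)).continuousOn isClosed_Icc isClosed_Icc
    have := (key n le_rfl).2
    rwa [h1] at this
  · rw [← h0, ← h1]
    refine IntervalIntegrable.trans_iterate fun i hi => ?_
    rcases (h2 i hi).eq_or_lt with e | e
    · rw [e]
    have c := ((h3 i hi).continuousOn_derivWithin (uniqueDiffOn_Icc e) le_rfl)
    rw [← uIcc_of_le e.le] at c
    refine c.intervalIntegrable.congr_uIoo fun t ht => ?_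
    rw [uIoo_of_le e.le] at ht
    rw [uIcc_of_le e.le]
    exact derivWithin_of_mem_nhds (Icc_mem_nhds ht.1 ht.2)
  · rintro t ⟨ht, hs⟩
    have key : ∀ m ≤ n, t < τ m → ∃ i < n, t ∈ Ioo (τ i) (τ (i + 1)) := by
      intro m
      induction m with
      | zero => intro _ h5; rw [h0] at h5; linarith [ht.1]
      | succ m ih =>
        intro hm h5
        rcases lt_trichotomy t (τ m) with h6 | h6 | h6
        · exact ih (by omega) h6
        · exact absurd ⟨m, h6.symm⟩ hs
        · exact ⟨m, by omega, h6, h5⟩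
    obtain ⟨i, hi, hti⟩ := key n le_rfl (by rw [h1]; exact ht.2)
    exact ((h3 i hi).contDiffAt (Icc_mem_nhds hti.1 hti.2)).differentiableAt one_ne_zero

lemma piecewiseC1_abs_sub_le {g B : ℝ → ℝ} (h : PiecewiseC1 g)
    (hB : IntervalIntegrable B volume 0 1) (hgB : ∀ t ∈ Icc (0:ℝ) 1, |deriv g t| ≤ B t)
    {t : ℝ} (ht : t ∈ Icc (0:ℝ) 1) : |g t - g 0| ≤ ∫ t in (0:ℝ)..1, B t := by
  obtain ⟨hc, hi, s, hs, hd⟩ := piecewiseC1_regular h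
  have hsub : uIcc 0 t ⊆ Icc (0:ℝ) 1 := by
    rw [uIcc_of_le ht.1]; exact Icc_subset_Icc_right ht.2
  have hsub' : uIcc 0 t ⊆ uIcc (0:ℝ) 1 := by rwa [uIcc_of_le zero_le_one]
  have e := integral_eq_of_hasDerivAt_off_countable g (deriv g) hs (hc.mono hsub)
    (fun x hx => (hd x ⟨⟨?_, ?_⟩, hx.2⟩).hasDerivAt) (hi.mono_set hsub')
  · rw [← e]
    calc _ ≤ ∫ t in (0:ℝ)..t, |deriv g t| := intervalIntegral.abs_integral_le_integral_abs ht.1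
      _ ≤ ∫ t in (0:ℝ)..t, B t := intervalIntegral.integral_mono_on ht.1 (hi.mono_set hsub').abs
          (hB.mono_set hsub') fun x hx => hgB x ⟨hx.1, hx.2.trans ht.2⟩
      _ ≤ _ := intervalIntegral.integral_mono_interval le_rfl ht.1 ht.2 (by
          refine (ae_restrict_iff' measurableSet_Ioc).2 (ae_of_all _ fun x hx => ?_)
          exact (abs_nonneg _).trans (hgB x ⟨hx.1.le, hx.2⟩)) hB
  · have := hx.1.1; rwa [min_eq_left ht.1] at this
  · have := hx.1.2; rw [max_eq_right ht.1] at this; exact this.trans_le ht.2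

end PiecewiseC1

lemma sqrt_sum_sq_le {a b c : ℝ} (ha : 0 ≤ a) (hb : 0 ≤ b) (hc : 0 ≤ c) :
    Real.sqrt (a ^ 2 + b ^ 2 + c ^ 2) ≤ a + b + c := by
  refine Real.sqrt_le_iff.2 ⟨by positivity, ?_⟩
  nlinarith [mul_nonneg ha hb, mul_nonneg ha hc, mul_nonneg hb hc]

lemma exp_mul_sq (u v : ℝ) : Real.exp u * v ^ 2 = (Real.exp (u / 2) * |v|) ^ 2 := by
  rw [mul_pow, sq_abs, ← Real.exp_nat_mul]; congr 2; push_cast; ring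

/-- The integrand of `solLength`. -/
def solSpeed (γ : ℝ → ℝ × ℝ × ℝ) (t : ℝ) : ℝ :=
  Real.sqrt (Real.exp (-(γ t).2.2) * (deriv (fun s => (γ s).1) t) ^ 2 +
      Real.exp ((γ t).2.2) * (deriv (fun s => (γ s).2.1) t) ^ 2 +
      (deriv (fun s => (γ s).2.2) t) ^ 2)

lemma solSpeed_nonneg (γ : ℝ → ℝ × ℝ × ℝ) (t : ℝ) : 0 ≤ solSpeed γ t := Real.sqrt_nonneg _

lemma solSpeed_le (γ : ℝ → ℝ × ℝ × ℝ) (t : ℝ) : solSpeed γ t ≤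
    Real.exp (-(γ t).2.2 / 2) * |deriv (fun s => (γ s).1) t| +
      Real.exp ((γ t).2.2 / 2) * |deriv (fun s => (γ s).2.1) t| +
      |deriv (fun s => (γ s).2.2) t| := by
  rw [solSpeed, exp_mul_sq, exp_mul_sq, ← sq_abs (deriv (fun s => (γ s).2.2) t)]
  exact sqrt_sum_sq_le (by positivity) (by positivity) (by positivity)

lemma le_solSpeed (γ : ℝ → ℝ × ℝ × ℝ) (t : ℝ) :
    Real.exp (-(γ t).2.2 / 2) * |deriv (fun s => (γ s).1) t| ≤ solSpeed γ t ∧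
      Real.exp ((γ t).2.2 / 2) * |deriv (fun s => (γ s).2.1) t| ≤ solSpeed γ t ∧
      |deriv (fun s => (γ s).2.2) t| ≤ solSpeed γ t := by
  rw [solSpeed, exp_mul_sq, exp_mul_sq, ← sq_abs (deriv (fun s => (γ s).2.2) t)]
  refine ⟨Real.le_sqrt_of_sq_le ?_, Real.le_sqrt_of_sq_le ?_, Real.le_sqrt_of_sq_le ?_⟩ <;>
  nlinarith [sq_nonneg (Real.exp (-(γ t).2.2 / 2) * |deriv (fun s => (γ s).1) t|),
    sq_nonneg (Real.exp ((γ t).2.2 / 2) * |deriv (fun s => (γ s).2.1) t|),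
    sq_nonneg (|deriv (fun s => (γ s).2.2) t|)]

lemma solLength_nonneg (γ : ℝ → ℝ × ℝ × ℝ) : 0 ≤ solLength γ :=
  intervalIntegral.integral_nonneg zero_le_one fun _ _ => Real.sqrt_nonneg _

lemma coord_le_of_solLength {γ : ℝ → ℝ × ℝ × ℝ} (h : PiecewiseC1 γ) {ℓ : ℝ}
    (hℓ : solLength γ ≤ ℓ) :
    |(γ 1).2.2 - (γ 0).2.2| ≤ ℓ ∧
      |(γ 1).1 - (γ 0).1| ≤ Real.exp (((γ 0).2.2 + ℓ) / 2) * ℓ ∧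
      |(γ 1).2.1 - (γ 0).2.1| ≤ Real.exp ((-(γ 0).2.2 + ℓ) / 2) * ℓ := by
  have hx : PiecewiseC1 (fun t => (γ t).1) := piecewiseC1_clm h (ContinuousLinearMap.fst ℝ ℝ (ℝ × ℝ))
  have hyz : PiecewiseC1 (fun t => (γ t).2) := piecewiseC1_clm h (ContinuousLinearMap.snd ℝ ℝ (ℝ × ℝ))
  have hy : PiecewiseC1 (fun t => (γ t).2.1) := piecewiseC1_clm hyz (ContinuousLinearMap.fst ℝ ℝ ℝ)
  have hz : PiecewiseC1 (fun t => (γ t).2.2) := piecewiseC1_clm hyz (ContinuousLinearMap.snd ℝ ℝ ℝ)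
  obtain ⟨cz, iz, -⟩ := piecewiseC1_regular hz
  have ix := (piecewiseC1_regular hx).2.1
  have iy := (piecewiseC1_regular hy).2.1
  have cz' : ContinuousOn (fun t => (γ t).2.2) (uIcc 0 1) := by rwa [uIcc_of_le zero_le_one]
  have hm : AEStronglyMeasurable (solSpeed γ) (volume.restrict (uIoc 0 1)) := by
    have c1 : AEMeasurable (fun t => (γ t).2.2) (volume.restrict (uIoc 0 1)) :=
      (cz'.mono uIoc_subset_uIcc).aemeasurable measurableSet_uIoc
    refine AEMeasurable.aestronglyMeasurable ?_
    have d1 := (measurable_deriv (fun t => (γ t).1)).aemeasurable (μ := volume.restrict (uIoc 0 1))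
    have d2 := (measurable_deriv (fun t => (γ t).2.1)).aemeasurable (μ := volume.restrict (uIoc 0 1))
    have d3 := (measurable_deriv (fun t => (γ t).2.2)).aemeasurable (μ := volume.restrict (uIoc 0 1))
    exact (((c1.neg.exp.mul (d1.pow_const 2)).add (c1.exp.mul (d2.pow_const 2))).add
      (d3.pow_const 2)).sqrt
  have hL : IntervalIntegrable (solSpeed γ) volume 0 1 := by
    refine IntervalIntegrable.mono_fun' (((ix.abs.continuousOn_mul (g := fun t => Real.exp (-(γ t).2.2 / 2)) ?_).add
      (iy.abs.continuousOn_mul (g := fun t => Real.exp ((γ t).2.2 / 2)) ?_)).add iz.abs) hm (ae_of_all _ fun t => ?_)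
    · exact (cz'.neg.div_const 2).rexp
    · exact (cz'.div_const 2).rexp
    · change ‖solSpeed γ t‖ ≤ _
      rw [Real.norm_of_nonneg (solSpeed_nonneg γ t)]; exact solSpeed_le γ t
  have hz1 : ∀ t ∈ Icc (0:ℝ) 1, |(γ t).2.2 - (γ 0).2.2| ≤ ℓ := fun t ht =>
    (piecewiseC1_abs_sub_le hz hL (fun s _ => (le_solSpeed γ s).2.2) ht).trans hℓ
  have h1 : (1:ℝ) ∈ Icc (0:ℝ) 1 := by simp
  have aux : ∀ u v d w : ℝ, u ≤ v → Real.exp (-u) * d ≤ w → 0 ≤ w → d ≤ Real.exp v * w := by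
    intro u v d w huv hd hw
    have e : d = Real.exp u * (Real.exp (-u) * d) := by
      rw [← mul_assoc, ← Real.exp_add, add_neg_cancel, Real.exp_zero, one_mul]
    rw [e]
    exact (mul_le_mul_of_nonneg_left hd (Real.exp_pos _).le).trans (by gcongr)
  refine ⟨hz1 1 h1, ?_, ?_⟩
  · refine (piecewiseC1_abs_sub_le hx (hL.const_mul (Real.exp (((γ 0).2.2 + ℓ) / 2)))
      (fun t ht => ?_) h1).trans ?_
    · refine aux ((γ t).2.2 / 2) _ _ _ ?_ ?_ (Real.sqrt_nonneg _)
      · linarith [(abs_le.1 (hz1 t ht)).2]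
      · rw [← neg_div]; exact (le_solSpeed γ t).1
    · rw [intervalIntegral.integral_const_mul]
      exact mul_le_mul_of_nonneg_left hℓ (Real.exp_pos _).le
  · refine (piecewiseC1_abs_sub_le hy (hL.const_mul (Real.exp ((-(γ 0).2.2 + ℓ) / 2)))
      (fun t ht => ?_) h1).trans ?_
    · refine aux (-(γ t).2.2 / 2) _ _ _ ?_ ?_ (Real.sqrt_nonneg _)
      · linarith [(abs_le.1 (hz1 t ht)).1]
      · rw [neg_div, neg_neg]; exact (le_solSpeed γ t).2.1
    · rw [intervalIntegral.integral_const_mul]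
      exact mul_le_mul_of_nonneg_left hℓ (Real.exp_pos _).le

/-- The coordinate segment from `p` to `q`. -/
def segPath (p q : ℝ × ℝ × ℝ) (t : ℝ) : ℝ × ℝ × ℝ := p + t • (q - p)

lemma segPath_mem (p q : ℝ × ℝ × ℝ) : segPath p q 0 = p ∧ segPath p q 1 = q ∧
    PiecewiseC1 (segPath p q) := by
  refine ⟨by simp [segPath], by simp [segPath], piecewiseC1_of_contDiff ?_⟩
  unfold segPath
  fun_prop

lemma coord_le_of_dSol {p q : ℝ × ℝ × ℝ} {ℓ : ℝ} (h : dSol p q < ℓ) :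
    |q.2.2 - p.2.2| ≤ ℓ ∧ |q.1 - p.1| ≤ Real.exp ((p.2.2 + ℓ) / 2) * ℓ ∧
      |q.2.1 - p.2.1| ≤ Real.exp ((-p.2.2 + ℓ) / 2) * ℓ := by
  obtain ⟨a, ⟨γ, rfl, rfl, hγ, rfl⟩, ha⟩ := exists_lt_of_csInf_lt
    (s := {ℓ : ℝ | ∃ γ : ℝ → ℝ × ℝ × ℝ, γ 0 = p ∧ γ 1 = q ∧ PiecewiseC1 γ ∧ solLength γ = ℓ})
    ⟨_, segPath p q, (segPath_mem p q).1, (segPath_mem p q).2.1, (segPath_mem p q).2.2, rfl⟩ h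
  exact coord_le_of_solLength hγ ha.le

lemma dSol_le (p q : ℝ × ℝ × ℝ) : dSol p q ≤
    Real.exp ((-p.2.2 + |q.2.2 - p.2.2|) / 2) * |q.1 - p.1| +
      Real.exp ((p.2.2 + |q.2.2 - p.2.2|) / 2) * |q.2.1 - p.2.1| + |q.2.2 - p.2.2| := by
  obtain ⟨h0, h1, hc⟩ := segPath_mem p q
  have hle : dSol p q ≤ solLength (segPath p q) := by
    refine csInf_le ⟨0, ?_⟩ ⟨_, h0, h1, hc, rfl⟩
    rintro _ ⟨γ, -, -, -, rfl⟩
    exact solLength_nonneg γ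
  refine hle.trans ?_
  have hb : ∀ t ∈ uIoc (0:ℝ) 1, ‖solSpeed (segPath p q) t‖ ≤
      Real.exp ((-p.2.2 + |q.2.2 - p.2.2|) / 2) * |q.1 - p.1| +
      Real.exp ((p.2.2 + |q.2.2 - p.2.2|) / 2) * |q.2.1 - p.2.1| + |q.2.2 - p.2.2| := by
    intro t ht
    rw [uIoc_of_le zero_le_one] at ht
    rw [Real.norm_of_nonneg (solSpeed_nonneg _ t)]
    refine (solSpeed_le _ t).trans ?_
    have hd : ∀ a b : ℝ, deriv (fun s : ℝ => a + s * b) t = b := fun a b => by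
      simp
    have e : (fun s => (segPath p q s).1) = fun s => p.1 + s * (q.1 - p.1) := by
      ext s; simp [segPath]
    have e1 : (fun s => (segPath p q s).2.1) = fun s => p.2.1 + s * (q.2.1 - p.2.1) := by
      ext s; simp [segPath]
    have e2 : ∀ s, (segPath p q s).2.2 = p.2.2 + s * (q.2.2 - p.2.2) := fun s => by
      simp [segPath]
    simp only [e, e1, e2, hd]
    have h3 : |t * (q.2.2 - p.2.2)| ≤ |q.2.2 - p.2.2| := by
      rw [abs_mul, abs_of_pos ht.1]
      exact mul_le_of_le_one_left (abs_nonneg _) ht.2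
    rw [abs_le] at h3
    gcongr <;> linarith [h3.1, h3.2]
  have := intervalIntegral.norm_integral_le_of_norm_le_const hb
  rw [sub_zero, abs_one, mul_one] at this
  exact (le_abs_self _).trans this

end

/-- The model point underlying a point of `Sol`, with heights rounded to multiples of
`2 * log 2`. -/
def toPt (p : ℝ × ℝ × ℝ) : Pt := ⟨p.1, p.2.1, ⌊p.2.2 / (2 * Real.log 2)⌋⟩

lemma exp_mul_log_two (k : ℤ) : Real.exp (k * Real.log 2) = (2:ℝ) ^ k := by
  rw [← Real.rpow_intCast, Real.rpow_def_of_pos two_pos, mul_comm]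

lemma toPt_surjective : Function.Surjective toPt := by
  rintro ⟨x, y, k⟩
  have h2 : 0 < Real.log 2 := Real.log_pos one_lt_two
  refine ⟨(x, y, k * (2 * Real.log 2)), ?_⟩
  rw [toPt, mul_div_cancel_right₀ _ (by positivity), Int.floor_intCast]

lemma toPt_zpow_bounds (p : ℝ × ℝ × ℝ) :
    (2:ℝ) ^ (toPt p).k ≤ Real.exp (p.2.2 / 2) ∧ Real.exp (p.2.2 / 2) ≤ 2 * (2:ℝ) ^ (toPt p).k := by
  have h2 : 0 < Real.log 2 := Real.log_pos one_lt_two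
  have h3 := Int.floor_le (p.2.2 / (2 * Real.log 2))
  have h4 := (Int.lt_floor_add_one (p.2.2 / (2 * Real.log 2))).le
  rw [le_div_iff₀ (by positivity)] at h3
  rw [div_le_iff₀ (by positivity)] at h4
  constructor
  · rw [← exp_mul_log_two]
    refine Real.exp_le_exp.2 ?_
    simp only [toPt]; linarith
  · rw [mul_comm, ← zpow_add_one₀ two_ne_zero, ← exp_mul_log_two]
    refine Real.exp_le_exp.2 ?_
    simp only [toPt]; push_cast; linarith

lemma toPt_zpow_neg_bounds (p : ℝ × ℝ × ℝ) :
    Real.exp (-p.2.2 / 2) ≤ (2:ℝ) ^ (-(toPt p).k) ∧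
      (2:ℝ) ^ (-(toPt p).k) ≤ 2 * Real.exp (-p.2.2 / 2) := by
  obtain ⟨h1, h2⟩ := toPt_zpow_bounds p
  have hp := zpow_two_pos (toPt p).k
  have he := Real.exp_pos (p.2.2 / 2)
  rw [neg_div, Real.exp_neg, zpow_neg]
  refine ⟨inv_anti₀ hp h1, ?_⟩
  rw [← div_eq_mul_inv, le_div_iff₀ he, ← div_eq_inv_mul, div_le_iff₀ hp]
  exact h2

lemma abs_floor_sub_floor_le (u v : ℝ) : |((⌊u⌋ - ⌊v⌋ : ℤ) : ℝ)| ≤ |u - v| + 1 := by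
  have h1 := Int.floor_le u
  have h2 := Int.lt_floor_add_one u
  have h3 := Int.floor_le v
  have h4 := Int.lt_floor_add_one v
  have h5 := neg_abs_le (u - v)
  have h6 := le_abs_self (u - v)
  push_cast
  rw [abs_le]; constructor <;> linarith

lemma exists_near_of_dSol_le (R : ℝ) : ∃ n, ∀ p q, dSol p q ≤ R → Near n (toPt p) (toPt q) := by
  obtain ⟨ℓ, hℓ, hR⟩ : ∃ ℓ : ℝ, 0 < ℓ ∧ R < ℓ :=
    ⟨max R 0 + 1, by positivity, by linarith [le_max_left R 0]⟩
  have h2 : 0 < Real.log 2 := Real.log_pos one_lt_two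
  obtain ⟨a₁, ha₁⟩ := pow_unbounded_of_one_lt (2 * (Real.exp (ℓ / 2) * ℓ)) one_lt_two
  obtain ⟨a₂, ha₂⟩ := exists_nat_gt (ℓ / (2 * Real.log 2))
  refine ⟨max a₁ a₂ + 1, fun p q h => ?_⟩
  obtain ⟨hz, hx, hy⟩ := coord_le_of_dSol (h.trans_lt hR)
  have ha : 2 * (Real.exp (ℓ / 2) * ℓ) ≤ (2:ℝ) ^ max a₁ a₂ :=
    ha₁.le.trans (pow_le_pow_right₀ one_le_two (le_max_left _ _))
  have he : 0 ≤ Real.exp (ℓ / 2) * ℓ := by positivity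
  refine near_of_bounds ?_ ?_ ?_
  · have h3 := abs_floor_sub_floor_le (q.2.2 / (2 * Real.log 2)) (p.2.2 / (2 * Real.log 2))
    rw [← sub_div, abs_div, abs_of_pos (by positivity : 0 < 2 * Real.log 2)] at h3
    have h4 : |q.2.2 - p.2.2| / (2 * Real.log 2) ≤ ℓ / (2 * Real.log 2) := by gcongr
    have h5 : (a₂:ℝ) ≤ (max a₁ a₂ : ℕ) := by exact_mod_cast le_max_right _ _
    have h6 : |(((toPt q).k - (toPt p).k : ℤ) : ℝ)| ≤ (max a₁ a₂ : ℕ) + 1 := by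
      simp only [toPt]; linarith
    exact_mod_cast h6
  · refine hx.trans ?_
    rw [add_div, Real.exp_add, mul_assoc]
    calc _ ≤ 2 * (2:ℝ) ^ (toPt p).k * (Real.exp (ℓ / 2) * ℓ) := by
          gcongr; exact (toPt_zpow_bounds p).2
      _ = 2 * (Real.exp (ℓ / 2) * ℓ) * (2:ℝ) ^ (toPt p).k := by ring
      _ ≤ _ := by gcongr
  · refine hy.trans ?_
    rw [add_div, Real.exp_add, mul_assoc, mul_comm]
    have := (toPt_zpow_neg_bounds p).1
    gcongr
    linarith

lemma exists_dSol_le_of_near (n : ℕ) :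
    ∃ R : ℝ, ∀ p q, Near n (toPt p) (toPt q) → dSol p q ≤ R := by
  have h2 : 0 < Real.log 2 := Real.log_pos one_lt_two
  obtain ⟨Z, hZ⟩ : ∃ Z, Z = (n + 1) * (2 * Real.log 2) := ⟨_, rfl⟩
  refine ⟨Real.exp (Z / 2) * 2 ^ n + Real.exp (Z / 2) * (2 * 2 ^ n) + Z, fun p q h => ?_⟩
  have hz : |q.2.2 - p.2.2| ≤ Z := by
    have h3 : |(((toPt q).k - (toPt p).k : ℤ) : ℝ)| ≤ n := by exact_mod_cast h.1
    have a1 := Int.floor_le (p.2.2 / (2 * Real.log 2))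
    have a2 := Int.lt_floor_add_one (p.2.2 / (2 * Real.log 2))
    have a3 := Int.floor_le (q.2.2 / (2 * Real.log 2))
    have a4 := Int.lt_floor_add_one (q.2.2 / (2 * Real.log 2))
    simp only [toPt] at h3
    push_cast at h3
    have h5 : |q.2.2 / (2 * Real.log 2) - p.2.2 / (2 * Real.log 2)| ≤ n + 1 := by
      rw [abs_le] at h3 ⊢; constructor <;> linarith
    rwa [← sub_div, abs_div, abs_of_pos (by positivity : 0 < 2 * Real.log 2),
      div_le_iff₀ (by positivity), ← hZ] at h5
  have h1 := one_le_two_pow_real n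
  have hx : |q.1 - p.1| ≤ 2 ^ n * Real.exp (p.2.2 / 2) := h.2.1.trans (by
    have := (toPt_zpow_bounds p).1
    gcongr; linarith)
  have hy : |q.2.1 - p.2.1| ≤ 2 ^ n * (2 * Real.exp (-p.2.2 / 2)) := h.2.2.trans (by
    have := (toPt_zpow_neg_bounds p).2
    gcongr; linarith)
  have e1 : Real.exp (-p.2.2 / 2) * Real.exp (p.2.2 / 2) = 1 := by
    rw [← Real.exp_add, neg_div, neg_add_cancel, Real.exp_zero]
  refine (dSol_le p q).trans (add_le_add (add_le_add ?_ ?_) hz)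
  · rw [add_div, Real.exp_add]
    calc _ ≤ Real.exp (-p.2.2 / 2) * Real.exp (Z / 2) * (2 ^ n * Real.exp (p.2.2 / 2)) := by gcongr
      _ = Real.exp (Z / 2) * 2 ^ n * (Real.exp (-p.2.2 / 2) * Real.exp (p.2.2 / 2)) := by ring
      _ = _ := by rw [e1, mul_one]
  · rw [add_div, Real.exp_add]
    calc _ ≤ Real.exp (p.2.2 / 2) * Real.exp (Z / 2) * (2 ^ n * (2 * Real.exp (-p.2.2 / 2))) := by
          gcongr
      _ = Real.exp (Z / 2) * (2 * 2 ^ n) * (Real.exp (-p.2.2 / 2) * Real.exp (p.2.2 / 2)) := by ring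
      _ = _ := by rw [e1, mul_one]

/-- `q` is reached from `p` by `m` steps of unit scale. -/
def Chain : ℕ → Pt → Pt → Prop
  | 0, p, q => p = q
  | m + 1, p, q => ∃ r, Near 1 p r ∧ Chain m r q

lemma Chain.trans {m n : ℕ} {p q r : Pt} (h : Chain m p q) (h' : Chain n q r) :
    Chain (m + n) p r := by
  induction m generalizing p with
  | zero => rw [zero_add]; cases h; exact h'
  | succ m ih =>
    obtain ⟨s, hs, h⟩ := h
    rw [Nat.add_right_comm]
    exact ⟨s, hs, ih h⟩

lemma Near.chain {p q : Pt} (h : Near 1 p q) : Chain 1 p q := ⟨q, h, rfl⟩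

lemma Chain.mono {m n : ℕ} (h : m ≤ n) {p q : Pt} (hm : Chain m p q) : Chain n p q := by
  induction n, h using Nat.le_induction with
  | base => exact hm
  | succ n _ ih => exact ih.trans (near_refl 1 q).chain

lemma chain_up (x y : ℝ) (k : ℤ) (n : ℕ) : Chain n ⟨x, y, k⟩ ⟨x, y, k + n⟩ := by
  induction n with
  | zero => simp [Chain]
  | succ n ih =>
    refine ih.trans (Near.chain ?_)
    have := CE.near_vert x y (k + n) 1
    rwa [show (k + ((n + 1 : ℕ) : ℤ)) = k + n + (1:ℕ) by push_cast; ring]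

lemma near_one_of_abs {x y x' y' : ℝ} {k k' : ℤ} (hk : |k' - k| ≤ 1)
    (hx : |x' - x| ≤ (2:ℝ) ^ k) (hy : |y' - y| ≤ (2:ℝ) ^ (-k)) :
    Near 1 ⟨x, y, k⟩ ⟨x', y', k'⟩ :=
  ⟨by simpa using hk, by simp only; linarith, by simp only; linarith⟩

lemma chain_down (x y : ℝ) (k : ℤ) (n : ℕ) : Chain n ⟨x, y, k⟩ ⟨x, y, k - n⟩ := by
  induction n with
  | zero => simp [Chain]
  | succ n ih =>
    refine ih.trans (Near.chain (near_one_of_abs ?_ ?_ ?_))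
    · rw [show (k - ((n + 1 : ℕ) : ℤ)) - (k - n) = -1 by push_cast; ring]; simp
    · simp only [sub_self, abs_zero]; positivity
    · simp only [sub_self, abs_zero]; positivity

lemma chain_vert (x y : ℝ) (k k' : ℤ) {n : ℕ} (h : |k' - k| ≤ n) :
    Chain n ⟨x, y, k⟩ ⟨x, y, k'⟩ := by
  rcases le_total k k' with hk | hk
  · obtain ⟨m, hm⟩ := Int.eq_ofNat_of_zero_le (sub_nonneg.2 hk)
    obtain rfl : k' = k + m := by omega
    rw [abs_le] at h
    exact (chain_up x y k m).mono (by omega)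
  · obtain ⟨m, hm⟩ := Int.eq_ofNat_of_zero_le (sub_nonneg.2 hk)
    obtain rfl : k' = k - m := by omega
    rw [abs_le] at h
    exact (chain_down x y k m).mono (by omega)

lemma Near.exists_chain {n : ℕ} {p q : Pt} (h : Near n p q) : Chain (5 * n + 2) p q := by
  obtain ⟨x, y, k⟩ := p
  obtain ⟨x', y', k'⟩ := q
  have hx := h.x_le
  have hy := h.y_le
  have hk := h.k_le
  simp only at hx hy hk
  have c1 := chain_vert x y k (k + n) (n := n) (by simp)
  have c2 : Chain 1 ⟨x, y, k + n⟩ ⟨x', y, k + n⟩ := (near_one_of_abs (by simp)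
    (by rwa [add_comm]) (by simp only [sub_self, abs_zero]; positivity)).chain
  have c3 := chain_vert x' y (k + n) (k - n) (n := 2 * n) (by rw [abs_le]; constructor <;> omega)
  have c4 : Chain 1 ⟨x', y, k - n⟩ ⟨x', y', k - n⟩ := (near_one_of_abs (by simp)
    (by simp only [sub_self, abs_zero]; positivity) (by rwa [neg_sub])).chain
  have c5 := chain_vert x' y' (k - n) k' (n := 2 * n) (by rw [abs_le] at hk ⊢; constructor <;> omega)
  exact ((((c1.trans c2).trans c3).trans c4).trans c5).mono (by omega)

section Word
variable {Γ : Type*} [Group Γ] {S : Set Γ}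

/-- `g` is a word of length at most `m` in `S`. -/
def IsWord (S : Set Γ) (m : ℕ) (g : Γ) : Prop :=
  ∃ l : List Γ, (∀ x ∈ l, x ∈ S) ∧ l.prod = g ∧ l.length ≤ m

lemma IsWord.mul {m n : ℕ} {g g' : Γ} (h : IsWord S m g) (h' : IsWord S n g') :
    IsWord S (m + n) (g * g') := by
  obtain ⟨l, h1, rfl, h3⟩ := h
  obtain ⟨l', h1', rfl, h3'⟩ := h'
  refine ⟨l ++ l', fun x hx => ?_, by simp, by simp; omega⟩
  rcases List.mem_append.1 hx with hx | hx
  exacts [h1 x hx, h1' x hx]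

lemma isWord_of_wordNorm_le (hS : IsFinSymmGen S) {m : ℕ} {g : Γ} (h : wordNorm S g ≤ m) :
    IsWord S m g := by
  have hne : {m : ℕ | ∃ l : List Γ, (∀ x ∈ l, x ∈ S) ∧ l.prod = g ∧ l.length = m}.Nonempty := by
    have hg : g ∈ (Subgroup.closure S).toSubmonoid := by rw [hS.2.2]; trivial
    rw [Subgroup.closure_toSubmonoid] at hg
    obtain ⟨l, hl, rfl⟩ := Submonoid.exists_list_of_mem_closure hg
    refine ⟨_, l, fun x hx => (hl x hx).elim id fun h => ?_, rfl, rfl⟩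
    simpa using hS.2.1 _ h
  obtain ⟨l, h1, h2, h3⟩ := Nat.sInf_mem hne
  exact ⟨l, h1, h2, h3.le.trans h⟩

lemma wordNorm_le_one {s : Γ} (hs : s ∈ S) : wordNorm S s ≤ 1 :=
  Nat.sInf_le ⟨[s], by simpa using hs, by simp, rfl⟩

lemma isWord_finite (hS : S.Finite) (m : ℕ) : {g | IsWord S m g}.Finite := by
  induction m with
  | zero =>
    refine (finite_singleton (1 : Γ)).subset ?_
    rintro _ ⟨l, -, rfl, h⟩
    obtain rfl := List.length_eq_zero_iff.1 (Nat.le_zero.1 h)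
    rfl
  | succ m ih =>
    refine ((finite_singleton (1 : Γ)).union (hS.image2 (· * ·) ih)).subset ?_
    rintro _ ⟨l, h1, rfl, h3⟩
    cases l with
    | nil => exact Or.inl rfl
    | cons s l =>
      refine Or.inr ⟨s, h1 s (by simp), l.prod, ⟨l, fun x hx => h1 x (by simp [hx]), rfl, ?_⟩,
          by simp⟩
      simpa using h3

end Word

/-- A group quasi-isometric to `Sol` quasi-acts on the model. -/
theorem exists_QA {Γ : Type*} [Group Γ] {S : Set Γ} (hS : IsFinSymmGen S)
    (hqi : QuasiIsometric (wordDist S) dSol) : ∃ (f : Γ → Pt) (A : ℕ), QA Γ f A := by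
  obtain ⟨K, C, φ, hK, hC, hφ, hd⟩ := hqi
  obtain ⟨f, hf⟩ : ∃ f : Γ → Pt, f = fun γ => toPt (φ γ) := ⟨_, rfl⟩
  obtain ⟨A₀, hA₀⟩ := exists_near_of_dSol_le C
  have onto : ∀ p, ∃ a, Near A₀ (f a) p := by
    intro p
    obtain ⟨P, rfl⟩ := toPt_surjective p
    obtain ⟨a, ha⟩ := hd P
    exact ⟨a, by rw [hf]; exact hA₀ _ _ ha⟩
  have word : ∀ n, ∃ m, ∀ a b, Near n (f a) (f b) → IsWord S m (a⁻¹ * b) := by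
    intro n
    obtain ⟨R, hR⟩ := exists_dSol_le_of_near n
    refine ⟨⌊K * (R + C)⌋₊, fun a b h => isWord_of_wordNorm_le hS (Nat.le_floor ?_)⟩
    rw [hf] at h
    have h1 := (hφ a b).1
    have h2 := hR _ _ h
    have h3 : 1 / K * wordDist S a b ≤ R + C := by linarith
    rw [one_div, ← div_eq_inv_mul, div_le_iff₀ (by linarith), mul_comm] at h3
    exact h3
  obtain ⟨n₁, hn₁⟩ := exists_near_of_dSol_le (K + C)
  have near : ∀ m a b, IsWord S m (a⁻¹ * b) → Near (n₁ * m) (f a) (f b) := by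
    intro m
    induction m with
    | zero =>
      rintro a b ⟨l, -, h2, h3⟩
      obtain rfl := List.length_eq_zero_iff.1 (Nat.le_zero.1 h3)
      rw [List.prod_nil, eq_comm, inv_mul_eq_one] at h2
      rw [h2]; exact near_refl _ _
    | succ m ih =>
      rintro a b ⟨l, h1, h2, h3⟩
      cases l with
      | nil =>
        rw [List.prod_nil, eq_comm, inv_mul_eq_one] at h2
        rw [h2]; exact near_refl _ _
      | cons s l =>
        have hs : Near n₁ (f a) (f (a * s)) := by
          rw [hf]
          refine hn₁ _ _ ((hφ _ _).2.trans ?_)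
          have : wordDist S a (a * s) ≤ 1 := by
            rw [wordDist, inv_mul_cancel_left]
            exact_mod_cast wordNorm_le_one (h1 s (by simp))
          have := mul_le_mul_of_nonneg_left this (by linarith : 0 ≤ K)
          linarith
        refine near_mono (by rw [mul_add, mul_one, add_comm]) (near_trans hs (ih (a * s) b ⟨l,
            fun x hx => h1 x (by simp [hx]), ?_, by simpa using h3⟩))
        rw [List.prod_cons] at h2
        rw [mul_inv_rev, mul_assoc, ← h2, inv_mul_cancel_left]
  obtain ⟨m₀, hm₀⟩ := word (A₀ + 1 + 2 * A₀)
  have chain : ∀ m p q, Chain m p q → ∀ a b, Near A₀ (f a) p → Near A₀ (f b) q →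
      IsWord S (m₀ * (m + 1)) (a⁻¹ * b) := by
    intro m
    induction m with
    | zero =>
      rintro p _ rfl a b ha hb
      rw [zero_add, mul_one]
      exact hm₀ a b (near_mono (by omega) (near_trans ha (near_symm hb)))
    | succ m ih =>
      rintro p q ⟨r, hr, h⟩ a b ha hb
      obtain ⟨c, hc⟩ := onto r
      have w1 := hm₀ a c (near_trans (near_trans ha hr) (near_symm hc))
      have w2 := w1.mul (ih r q h c b hc hb)
      rw [mul_assoc, mul_inv_cancel_left] at w2
      rwa [mul_add m₀ (m + 1), mul_one, add_comm]
  refine ⟨f, A₀ + n₁ * (m₀ * 5), fun n a b h γ => ?_, fun p => ?_, fun n p => ?_⟩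
  · have w := chain _ _ _ h.exists_chain a b (near_refl _ _) (near_refl _ _)
    rw [show a⁻¹ * b = (γ * a)⁻¹ * (γ * b) by group] at w
    refine near_mono ?_ (near _ _ _ w)
    calc n₁ * (m₀ * (5 * n + 2 + 1)) ≤ n₁ * (m₀ * (5 * (n + 1))) := by gcongr; omega
      _ = n₁ * (m₀ * 5) * (n + 1) := by ring
      _ ≤ _ := Nat.mul_le_mul_right _ (Nat.le_add_left _ _)
  · obtain ⟨a, ha⟩ := onto p
    exact ⟨a, near_mono (Nat.le_add_right _ _) ha⟩
  · obtain ⟨a, ha⟩ := onto p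
    obtain ⟨m, hm⟩ := word (A₀ + n)
    refine ((isWord_finite hS.1 m).image (a * ·)).subset fun γ hγ => ?_
    exact ⟨a⁻¹ * γ, hm a γ (near_trans ha hγ), mul_inv_cancel_left a γ⟩

end SolQI

/-- **Theorem (Eskin–Fisher–Whyte).** Any finitely generated group quasi-isometric to `Sol`
is virtually a lattice in `Sol`: some finite-index subgroup `Γ'`, modulo a finite normal
subgroup `N`, is isomorphic to a discrete cocompact subgroup of `Sol`. -/
theorem qi_sol_virtually_lattice
    (Γ : Type*) [Group Γ] (S : Set Γ) (hS : IsFinSymmGen S)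
    (hqi : QuasiIsometric (wordDist S) dSol) :
    ∃ Γ' : Subgroup Γ, Γ'.FiniteIndex ∧
      ∃ N : Subgroup Γ', N.Normal ∧ Finite N ∧
        ∃ ρ : Γ' → ℝ × ℝ × ℝ,
          (∀ a b : Γ', ρ (a * b) = solMul (ρ a) (ρ b)) ∧
          ρ 1 = (0, 0, 0) ∧
          (∀ a : Γ', ρ a = (0, 0, 0) ↔ a ∈ N) ∧
          -- the image Λ = range ρ is discrete in ℝ³
          (∀ p ∈ Set.range ρ, ∃ ε > (0:ℝ), ∀ q ∈ Set.range ρ, dist q p < ε → q = p) ∧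
          -- and cocompact: Λ · K = Sol for some compact K ⊆ ℝ³
          ∃ Kc : Set (ℝ × ℝ × ℝ), IsCompact Kc ∧
            ∀ g : ℝ × ℝ × ℝ, ∃ l ∈ Set.range ρ, ∃ k ∈ Kc, g = solMul l k := by
  obtain ⟨f, A, h⟩ := SolQI.exists_QA hS hqi
  obtain ⟨G, hG, ρ, hρ⟩ := h.exists_isLatticeMap
  exact ⟨G, hG, hρ.ker, hρ.ker_normal, hρ.finite_ker.to_subtype, ρ, hρ.map_mul, hρ.map_one,
    fun _ => Iff.rfl, hρ.discrete, hρ.cocompact⟩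

end
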